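/- There exist c > 0 and ε₀'' > 0 such that for all 0 < ε < ε₀'' one has |y⁺(ε)| ≥ c e^{−π²/(2√ε)} and |y⁻(ε)| ≥ c e^{−π²/(2√ε)}. -/

import Mathlib

open Real Filter Set Classical

noncomputable section

/-- The standard map (lift to `ℝ²`): `T_ε(x,y) = (x + y + ε sin x, y + ε sin x)`. -/
def stdMap (ε : ℝ) (p : ℝ × ℝ) : ℝ × ℝ :=
  (p.1 + p.2 + ε * Real.sin p.1, p.2 + ε * Real.sin p.1)

/-- `γ : ℝ → ℝ²` is (the lift of) a `C¹`, homotopically non-trivial, invariant circle of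
`T_ε` with rotation number `ω`: a `C¹` embedding with `γ(s+2π) = γ(s) + (2π,0)`, whose image
is invariant under `T_ε` and on which the translation number is `2πω`. -/
def IsInvCircle (ε ω : ℝ) (γ : ℝ → ℝ × ℝ) : Prop :=
  ContDiff ℝ 1 γ ∧
  (∀ s, deriv γ s ≠ 0) ∧
  (∀ s t : ℝ, γ s = γ t → ∃ k : ℤ, t = s + 2 * π * k) ∧
  (∀ s, γ (s + 2 * π) = γ s + (2 * π, 0)) ∧
  stdMap ε '' Set.range γ = Set.range γ ∧
  (∀ p ∈ Set.range γ,
    Filter.Tendsto (fun n : ℕ => (((stdMap ε)^[n] p).1 - p.1) / n)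
      Filter.atTop (nhds (2 * π * ω)))

/-- `T_ε` has a `C¹`, homotopically non-trivial, invariant circle of rotation number `ω`. -/
def HasInvCircle (ε ω : ℝ) : Prop := ∃ γ : ℝ → ℝ × ℝ, IsInvCircle ε ω γ

/-- `ω⁺(ε) = inf{ω > 0 : T_ε has a C¹, homotopically non-trivial, invariant circle of
rotation number ω}`. -/
def omegaPlus (ε : ℝ) : ℝ := sInf {ω : ℝ | 0 < ω ∧ HasInvCircle ε ω}

/-- `ω⁻(ε) = sup{ω < 0 : T_ε has a C¹, homotopically non-trivial, invariant circle of
rotation number ω}`. -/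
def omegaMinus (ε : ℝ) : ℝ := sSup {ω : ℝ | ω < 0 ∧ HasInvCircle ε ω}

/-- `y` is the `y`-coordinate of an intersection with the `y`-axis `{x ≡ 0 mod 2π}` of a
`C¹`, homotopically non-trivial, invariant circle of `T_ε` of rotation number `ω`. -/
def IsYIntersection (ε ω y : ℝ) : Prop :=
  ∃ γ : ℝ → ℝ × ℝ, IsInvCircle ε ω γ ∧ ∃ k : ℤ, (2 * π * (k : ℝ), y) ∈ Set.range γ

open scoped Topology

/-- The one-periodic Cauchy kernel. -/
def stripKernel (z : ℂ) : ℂ := (1 - Complex.exp (-(2 * π * Complex.I * z)))⁻¹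

lemma stripKernel_add_one (z : ℂ) : stripKernel (z + 1) = stripKernel z := by
  unfold stripKernel
  have : -(2 * π * Complex.I * (z + 1)) = -(2 * π * Complex.I * z) - 2 * π * Complex.I := by ring
  rw [this, Complex.exp_sub, Complex.exp_two_pi_mul_I, div_one]

lemma norm_exp_strip (z : ℂ) :
    ‖Complex.exp (-(2 * π * Complex.I * z))‖ = Real.exp (2 * π * z.im) := by
  rw [Complex.norm_exp]; congr 1; simp

lemma stripKernel_denom_ne {z : ℂ} (h0 : z ≠ 0) (h1 : |z.re| < 1) :
    1 - Complex.exp (-(2 * π * Complex.I * z)) ≠ 0 := by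
  intro h
  have h2 : Complex.exp (-(2 * π * Complex.I * z)) = 1 := by linear_combination -h
  obtain ⟨n, hn⟩ := Complex.exp_eq_one_iff.1 h2
  have hz : z = -n := by
    have h3 : (2 * π * Complex.I : ℂ) ≠ 0 := by simp [Real.pi_ne_zero]
    apply mul_left_cancel₀ h3
    linear_combination -hn
  rw [hz] at h1
  simp only [Complex.neg_re, Complex.intCast_re, abs_neg] at h1
  have : |n| < 1 := by exact_mod_cast h1
  have hn0 : n = 0 := Int.abs_lt_one_iff.1 this
  exact h0 (by simp [hz, hn0])

lemma cauchy_strip {f : ℂ → ℂ} {x₀ a b : ℝ} (hf : ∀ z : ℂ, |z.re - x₀| ≤ 1 / 2 → a ≤ z.im →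
    z.im ≤ b → DifferentiableAt ℂ f z) {t : ℂ} (ht : |t.re - x₀| ≤ 1 / 4) (ha : a < t.im)
    (hb : t.im < b) :
    f t = (∫ x in (x₀ - 1 / 2)..(x₀ + 1 / 2), f (x + a * Complex.I))
      + (∫ x in (x₀ - 1 / 2)..(x₀ + 1 / 2), (f (x + a * Complex.I) - f t) *
          (stripKernel (x + a * Complex.I - t) - 1))
      - (∫ x in (x₀ - 1 / 2)..(x₀ + 1 / 2), (f (x + b * Complex.I) - f t) *
          stripKernel (x + b * Complex.I - t))
      + Complex.I * ∫ y in a..b, (f (((x₀ + 1 / 2 : ℝ) : ℂ) + y * Complex.I)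
          - f (((x₀ - 1 / 2 : ℝ) : ℂ) + y * Complex.I)) *
          stripKernel (((x₀ - 1 / 2 : ℝ) : ℂ) + y * Complex.I - t) := by
  set g : ℂ → ℂ := fun s => dslope f t s *
    (dslope (fun s => 1 - Complex.exp (-(2 * π * Complex.I * (s - t)))) t s)⁻¹ with hg
  set e : ℂ → ℂ := fun s => 1 - Complex.exp (-(2 * π * Complex.I * (s - t))) with he
  have hed : Differentiable ℂ e := by fun_prop
  have het : e t = 0 := by simp [he]
  have hne : ∀ z : ℂ, |z.re - x₀| ≤ 1 / 2 → dslope e t z ≠ 0 := by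
    intro z hz
    by_cases hzt : z = t
    · rw [hzt, dslope_same]
      have : HasDerivAt e (2 * π * Complex.I) t := by
        have h1 : HasDerivAt (fun s : ℂ => -(2 * π * Complex.I * (s - t)))
            (-(2 * π * Complex.I * 1)) t :=
          (((hasDerivAt_id t).sub_const t).const_mul _).neg
        have h2 := (h1.cexp).const_sub 1
        simpa using h2
      rw [this.deriv]; simp [Real.pi_ne_zero]
    · rw [dslope_of_ne _ hzt, slope_def_field, het, sub_zero]
      refine div_ne_zero (stripKernel_denom_ne (sub_ne_zero.2 hzt) ?_) (sub_ne_zero.2 hzt)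
      rw [Complex.sub_re, abs_lt]; rw [abs_le] at hz ht
      constructor <;> linarith
  have hgne : ∀ z, z ≠ t → g z = (f z - f t) * stripKernel (z - t) := by
    intro z hz
    simp only [hg]
    rw [dslope_of_ne _ hz, dslope_of_ne _ hz, slope_def_field, slope_def_field]
    have : z - t ≠ 0 := sub_ne_zero.2 hz
    rw [het, sub_zero, show stripKernel (z - t) = (e z)⁻¹ from rfl]
    field_simp
  have hmem : ∀ z ∈ (uIcc (x₀ - 1 / 2) (x₀ + 1 / 2) ×ℂ uIcc a b), |z.re - x₀| ≤ 1 / 2 ∧ a ≤ z.im ∧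
      z.im ≤ b := by
    intro z hz
    rw [Complex.mem_reProdIm, uIcc_of_le (by linarith), uIcc_of_le (by linarith)] at hz
    refine ⟨abs_le.2 ⟨by linarith [hz.1.1], by linarith [hz.1.2]⟩, hz.2.1, hz.2.2⟩
  have hrect := Complex.integral_boundary_rect_eq_zero_of_differentiable_on_off_countable g
    (⟨x₀ - 1 / 2, a⟩ : ℂ) (⟨x₀ + 1 / 2, b⟩ : ℂ) {t} (countable_singleton t)
    (by
      intro z hz
      obtain ⟨h1, h2, h3⟩ := hmem z hz
      have hfz := hf z h1 h2 h3
      apply ContinuousAt.continuousWithinAt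
      apply ContinuousAt.mul
      · by_cases hzt : z = t
        · rw [hzt] at hfz ⊢; exact continuousAt_dslope_same.2 hfz
        · exact (continuousAt_dslope_of_ne hzt).2 hfz.continuousAt
      · apply ContinuousAt.inv₀ _ (hne z h1)
        by_cases hzt : z = t
        · rw [hzt]; exact continuousAt_dslope_same.2 (hed t)
        · exact (continuousAt_dslope_of_ne hzt).2 (hed z).continuousAt)
    (by
      rintro z ⟨hz, hzt⟩
      have hzt' : z ≠ t := hzt
      have hz' : z ∈ (uIcc (x₀ - 1 / 2) (x₀ + 1 / 2) ×ℂ uIcc a b) := by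
        rw [Complex.mem_reProdIm] at hz ⊢
        rw [min_eq_left (by linarith), max_eq_right (by linarith), min_eq_left (by linarith),
          max_eq_right (by linarith)] at hz
        rw [uIcc_of_le (by linarith), uIcc_of_le (by linarith)]
        exact ⟨Ioo_subset_Icc_self hz.1, Ioo_subset_Icc_self hz.2⟩
      obtain ⟨h1, h2, h3⟩ := hmem z hz'
      apply DifferentiableAt.mul
      · exact (differentiableAt_dslope_of_ne hzt').2 (hf z h1 h2 h3)
      · exact ((differentiableAt_dslope_of_ne hzt').2 (hed z)).inv (hne z h1))
  simp only [smul_eq_mul] at hrect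
  have hcf : ∀ z : ℂ, |z.re - x₀| ≤ 1 / 2 → a ≤ z.im → z.im ≤ b → z ≠ t →
      ContinuousAt (fun z => (f z - f t) * stripKernel (z - t)) z := by
    intro z h1 h2 h3 h4
    refine ((hf z h1 h2 h3).continuousAt.sub continuousAt_const).mul ?_
    unfold stripKernel
    refine ContinuousAt.inv₀ (by fun_prop) (stripKernel_denom_ne (sub_ne_zero.2 h4) ?_)
    rw [Complex.sub_re, abs_lt]; rw [abs_le] at h1 ht
    constructor <;> linarith
  have hle : x₀ - 1 / 2 ≤ x₀ + 1 / 2 := by linarith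
  have hba : (∫ x in (x₀ - 1 / 2)..(x₀ + 1 / 2), g (x + a * Complex.I))
      = (∫ x in (x₀ - 1 / 2)..(x₀ + 1 / 2), f (x + a * Complex.I)) - f t
      + (∫ x in (x₀ - 1 / 2)..(x₀ + 1 / 2), (f (x + a * Complex.I) - f t) *
          (stripKernel (x + a * Complex.I - t) - 1)) := by
    have hc1 : ContinuousOn (fun x : ℝ => f (x + a * Complex.I)) (uIcc (x₀ - 1 / 2) (x₀ + 1 / 2)) := by
      intro x hx
      rw [uIcc_of_le hle] at hx
      apply ContinuousAt.continuousWithinAt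
      exact ContinuousAt.comp (f := fun x : ℝ => (x + a * Complex.I : ℂ)) (g := f)
        (hf _ (by simp [abs_le]; constructor <;> linarith [hx.1, hx.2])
          (by simp) (by simp; linarith)).continuousAt (by fun_prop)
    have hc2 : ContinuousOn (fun x : ℝ => (f (x + a * Complex.I) - f t) *
          stripKernel (x + a * Complex.I - t)) (uIcc (x₀ - 1 / 2) (x₀ + 1 / 2)) := by
      intro x hx
      rw [uIcc_of_le hle] at hx
      apply ContinuousAt.continuousWithinAt
      refine ContinuousAt.comp (f := fun x : ℝ => (x + a * Complex.I : ℂ))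
        (g := fun z => (f z - f t) * stripKernel (z - t))
        (hcf _ (by simp [abs_le]; constructor <;> linarith [hx.1, hx.2])
          (by simp) (by simp; linarith) ?_) (by fun_prop)
      intro h; have := congrArg Complex.im h; simp at this; linarith
    have e1 : (∫ x in (x₀ - 1 / 2)..(x₀ + 1 / 2), g (x + a * Complex.I)) =
        ∫ x in (x₀ - 1 / 2)..(x₀ + 1 / 2), (f (x + a * Complex.I) - f t) *
          stripKernel (x + a * Complex.I - t) := by
      apply intervalIntegral.integral_congr
      intro x _
      apply hgne
      intro h; have := congrArg Complex.im h; simp at this; linarith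
    have e2 : (fun x : ℝ => (f (x + a * Complex.I) - f t) * (stripKernel (x + a * Complex.I - t) - 1))
        = fun x : ℝ => (f (x + a * Complex.I) - f t) * stripKernel (x + a * Complex.I - t)
          - (f (x + a * Complex.I) - f t) := by ext x; ring
    rw [e1, e2, intervalIntegral.integral_sub hc2.intervalIntegrable
      (show ContinuousOn (fun x : ℝ => f (x + a * Complex.I) - f t) _ from
        hc1.sub continuousOn_const).intervalIntegrable,
      intervalIntegral.integral_sub hc1.intervalIntegrable
      continuousOn_const.intervalIntegrable]
    simp only [intervalIntegral.integral_const]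
    have : (x₀ + 1 / 2 - (x₀ - 1 / 2)) = (1 : ℝ) := by ring
    rw [this, one_smul]; ring
  have hto : (∫ x in (x₀ - 1 / 2)..(x₀ + 1 / 2), g (x + b * Complex.I)) =
        ∫ x in (x₀ - 1 / 2)..(x₀ + 1 / 2), (f (x + b * Complex.I) - f t) *
          stripKernel (x + b * Complex.I - t) := by
    apply intervalIntegral.integral_congr
    intro x _
    apply hgne
    intro h; have := congrArg Complex.im h; simp at this; linarith
  have hside : ∀ (u : ℝ), |u - x₀| = 1 / 2 → ContinuousOn (fun y : ℝ => g (u + y * Complex.I))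
      (uIcc a b) := by
    intro u hu y hy
    rw [uIcc_of_le (by linarith)] at hy
    apply ContinuousAt.continuousWithinAt
    have hne' : (u + y * Complex.I : ℂ) ≠ t := by
      intro h; have := congrArg Complex.re h; simp at this
      rw [← this] at ht; linarith
    have h0 := hcf (u + y * Complex.I) (by simp [hu]) (by simpa using hy.1) (by simpa using hy.2) hne'
    have h1 : ContinuousAt g (u + y * Complex.I) := by
      refine h0.congr ?_
      filter_upwards [isOpen_ne.mem_nhds hne'] with z hz
      exact (hgne z hz).symm
    exact ContinuousAt.comp (f := fun y : ℝ => (u + y * Complex.I : ℂ)) (g := g) h1 (by fun_prop)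
  have hs : (∫ y in a..b, g (((x₀ + 1 / 2 : ℝ) : ℂ) + y * Complex.I))
      - (∫ y in a..b, g (((x₀ - 1 / 2 : ℝ) : ℂ) + y * Complex.I)) =
      ∫ y in a..b, (f (((x₀ + 1 / 2 : ℝ) : ℂ) + y * Complex.I)
          - f (((x₀ - 1 / 2 : ℝ) : ℂ) + y * Complex.I)) *
          stripKernel (((x₀ - 1 / 2 : ℝ) : ℂ) + y * Complex.I - t) := by
    have n1 : |x₀ + 1 / 2 - x₀| = 1 / 2 := by rw [add_sub_cancel_left]; norm_num
    have n2 : |x₀ - 1 / 2 - x₀| = 1 / 2 := by rw [sub_sub_cancel_left]; norm_num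
    rw [← intervalIntegral.integral_sub (hside _ n1).intervalIntegrable
      (hside _ n2).intervalIntegrable]
    apply intervalIntegral.integral_congr
    intro y _
    simp only
    have key : ∀ u : ℝ, |u - x₀| = 1 / 2 → (u + y * Complex.I : ℂ) ≠ t := by
      intro u hu h; have := congrArg Complex.re h; simp at this
      rw [← this] at ht; linarith
    rw [hgne _ (key _ n1), hgne _ (key _ n2)]
    have : (((x₀ + 1 / 2 : ℝ) : ℂ) + y * Complex.I - t)
      = (((x₀ - 1 / 2 : ℝ) : ℂ) + y * Complex.I - t) + 1 := by push_cast; ring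
    rw [this, stripKernel_add_one]; ring
  rw [hba, hto] at hrect
  rw [← hs]
  linear_combination -hrect

lemma stripKernel_sub_one {z : ℂ} (h : 1 - Complex.exp (-(2 * π * Complex.I * z)) ≠ 0) :
    stripKernel z - 1 = Complex.exp (-(2 * π * Complex.I * z)) * stripKernel z := by
  unfold stripKernel; field_simp; ring

lemma two_le_exp_two_pi : (2 : ℝ) ≤ Real.exp (2 * π) := by
  have := Real.add_one_le_exp (2 * π); linarith [Real.pi_gt_three]

lemma norm_stripKernel_le_of_one_le_im {z : ℂ} (h : 1 ≤ z.im) :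
    ‖stripKernel z‖ ≤ 2 * Real.exp (-(2 * π * z.im)) := by
  unfold stripKernel
  have h1 : Real.exp (2 * π) ≤ Real.exp (2 * π * z.im) := Real.exp_le_exp.2 (by
    nlinarith [Real.pi_pos])
  have h2 : Real.exp (2 * π * z.im) / 2 ≤ ‖1 - Complex.exp (-(2 * π * Complex.I * z))‖ := by
    have := norm_sub_norm_le (Complex.exp (-(2 * π * Complex.I * z))) 1
    rw [norm_sub_rev, norm_exp_strip, norm_one] at this
    linarith [two_le_exp_two_pi]
  rw [norm_inv, Real.exp_neg]
  calc _ ≤ (Real.exp (2 * π * z.im) / 2)⁻¹ := inv_anti₀ (by positivity) h2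
    _ = _ := by rw [inv_div]; rfl

lemma norm_stripKernel_sub_one_le_of_im_le {z : ℂ} (h : z.im ≤ -1) :
    ‖stripKernel z - 1‖ ≤ 2 * Real.exp (2 * π * z.im) := by
  have h1 : Real.exp (2 * π * z.im) ≤ Real.exp (-(2 * π)) := Real.exp_le_exp.2 (by
    nlinarith [Real.pi_pos])
  have h3 : Real.exp (-(2 * π)) ≤ 1 / 2 := by
    rw [Real.exp_neg, ← one_div]
    exact one_div_le_one_div_of_le (by norm_num) two_le_exp_two_pi
  have h2 : 1 / 2 ≤ ‖1 - Complex.exp (-(2 * π * Complex.I * z))‖ := by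
    have := norm_sub_norm_le 1 (Complex.exp (-(2 * π * Complex.I * z)))
    rw [norm_exp_strip, norm_one] at this
    linarith
  rw [stripKernel_sub_one (norm_pos_iff.1 (by linarith)), norm_mul, norm_exp_strip, mul_comm]
  gcongr
  unfold stripKernel
  rw [norm_inv]
  calc _ ≤ (1 / 2 : ℝ)⁻¹ := inv_anti₀ (by norm_num) h2
    _ = 2 := by norm_num

lemma exp_strip_re_nonpos {z : ℂ} (h : -(3 / 4) ≤ z.re) (h' : z.re ≤ -(1 / 4)) :
    (Complex.exp (-(2 * π * Complex.I * z))).re ≤ 0 := by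
  rw [Complex.exp_re]
  have : (-(2 * π * Complex.I * z)).im = -(2 * π * z.re) := by simp
  rw [this]
  refine mul_nonpos_of_nonneg_of_nonpos (Real.exp_pos _).le
    (Real.cos_nonpos_of_pi_div_two_le_of_le ?_ ?_) <;> nlinarith [Real.pi_pos]

lemma one_le_norm_strip {z : ℂ} (h : -(3 / 4) ≤ z.re) (h' : z.re ≤ -(1 / 4)) :
    1 ≤ ‖1 - Complex.exp (-(2 * π * Complex.I * z))‖ := by
  have := Complex.re_le_norm (1 - Complex.exp (-(2 * π * Complex.I * z)))
  rw [Complex.sub_re, Complex.one_re] at this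
  linarith [exp_strip_re_nonpos h h']

lemma norm_stripKernel_le_one {z : ℂ} (h : -(3 / 4) ≤ z.re) (h' : z.re ≤ -(1 / 4)) :
    ‖stripKernel z‖ ≤ 1 := by
  unfold stripKernel
  rw [norm_inv]
  exact inv_le_one_of_one_le₀ (one_le_norm_strip h h')

lemma norm_stripKernel_sub_one_le {z : ℂ} (h : -(3 / 4) ≤ z.re) (h' : z.re ≤ -(1 / 4)) :
    ‖stripKernel z - 1‖ ≤ Real.exp (2 * π * z.im) := by
  rw [stripKernel_sub_one (norm_pos_iff.1 (by linarith [one_le_norm_strip h h'])), norm_mul,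
    norm_exp_strip]
  exact mul_le_of_le_one_right (Real.exp_pos _).le (norm_stripKernel_le_one h h')

lemma norm_stripKernel_le_exp {z : ℂ} (h : -(3 / 4) ≤ z.re) (h' : z.re ≤ -(1 / 4)) :
    ‖stripKernel z‖ ≤ Real.exp (-(2 * π * z.im)) := by
  have h0 := one_le_norm_strip h h'
  unfold stripKernel
  rw [norm_inv, Real.exp_neg, ← norm_exp_strip]
  refine inv_anti₀ (norm_pos_iff.2 (Complex.exp_ne_zero _)) ?_
  rw [← sq_le_sq₀ (norm_nonneg _) (norm_nonneg _), Complex.sq_norm, Complex.sq_norm,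
    Complex.normSq_apply, Complex.normSq_apply, Complex.sub_re, Complex.sub_im, Complex.one_re,
    Complex.one_im]
  nlinarith [exp_strip_re_nonpos h h']
  
lemma strip_error {f : ℂ → ℂ} {x₀ Z F : ℝ} (hf : ∀ z : ℂ, |z.re - x₀| ≤ 1 / 2 → |z.im| ≤ Z →
    DifferentiableAt ℂ f z ∧ ‖f z‖ ≤ F) {t : ℂ} (ht : |t.re - x₀| ≤ 1 / 4) (h0 : 0 ≤ t.im)
    (hZ : t.im + 1 ≤ Z) :
    ‖f t - (∫ x in (x₀ - 1 / 2)..(x₀ + 1 / 2), f (x + (-Z : ℝ) * Complex.I))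
      - Complex.I * ∫ y in (-Z)..Z, (f (((x₀ + 1 / 2 : ℝ) : ℂ) + y * Complex.I)
          - f (((x₀ - 1 / 2 : ℝ) : ℂ) + y * Complex.I)) *
          stripKernel (((x₀ - 1 / 2 : ℝ) : ℂ) + y * Complex.I - t)‖
      ≤ 8 * F * Real.exp (-(2 * π * (Z - t.im))) := by
  have hF : 0 ≤ F := (norm_nonneg _).trans (hf t (by linarith) (by rw [abs_of_nonneg h0]; linarith)).2
  have hc := cauchy_strip (f := f) (x₀ := x₀) (a := -Z) (b := Z) (t := t)
    (fun z h1 h2 h3 => (hf z h1 (abs_le.2 ⟨h2, h3⟩)).1) ht (by linarith) (by linarith)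
  have hft : ‖f t‖ ≤ F := (hf t (by linarith) (by rw [abs_of_nonneg h0]; linarith)).2
  have hle : x₀ - 1 / 2 ≤ x₀ + 1 / 2 := by linarith
  have e1 : ‖∫ x in (x₀ - 1 / 2)..(x₀ + 1 / 2), (f (x + (-Z : ℝ) * Complex.I) - f t) *
          (stripKernel (x + (-Z : ℝ) * Complex.I - t) - 1)‖ ≤ 4 * F * Real.exp (-(2 * π * (Z - t.im))) := by
    have := intervalIntegral.norm_integral_le_of_norm_le_const (a := x₀ - 1 / 2) (b := x₀ + 1 / 2)
      (C := 4 * F * Real.exp (-(2 * π * (Z - t.im))))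
      (f := fun x : ℝ => (f (x + (-Z : ℝ) * Complex.I) - f t) *
          (stripKernel (x + (-Z : ℝ) * Complex.I - t) - 1)) (by
        intro x hx
        rw [uIoc_of_le hle] at hx
        have a1 : ‖f (x + (-Z : ℝ) * Complex.I)‖ ≤ F := (hf _
          (by simp [abs_le]; constructor <;> linarith [hx.1, hx.2])
          (by simp [abs_of_nonneg (show 0 ≤ Z by linarith)])).2
        have a2 : ‖stripKernel (x + (-Z : ℝ) * Complex.I - t) - 1‖ ≤ 2 * Real.exp (-(2 * π * (Z - t.im))) := by
          refine (norm_stripKernel_sub_one_le_of_im_le (by simp; linarith)).trans ?_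
          gcongr
          simp
          nlinarith [Real.pi_pos]
        rw [norm_mul]
        calc _ ≤ (F + F) * (2 * Real.exp (-(2 * π * (Z - t.im)))) := by
              gcongr
              exact (norm_sub_le _ _).trans (add_le_add a1 hft)
          _ = _ := by ring)
    rw [show x₀ + 1 / 2 - (x₀ - 1 / 2) = (1 : ℝ) by ring] at this
    simpa using this
  have e2 : ‖∫ x in (x₀ - 1 / 2)..(x₀ + 1 / 2), (f (x + Z * Complex.I) - f t) *
          stripKernel (x + Z * Complex.I - t)‖ ≤ 4 * F * Real.exp (-(2 * π * (Z - t.im))) := by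
    have := intervalIntegral.norm_integral_le_of_norm_le_const (a := x₀ - 1 / 2) (b := x₀ + 1 / 2)
      (C := 4 * F * Real.exp (-(2 * π * (Z - t.im))))
      (f := fun x : ℝ => (f (x + Z * Complex.I) - f t) * stripKernel (x + Z * Complex.I - t)) (by
        intro x hx
        rw [uIoc_of_le hle] at hx
        have a1 : ‖f (x + Z * Complex.I)‖ ≤ F := (hf _
          (by simp [abs_le]; constructor <;> linarith [hx.1, hx.2])
          (by simp [abs_of_nonneg (show 0 ≤ Z by linarith)])).2
        have a2 : ‖stripKernel (x + Z * Complex.I - t)‖ ≤ 2 * Real.exp (-(2 * π * (Z - t.im))) := by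
          refine (norm_stripKernel_le_of_one_le_im (by simp; linarith)).trans ?_
          simp
        rw [norm_mul]
        calc _ ≤ (F + F) * (2 * Real.exp (-(2 * π * (Z - t.im)))) := by
              gcongr
              exact (norm_sub_le _ _).trans (add_le_add a1 hft)
          _ = _ := by ring)
    rw [show x₀ + 1 / 2 - (x₀ - 1 / 2) = (1 : ℝ) by ring] at this
    simpa using this
  rw [show f t - (∫ x in (x₀ - 1 / 2)..(x₀ + 1 / 2), f (x + (-Z : ℝ) * Complex.I))
      - Complex.I * ∫ y in (-Z)..Z, (f (((x₀ + 1 / 2 : ℝ) : ℂ) + y * Complex.I)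
          - f (((x₀ - 1 / 2 : ℝ) : ℂ) + y * Complex.I)) *
          stripKernel (((x₀ - 1 / 2 : ℝ) : ℂ) + y * Complex.I - t) =
      (∫ x in (x₀ - 1 / 2)..(x₀ + 1 / 2), (f (x + (-Z : ℝ) * Complex.I) - f t) *
          (stripKernel (x + (-Z : ℝ) * Complex.I - t) - 1))
      - ∫ x in (x₀ - 1 / 2)..(x₀ + 1 / 2), (f (x + Z * Complex.I) - f t) *
          stripKernel (x + Z * Complex.I - t) by linear_combination hc]
  refine (norm_sub_le _ _).trans ?_
  linarith

lemma anchored_strip {f : ℂ → ℂ} {x₀ Z F K₁ K₂ K₃ : ℝ} (hf : ∀ z : ℂ, |z.re - x₀| ≤ 1 / 2 →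
    |z.im| ≤ Z → DifferentiableAt ℂ f z ∧ ‖f z‖ ≤ F) {t t₀ : ℂ} (ht : |t.re - x₀| ≤ 1 / 4)
    (h0 : 0 ≤ t.im) (hZ : t.im + 1 ≤ Z) (ht₀ : |t₀.re - x₀| ≤ 1 / 4) (h₀ : t₀.im = 0)
    (hK₁ : ∫ y in (-Z)..0, ‖f (((x₀ + 1 / 2 : ℝ) : ℂ) + y * Complex.I)
      - f (((x₀ - 1 / 2 : ℝ) : ℂ) + y * Complex.I)‖ * Real.exp (2 * π * y) ≤ K₁)
    (hK₂ : ∫ y in (0)..t.im, ‖f (((x₀ + 1 / 2 : ℝ) : ℂ) + y * Complex.I)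
      - f (((x₀ - 1 / 2 : ℝ) : ℂ) + y * Complex.I)‖ ≤ K₂)
    (hK₃ : ∫ y in (t.im)..Z, ‖f (((x₀ + 1 / 2 : ℝ) : ℂ) + y * Complex.I)
      - f (((x₀ - 1 / 2 : ℝ) : ℂ) + y * Complex.I)‖ * Real.exp (-(2 * π * (y - t.im))) ≤ K₃) :
    ‖f t - f t₀‖ ≤ 16 * F * Real.exp (-(2 * π * (Z - t.im))) + 2 * (K₁ + K₂ + K₃) := by
  have hF : 0 ≤ F := (norm_nonneg _).trans (hf t (by linarith) (by rw [abs_of_nonneg h0]; linarith)).2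
  have E1 := strip_error hf ht h0 hZ
  have E2 := strip_error hf ht₀ h₀.ge (by linarith)
  set J : ℝ → ℂ := fun y => f (((x₀ + 1 / 2 : ℝ) : ℂ) + y * Complex.I)
      - f (((x₀ - 1 / 2 : ℝ) : ℂ) + y * Complex.I) with hJ
  set s : ℝ → ℂ := fun y => ((x₀ - 1 / 2 : ℝ) : ℂ) + y * Complex.I with hs
  have hJc : ContinuousOn J (Icc (-Z) Z) := by
    intro y hy
    apply ContinuousAt.continuousWithinAt
    have a : |y| ≤ Z := abs_le.2 hy
    apply ContinuousAt.sub
    · exact ContinuousAt.comp (g := f) (f := fun y : ℝ => (((x₀ + 1 / 2 : ℝ) : ℂ) + y * Complex.I))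
        (hf _ (by simp) (by simpa using a)).1.continuousAt (by fun_prop)
    · exact ContinuousAt.comp (g := f) (f := fun y : ℝ => (((x₀ - 1 / 2 : ℝ) : ℂ) + y * Complex.I))
        (hf _ (by simp) (by simpa using a)).1.continuousAt (by fun_prop)
  have hre : ∀ (w : ℂ) (y : ℝ), |w.re - x₀| ≤ 1 / 4 → -(3 / 4) ≤ (s y - w).re ∧ (s y - w).re ≤ -(1 / 4) := by
    intro w y hw
    rw [abs_le] at hw
    simp [hs]
    constructor <;> linarith
  have him : ∀ (w : ℂ) (y : ℝ), (s y - w).im = y - w.im := by intro w y; simp [hs]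
  have hkc : ∀ w : ℂ, |w.re - x₀| ≤ 1 / 4 → Continuous (fun y : ℝ => stripKernel (s y - w)) := by
    intro w hw
    unfold stripKernel
    refine Continuous.inv₀ (by fun_prop) fun y => ?_
    exact norm_pos_iff.1 (by linarith [one_le_norm_strip (hre w y hw).1 (hre w y hw).2])
  set k : ℝ → ℂ := fun y => stripKernel (s y - t) - stripKernel (s y - t₀) with hk
  have hkc' : Continuous k := (hkc t ht).sub (hkc t₀ ht₀)
  have hinteg : ∀ a b, -Z ≤ a → a ≤ b → b ≤ Z → ContinuousOn J (uIcc a b) := by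
    intro a b h1 h2 h3
    rw [uIcc_of_le h2]
    exact hJc.mono (Icc_subset_Icc h1 h3)
  have hdiff : (∫ y in (-Z)..Z, J y * stripKernel (s y - t))
      - (∫ y in (-Z)..Z, J y * stripKernel (s y - t₀))
      = (∫ y in (-Z)..0, J y * k y) + (∫ y in (0)..t.im, J y * k y) + ∫ y in (t.im)..Z, J y * k y := by
    rw [intervalIntegral.integral_add_adjacent_intervals, intervalIntegral.integral_add_adjacent_intervals,
      ← intervalIntegral.integral_sub]
    · apply intervalIntegral.integral_congr; intro y _; simp only [hk]; ring
    all_goals apply ContinuousOn.intervalIntegrable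
    · exact (hinteg _ _ le_rfl (by linarith) le_rfl).mul (hkc t ht).continuousOn
    · exact (hinteg _ _ le_rfl (by linarith) le_rfl).mul (hkc t₀ ht₀).continuousOn
    · exact (hinteg _ _ le_rfl (by linarith) (by linarith)).mul hkc'.continuousOn
    · exact (hinteg _ _ (by linarith) (by linarith) le_rfl).mul hkc'.continuousOn
    · exact (hinteg _ _ le_rfl (by linarith) (by linarith)).mul hkc'.continuousOn
    · exact (hinteg _ _ (by linarith) (by linarith) (by linarith)).mul hkc'.continuousOn
  have b1 : ‖∫ y in (-Z)..0, J y * k y‖ ≤ 2 * K₁ := by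
    refine (intervalIntegral.norm_integral_le_of_norm_le (by linarith)
      (g := fun y => 2 * (‖J y‖ * Real.exp (2 * π * y))) ?_ ?_).trans ?_
    · refine MeasureTheory.ae_of_all _ fun y hy => ?_
      rw [norm_mul]
      have : ‖k y‖ ≤ 2 * Real.exp (2 * π * y) := by
        have e : k y = (stripKernel (s y - t) - 1) - (stripKernel (s y - t₀) - 1) := by simp [hk]
        rw [e]
        refine (norm_sub_le _ _).trans ?_
        have i1 := norm_stripKernel_sub_one_le (hre t y ht).1 (hre t y ht).2
        have i2 := norm_stripKernel_sub_one_le (hre t₀ y ht₀).1 (hre t₀ y ht₀).2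
        rw [him] at i1 i2
        have : Real.exp (2 * π * (y - t.im)) ≤ Real.exp (2 * π * y) :=
          Real.exp_le_exp.2 (by nlinarith [Real.pi_pos])
        rw [h₀, sub_zero] at i2
        linarith
      calc _ ≤ ‖J y‖ * (2 * Real.exp (2 * π * y)) := by gcongr
        _ = _ := by ring
    · apply ContinuousOn.intervalIntegrable
      have := hinteg (-Z) 0 le_rfl (by linarith) (by linarith)
      fun_prop
    · rw [intervalIntegral.integral_const_mul]; linarith
  have b2 : ‖∫ y in (0)..t.im, J y * k y‖ ≤ 2 * K₂ := by
    refine (intervalIntegral.norm_integral_le_of_norm_le (by linarith)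
      (g := fun y => 2 * ‖J y‖) ?_ ?_).trans ?_
    · refine MeasureTheory.ae_of_all _ fun y hy => ?_
      rw [norm_mul]
      have : ‖k y‖ ≤ 2 := by
        refine (norm_sub_le _ _).trans ?_
        have i1 := norm_stripKernel_le_one (hre t y ht).1 (hre t y ht).2
        have i2 := norm_stripKernel_le_one (hre t₀ y ht₀).1 (hre t₀ y ht₀).2
        linarith
      calc _ ≤ ‖J y‖ * 2 := by gcongr
        _ = _ := by ring
    · apply ContinuousOn.intervalIntegrable
      have := hinteg 0 t.im (by linarith) (by linarith) (by linarith)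
      fun_prop
    · rw [intervalIntegral.integral_const_mul]; linarith
  have b3 : ‖∫ y in (t.im)..Z, J y * k y‖ ≤ 2 * K₃ := by
    refine (intervalIntegral.norm_integral_le_of_norm_le (by linarith)
      (g := fun y => 2 * (‖J y‖ * Real.exp (-(2 * π * (y - t.im))))) ?_ ?_).trans ?_
    · refine MeasureTheory.ae_of_all _ fun y hy => ?_
      rw [norm_mul]
      have : ‖k y‖ ≤ 2 * Real.exp (-(2 * π * (y - t.im))) := by
        refine (norm_sub_le _ _).trans ?_
        have i1 := norm_stripKernel_le_exp (hre t y ht).1 (hre t y ht).2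
        have i2 := norm_stripKernel_le_exp (hre t₀ y ht₀).1 (hre t₀ y ht₀).2
        rw [him] at i1 i2
        have : Real.exp (-(2 * π * (y - t₀.im))) ≤ Real.exp (-(2 * π * (y - t.im))) :=
          Real.exp_le_exp.2 (by rw [h₀]; nlinarith [Real.pi_pos])
        linarith
      calc _ ≤ ‖J y‖ * (2 * Real.exp (-(2 * π * (y - t.im)))) := by gcongr
        _ = _ := by ring
    · apply ContinuousOn.intervalIntegrable
      have := hinteg t.im Z (by linarith) (by linarith) le_rfl
      fun_prop
    · rw [intervalIntegral.integral_const_mul]; linarith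
  have hexp : Real.exp (-(2 * π * (Z - t₀.im))) ≤ Real.exp (-(2 * π * (Z - t.im))) :=
    Real.exp_le_exp.2 (by rw [h₀]; nlinarith [Real.pi_pos])
  have hE2 := E2.trans (mul_le_mul_of_nonneg_left hexp (by positivity))
  have hfin := norm_sub_le_of_le E1 hE2
  set m := ∫ x in (x₀ - 1 / 2)..(x₀ + 1 / 2), f (x + (-Z : ℝ) * Complex.I)
  set A := ∫ y in (-Z)..Z, J y * stripKernel (s y - t)
  set B := ∫ y in (-Z)..Z, J y * stripKernel (s y - t₀)
  have e : f t - f t₀ = (f t - m - Complex.I * A - (f t₀ - m - Complex.I * B))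
      + Complex.I * ((∫ y in (-Z)..0, J y * k y) + (∫ y in (0)..t.im, J y * k y) + ∫ y in (t.im)..Z, J y * k y) := by
    rw [← hdiff]; ring
  rw [e]
  refine (norm_add_le _ _).trans ?_
  rw [norm_mul, Complex.norm_I, one_mul]
  have := norm_add₃_le (a := ∫ y in (-Z)..0, J y * k y) (b := ∫ y in (0)..t.im, J y * k y)
    (c := ∫ y in (t.im)..Z, J y * k y)
  linarith

lemma integral_le_of_le_deriv {a b : ℝ} (hab : a ≤ b) {g H H' : ℝ → ℝ}
    (hg : ContinuousOn g (Icc a b)) (hH : ∀ x ∈ Icc a b, HasDerivAt H (H' x) x)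
    (h : ∀ x ∈ Icc a b, g x ≤ H' x) : ∫ x in a..b, g x ≤ H b - H a :=
  intervalIntegral.integral_le_sub_of_hasDeriv_right_of_le hab
    (fun x hx => (hH x hx).continuousAt.continuousWithinAt)
    (fun x hx => (hH x (Ioo_subset_Icc_self hx)).hasDerivWithinAt) hg.integrableOn_Icc
    (fun x hx => h x (Ioo_subset_Icc_self hx))

lemma weighted_strip {f : ℂ → ℂ} {x₀ Z F L : ℝ} {w W W' V V' : ℝ → ℝ}
    (hf : ∀ z : ℂ, |z.re - x₀| ≤ 1 / 2 → |z.im| ≤ Z → DifferentiableAt ℂ f z ∧ ‖f z‖ ≤ F)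
    {t t₀ : ℂ} (ht : |t.re - x₀| ≤ 1 / 4)
    (h0 : 0 ≤ t.im) (hZ : t.im + 1 ≤ Z) (ht₀ : |t₀.re - x₀| ≤ 1 / 4) (h₀ : t₀.im = 0)
    (hJ : ∀ y : ℝ, |y| ≤ Z → ‖f (((x₀ + 1 / 2 : ℝ) : ℂ) + y * Complex.I)
      - f (((x₀ - 1 / 2 : ℝ) : ℂ) + y * Complex.I)‖ ≤
        w (L - |y|) * Real.exp (-(2 * π * (L - |y|))))
    (hW : ∀ r, L - Z ≤ r → r ≤ L → HasDerivAt W (W' r) r ∧ w r ≤ W' r ∧ 0 ≤ W r)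
    (hV : ∀ r, L - Z ≤ r → r ≤ L → HasDerivAt V (V' r) r ∧
      w r * Real.exp (-(2 * π * r)) ≤ - V' r ∧ 0 ≤ V r) :
    ‖f t - f t₀‖ ≤ 16 * F * Real.exp (-(2 * π * (Z - t.im))) + 2 * (Real.exp (-(2 * π * L)) * W L
      + V (L - t.im) + Real.exp (-(2 * π * (L - t.im))) * W (L - t.im)) := by
  set J : ℝ → ℂ := fun y => f (((x₀ + 1 / 2 : ℝ) : ℂ) + y * Complex.I)
      - f (((x₀ - 1 / 2 : ℝ) : ℂ) + y * Complex.I) with hJdef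
  have hJc : ContinuousOn J (Icc (-Z) Z) := by
    intro y hy
    apply ContinuousAt.continuousWithinAt
    have a : |y| ≤ Z := abs_le.2 hy
    apply ContinuousAt.sub
    · exact ContinuousAt.comp (g := f) (f := fun y : ℝ => (((x₀ + 1 / 2 : ℝ) : ℂ) + y * Complex.I))
        (hf _ (by simp) (by simpa using a)).1.continuousAt (by fun_prop)
    · exact ContinuousAt.comp (g := f) (f := fun y : ℝ => (((x₀ - 1 / 2 : ℝ) : ℂ) + y * Complex.I))
        (hf _ (by simp) (by simpa using a)).1.continuousAt (by fun_prop)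
  apply anchored_strip hf ht h0 hZ ht₀ h₀
  · have := integral_le_of_le_deriv (a := -Z) (b := 0) (by linarith)
      (g := fun y => ‖J y‖ * Real.exp (2 * π * y)) (H := fun y => Real.exp (-(2 * π * L)) * W (L + y))
      (H' := fun y => Real.exp (-(2 * π * L)) * W' (L + y)) ?_ ?_ ?_
    · refine this.trans ?_
      have := (hW (L + -Z) (by linarith) (by linarith)).2.2
      have h2 := mul_nonneg (Real.exp_pos (-(2 * π * L))).le this
      simp only [add_zero]; linarith
    · have : ContinuousOn J (Icc (-Z) 0) := hJc.mono (Icc_subset_Icc le_rfl (by linarith))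
      fun_prop
    · intro y hy
      exact (HasDerivAt.comp_const_add L y (hW _ (by linarith [hy.1]) (by linarith [hy.2])).1).const_mul _
    · intro y hy
      have h1 := hJ y (by rw [abs_of_nonpos hy.2]; linarith [hy.1])
      rw [abs_of_nonpos hy.2, sub_neg_eq_add] at h1
      have h2 := (hW (L + y) (by linarith [hy.1]) (by linarith [hy.2])).2.1
      calc ‖J y‖ * Real.exp (2 * π * y)
          ≤ w (L + y) * Real.exp (-(2 * π * (L + y))) * Real.exp (2 * π * y) := by gcongr
        _ = Real.exp (-(2 * π * L)) * w (L + y) := by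
            rw [mul_assoc, ← Real.exp_add, mul_comm]; congr 2; ring
        _ ≤ _ := by gcongr
  · have := integral_le_of_le_deriv (a := 0) (b := t.im) h0
      (g := fun y => ‖J y‖) (H := fun y => V (L - y))
      (H' := fun y => - V' (L - y)) ?_ ?_ ?_
    · refine this.trans ?_
      have := (hV (L - 0) (by linarith) (by linarith)).2.2
      linarith
    · have : ContinuousOn J (Icc 0 t.im) := hJc.mono (Icc_subset_Icc (by linarith) (by linarith))
      fun_prop
    · intro y hy
      exact HasDerivAt.comp_const_sub L y (hV _ (by linarith [hy.2]) (by linarith [hy.1])).1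
    · intro y hy
      have h1 := hJ y (by rw [abs_of_nonneg hy.1]; linarith [hy.2])
      rw [abs_of_nonneg hy.1] at h1
      exact h1.trans (hV (L - y) (by linarith [hy.2]) (by linarith [hy.1])).2.1
  · have := integral_le_of_le_deriv (a := t.im) (b := Z) (by linarith)
      (g := fun y => ‖J y‖ * Real.exp (-(2 * π * (y - t.im))))
      (H := fun y => Real.exp (-(2 * π * (L - t.im))) * (-W (L - y)))
      (H' := fun y => Real.exp (-(2 * π * (L - t.im))) * W' (L - y)) ?_ ?_ ?_
    · refine this.trans ?_
      have := (hW (L - Z) (by linarith) (by linarith)).2.2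
      have h2 := mul_nonneg (Real.exp_pos (-(2 * π * (L - t.im)))).le this
      linarith
    · have : ContinuousOn J (Icc t.im Z) := hJc.mono (Icc_subset_Icc (by linarith) (by linarith))
      fun_prop
    · intro y hy
      have := (HasDerivAt.comp_const_sub L y (hW _ (by linarith [hy.2]) (by linarith [hy.1])).1).neg.const_mul
        (Real.exp (-(2 * π * (L - t.im))))
      simpa using this
    · intro y hy
      have h1 := hJ y (by rw [abs_of_nonneg (h0.trans hy.1)]; linarith [hy.2])
      rw [abs_of_nonneg (h0.trans hy.1)] at h1
      have h2 := (hW (L - y) (by linarith [hy.2]) (by linarith [hy.1])).2.1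
      calc ‖J y‖ * Real.exp (-(2 * π * (y - t.im)))
          ≤ w (L - y) * Real.exp (-(2 * π * (L - y))) * Real.exp (-(2 * π * (y - t.im))) := by gcongr
        _ = Real.exp (-(2 * π * (L - t.im))) * w (L - y) := by
            rw [mul_assoc, ← Real.exp_add, mul_comm]; congr 2; ring
        _ ≤ _ := by gcongr

/-- The discrete Wronskian of two functions. -/
def wronskian (D G : ℂ → ℂ) (s : ℂ) : ℂ := D (s + 1) * G s - D s * G (s + 1)

/-- Difference `D` of two nearby solutions of a second order difference equation, and a solution
`G` of the linearised equation, in the strip of half-width `L`, away from its boundary. -/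
structure SplitPair (c C₀ L : ℝ) (D G R : ℂ → ℂ) : Prop where
  diff_D : Differentiable ℂ D
  diff_G : Differentiable ℂ G
  wronskian_step : ∀ s, wronskian D G s - wronskian D G (s - 1) = G s * R s
  G_lower : ∀ s : ℂ, |s.re| ≤ 3 / 2 → C₀ ≤ L - |s.im| → 1 ≤ c * (L - |s.im|) * ‖G s‖
  G_upper : ∀ s : ℂ, |s.re| ≤ 3 / 2 → C₀ ≤ L - |s.im| → ‖G s‖ * (L - |s.im|) ≤ c
  D_upper : ∀ s : ℂ, |s.re| ≤ 3 / 2 → C₀ ≤ L - |s.im| → ‖D s‖ * (L - |s.im|) ^ 2 ≤ c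
  R_upper : ∀ s : ℂ, |s.re| ≤ 3 / 2 → C₀ ≤ L - |s.im| → ‖R s‖ * (L - |s.im|) ^ 2 ≤ c * ‖D s‖ ^ 2
  D_zero : D 0 = 0
  D_one : D 1 = 0
  D_neg_one : D (-1) = 0
  conj_D : ∀ s, D (starRingEnd ℂ s) = starRingEnd ℂ (D s)
  conj_G : ∀ s, G (starRingEnd ℂ s) = starRingEnd ℂ (G s)

lemma exp_two_pi_mul_le {C₀ L y : ℝ} (h : L - y ≤ C₀ + 1) :
    1 ≤ Real.exp (2 * π * (C₀ + 1)) * Real.exp (-(2 * π * (L - y))) := by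
  rw [← Real.exp_add]
  apply Real.one_le_exp
  nlinarith [Real.pi_pos]

lemma pow_three_mul_exp_anti {a b : ℝ} (ha : 1 ≤ a) (hab : a ≤ b) :
    b ^ 3 * Real.exp (-(2 * π * b)) ≤ a ^ 3 * Real.exp (-(2 * π * a)) := by
  have hb : b = a * (b / a) := by field_simp
  have h1 : b / a ≤ Real.exp (b - a) := by
    have h2 := Real.add_one_le_exp (b - a)
    refine le_trans ?_ h2
    rw [div_le_iff₀ (by linarith)]
    nlinarith
  have h0 : 0 ≤ b / a := div_nonneg (by linarith) (by linarith)
  have h3 : (b / a) ^ 3 ≤ Real.exp (2 * π * (b - a)) := by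
    calc (b / a) ^ 3 ≤ Real.exp (b - a) ^ 3 := by gcongr
      _ = Real.exp (3 * (b - a)) := by rw [← Real.exp_nat_mul]; norm_num
      _ ≤ _ := Real.exp_le_exp.2 (by nlinarith [Real.pi_gt_three])
  have h4 : b ^ 3 = a ^ 3 * (b / a) ^ 3 := by rw [← mul_pow, ← hb]
  rw [h4, mul_assoc]
  gcongr
  calc (b / a) ^ 3 * Real.exp (-(2 * π * b)) ≤ Real.exp (2 * π * (b - a)) * Real.exp (-(2 * π * b)) := by
        gcongr
    _ = _ := by rw [← Real.exp_add]; congr 1; ring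

namespace SplitPair

variable {c C₀ L : ℝ} {D G R : ℂ → ℂ}

lemma norm_D_le (h : SplitPair c C₀ L D G R) (hC : 1 ≤ C₀) {s : ℂ} (h1 : |s.re| ≤ 3 / 2)
    (h2 : C₀ ≤ L - |s.im|) : ‖D s‖ ≤ c / (L - |s.im|) ^ 2 := by
  rw [le_div_iff₀ (pow_pos (by linarith) 2)]; exact h.D_upper s h1 h2

lemma norm_G_le (h : SplitPair c C₀ L D G R) (hC : 1 ≤ C₀) {s : ℂ} (h1 : |s.re| ≤ 3 / 2)
    (h2 : C₀ ≤ L - |s.im|) : ‖G s‖ ≤ c / (L - |s.im|) := by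
  rw [le_div_iff₀ (by linarith)]; exact h.G_upper s h1 h2

lemma c_nonneg (h : SplitPair c C₀ L D G R) (hL : C₀ ≤ L) (hC : 1 ≤ C₀) : 0 ≤ c := by
  have := h.G_upper 0 (by norm_num) (by simpa using hL)
  refine le_trans ?_ this
  simp
  exact mul_nonneg (norm_nonneg _) (by linarith)

lemma norm_D_le_const (h : SplitPair c C₀ L D G R) (hL : C₀ ≤ L) (hC : 1 ≤ C₀) {s : ℂ}
    (h1 : |s.re| ≤ 3 / 2) (h2 : C₀ ≤ L - |s.im|) : ‖D s‖ ≤ c :=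
  (h.norm_D_le hC h1 h2).trans (div_le_self (h.c_nonneg hL hC) (one_le_pow₀ (by linarith)))

lemma norm_G_le_const (h : SplitPair c C₀ L D G R) (hL : C₀ ≤ L) (hC : 1 ≤ C₀) {s : ℂ}
    (h1 : |s.re| ≤ 3 / 2) (h2 : C₀ ≤ L - |s.im|) : ‖G s‖ ≤ c :=
  (h.norm_G_le hC h1 h2).trans (div_le_self (h.c_nonneg hL hC) (by linarith))

lemma G_ne (h : SplitPair c C₀ L D G R) {s : ℂ}
    (h1 : |s.re| ≤ 3 / 2) (h2 : C₀ ≤ L - |s.im|) : G s ≠ 0 := by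
  intro h0
  have := h.G_lower s h1 h2
  rw [h0, norm_zero, mul_zero] at this
  linarith

lemma norm_inv_G_le (h : SplitPair c C₀ L D G R) {s : ℂ}
    (h1 : |s.re| ≤ 3 / 2) (h2 : C₀ ≤ L - |s.im|) : ‖(G s)⁻¹‖ ≤ c * (L - |s.im|) := by
  rw [norm_inv, inv_le_iff_one_le_mul₀ (norm_pos_iff.2 (h.G_ne h1 h2))]
  exact h.G_lower s h1 h2

lemma wronskian_conj (h : SplitPair c C₀ L D G R) (s : ℂ) :
    wronskian D G (starRingEnd ℂ s) = starRingEnd ℂ (wronskian D G s) := by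
  have : starRingEnd ℂ s + 1 = starRingEnd ℂ (s + 1) := by simp
  simp only [wronskian, this, h.conj_D, h.conj_G, map_sub, map_mul]

lemma diff_wronskian (h : SplitPair c C₀ L D G R) : Differentiable ℂ (wronskian D G) := by
  have h1 := h.diff_D
  have h2 := h.diff_G
  unfold wronskian
  fun_prop

lemma norm_wronskian_le_const (h : SplitPair c C₀ L D G R) (hL : C₀ ≤ L) (hC : 1 ≤ C₀) {s : ℂ}
    (h1 : |s.re| ≤ 3 / 2) (h1' : |s.re + 1| ≤ 3 / 2) (h2 : C₀ ≤ L - |s.im|) :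
    ‖wronskian D G s‖ ≤ 2 * c ^ 2 := by
  have a : |(s + 1).re| ≤ 3 / 2 := by simpa using h1'
  have b : C₀ ≤ L - |(s + 1).im| := by simpa using h2
  have hc := h.c_nonneg hL hC
  have := norm_sub_le (D (s + 1) * G s) (D s * G (s + 1))
  rw [norm_mul, norm_mul] at this
  have i1 : ‖D (s + 1)‖ * ‖G s‖ ≤ c * c := by
    gcongr
    · exact h.norm_D_le_const hL hC a b
    · exact h.norm_G_le_const hL hC h1 h2
  have i2 : ‖D s‖ * ‖G (s + 1)‖ ≤ c * c := by
    gcongr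
    · exact h.norm_D_le_const hL hC h1 h2
    · exact h.norm_G_le_const hL hC a b
  unfold wronskian
  nlinarith

lemma norm_GR_le (h : SplitPair c C₀ L D G R) (hL : C₀ ≤ L) (hC : 1 ≤ C₀) {s : ℂ}
    (h1 : |s.re| ≤ 3 / 2) (h2 : C₀ ≤ L - |s.im|) :
    ‖G s * R s‖ ≤ c ^ 2 / (L - |s.im|) ^ 3 * ‖D s‖ ^ 2 := by
  have hc := h.c_nonneg hL hC
  have hr : 0 < L - |s.im| := by linarith
  rw [norm_mul]
  have i1 : ‖R s‖ ≤ c * ‖D s‖ ^ 2 / (L - |s.im|) ^ 2 := by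
    rw [le_div_iff₀ (by positivity)]; exact h.R_upper s h1 h2
  calc ‖G s‖ * ‖R s‖ ≤ c / (L - |s.im|) * (c * ‖D s‖ ^ 2 / (L - |s.im|) ^ 2) := by
        gcongr; exact h.norm_G_le hC h1 h2
    _ = _ := by field_simp

lemma wronskian_bound_upper (h : SplitPair c C₀ L D G R) (hL : C₀ ≤ L) (hC : 1 ≤ C₀) {N : ℝ}
    (hN : 0 ≤ N) (hD : ∀ s : ℂ, |s.re| ≤ 1 / 2 → C₀ ≤ L - |s.im| →
      ‖D s‖ ≤ N * (L - |s.im|) ^ 2 * Real.exp (-(2 * π * (L - |s.im|)))) {t : ℂ}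
    (ht : -(5 / 4) ≤ t.re) (ht' : t.re ≤ 1 / 4) (htZ : C₀ ≤ L - t.im) (h0 : 0 ≤ t.im) :
    ‖wronskian D G t‖ ≤ (32 * c ^ 2 * Real.exp (2 * π * (C₀ + 1)) + 4 * c ^ 3 * N / C₀ ^ 2) *
      Real.exp (-(2 * π * (L - t.im))) := by
  have hc := h.c_nonneg hL hC
  set M := c ^ 3 * N with hM
  have hE := Real.exp_pos (-(2 * π * (L - t.im)))
  by_cases hZ : t.im + 1 ≤ L - C₀
  · obtain ⟨x₀, t₀, ht₀, ht₀i, hmid, hx₀, hz⟩ : ∃ (x₀ : ℝ) (t₀ : ℂ), |t₀.re - x₀| ≤ 1 / 4 ∧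
        t₀.im = 0 ∧ |t.re - x₀| ≤ 1 / 4 ∧ |x₀ + 1 / 2| ≤ 1 / 2 ∧ wronskian D G t₀ = 0 := by
      have z0 : wronskian D G 0 = 0 := by simp [wronskian, h.D_zero, h.D_one]
      have z1 : wronskian D G (-1) = 0 := by simp [wronskian, h.D_zero, h.D_neg_one]
      simp only [abs_le]
      rcases le_total t.re (-(3 / 4)) with h1 | h1
      · exact ⟨-1, -1, by simp, by simp, by constructor <;> linarith, by norm_num, z1⟩
      rcases le_total t.re (-(1 / 2)) with h2 | h2
      · exact ⟨-(3 / 4), -1, by norm_num, by simp, by constructor <;> linarith, by norm_num, z1⟩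
      rcases le_total t.re (-(1 / 4)) with h3 | h3
      · exact ⟨-(1 / 4), 0, by norm_num, by simp, by constructor <;> linarith, by norm_num, z0⟩
      · exact ⟨0, 0, by norm_num, by simp, by constructor <;> linarith, by norm_num, z0⟩
    have hbox : ∀ z : ℂ, |z.re - x₀| ≤ 1 / 2 → |z.im| ≤ L - C₀ →
        DifferentiableAt ℂ (wronskian D G) z ∧ ‖wronskian D G z‖ ≤ 2 * c ^ 2 := by
      intro z h1 h2
      refine ⟨h.diff_wronskian z, ?_⟩
      rw [abs_le] at h1 hx₀
      apply h.norm_wronskian_le_const hL hC _ _ (by linarith) <;>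
      · rw [abs_le]; constructor <;> linarith
    have key := weighted_strip (L := L) (w := fun r => M / r ^ 3)
      (W := fun r => M * (C₀⁻¹ ^ 2 - r⁻¹ ^ 2) / 2) (W' := fun r => M / r ^ 3)
      (V := fun r => M / C₀ ^ 2 * Real.exp (-(2 * π * r)))
      (V' := fun r => M / C₀ ^ 2 * (Real.exp (-(2 * π * r)) * (-(2 * π * 1))))
      hbox hmid h0 hZ ht₀ ht₀i ?_ ?_ ?_
    · rw [hz, sub_zero] at key
      refine key.trans ?_
      have e1 : Real.exp (-(2 * π * (L - C₀ - t.im))) ≤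
          Real.exp (2 * π * (C₀ + 1)) * Real.exp (-(2 * π * (L - t.im))) := by
        rw [← Real.exp_add]; exact Real.exp_le_exp.2 (by nlinarith [Real.pi_pos])
      have e2 : Real.exp (-(2 * π * L)) ≤ Real.exp (-(2 * π * (L - t.im))) :=
        Real.exp_le_exp.2 (by nlinarith [Real.pi_pos])
      have e3 : ∀ r : ℝ, M * (C₀⁻¹ ^ 2 - r⁻¹ ^ 2) / 2 ≤ M / C₀ ^ 2 / 2 := by
        intro r
        have : M * (C₀⁻¹ ^ 2 - r⁻¹ ^ 2) / 2 = M / C₀ ^ 2 / 2 - M * r⁻¹ ^ 2 / 2 := by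
          field_simp
        rw [this]
        have : 0 ≤ M * r⁻¹ ^ 2 / 2 := by positivity
        linarith
      calc _ ≤ 16 * (2 * c ^ 2) * (Real.exp (2 * π * (C₀ + 1)) * Real.exp (-(2 * π * (L - t.im))))
            + 2 * (Real.exp (-(2 * π * (L - t.im))) * (M / C₀ ^ 2 / 2)
            + M / C₀ ^ 2 * Real.exp (-(2 * π * (L - t.im)))
            + Real.exp (-(2 * π * (L - t.im))) * (M / C₀ ^ 2 / 2)) := by
            have j1 := (mul_le_mul_of_nonneg_left (e3 L) (Real.exp_pos (-(2 * π * L))).le).trans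
                (mul_le_mul_of_nonneg_right e2 (by positivity))
            have j2 := mul_le_mul_of_nonneg_left (e3 (L - t.im)) hE.le
            have j3 := mul_le_mul_of_nonneg_left e1 (show 0 ≤ 16 * (2 * c ^ 2) by positivity)
            linarith
        _ = _ := by rw [hM]; ring
    · intro y hy
      have e : (((x₀ + 1 / 2 : ℝ) : ℂ) + y * Complex.I) - 1 = ((x₀ - 1 / 2 : ℝ) : ℂ) + y * Complex.I := by
        push_cast; ring
      rw [← e, h.wronskian_step]
      generalize hs : (((x₀ + 1 / 2 : ℝ) : ℂ) + y * Complex.I) = s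
      have h1 : |s.re| ≤ 1 / 2 := by rw [← hs]; simpa using hx₀
      have h2 : s.im = y := by rw [← hs]; simp
      have hr : C₀ ≤ L - |s.im| := by rw [h2]; linarith
      have hr0 : 0 < L - |s.im| := by linarith
      have i1 := h.norm_GR_le hL hC (by linarith) hr
      have i2 := h.norm_D_le hC (by linarith) hr
      have i3 := hD s h1 hr
      rw [← h2]
      generalize L - |s.im| = r at *
      calc _ ≤ c ^ 2 / r ^ 3 * (‖D s‖ * ‖D s‖) := by rw [← sq]; exact i1
        _ ≤ c ^ 2 / r ^ 3 * ((c / r ^ 2) * (N * r ^ 2 * Real.exp (-(2 * π * r)))) := by gcongr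
        _ = _ := by rw [hM]; field_simp
    · intro r h1 h2
      have hr : 0 < r := by linarith
      refine ⟨?_, le_rfl, ?_⟩
      · have := ((((hasDerivAt_inv hr.ne').fun_pow 2).const_sub (C₀⁻¹ ^ 2)).const_mul M).div_const 2
        refine this.congr_deriv ?_
        push_cast; field_simp
      · have : r⁻¹ ^ 2 ≤ C₀⁻¹ ^ 2 := by gcongr; linarith
        have : 0 ≤ C₀⁻¹ ^ 2 - r⁻¹ ^ 2 := by linarith
        positivity
    · intro r h1 h2
      have hr : C₀ ≤ r := by linarith
      refine ⟨((((hasDerivAt_id r).const_mul (2 * π)).neg).exp).const_mul _, ?_, by positivity⟩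
      have i1 : M / r ^ 3 ≤ M / C₀ ^ 2 := by
        gcongr
        calc C₀ ^ 2 ≤ C₀ ^ 3 := pow_le_pow_right₀ hC (by norm_num)
          _ ≤ r ^ 3 := by gcongr
      have i2 : 0 ≤ M / C₀ ^ 2 := by positivity
      calc _ ≤ M / C₀ ^ 2 * Real.exp (-(2 * π * r)) * 1 := by rw [mul_one]; gcongr
        _ ≤ M / C₀ ^ 2 * Real.exp (-(2 * π * r)) * (2 * π) := by
            gcongr; linarith [Real.pi_gt_three]
        _ = _ := by ring
  · have := h.norm_wronskian_le_const hL hC (s := t) (by rw [abs_le]; constructor <;> linarith)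
      (by rw [abs_le]; constructor <;> linarith) (by rwa [abs_of_nonneg h0])
    have e := exp_two_pi_mul_le (C₀ := C₀) (L := L) (y := t.im) (by linarith)
    have i2 : 0 ≤ 4 * M / C₀ ^ 2 * Real.exp (-(2 * π * (L - t.im))) := by positivity
    calc _ ≤ 2 * c ^ 2 * 1 := by linarith
      _ ≤ 32 * c ^ 2 * (Real.exp (2 * π * (C₀ + 1)) * Real.exp (-(2 * π * (L - t.im)))) := by
        gcongr; norm_num
      _ ≤ 32 * c ^ 2 * (Real.exp (2 * π * (C₀ + 1)) * Real.exp (-(2 * π * (L - t.im))))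
        + 4 * M / C₀ ^ 2 * Real.exp (-(2 * π * (L - t.im))) := by linarith
      _ = _ := by rw [hM]; ring

lemma wronskian_bound (h : SplitPair c C₀ L D G R) (hL : C₀ ≤ L) (hC : 1 ≤ C₀) {N : ℝ} (hN : 0 ≤ N)
    (hD : ∀ s : ℂ, |s.re| ≤ 1 / 2 → C₀ ≤ L - |s.im| →
      ‖D s‖ ≤ N * (L - |s.im|) ^ 2 * Real.exp (-(2 * π * (L - |s.im|)))) {t : ℂ}
    (ht : -(5 / 4) ≤ t.re) (ht' : t.re ≤ 1 / 4) (htZ : C₀ ≤ L - |t.im|) :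
    ‖wronskian D G t‖ ≤ (32 * c ^ 2 * Real.exp (2 * π * (C₀ + 1)) + 4 * c ^ 3 * N / C₀ ^ 2) *
      Real.exp (-(2 * π * (L - |t.im|))) := by
  rcases le_total 0 t.im with h0 | h0
  · rw [abs_of_nonneg h0] at htZ ⊢
    exact h.wronskian_bound_upper hL hC hN hD ht ht' htZ h0
  · rw [abs_of_nonpos h0] at htZ ⊢
    have := h.wronskian_bound_upper hL hC hN hD (t := starRingEnd ℂ t) (by simpa using ht) (by simpa using ht')
      (by simpa using htZ) (by simpa using h0)
    simpa [h.wronskian_conj] using this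

end SplitPair

namespace SplitPair

variable {c C₀ L : ℝ} {D G R : ℂ → ℂ}

lemma norm_ratio_le_const (h : SplitPair c C₀ L D G R) (hL : C₀ ≤ L) (hC : 1 ≤ C₀) {s : ℂ}
    (h1 : |s.re| ≤ 3 / 2) (h2 : C₀ ≤ L - |s.im|) : ‖D s / G s‖ ≤ c ^ 2 := by
  have hc := h.c_nonneg hL hC
  have hr : 1 ≤ L - |s.im| := by linarith
  have i1 := h.norm_D_le hC h1 h2
  have i2 := h.norm_inv_G_le h1 h2
  rw [div_eq_mul_inv, norm_mul]
  calc _ ≤ c / (L - |s.im|) ^ 2 * (c * (L - |s.im|)) := by gcongr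
    _ = c ^ 2 / (L - |s.im|) := by field_simp
    _ ≤ c ^ 2 := div_le_self (by positivity) hr

lemma ratio_strip (h : SplitPair c C₀ L D G R) (hL : C₀ ≤ L) (hC : 1 ≤ C₀) {w W W' V V' : ℝ → ℝ}
    {t : ℂ} (ht : |t.re| ≤ 1 / 2) (h0 : 0 ≤ t.im) (hZ : t.im + 1 ≤ L - C₀)
    (hw : ∀ s : ℂ, s.re = t.re / 2 - 1 / 2 → C₀ ≤ L - |s.im| →
      c ^ 2 * (L - |s.im|) ^ 2 * ‖wronskian D G s‖ ≤
        w (L - |s.im|) * Real.exp (-(2 * π * (L - |s.im|))))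
    (hW : ∀ r, C₀ ≤ r → r ≤ L → HasDerivAt W (W' r) r ∧ w r ≤ W' r ∧ 0 ≤ W r)
    (hV : ∀ r, C₀ ≤ r → r ≤ L → HasDerivAt V (V' r) r ∧
      w r * Real.exp (-(2 * π * r)) ≤ - V' r ∧ 0 ≤ V r) :
    ‖D t / G t‖ ≤ 16 * c ^ 2 * (Real.exp (2 * π * (C₀ + 1)) * Real.exp (-(2 * π * (L - t.im))))
      + 2 * (Real.exp (-(2 * π * L)) * W L
      + V (L - t.im) + Real.exp (-(2 * π * (L - t.im))) * W (L - t.im)) := by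
  have hc := h.c_nonneg hL hC
  rw [abs_le] at ht
  have key := weighted_strip (f := fun z => D z / G z) (F := c ^ 2) (L := L) (w := w) (W := W)
    (W' := W') (V := V) (V' := V') (Z := L - C₀) (x₀ := t.re / 2) (t := t) (t₀ := 0) ?_
    (by rw [abs_le]; constructor <;> linarith) h0 hZ
    (by simp [abs_le]; constructor <;> linarith) (by simp) ?_
    (fun r h1 h2 => hW r (by linarith) h2) (fun r h1 h2 => hV r (by linarith) h2)
  · simp only [h.D_zero, zero_div, sub_zero] at key
    refine key.trans ?_
    gcongr
    rw [← Real.exp_add]; exact Real.exp_le_exp.2 (by nlinarith [Real.pi_pos])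
  · intro z h1 h2
    rw [abs_le] at h1
    have h3 : |z.re| ≤ 3 / 2 := by rw [abs_le]; constructor <;> linarith
    exact ⟨(h.diff_D z).div (h.diff_G z) (h.G_ne h3 (by linarith)),
      h.norm_ratio_le_const hL hC h3 (by linarith)⟩
  · intro y hy
    have e : ((t.re / 2 + 1 / 2 : ℝ) : ℂ) + y * Complex.I
        = (((t.re / 2 - 1 / 2 : ℝ) : ℂ) + y * Complex.I) + 1 := by push_cast; ring
    rw [e]
    generalize hs : (((t.re / 2 - 1 / 2 : ℝ) : ℂ) + y * Complex.I) = s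
    have h1 : s.re = t.re / 2 - 1 / 2 := by rw [← hs]; simp
    have h2 : s.im = y := by rw [← hs]; simp
    rw [← h2] at hy ⊢
    have hr : C₀ ≤ L - |s.im| := by linarith
    have a1 : |s.re| ≤ 3 / 2 := by rw [abs_le]; constructor <;> linarith
    have a2 : |(s + 1).re| ≤ 3 / 2 := by
      rw [Complex.add_re, Complex.one_re, abs_le]; constructor <;> linarith
    have hr2 : C₀ ≤ L - |(s + 1).im| := by simpa using hr
    have n1 := h.G_ne a1 hr
    have n2 := h.G_ne a2 hr2
    have i1 := h.norm_inv_G_le a1 hr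
    have i2 := h.norm_inv_G_le a2 hr2
    rw [show (s + 1).im = s.im by simp] at i2
    have e2 : D (s + 1) / G (s + 1) - D s / G s = wronskian D G s * ((G s)⁻¹ * (G (s + 1))⁻¹) := by
      unfold wronskian; field_simp
    rw [e2, norm_mul, norm_mul]
    refine le_trans ?_ (hw s h1 hr)
    have hr0 : 0 ≤ L - |s.im| := by linarith
    calc _ ≤ ‖wronskian D G s‖ * ((c * (L - |s.im|)) * (c * (L - |s.im|))) := by gcongr
      _ = _ := by ring

lemma D_bound_step (h : SplitPair c C₀ L D G R) (hL : C₀ ≤ L) (hC : 1 ≤ C₀) {B : ℝ} (hB0 : 0 ≤ B)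
    (hB : ∀ s : ℂ, -(3 / 4) ≤ s.re → s.re ≤ -(1 / 4) → C₀ ≤ L - |s.im| →
      ‖wronskian D G s‖ ≤ B * Real.exp (-(2 * π * (L - |s.im|)))) {t : ℂ}
    (ht : |t.re| ≤ 1 / 2) (h0 : 0 ≤ t.im) (htZ : C₀ ≤ L - t.im) :
    ‖D t‖ ≤ (16 * c ^ 3 * Real.exp (2 * π * (C₀ + 1)) + 4 * c ^ 3 * B) * (L - t.im) ^ 2 *
      Real.exp (-(2 * π * (L - t.im))) := by
  have hr : 1 ≤ L - t.im := by linarith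
  have ht' : |t.re| ≤ 3 / 2 := by linarith
  have htZ' : C₀ ≤ L - |t.im| := by rwa [abs_of_nonneg h0]
  have hp3 : 1 ≤ (L - t.im) ^ 3 := one_le_pow₀ hr
  have hP : ‖D t / G t‖ ≤ (16 * c ^ 2 * Real.exp (2 * π * (C₀ + 1)) + 4 * c ^ 2 * B) *
      (L - t.im) ^ 3 * Real.exp (-(2 * π * (L - t.im))) := by
    by_cases hZ : t.im + 1 ≤ L - C₀
    · have key := h.ratio_strip hL hC (w := fun r => c ^ 2 * B * r ^ 2)
        (W := fun r => c ^ 2 * B * (r ^ 3 / 3)) (W' := fun r => c ^ 2 * B * r ^ 2)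
        (V := fun r => c ^ 2 * B * (r ^ 2 * Real.exp (-(2 * π * r))))
        (V' := fun r => c ^ 2 * B * ((2 : ℕ) * r ^ (2 - 1) * Real.exp (-(2 * π * r)) +
          r ^ 2 * (Real.exp (-(2 * π * r)) * (-(2 * π * 1))))) ht h0 hZ ?_ ?_ ?_
      · refine key.trans ?_
        have e2 := pow_three_mul_exp_anti hr (show L - t.im ≤ L by linarith)
        have hM : 0 ≤ c ^ 2 * B := by positivity
        generalize L - t.im = r at *
        have j1 := mul_le_mul_of_nonneg_left e2 hM
        have j3 := mul_le_mul_of_nonneg_left hp3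
          (show 0 ≤ 16 * c ^ 2 * Real.exp (2 * π * (C₀ + 1)) * Real.exp (-(2 * π * r)) by positivity)
        have j4 : 0 ≤ c ^ 2 * B * (r ^ 3 * Real.exp (-(2 * π * r))) := by positivity
        nlinarith
      · intro s hs1 hs2
        rw [abs_le] at ht
        have := hB s (by linarith) (by linarith) hs2
        calc _ ≤ c ^ 2 * (L - |s.im|) ^ 2 * (B * Real.exp (-(2 * π * (L - |s.im|)))) := by gcongr
          _ = _ := by ring
      · intro r h1 h2
        have : 0 < r := by linarith
        refine ⟨(((hasDerivAt_pow 3 r).div_const 3).const_mul (c ^ 2 * B)).congr_deriv ?_, le_rfl,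
          by positivity⟩
        push_cast; ring
      · intro r h1 h2
        refine ⟨((hasDerivAt_pow 2 r).mul
          ((((hasDerivAt_id r).const_mul (2 * π)).neg).exp)).const_mul _, ?_, by positivity⟩
        have hM : 0 ≤ c ^ 2 * B * Real.exp (-(2 * π * r)) := by positivity
        have : r ^ 2 ≤ 2 * π * r ^ 2 - 2 * r := by nlinarith [Real.pi_gt_three]
        have := mul_le_mul_of_nonneg_left this hM
        push_cast
        nlinarith
    · have i1 := h.norm_ratio_le_const hL hC ht' htZ'
      have e := exp_two_pi_mul_le (C₀ := C₀) (L := L) (y := t.im) (by linarith)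
      calc _ ≤ c ^ 2 * 1 * 1 := by linarith
        _ ≤ (16 * c ^ 2) * (Real.exp (2 * π * (C₀ + 1)) * Real.exp (-(2 * π * (L - t.im)))) *
            (L - t.im) ^ 3 := by
          gcongr; nlinarith
        _ ≤ (16 * c ^ 2) * (Real.exp (2 * π * (C₀ + 1)) * Real.exp (-(2 * π * (L - t.im)))) *
            (L - t.im) ^ 3 + 4 * c ^ 2 * B * (L - t.im) ^ 3 * Real.exp (-(2 * π * (L - t.im))) :=
          le_add_of_nonneg_right (by positivity)
        _ = _ := by ring
  have hG := h.norm_G_le hC ht' htZ'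
  rw [abs_of_nonneg h0] at hG
  have e : D t = D t / G t * G t := by field_simp [h.G_ne ht' htZ']
  rw [e, norm_mul]
  calc _ ≤ ((16 * c ^ 2 * Real.exp (2 * π * (C₀ + 1)) + 4 * c ^ 2 * B) *
      (L - t.im) ^ 3 * Real.exp (-(2 * π * (L - t.im)))) * (c / (L - t.im)) := by gcongr
    _ = _ := by field_simp

/-- First exponentially small bound on the splitting. -/
theorem first_bound (h : SplitPair c C₀ L D G R) (hL : C₀ ≤ L) (hC : 1 ≤ C₀) (hcC : 6 * c ^ 3 ≤ C₀)
    {A : ℝ} (hA : A = 2 * (16 * c ^ 3 + 128 * c ^ 5) * Real.exp (2 * π * (C₀ + 1))) :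
    (∀ s : ℂ, |s.re| ≤ 1 / 2 → C₀ ≤ L - |s.im| →
      ‖D s‖ ≤ A * (L - |s.im|) ^ 2 * Real.exp (-(2 * π * (L - |s.im|)))) ∧
    (∀ s : ℂ, -(5 / 4) ≤ s.re → s.re ≤ 1 / 4 → C₀ ≤ L - |s.im| →
      ‖wronskian D G s‖ ≤ (32 * c ^ 2 * Real.exp (2 * π * (C₀ + 1)) + 4 * c ^ 3 * A / C₀ ^ 2) *
        Real.exp (-(2 * π * (L - |s.im|)))) := by
  have hc := h.c_nonneg hL hC
  set φ : ℂ → ℝ := fun s => ‖D s‖ / ((L - |s.im|) ^ 2 * Real.exp (-(2 * π * (L - |s.im|)))) with hφ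
  set S : Set ℂ := Icc (-(1 / 2)) (1 / 2) ×ℂ Icc (-(L - C₀)) (L - C₀) with hS
  have hSmem : ∀ s, s ∈ S ↔ |s.re| ≤ 1 / 2 ∧ C₀ ≤ L - |s.im| := by
    intro s
    rw [hS, Complex.mem_reProdIm, abs_le, le_sub_comm, abs_le]; rfl
  have hScomp : IsCompact S := isCompact_Icc.reProdIm isCompact_Icc
  have hpos : ∀ s ∈ S, 0 < (L - |s.im|) ^ 2 * Real.exp (-(2 * π * (L - |s.im|))) := by
    intro s hs
    have := ((hSmem s).1 hs).2
    have : 0 < L - |s.im| := by linarith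
    positivity
  have hφc : ContinuousOn φ S := by
    refine ContinuousOn.div h.diff_D.continuous.norm.continuousOn (Continuous.continuousOn ?_)
      fun s hs => (hpos s hs).ne'
    have := Complex.continuous_im
    fun_prop
  obtain ⟨s₀, hs₀, hmax⟩ := hScomp.exists_isMaxOn ⟨0, by rw [hSmem]; simpa using hL⟩ hφc
  have hbd : ∀ s : ℂ, |s.re| ≤ 1 / 2 → C₀ ≤ L - |s.im| →
      ‖D s‖ ≤ φ s₀ * (L - |s.im|) ^ 2 * Real.exp (-(2 * π * (L - |s.im|))) := by
    intro s h1 h2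
    have hs := (hSmem s).2 ⟨h1, h2⟩
    have h3 : φ s ≤ φ s₀ := hmax hs
    rw [mul_assoc, ← div_le_iff₀ (hpos s hs)]
    exact h3
  have hφ0 : 0 ≤ φ s₀ := div_nonneg (norm_nonneg _) (hpos s₀ hs₀).le
  have hW := fun (s : ℂ) a b d => h.wronskian_bound hL hC hφ0 hbd (t := s) a b d
  set B := 32 * c ^ 2 * Real.exp (2 * π * (C₀ + 1)) + 4 * c ^ 3 * φ s₀ / C₀ ^ 2 with hBd
  have hB0 : 0 ≤ B := by positivity
  have hstep : φ s₀ ≤ 16 * c ^ 3 * Real.exp (2 * π * (C₀ + 1)) + 4 * c ^ 3 * B := by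
    obtain ⟨h1, h2⟩ := (hSmem s₀).1 hs₀
    simp only [hφ]
    rw [div_le_iff₀ (hpos s₀ hs₀), ← mul_assoc]
    rcases le_total 0 s₀.im with h0 | h0
    · rw [abs_of_nonneg h0] at h2 ⊢
      exact h.D_bound_step hL hC hB0 (fun s a b => hW s (by linarith) (by linarith)) h1 h0 h2
    · rw [abs_of_nonpos h0] at h2 ⊢
      have := h.D_bound_step hL hC hB0 (fun s a b => hW s (by linarith) (by linarith)) (t := starRingEnd ℂ s₀) (by simpa using h1) (by simpa using h0)
        (by simpa using h2)
      simpa [h.conj_D] using this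
  have hle : φ s₀ ≤ A := by
    have i1 : 16 * c ^ 6 * φ s₀ / C₀ ^ 2 ≤ φ s₀ / 2 := by
      rw [div_le_iff₀ (by positivity)]
      have : 36 * c ^ 6 ≤ C₀ ^ 2 := by
        calc 36 * c ^ 6 = (6 * c ^ 3) ^ 2 := by ring
          _ ≤ C₀ ^ 2 := by gcongr
      nlinarith
    have i2 : 4 * c ^ 3 * B = 128 * c ^ 5 * Real.exp (2 * π * (C₀ + 1)) + 16 * c ^ 6 * φ s₀ / C₀ ^ 2 := by
      rw [hBd]; ring
    rw [hA]
    linarith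
  refine ⟨fun s h1 h2 => (hbd s h1 h2).trans (by gcongr), fun s h1 h2 h3 => (hW s h1 h2 h3).trans ?_⟩
  rw [hBd]
  gcongr

end SplitPair

lemma half_strip {f : ℂ → ℂ} {Z F B K₁ K₂ : ℝ} (hf : ∀ z : ℂ, -1 ≤ z.re → z.re ≤ 0 →
    0 ≤ z.im → z.im ≤ Z → DifferentiableAt ℂ f z ∧ ‖f z‖ ≤ F) {ζ : ℝ}
    (hζ : 1 ≤ ζ) (hZ : ζ + 1 ≤ Z) (hB : ∀ x : ℝ, -1 ≤ x → x ≤ 0 → ‖f x‖ ≤ B)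
    (hK₁ : ∫ y in (0)..ζ, ‖f (y * Complex.I) - f (y * Complex.I - 1)‖ *
      Real.exp (2 * π * (ζ - y)) ≤ K₁)
    (hK₂ : ∫ y in ζ..Z, ‖f (y * Complex.I) - f (y * Complex.I - 1)‖ *
      Real.exp (-(4 * π * (y - ζ))) ≤ K₂) :
    ‖f (-(1 / 2) + ζ * Complex.I)‖ ≤ 2 * (2 * B * Real.exp (2 * π * ζ) +
      2 * F * Real.exp (-(4 * π * (Z - ζ))) + K₁ + K₂) := by
  set t : ℂ := -(1 / 2) + ζ * Complex.I with ht
  have htre : t.re = -(1 / 2) := by simp [ht]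
  have htim : t.im = ζ := by simp [ht]
  have hF : 0 ≤ F := (norm_nonneg _).trans
    (hf t (by rw [htre]; norm_num) (by rw [htre]; norm_num) (by linarith) (by linarith)).2
  have hB0 : 0 ≤ B := (norm_nonneg _).trans (hB 0 (by norm_num) le_rfl)
  have h16 : (16 : ℝ) ≤ Real.exp (2 * π) := by
    have h1 : (2 : ℝ) ≤ Real.exp 1 := by have := Real.add_one_le_exp (1 : ℝ); linarith
    calc (16 : ℝ) = 2 ^ 4 := by norm_num
      _ ≤ Real.exp 1 ^ 4 := by gcongr
      _ = Real.exp 4 := by rw [← Real.exp_nat_mul]; norm_num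
      _ ≤ _ := Real.exp_le_exp.2 (by linarith [Real.pi_gt_three])
  have hsmall : ∀ v : ℝ, 1 ≤ v → Real.exp (-(2 * π * v)) ≤ 1 / 16 := by
    intro v hv
    rw [Real.exp_neg, ← one_div]
    apply one_div_le_one_div_of_le (by norm_num)
    exact h16.trans (Real.exp_le_exp.2 (by nlinarith [Real.pi_pos]))
  set g : ℂ → ℂ := fun s => f s * Complex.exp (2 * π * Complex.I * (s - t)) with hg
  have hnorm : ∀ s : ℂ, ‖g s‖ = ‖f s‖ * Real.exp (-(2 * π * (s.im - ζ))) := by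
    intro s
    rw [hg]; simp only [norm_mul]; congr 1
    rw [Complex.norm_exp]; congr 1; simp [htim]
  have hgt : g t = f t := by simp [hg]
  have hc := cauchy_strip (f := g) (x₀ := -(1 / 2)) (a := 0) (b := Z) (t := t) (by
      intro z h1 h2 h3
      rw [abs_le] at h1
      have := (hf z (by linarith) (by linarith) h2 h3).1
      exact this.mul (by fun_prop)) (by rw [htre]; norm_num) (by linarith) (by linarith)
  rw [hgt] at hc
  simp only [show (-(1 / 2) - 1 / 2 : ℝ) = -1 by norm_num, show (-(1 / 2) + 1 / 2 : ℝ) = 0 by norm_num,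
    Complex.ofReal_zero, zero_mul, add_zero, zero_add] at hc
  have e1 : ‖∫ x in (-1 : ℝ)..0, g x‖ ≤ B * Real.exp (2 * π * ζ) := by
    have := intervalIntegral.norm_integral_le_of_norm_le_const (a := (-1 : ℝ)) (b := 0)
      (C := B * Real.exp (2 * π * ζ)) (f := fun x : ℝ => g x) (by
        intro x hx
        rw [uIoc_of_le (by norm_num)] at hx
        rw [hnorm]
        have := hB x hx.1.le hx.2
        simp only [Complex.ofReal_im, zero_sub, mul_neg, neg_neg]
        gcongr)
    simpa using this
  have e2 : ‖∫ x in (-1 : ℝ)..0, (g x - f t) * (stripKernel (x - t) - 1)‖ ≤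
      (B * Real.exp (2 * π * ζ) + ‖f t‖) * (1 / 8) := by
    have := intervalIntegral.norm_integral_le_of_norm_le_const (a := (-1 : ℝ)) (b := 0)
      (C := (B * Real.exp (2 * π * ζ) + ‖f t‖) * (1 / 8))
      (f := fun x : ℝ => (g x - f t) * (stripKernel (x - t) - 1)) (by
        intro x hx
        rw [uIoc_of_le (by norm_num)] at hx
        rw [norm_mul]
        have h1 := hB x hx.1.le hx.2
        have h2 : ‖g x‖ ≤ B * Real.exp (2 * π * ζ) := by
          rw [hnorm]
          simp only [Complex.ofReal_im, zero_sub, mul_neg, neg_neg]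
          gcongr
        have h3 := norm_stripKernel_sub_one_le_of_im_le (z := x - t) (by simp [htim]; linarith)
        simp only [Complex.sub_im, Complex.ofReal_im, htim, zero_sub, mul_neg] at h3
        have h4 := hsmall ζ hζ
        gcongr
        · exact (norm_sub_le _ _).trans (by linarith)
        · linarith)
    simpa using this
  have e3 : ‖∫ x in (-1 : ℝ)..0, (g (x + Z * Complex.I) - f t) * stripKernel (x + Z * Complex.I - t)‖ ≤
      2 * F * Real.exp (-(4 * π * (Z - ζ))) + ‖f t‖ * (1 / 8) := by
    have := intervalIntegral.norm_integral_le_of_norm_le_const (a := (-1 : ℝ)) (b := 0)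
      (C := 2 * F * Real.exp (-(4 * π * (Z - ζ))) + ‖f t‖ * (1 / 8))
      (f := fun x : ℝ => (g (x + Z * Complex.I) - f t) * stripKernel (x + Z * Complex.I - t)) (by
        intro x hx
        rw [uIoc_of_le (by norm_num)] at hx
        rw [norm_mul]
        have h1 := (hf (x + Z * Complex.I) (by simpa using hx.1.le) (by simpa using hx.2)
          (by simp; linarith) (by simp)).2
        have h2 : ‖g (x + Z * Complex.I)‖ ≤ F * Real.exp (-(2 * π * (Z - ζ))) := by
          rw [hnorm]
          have : (x + Z * Complex.I : ℂ).im = Z := by simp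
          rw [this]
          gcongr
        have h3 := norm_stripKernel_le_of_one_le_im (z := x + Z * Complex.I - t)
          (by simp [htim]; linarith)
        have h5 : (x + Z * Complex.I - t : ℂ).im = Z - ζ := by simp [htim]
        rw [h5] at h3
        have h4 := hsmall (Z - ζ) (by linarith)
        have h6 : Real.exp (-(4 * π * (Z - ζ))) = Real.exp (-(2 * π * (Z - ζ))) * Real.exp (-(2 * π * (Z - ζ))) := by
          rw [← Real.exp_add]; congr 1; ring
        rw [h6]
        calc _ ≤ (F * Real.exp (-(2 * π * (Z - ζ))) + ‖f t‖) * (2 * Real.exp (-(2 * π * (Z - ζ)))) := by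
              gcongr
              exact (norm_sub_le _ _).trans (by linarith)
          _ ≤ _ := by nlinarith [norm_nonneg (f t)])
    simpa using this
  set J : ℝ → ℂ := fun y => f (y * Complex.I) - f (y * Complex.I - 1) with hJ
  have hJc : ContinuousOn J (Icc 0 Z) := by
    intro y hy
    apply ContinuousAt.continuousWithinAt
    apply ContinuousAt.sub
    · exact ContinuousAt.comp (g := f) (f := fun y : ℝ => (y * Complex.I))
        (hf _ (by simp) (by simp) (by simpa using hy.1) (by simpa using hy.2)).1.continuousAt (by fun_prop)
    · exact ContinuousAt.comp (g := f) (f := fun y : ℝ => (y * Complex.I - 1))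
        (hf _ (by simp) (by simp) (by simpa using hy.1) (by simpa using hy.2)).1.continuousAt (by fun_prop)
  set k : ℝ → ℂ := fun y => Complex.exp (2 * π * Complex.I * (y * Complex.I - 1 - t)) *
    stripKernel (y * Complex.I - 1 - t) with hk
  have hre : ∀ y : ℝ, -(3 / 4) ≤ (y * Complex.I - 1 - t).re ∧ (y * Complex.I - 1 - t).re ≤ -(1 / 4) := by
    intro y; simp [htre]; constructor <;> norm_num
  have him : ∀ y : ℝ, (y * Complex.I - 1 - t).im = y - ζ := by intro y; simp [htim]
  have hkc : Continuous k := by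
    refine Continuous.mul (by fun_prop) ?_
    unfold stripKernel
    refine Continuous.inv₀ (by fun_prop) fun y => ?_
    exact norm_pos_iff.1 (by linarith [one_le_norm_strip (hre y).1 (hre y).2])
  have hkn : ∀ y, ‖k y‖ = Real.exp (2 * π * (ζ - y)) * ‖stripKernel (y * Complex.I - 1 - t)‖ := by
    intro y
    rw [hk]; simp only [norm_mul]; congr 1
    rw [Complex.norm_exp]; congr 1
    have : (2 * π * Complex.I * (y * Complex.I - 1 - t)).re = - (2 * π * (y * Complex.I - 1 - t).im) := by
      simp
    rw [this, him]; ring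
  have hcj : (∫ y in (0)..Z, (g (y * Complex.I) - g (((-1 : ℝ) : ℂ) + y * Complex.I)) *
      stripKernel (((-1 : ℝ) : ℂ) + y * Complex.I - t))
      = (∫ y in (0)..ζ, J y * k y) + ∫ y in ζ..Z, J y * k y := by
    rw [intervalIntegral.integral_add_adjacent_intervals]
    · apply intervalIntegral.integral_congr
      intro y _
      have e : ((-1 : ℝ) : ℂ) + y * Complex.I = y * Complex.I - 1 := by push_cast; ring
      have e2 : Complex.exp (2 * π * Complex.I * (y * Complex.I - t)) =
          Complex.exp (2 * π * Complex.I * (y * Complex.I - 1 - t)) := by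
        have : 2 * π * Complex.I * (y * Complex.I - t) =
          2 * π * Complex.I * (y * Complex.I - 1 - t) + 2 * π * Complex.I := by ring
        rw [this, Complex.exp_add, Complex.exp_two_pi_mul_I, mul_one]
      simp only [e, hg, e2, hJ, hk]; ring
    all_goals apply ContinuousOn.intervalIntegrable; rw [uIcc_of_le (by linarith)]
    · exact (hJc.mono (Icc_subset_Icc le_rfl (by linarith))).mul hkc.continuousOn
    · exact (hJc.mono (Icc_subset_Icc (by linarith) le_rfl)).mul hkc.continuousOn
  have b1 : ‖∫ y in (0)..ζ, J y * k y‖ ≤ K₁ := by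
    refine (intervalIntegral.norm_integral_le_of_norm_le (by linarith)
      (g := fun y => ‖J y‖ * Real.exp (2 * π * (ζ - y))) ?_ ?_).trans hK₁
    · refine MeasureTheory.ae_of_all _ fun y hy => ?_
      rw [norm_mul, hkn]
      have i1 := norm_stripKernel_le_one (hre y).1 (hre y).2
      gcongr
      exact mul_le_of_le_one_right (Real.exp_pos _).le i1
    · apply ContinuousOn.intervalIntegrable
      rw [uIcc_of_le (by linarith)]
      have := hJc.mono (Icc_subset_Icc (le_refl (0 : ℝ)) (show ζ ≤ Z by linarith))
      fun_prop
  have b2 : ‖∫ y in ζ..Z, J y * k y‖ ≤ K₂ := by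
    refine (intervalIntegral.norm_integral_le_of_norm_le (by linarith)
      (g := fun y => ‖J y‖ * Real.exp (-(4 * π * (y - ζ)))) ?_ ?_).trans hK₂
    · refine MeasureTheory.ae_of_all _ fun y hy => ?_
      rw [norm_mul, hkn]
      have i1 := norm_stripKernel_le_exp (hre y).1 (hre y).2
      rw [him] at i1
      gcongr
      calc _ ≤ Real.exp (2 * π * (ζ - y)) * Real.exp (-(2 * π * (y - ζ))) := by gcongr
        _ = _ := by rw [← Real.exp_add]; congr 1; ring
    · apply ContinuousOn.intervalIntegrable
      rw [uIcc_of_le (by linarith)]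
      have := hJc.mono (Icc_subset_Icc (show 0 ≤ ζ by linarith) (le_refl Z))
      fun_prop
  rw [hcj] at hc
  have hfin : ‖f t‖ ≤ B * Real.exp (2 * π * ζ) + (B * Real.exp (2 * π * ζ) + ‖f t‖) * (1 / 8) +
      (2 * F * Real.exp (-(4 * π * (Z - ζ))) + ‖f t‖ * (1 / 8)) + (K₁ + K₂) := by
    conv_lhs => rw [hc]
    refine (norm_add_le _ _).trans (add_le_add ((norm_sub_le _ _).trans (add_le_add
      ((norm_add_le _ _).trans (add_le_add e1 e2)) e3)) ?_)
    rw [norm_mul, Complex.norm_I, one_mul]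
    exact (norm_add_le _ _).trans (add_le_add b1 b2)
  have := Real.exp_pos (2 * π * ζ)
  have i0 : 0 ≤ B * Real.exp (2 * π * ζ) := by positivity
  have i1 : 0 ≤ F * Real.exp (-(4 * π * (Z - ζ))) := by positivity
  have i2 : 0 ≤ K₁ := (norm_nonneg _).trans b1
  have i3 : 0 ≤ K₂ := (norm_nonneg _).trans b2
  linarith

namespace SplitPair

variable {c C₀ L : ℝ} {D G R : ℂ → ℂ}

lemma wronskian_mid_bound (h : SplitPair c C₀ L D G R) (hC : 1 ≤ C₀) {A B η : ℝ}
    (hη : 0 ≤ η)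
    (hD : ∀ s : ℂ, |s.re| ≤ 1 / 2 → C₀ ≤ L - |s.im| →
      ‖D s‖ ≤ A * (L - |s.im|) ^ 2 * Real.exp (-(2 * π * (L - |s.im|))))
    (hB : 0 ≤ B)
    (hW : ∀ s : ℂ, -(3 / 4) ≤ s.re → s.re ≤ -(1 / 4) → C₀ ≤ L - |s.im| →
      ‖wronskian D G s‖ ≤ B * Real.exp (-(2 * π * (L - |s.im|))))
    (hreal : ∀ x : ℝ, -1 ≤ x → x ≤ 0 → ‖wronskian D G x‖ ≤ η * Real.exp (-(2 * π * L)))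
    {ζ : ℝ} (h0 : 0 ≤ ζ) (hζ : C₀ ≤ L - ζ) :
    ‖wronskian D G (-(1 / 2) + ζ * Complex.I)‖ ≤
      (4 + 8 * c ^ 2 * Real.exp (4 * π * (C₀ + 1)) + 3 * c ^ 2 * A ^ 2 + B * Real.exp (2 * π)) *
      ((L - ζ) ^ 2 * Real.exp (-(4 * π * (L - ζ))) + η * Real.exp (-(2 * π * (L - ζ))) +
        Real.exp (-(2 * π * L))) := by
  have hL : C₀ ≤ L := by linarith
  have hr : 1 ≤ L - ζ := by linarith
  have hre : (-(1 / 2) + ζ * Complex.I : ℂ).re = -(1 / 2) := by simp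
  have him : (-(1 / 2) + ζ * Complex.I : ℂ).im = ζ := by simp
  have hEL := Real.exp_pos (-(2 * π * L))
  have hp2 : 1 ≤ (L - ζ) ^ 2 := one_le_pow₀ hr
  rcases lt_or_ge ζ 1 with hz | hz
  · have i1 := hW (-(1 / 2) + ζ * Complex.I) (by rw [hre]; norm_num) (by rw [hre]; norm_num)
      (by rw [him, abs_of_nonneg h0]; exact hζ)
    rw [him, abs_of_nonneg h0] at i1
    have e : Real.exp (-(2 * π * (L - ζ))) ≤ Real.exp (2 * π) * Real.exp (-(2 * π * L)) := by
      rw [← Real.exp_add]; exact Real.exp_le_exp.2 (by nlinarith [Real.pi_pos])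
    calc _ ≤ B * (Real.exp (2 * π) * Real.exp (-(2 * π * L))) := i1.trans (by gcongr)
      _ = (0 + B * Real.exp (2 * π)) * (0 + Real.exp (-(2 * π * L))) := by ring
      _ ≤ _ := by gcongr <;> positivity
  rcases lt_or_ge (L - C₀) (ζ + 1) with ht | ht
  · have i1 := h.norm_wronskian_le_const hL hC (s := -(1 / 2) + ζ * Complex.I)
      (by rw [hre]; norm_num [abs_le]) (by rw [hre]; norm_num [abs_le])
      (by rw [him, abs_of_nonneg h0]; exact hζ)
    have e : 1 ≤ Real.exp (4 * π * (C₀ + 1)) * Real.exp (-(4 * π * (L - ζ))) := by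
      rw [← Real.exp_add]; exact Real.one_le_exp (by nlinarith [Real.pi_pos])
    calc _ ≤ 8 * c ^ 2 * 1 := by nlinarith [sq_nonneg c]
      _ ≤ 8 * c ^ 2 * (1 * (Real.exp (4 * π * (C₀ + 1)) * Real.exp (-(4 * π * (L - ζ))))) := by
          gcongr; linarith
      _ ≤ 8 * c ^ 2 * ((L - ζ) ^ 2 * (Real.exp (4 * π * (C₀ + 1)) * Real.exp (-(4 * π * (L - ζ))))) := by
          gcongr
      _ = (0 + 8 * c ^ 2 * Real.exp (4 * π * (C₀ + 1)) + 0 + 0) *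
        ((L - ζ) ^ 2 * Real.exp (-(4 * π * (L - ζ))) + 0 + 0) := by ring
      _ ≤ _ := by gcongr <;> positivity
  have hGR : ∀ y : ℝ, 0 ≤ y → y ≤ L - C₀ →
      ‖wronskian D G (y * Complex.I) - wronskian D G (y * Complex.I - 1)‖ ≤
        c ^ 2 * A ^ 2 * (L - y) * Real.exp (-(4 * π * (L - y))) := by
    intro y hy0 hy
    have a1 : |(y * Complex.I : ℂ).re| ≤ 1 / 2 := by simp
    have a2 : C₀ ≤ L - |(y * Complex.I : ℂ).im| := by simp [abs_of_nonneg hy0]; linarith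
    have i1 := hD _ a1 a2
    have i2 := h.norm_GR_le hL hC (a1.trans (by norm_num)) a2
    rw [← h.wronskian_step] at i2
    have e : (y * Complex.I : ℂ).im = y := by simp
    rw [e, abs_of_nonneg hy0] at i1 i2
    have hy1 : 0 < L - y := by linarith
    refine i2.trans ?_
    calc _ ≤ c ^ 2 / (L - y) ^ 3 * (A * (L - y) ^ 2 * Real.exp (-(2 * π * (L - y)))) ^ 2 := by gcongr
      _ = c ^ 2 * A ^ 2 * (L - y) * (Real.exp (-(2 * π * (L - y))) * Real.exp (-(2 * π * (L - y)))) := by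
          field_simp
      _ = _ := by rw [← Real.exp_add]; congr 2; ring
  have hcont : Continuous fun y : ℝ => ‖wronskian D G (y * Complex.I) - wronskian D G (y * Complex.I - 1)‖ := by
    have := h.diff_wronskian.continuous
    fun_prop
  have key := half_strip (f := wronskian D G) (Z := L - C₀) (F := 2 * c ^ 2)
    (B := η * Real.exp (-(2 * π * L))) (K₁ := c ^ 2 * A ^ 2 * (L - ζ) * Real.exp (-(4 * π * (L - ζ))))
    (K₂ := c ^ 2 * A ^ 2 * (L - ζ) ^ 2 / 2 * Real.exp (-(4 * π * (L - ζ))))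
    (ζ := ζ) ?_ hz ht hreal ?_ ?_
  · refine key.trans ?_
    have e1 : Real.exp (-(2 * π * L)) * Real.exp (2 * π * ζ) = Real.exp (-(2 * π * (L - ζ))) := by
      rw [← Real.exp_add]; congr 1; ring
    have e2 : Real.exp (-(4 * π * (L - C₀ - ζ))) ≤
        Real.exp (4 * π * (C₀ + 1)) * Real.exp (-(4 * π * (L - ζ))) := by
      rw [← Real.exp_add]; exact Real.exp_le_exp.2 (by nlinarith [Real.pi_pos])
    have e3 : 2 * (η * Real.exp (-(2 * π * L))) * Real.exp (2 * π * ζ) =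
      2 * η * Real.exp (-(2 * π * (L - ζ))) := by rw [← e1]; ring
    have e4 : (L - ζ) ≤ (L - ζ) ^ 2 := by nlinarith
    rw [e3]
    set E4 := Real.exp (-(4 * π * (L - ζ)))
    set E2 := Real.exp (-(2 * π * (L - ζ)))
    set K := Real.exp (4 * π * (C₀ + 1))
    calc _ ≤ 2 * (2 * η * E2 + 2 * (2 * c ^ 2) * (K * E4) + c ^ 2 * A ^ 2 * (L - ζ) ^ 2 * E4 +
          c ^ 2 * A ^ 2 * (L - ζ) ^ 2 / 2 * E4) := by gcongr
      _ = 4 * (η * E2) + (8 * c ^ 2 * K) * (1 * E4) + (3 * c ^ 2 * A ^ 2) * ((L - ζ) ^ 2 * E4) := by ring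
      _ ≤ 4 * (η * E2) + (8 * c ^ 2 * K) * ((L - ζ) ^ 2 * E4) + (3 * c ^ 2 * A ^ 2) * ((L - ζ) ^ 2 * E4) := by
          gcongr
      _ ≤ _ := by
          have j1 : 0 ≤ η * E2 := by positivity
          have j2 : 0 ≤ (L - ζ) ^ 2 * E4 := by positivity
          have j3 : 0 ≤ 8 * c ^ 2 * K := by positivity
          have j4 : 0 ≤ 3 * c ^ 2 * A ^ 2 := by positivity
          have j5 : 0 ≤ B * Real.exp (2 * π) := by positivity
          generalize 8 * c ^ 2 * K = a at *
          generalize 3 * c ^ 2 * A ^ 2 = b at *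
          generalize B * Real.exp (2 * π) = d at *
          generalize (L - ζ) ^ 2 * E4 = x at *
          generalize η * E2 = y at *
          nlinarith
  · intro z h1 h2 h3 h4
    refine ⟨h.diff_wronskian z, h.norm_wronskian_le_const hL hC ?_ ?_ ?_⟩
    · rw [abs_le]; constructor <;> linarith
    · rw [abs_le]; constructor <;> linarith
    · rw [abs_of_nonneg h3]; linarith
  · refine (integral_le_of_le_deriv (H := fun y => c ^ 2 * A ^ 2 * ((L - y) *
      Real.exp (2 * π * y + (2 * π * ζ - 4 * π * L))))
      (H' := fun y => c ^ 2 * A ^ 2 * ((-1) * Real.exp (2 * π * y + (2 * π * ζ - 4 * π * L)) + (L - y) *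
        (Real.exp (2 * π * y + (2 * π * ζ - 4 * π * L)) * (2 * π * 1)))) h0 ?_ ?_ ?_).trans ?_
    · exact (hcont.mul (by fun_prop)).continuousOn
    · intro y hy
      exact (((hasDerivAt_id y).const_sub L).mul
        ((((hasDerivAt_id y).const_mul (2 * π)).add_const _).exp)).const_mul _
    · intro y hy
      have i1 := hGR y hy.1 (by linarith [hy.2])
      have hy1 : 1 ≤ L - y := by linarith [hy.2]
      have e : Real.exp (2 * π * y + (2 * π * ζ - 4 * π * L)) =
          Real.exp (-(4 * π * (L - y))) * Real.exp (2 * π * (ζ - y)) := by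
        rw [← Real.exp_add]; congr 1; ring
      have hh : (L - y) ≤ -1 + (L - y) * (2 * π) := by nlinarith [Real.pi_gt_three]
      calc _ ≤ c ^ 2 * A ^ 2 * (L - y) * Real.exp (-(4 * π * (L - y))) * Real.exp (2 * π * (ζ - y)) := by
            gcongr
        _ = c ^ 2 * A ^ 2 * ((L - y) * (Real.exp (-(4 * π * (L - y))) * Real.exp (2 * π * (ζ - y)))) := by
            ring
        _ ≤ c ^ 2 * A ^ 2 * ((-1 + (L - y) * (2 * π)) * (Real.exp (-(4 * π * (L - y))) * Real.exp (2 * π * (ζ - y)))) := by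
            gcongr
        _ = _ := by rw [← e]; ring
    · have e : 2 * π * ζ + (2 * π * ζ - 4 * π * L) = -(4 * π * (L - ζ)) := by ring
      simp only [e]
      have : 0 ≤ c ^ 2 * A ^ 2 * ((L - 0) * Real.exp (2 * π * 0 + (2 * π * ζ - 4 * π * L))) := by
        have : 0 ≤ L - 0 := by linarith
        positivity
      linarith
  · refine (integral_le_of_le_deriv (H := fun y => c ^ 2 * A ^ 2 * Real.exp (-(4 * π * (L - ζ))) *
      (-((L - y) ^ 2 / 2)))
      (H' := fun y => c ^ 2 * A ^ 2 * Real.exp (-(4 * π * (L - ζ))) * (L - y)) (by linarith) ?_ ?_ ?_).trans ?_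
    · exact (hcont.mul (by fun_prop)).continuousOn
    · intro y hy
      refine (((((hasDerivAt_id y).const_sub L).pow 2).div_const 2).neg.const_mul _).congr_deriv ?_
      simp; ring
    · intro y hy
      have i1 := hGR y (by linarith [hy.1]) (by linarith [hy.2])
      have e : Real.exp (-(4 * π * (L - y))) * Real.exp (-(4 * π * (y - ζ))) = Real.exp (-(4 * π * (L - ζ))) := by
        rw [← Real.exp_add]; congr 1; ring
      calc _ ≤ c ^ 2 * A ^ 2 * (L - y) * Real.exp (-(4 * π * (L - y))) * Real.exp (-(4 * π * (y - ζ))) := by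
            gcongr
        _ = _ := by rw [mul_assoc, e]; ring
    · have : 0 ≤ c ^ 2 * A ^ 2 * Real.exp (-(4 * π * (L - ζ))) * ((L - (L - C₀)) ^ 2 / 2) := by positivity
      nlinarith

lemma pow_four_mul_exp_le_one {r : ℝ} (hr : 0 ≤ r) : r ^ 4 * Real.exp (-(2 * π * r)) ≤ 1 := by
  have h1 : r ≤ Real.exp r := by linarith [Real.add_one_le_exp r]
  calc r ^ 4 * Real.exp (-(2 * π * r)) ≤ Real.exp r ^ 4 * Real.exp (-(2 * π * r)) := by gcongr
    _ = Real.exp (4 * r - 2 * π * r) := by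
        rw [← Real.exp_nat_mul, ← Real.exp_add]; push_cast; ring_nf
    _ ≤ 1 := Real.exp_le_one_iff.2 (by nlinarith [Real.pi_gt_three])

set_option maxHeartbeats 1000000 in
lemma second_bound_aux (h : SplitPair c C₀ L D G R) (hC : 1 ≤ C₀) {A₃ η : ℝ} (hA : 0 ≤ A₃)
    (hη : 0 ≤ η) (hη1 : η ≤ 1)
    (hW : ∀ ζ : ℝ, 0 ≤ ζ → C₀ ≤ L - ζ → ‖wronskian D G (-(1 / 2) + ζ * Complex.I)‖ ≤
      A₃ * ((L - ζ) ^ 2 * Real.exp (-(4 * π * (L - ζ))) + η * Real.exp (-(2 * π * (L - ζ))) +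
        Real.exp (-(2 * π * L))))
    {ζ : ℝ} (h0 : 0 ≤ ζ) (hζ : C₀ ≤ L - ζ) : ‖D (ζ * Complex.I)‖ ≤
      (c * (16 * c ^ 2 * Real.exp (2 * π * (C₀ + 1)) + 9 * (c ^ 2 * A₃)) + c * Real.exp (2 * π * (C₀ + 1))) *
      (Real.exp (-(2 * π * (L - ζ))) * (1 + η * (L - ζ) ^ 2) + L ^ 3 * Real.exp (-(2 * π * L))) := by
  have hL : C₀ ≤ L := by linarith
  have hL1 : 1 ≤ L := by linarith
  have hc := h.c_nonneg hL hC
  have hr : 1 ≤ L - ζ := by linarith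
  have hre : (ζ * Complex.I : ℂ).re = 0 := by simp
  have him : (ζ * Complex.I : ℂ).im = ζ := by simp
  have hE2 := Real.exp_pos (-(2 * π * (L - ζ)))
  have hEL := Real.exp_pos (-(2 * π * L))
  have hK := Real.exp_pos (2 * π * (C₀ + 1))
  have ht' : |(ζ * Complex.I : ℂ).re| ≤ 3 / 2 := by rw [hre]; norm_num
  have htZ' : C₀ ≤ L - |(ζ * Complex.I : ℂ).im| := by rw [him, abs_of_nonneg h0]; exact hζ
  rcases lt_or_ge (L - C₀) (ζ + 1) with ht | ht
  · have i1 := h.norm_D_le_const hL hC ht' htZ'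
    have e := exp_two_pi_mul_le (C₀ := C₀) (L := L) (y := ζ) (by linarith)
    calc _ ≤ c * (Real.exp (2 * π * (C₀ + 1)) * Real.exp (-(2 * π * (L - ζ)))) :=
          i1.trans (le_mul_of_one_le_right hc e)
      _ = (0 + c * Real.exp (2 * π * (C₀ + 1))) * (Real.exp (-(2 * π * (L - ζ))) * (1 + 0) + 0) := by ring
      _ ≤ _ := by gcongr <;> positivity
  set M := c ^ 2 * A₃ with hM
  have hM0 : 0 ≤ M := by positivity
  have key := h.ratio_strip hL hC (t := ζ * Complex.I)
    (w := fun r => M * (r ^ 4 * Real.exp (-(2 * π * r)) + η * r ^ 2 + r ^ 2 * Real.exp (-(2 * π * (L - r)))))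
    (W := fun r => M * (1 - r ^ 4 * Real.exp (-(2 * π * r)) + η * (r ^ 3 / 3) +
      r ^ 2 * Real.exp (-(2 * π * (L - r)))))
    (W' := fun r => M * (-(4 * r ^ 3 * Real.exp (-(2 * π * r)) + r ^ 4 * (Real.exp (-(2 * π * r)) * (-(2 * π)))) +
      η * r ^ 2 + (2 * r * Real.exp (-(2 * π * (L - r))) + r ^ 2 * (Real.exp (-(2 * π * (L - r))) * (2 * π)))))
    (V := fun r => M * (r ^ 4 * Real.exp (-(4 * π * r)) + η * (r ^ 2 * Real.exp (-(2 * π * r))) +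
      Real.exp (-(2 * π * L)) * ((L ^ 3 - r ^ 3) / 3)))
    (V' := fun r => M * ((4 * r ^ 3 * Real.exp (-(4 * π * r)) + r ^ 4 * (Real.exp (-(4 * π * r)) * (-(4 * π)))) +
      η * (2 * r * Real.exp (-(2 * π * r)) + r ^ 2 * (Real.exp (-(2 * π * r)) * (-(2 * π)))) +
      Real.exp (-(2 * π * L)) * (-(r ^ 2)))) (by simp) (by rw [him]; exact h0) (by rw [him]; exact ht) ?_ ?_ ?_
  · rw [him] at key
    have hP : ‖D (ζ * Complex.I) / G (ζ * Complex.I)‖ ≤ (L - ζ) *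
        ((16 * c ^ 2 * Real.exp (2 * π * (C₀ + 1)) + 9 * M) *
        (Real.exp (-(2 * π * (L - ζ))) * (1 + η * (L - ζ) ^ 2) + L ^ 3 * Real.exp (-(2 * π * L)))) := by
      refine key.trans ?_
      have e2 : Real.exp (-(4 * π * (L - ζ))) = Real.exp (-(2 * π * (L - ζ))) * Real.exp (-(2 * π * (L - ζ))) := by
        rw [← Real.exp_add]; congr 1; ring
      have e3 : Real.exp (-(2 * π * (L - ζ))) * Real.exp (-(2 * π * (L - (L - ζ)))) = Real.exp (-(2 * π * L)) := by
        rw [← Real.exp_add]; congr 1; ring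
      have hrL : L - ζ ≤ L := by linarith
      have q1 := pow_four_mul_exp_le_one (show 0 ≤ L - ζ by linarith)
      have q2 : 0 ≤ L ^ 4 * Real.exp (-(2 * π * L)) := by positivity
      rw [e2]
      simp only [sub_self, mul_zero, neg_zero, Real.exp_zero, mul_one]
      generalize L - ζ = r at *
      generalize Real.exp (-(2 * π * r)) = E at *
      generalize Real.exp (-(2 * π * L)) = EL at *
      generalize Real.exp (2 * π * (C₀ + 1)) = K at *
      have hr3 : r ^ 3 ≤ L ^ 3 := by gcongr
      have hr2 : r ^ 2 ≤ L ^ 3 := by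
        calc r ^ 2 ≤ r ^ 3 := pow_le_pow_right₀ hr (by norm_num)
          _ ≤ _ := hr3
      have a1 : EL * (M * (1 - L ^ 4 * EL + η * (L ^ 3 / 3) + L ^ 2)) ≤ M * (3 * (L ^ 3 * EL)) := by
        have : 1 - L ^ 4 * EL + η * (L ^ 3 / 3) + L ^ 2 ≤ 3 * L ^ 3 := by nlinarith
        calc _ ≤ EL * (M * (3 * L ^ 3)) := by gcongr
          _ = _ := by ring
      have a2 : M * (r ^ 4 * (E * E) + η * (r ^ 2 * E) + EL * ((L ^ 3 - r ^ 3) / 3)) ≤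
          M * (E + η * (r ^ 2 * E) + (1 / 3) * (L ^ 3 * EL)) := by
        have : r ^ 4 * (E * E) ≤ E := by nlinarith
        have : 0 ≤ r ^ 3 * EL := by positivity
        apply mul_le_mul_of_nonneg_left _ hM0
        linarith
      have a3 : E * (M * (1 - r ^ 4 * E + η * (r ^ 3 / 3) + r ^ 2 * Real.exp (-(2 * π * (L - r))))) ≤
          M * (E + η * (r ^ 2 * E) * r / 3 + L ^ 3 * EL) := by
        have : r ^ 2 * EL ≤ L ^ 3 * EL := by gcongr
        have h4 : 0 ≤ r ^ 4 * E * E := by positivity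
        have e : E * (M * (1 - r ^ 4 * E + η * (r ^ 3 / 3) + r ^ 2 * Real.exp (-(2 * π * (L - r))))) =
          M * (E - r ^ 4 * E * E + η * (r ^ 2 * E) * r / 3 + r ^ 2 * (E * Real.exp (-(2 * π * (L - r))))) := by ring
        rw [e, e3]
        apply mul_le_mul_of_nonneg_left _ hM0
        linarith
      have b0 : 0 ≤ 16 * c ^ 2 * K := by positivity
      have b1 : 0 ≤ η * (r ^ 2 * E) := by positivity
      have b2 : 0 ≤ L ^ 3 * EL := by positivity
      have b3 : η * (r ^ 2 * E) ≤ η * (r ^ 2 * E) * r := le_mul_of_one_le_right b1 hr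
      have b4 : E ≤ E * r := le_mul_of_one_le_right hE2.le hr
      have b5 : L ^ 3 * EL ≤ L ^ 3 * EL * r := le_mul_of_one_le_right b2 hr
      rw [← mul_assoc (16 * c ^ 2) K E]
      generalize 16 * c ^ 2 * K = a at *
      calc _ ≤ a * E + 2 * (M * (3 * (L ^ 3 * EL)) + M * (E + η * (r ^ 2 * E) + (1 / 3) * (L ^ 3 * EL)) +
            M * (E + η * (r ^ 2 * E) * r / 3 + L ^ 3 * EL)) := by
            gcongr
        _ ≤ (a + 9 * M) * (E * r + η * (r ^ 2 * E) * r + L ^ 3 * EL * r) := by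
            have c1 := mul_le_mul_of_nonneg_left b3 hM0
            have c2 := mul_le_mul_of_nonneg_left b4 hM0
            have c3 := mul_le_mul_of_nonneg_left b5 hM0
            have c4 := mul_le_mul_of_nonneg_left b4 b0
            have c5 : 0 ≤ a * (η * (r ^ 2 * E) * r) := by positivity
            have c6 : 0 ≤ a * (L ^ 3 * EL * r) := by positivity
            have c7 : 0 ≤ M * E := by positivity
            have c8 : 0 ≤ M * (η * (r ^ 2 * E)) := by positivity
            have c9 : 0 ≤ M * (L ^ 3 * EL) := by positivity
            linarith
        _ = _ := by ring
    have hG := h.norm_G_le hC ht' htZ'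
    rw [him, abs_of_nonneg h0] at hG
    have e : D (ζ * Complex.I) = D (ζ * Complex.I) / G (ζ * Complex.I) * G (ζ * Complex.I) :=
      (div_mul_cancel₀ _ (h.G_ne ht' htZ')).symm
    rw [e, norm_mul]
    have hX : 0 ≤ Real.exp (-(2 * π * (L - ζ))) * (1 + η * (L - ζ) ^ 2) + L ^ 3 * Real.exp (-(2 * π * L)) := by
      positivity
    calc _ ≤ ((L - ζ) * ((16 * c ^ 2 * Real.exp (2 * π * (C₀ + 1)) + 9 * M) *
        (Real.exp (-(2 * π * (L - ζ))) * (1 + η * (L - ζ) ^ 2) + L ^ 3 * Real.exp (-(2 * π * L))))) *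
        (c / (L - ζ)) := by gcongr
      _ = (c * (16 * c ^ 2 * Real.exp (2 * π * (C₀ + 1)) + 9 * M)) *
        (Real.exp (-(2 * π * (L - ζ))) * (1 + η * (L - ζ) ^ 2) + L ^ 3 * Real.exp (-(2 * π * L))) := by
          field_simp
      _ ≤ _ := by
          gcongr
          exact le_add_of_nonneg_right (by positivity)
  · intro s hs1 hs2
    have hs1' : s.re = -(1 / 2) := by rw [hs1, hre]; norm_num
    have hWs : ‖wronskian D G s‖ ≤ A₃ * ((L - |s.im|) ^ 2 * Real.exp (-(4 * π * (L - |s.im|))) +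
        η * Real.exp (-(2 * π * (L - |s.im|))) + Real.exp (-(2 * π * L))) := by
      have := hW |s.im| (abs_nonneg _) hs2
      refine le_trans (le_of_eq ?_) this
      rcases le_total 0 s.im with h1 | h1
      · congr 2; apply Complex.ext <;> simp [hs1', abs_of_nonneg h1]
      · rw [← Complex.norm_conj, ← h.wronskian_conj]
        congr 2; apply Complex.ext <;> simp [hs1', abs_of_nonpos h1]
    have e2 : Real.exp (-(4 * π * (L - |s.im|))) = Real.exp (-(2 * π * (L - |s.im|))) * Real.exp (-(2 * π * (L - |s.im|))) := by
      rw [← Real.exp_add]; congr 1; ring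
    have e3 : Real.exp (-(2 * π * L)) = Real.exp (-(2 * π * (L - (L - |s.im|)))) * Real.exp (-(2 * π * (L - |s.im|))) := by
      rw [← Real.exp_add]; congr 1; ring
    rw [e2, e3] at hWs
    calc _ ≤ _ := mul_le_mul_of_nonneg_left hWs (by positivity)
      _ = _ := by rw [hM]; ring
  · intro r h1 h2
    have hr1 : 1 ≤ r := by linarith
    have d1 : HasDerivAt (fun r : ℝ => Real.exp (-(2 * π * r))) (Real.exp (-(2 * π * r)) * (-(2 * π))) r := by
      simpa using (((hasDerivAt_id r).const_mul (2 * π)).neg).exp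
    have d2 : HasDerivAt (fun r : ℝ => Real.exp (-(2 * π * (L - r)))) (Real.exp (-(2 * π * (L - r))) * (2 * π)) r := by
      simpa using (((((hasDerivAt_id r).const_sub L).const_mul (2 * π)).neg).exp)
    refine ⟨(((((hasDerivAt_pow 4 r).mul d1).const_sub 1).add
      (((hasDerivAt_pow 3 r).div_const 3).const_mul η)).add ((hasDerivAt_pow 2 r).mul d2)).const_mul M |>.congr_deriv ?_,
      ?_, ?_⟩
    · push_cast; ring
    · have a1 := Real.exp_pos (-(2 * π * r))
      have a2 := Real.exp_pos (-(2 * π * (L - r)))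
      apply mul_le_mul_of_nonneg_left _ hM0
      have b1 : r ^ 4 ≤ r ^ 4 * (2 * π) - 4 * r ^ 3 := by
        have : r ^ 4 * 5 ≤ r ^ 4 * (2 * π - 1) := by gcongr; linarith [Real.pi_gt_three]
        nlinarith [pow_pos (by linarith : 0 < r) 3]
      have b2 : r ^ 2 ≤ 2 * r + r ^ 2 * (2 * π) := by nlinarith [Real.pi_gt_three]
      have c1 := mul_le_mul_of_nonneg_right b1 a1.le
      have c2 := mul_le_mul_of_nonneg_right b2 a2.le
      linarith
    · have := pow_four_mul_exp_le_one (show 0 ≤ r by linarith)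
      have : 0 ≤ 1 - r ^ 4 * Real.exp (-(2 * π * r)) := by linarith
      positivity
  · intro r h1 h2
    have hr1 : 1 ≤ r := by linarith
    have d1 : HasDerivAt (fun r : ℝ => Real.exp (-(2 * π * r))) (Real.exp (-(2 * π * r)) * (-(2 * π))) r := by
      simpa using (((hasDerivAt_id r).const_mul (2 * π)).neg).exp
    have d2 : HasDerivAt (fun r : ℝ => Real.exp (-(4 * π * r))) (Real.exp (-(4 * π * r)) * (-(4 * π))) r := by
      simpa using (((hasDerivAt_id r).const_mul (4 * π)).neg).exp
    refine ⟨((((hasDerivAt_pow 4 r).mul d2).add (((hasDerivAt_pow 2 r).mul d1).const_mul η)).add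
      ((((hasDerivAt_pow 3 r).const_sub (L ^ 3)).div_const 3).const_mul
        (Real.exp (-(2 * π * L))))).const_mul M |>.congr_deriv ?_, ?_, ?_⟩
    · push_cast; ring
    · have a1 := Real.exp_pos (-(2 * π * r))
      have a2 := Real.exp_pos (-(4 * π * r))
      have e2 : Real.exp (-(2 * π * r)) * Real.exp (-(2 * π * r)) = Real.exp (-(4 * π * r)) := by
        rw [← Real.exp_add]; congr 1; ring
      have e3 : Real.exp (-(2 * π * (L - r))) * Real.exp (-(2 * π * r)) = Real.exp (-(2 * π * L)) := by
        rw [← Real.exp_add]; congr 1; ring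
      have b1 : r ^ 4 ≤ r ^ 4 * (4 * π) - 4 * r ^ 3 := by
        have : r ^ 4 * 5 ≤ r ^ 4 * (4 * π - 1) := by gcongr; linarith [Real.pi_gt_three]
        nlinarith [pow_pos (by linarith : 0 < r) 3]
      have b2 : r ^ 2 ≤ r ^ 2 * (2 * π) - 2 * r := by nlinarith [Real.pi_gt_three]
      have c1 := mul_le_mul_of_nonneg_right b1 a2.le
      have c2 := mul_le_mul_of_nonneg_left (mul_le_mul_of_nonneg_right b2 a1.le) hη
      rw [← mul_neg M, mul_assoc M]
      apply mul_le_mul_of_nonneg_left _ hM0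
      calc _ = r ^ 4 * (Real.exp (-(2 * π * r)) * Real.exp (-(2 * π * r))) + η * (r ^ 2 * Real.exp (-(2 * π * r))) +
            r ^ 2 * (Real.exp (-(2 * π * (L - r))) * Real.exp (-(2 * π * r))) := by ring
        _ ≤ _ := by rw [e2, e3]; linarith
    · have : 0 ≤ L ^ 3 - r ^ 3 := sub_nonneg.2 (by gcongr)
      positivity

/-- Second bound on the splitting, in terms of the size of the Wronskian on the real line. -/
theorem second_bound (c C₀ : ℝ) (hC : 1 ≤ C₀) (hcC : 6 * c ^ 3 ≤ C₀) : ∃ A : ℝ, 0 ≤ A ∧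
    ∀ (L : ℝ) (D G R : ℂ → ℂ) (η : ℝ), C₀ ≤ L → SplitPair c C₀ L D G R → 0 ≤ η → η ≤ 1 →
    (∀ x : ℝ, -1 ≤ x → x ≤ 0 → ‖wronskian D G x‖ ≤ η * Real.exp (-(2 * π * L))) →
    ∀ ζ : ℝ, 0 ≤ ζ → C₀ ≤ L - ζ → ‖D (ζ * Complex.I)‖ ≤
      A * (Real.exp (-(2 * π * (L - ζ))) * (1 + η * (L - ζ) ^ 2) + L ^ 3 * Real.exp (-(2 * π * L))) := by
  rcases lt_or_ge c 0 with hc | hc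
  · exact ⟨0, le_rfl, fun L D G R η hL h => absurd (h.c_nonneg hL hC) (not_le.2 hc)⟩
  obtain ⟨A, hA⟩ : ∃ A, A = 2 * (16 * c ^ 3 + 128 * c ^ 5) * Real.exp (2 * π * (C₀ + 1)) := ⟨_, rfl⟩
  obtain ⟨B, hB⟩ : ∃ B, B = 32 * c ^ 2 * Real.exp (2 * π * (C₀ + 1)) + 4 * c ^ 3 * A / C₀ ^ 2 := ⟨_, rfl⟩
  have hA0 : 0 ≤ A := by rw [hA]; positivity
  have hB0 : 0 ≤ B := by rw [hB]; positivity
  obtain ⟨A₃, hA₃⟩ : ∃ A₃, A₃ = 4 + 8 * c ^ 2 * Real.exp (4 * π * (C₀ + 1)) + 3 * c ^ 2 * A ^ 2 +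
    B * Real.exp (2 * π) := ⟨_, rfl⟩
  have hA₃0 : 0 ≤ A₃ := by rw [hA₃]; positivity
  refine ⟨c * (16 * c ^ 2 * Real.exp (2 * π * (C₀ + 1)) + 9 * (c ^ 2 * A₃)) +
    c * Real.exp (2 * π * (C₀ + 1)), by positivity, fun L D G R η hL h hη hη1 hreal ζ h0 hζ => ?_⟩
  obtain ⟨h1, h2⟩ := h.first_bound hL hC hcC hA
  rw [← hB] at h2
  refine h.second_bound_aux hC hA₃0 hη hη1 (fun ζ h0 hζ => ?_) h0 hζ
  rw [hA₃]
  exact h.wronskian_mid_bound hC hη h1 hB0 (fun s a b => h2 s (by linarith) (by linarith)) hreal h0 hζ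

end SplitPair

/-- The symbol `4 sinh² (x h / 2)` of the second difference operator with step `h`. -/
def diffSymbol (h x : ℝ) : ℝ := 4 * Real.sinh (x * h / 2) ^ 2

/-- Coefficients `(bₙ, wₙ)` of the formal series `v` and `exp v`, where `v` is odd, `v = 4 z + ⋯`
and `v` solves the analogue of the stationary pendulum equation for the standard map. -/
def waveCoef (h : ℝ) : ℕ → ℝ × ℝ
  | 0 => (0, 1)
  | 1 => (4, 4)
  | n + 2 =>
    let Q := (∑ k : Fin (n + 1), ((k : ℝ) + 1) * (waveCoef h (k + 1)).1 * (waveCoef h (n + 1 - k)).2) /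
      ((n : ℝ) + 2)
    let b := if Even n then 0 else diffSymbol h 1 * Q / (diffSymbol h ((n : ℝ) + 2) - diffSymbol h 1)
    (b, b + Q)

/-- Coefficients of `v`. -/
def bCoef (h : ℝ) (n : ℕ) : ℝ := (waveCoef h n).1

/-- Coefficients of `exp v`. -/
def wCoef (h : ℝ) (n : ℕ) : ℝ := (waveCoef h n).2

/-- The part of the convolution defining `wCoef h n` which does not involve `bCoef h n`. -/
def qCoef (h : ℝ) (n : ℕ) : ℝ :=
  (∑ k ∈ Finset.range n, (k : ℝ) * bCoef h k * wCoef h (n - k)) / n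

lemma bCoef_zero (h : ℝ) : bCoef h 0 = 0 := by simp [bCoef, waveCoef]
lemma bCoef_one (h : ℝ) : bCoef h 1 = 4 := by simp [bCoef, waveCoef]
lemma wCoef_zero (h : ℝ) : wCoef h 0 = 1 := by simp [wCoef, waveCoef]
lemma wCoef_one (h : ℝ) : wCoef h 1 = 4 := by simp [wCoef, waveCoef]

lemma qCoef_add_two (h : ℝ) (n : ℕ) : qCoef h (n + 2) =
    (∑ k : Fin (n + 1), ((k : ℝ) + 1) * (waveCoef h (k + 1)).1 * (waveCoef h (n + 1 - k)).2) /
      ((n : ℝ) + 2) := by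
  unfold qCoef
  congr 1
  · rw [Finset.sum_range_succ', Finset.sum_range (n := n + 1)]
    simp [bCoef, wCoef]
  · push_cast; ring

lemma bCoef_add_two (h : ℝ) (n : ℕ) : bCoef h (n + 2) = if Even n then 0 else
    diffSymbol h 1 * qCoef h (n + 2) / (diffSymbol h ((n : ℝ) + 2) - diffSymbol h 1) := by
  rw [qCoef_add_two, bCoef, waveCoef]

lemma wCoef_add_two (h : ℝ) (n : ℕ) : wCoef h (n + 2) = bCoef h (n + 2) + qCoef h (n + 2) := by
  rw [qCoef_add_two, bCoef, wCoef, waveCoef]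

lemma wCoef_eq (h : ℝ) {n : ℕ} (hn : 1 ≤ n) : wCoef h n = bCoef h n + qCoef h n := by
  obtain rfl | hn := hn.eq_or_lt
  · simp [wCoef_one, bCoef_one, qCoef]
  · obtain ⟨m, rfl⟩ := Nat.exists_eq_add_of_le' hn
    exact wCoef_add_two h m

lemma bCoef_even (h : ℝ) {n : ℕ} (hn : Even n) : bCoef h n = 0 := by
  match n with
  | 0 => exact bCoef_zero h
  | 1 => exact absurd hn (by decide)
  | n + 2 =>
    rw [bCoef_add_two, if_pos]
    simpa [Nat.even_add] using hn

lemma nat_mul_sinh_le {x : ℝ} (hx : 0 ≤ x) (n : ℕ) : n * Real.sinh x ≤ Real.sinh (n * x) := by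
  induction n with
  | zero => simp
  | succ n ih =>
    have e : ((n + 1 : ℕ) : ℝ) * x = n * x + x := by push_cast; ring
    rw [e, Real.sinh_add]
    have h1 : 0 ≤ Real.sinh x := Real.sinh_nonneg_iff.2 hx
    have h2 : 0 ≤ Real.sinh (n * x) := Real.sinh_nonneg_iff.2 (by positivity)
    have h3 := Real.one_le_cosh x
    have h4 := Real.one_le_cosh (n * x)
    push_cast
    nlinarith

lemma sinh_le_mul_cosh {x : ℝ} (hx : 0 ≤ x) : Real.sinh x ≤ x * Real.cosh x := by
  have := (convex_Icc 0 x).image_sub_le_mul_sub_of_deriv_le (f := Real.sinh) (C := Real.cosh x)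
    Real.continuous_sinh.continuousOn Real.differentiable_sinh.differentiableOn (by
      intro y hy
      rw [interior_Icc] at hy
      rw [Real.deriv_sinh, Real.cosh_le_cosh, abs_of_pos hy.1, abs_of_nonneg hx]
      exact hy.2.le) 0 ⟨le_rfl, hx⟩ x ⟨hx, le_rfl⟩ hx
  simpa [mul_comm] using this

lemma diffSymbol_pos {h x : ℝ} (hh : 0 < h) (hx : 0 < x) : 0 < diffSymbol h x := by
  have : 0 < Real.sinh (x * h / 2) := Real.sinh_pos_iff.2 (by positivity)
  unfold diffSymbol; positivity

lemma diffSymbol_one_mul_sq_le {h : ℝ} (hh : 0 ≤ h) (n : ℕ) :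
    n ^ 2 * diffSymbol h 1 ≤ diffSymbol h n := by
  have h1 := nat_mul_sinh_le (show 0 ≤ 1 * h / 2 by positivity) n
  have e : (n : ℝ) * (1 * h / 2) = n * h / 2 := by ring
  rw [e] at h1
  unfold diffSymbol
  calc _ = 4 * (n * Real.sinh (1 * h / 2)) ^ 2 := by ring
    _ ≤ _ := by gcongr

lemma diffSymbol_le {h : ℝ} (hh : 0 ≤ h) (n : ℕ) (hn : n * h ≤ 1) :
    diffSymbol h n ≤ n ^ 2 * (1 + n ^ 2 * h ^ 2 / 2) * diffSymbol h 1 := by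
  have h0 : 0 ≤ n * h / 2 := by positivity
  have h1 := sinh_le_mul_cosh h0
  have h2 := Real.cosh_le_exp_half_sq (n * h / 2)
  have h3 : h / 2 ≤ Real.sinh (1 * h / 2) := by rw [one_mul]; exact Real.self_le_sinh_iff.2 (by positivity)
  have h4 : (n * h / 2) ^ 2 ≤ 1 / 4 := by nlinarith
  have h5 := Real.abs_exp_sub_one_le (x := (n * h / 2) ^ 2) (by rw [abs_of_nonneg (by positivity)]; linarith)
  rw [abs_of_nonneg (by positivity : 0 ≤ (n * h / 2) ^ 2)] at h5
  have h6 := (le_abs_self _).trans h5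
  have h8 : Real.sinh (n * h / 2) ^ 2 ≤ (n * h / 2) ^ 2 * (1 + n ^ 2 * h ^ 2 / 2) := by
    calc _ ≤ (n * h / 2 * Real.exp ((n * h / 2) ^ 2 / 2)) ^ 2 := by gcongr; exact h1.trans (by gcongr)
      _ = (n * h / 2) ^ 2 * Real.exp ((n * h / 2) ^ 2) := by
          rw [mul_pow, ← Real.exp_nat_mul]; congr 2; push_cast; ring
      _ ≤ _ := by gcongr; nlinarith
  unfold diffSymbol
  calc _ ≤ 4 * ((n * h / 2) ^ 2 * (1 + n ^ 2 * h ^ 2 / 2)) := by gcongr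
    _ = n ^ 2 * (1 + n ^ 2 * h ^ 2 / 2) * (4 * (h / 2) ^ 2) := by ring
    _ ≤ _ := by gcongr

lemma wCoef_convolution (h : ℝ) (n : ℕ) : ((n : ℝ) + 1) * wCoef h (n + 1) =
    ∑ k ∈ Finset.range (n + 1), ((k : ℝ) + 1) * bCoef h (k + 1) * wCoef h (n - k) := by
  have e : ∑ k ∈ Finset.range (n + 1), (k : ℝ) * bCoef h k * wCoef h (n + 1 - k) =
      ∑ k ∈ Finset.range n, ((k : ℝ) + 1) * bCoef h (k + 1) * wCoef h (n - k) := by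
    rw [Finset.sum_range_succ']
    simp
  rw [wCoef_eq h (by omega), qCoef, e, Finset.sum_range_succ]
  simp [wCoef_zero]
  field_simp
  ring

lemma diffSymbol_mul_bCoef {h : ℝ} (hh : 0 < h) {n : ℕ} (hn : Odd n) :
    diffSymbol h n * bCoef h n = diffSymbol h 1 * wCoef h n := by
  match n with
  | 0 => exact absurd hn (by decide)
  | 1 => simp [bCoef_one, wCoef_one]
  | n + 2 =>
    have hn' : ¬ Even n := by rw [Nat.not_even_iff_odd]; simpa [Nat.odd_add] using hn
    have h1 := diffSymbol_one_mul_sq_le hh.le (n + 2)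
    have h2 := diffSymbol_pos hh one_pos
    have h3 : diffSymbol h ((n : ℝ) + 2) - diffSymbol h 1 ≠ 0 := by
      push_cast at h1
      have : 4 * diffSymbol h 1 ≤ ((n : ℝ) + 2) ^ 2 * diffSymbol h 1 := by
        gcongr; nlinarith [Nat.cast_nonneg (α := ℝ) n]
      linarith
    rw [wCoef_add_two, bCoef_add_two, if_neg hn']
    push_cast
    field_simp
    ring

/-- Indicator of odd numbers. -/
def oddInd (k : ℕ) : ℝ := (1 - (-1) ^ k) / 2

lemma oddInd_of_odd {k : ℕ} (hk : Odd k) : oddInd k = 1 := by rw [oddInd, hk.neg_one_pow]; norm_num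
lemma oddInd_of_even {k : ℕ} (hk : Even k) : oddInd k = 0 := by simp [oddInd, hk.neg_one_pow]
lemma oddInd_nonneg (k : ℕ) : 0 ≤ oddInd k := by
  rcases Nat.even_or_odd k with hk | hk
  · rw [oddInd_of_even hk]
  · rw [oddInd_of_odd hk]; norm_num

lemma sum_oddInd (n : ℕ) : ∑ k ∈ Finset.range n, oddInd k =
    (1 - oddInd n) * (n / 2) + oddInd n * ((n - 1) / 2) := by
  induction n with
  | zero => simp [oddInd]
  | succ n ih => rw [Finset.sum_range_succ, ih]; simp only [oddInd, pow_succ]; push_cast; ring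

lemma sum_oddInd_mul (n : ℕ) : ∑ k ∈ Finset.range n, oddInd k * k =
    (1 - oddInd n) * (n ^ 2 / 4) + oddInd n * ((n - 1) ^ 2 / 4) := by
  induction n with
  | zero => simp [oddInd]
  | succ n ih => rw [Finset.sum_range_succ, ih]; simp only [oddInd, pow_succ]; push_cast; ring

lemma sum_oddInd_mul_sq (n : ℕ) : ∑ k ∈ Finset.range n, oddInd k * k ^ 2 =
    (1 - oddInd n) * (n * (n ^ 2 - 1) / 6) + oddInd n * ((n - 1) * n * (n - 2) / 6) := by
  induction n with
  | zero => simp [oddInd]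
  | succ n ih => rw [Finset.sum_range_succ, ih]; simp only [oddInd, pow_succ]; push_cast; ring

lemma sum_oddInd_mul_cube (n : ℕ) : ∑ k ∈ Finset.range n, oddInd k * k ^ 3 =
    (1 - oddInd n) * (n ^ 2 / 4 * (n ^ 2 / 2 - 1)) +
      oddInd n * ((n - 1) ^ 2 / 4 * ((n - 1) ^ 2 / 2 - 1)) := by
  induction n with
  | zero => simp [oddInd]
  | succ n ih => rw [Finset.sum_range_succ, ih]; simp only [oddInd, pow_succ]; push_cast; ring

lemma sum_oddInd_sub (n : ℕ) : ∑ k ∈ Finset.range n, oddInd k * ((n : ℝ) - k) =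
    (n ^ 2 - oddInd n) / 4 := by
  have : ∀ k ∈ Finset.range n, oddInd k * ((n : ℝ) - k) = n * oddInd k - oddInd k * k := by
    intros; ring
  rw [Finset.sum_congr rfl this, Finset.sum_sub_distrib, ← Finset.mul_sum, sum_oddInd, sum_oddInd_mul]
  ring

lemma sum_oddInd_loss (n : ℕ) :
    ∑ k ∈ Finset.range n, oddInd k * (((n : ℝ) - k) * (k ^ 2 + (n - k) ^ 2 / 2)) =
    (1 - oddInd n) * (n ^ 2 * (n ^ 2 + 2) / 24 + n ^ 2 * (n ^ 2 - 2) / 16) +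
      oddInd n * ((n ^ 2 - 1) * (n ^ 2 - 3) / 24 + (n ^ 2 - 1) ^ 2 / 16) := by
  have : ∀ k ∈ Finset.range n, oddInd k * (((n : ℝ) - k) * (k ^ 2 + (n - k) ^ 2 / 2)) =
      n ^ 3 / 2 * oddInd k - 3 / 2 * n ^ 2 * (oddInd k * k) + 5 / 2 * n * (oddInd k * k ^ 2) -
      3 / 2 * (oddInd k * k ^ 3) := by
    intros; ring
  rw [Finset.sum_congr rfl this, Finset.sum_sub_distrib, Finset.sum_add_distrib, Finset.sum_sub_distrib]
  simp only [← Finset.mul_sum]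
  rw [sum_oddInd, sum_oddInd_mul, sum_oddInd_mul_sq, sum_oddInd_mul_cube]
  ring

lemma nat_mul_qCoef (h : ℝ) {n : ℕ} (hn : 1 ≤ n) :
    n * qCoef h n = ∑ k ∈ Finset.range n, (k : ℝ) * bCoef h k * wCoef h (n - k) := by
  have : (n : ℝ) ≠ 0 := by positivity
  rw [qCoef]; field_simp

lemma coef_bounds {h : ℝ} (hh : 0 < h) (n : ℕ) : 0 ≤ bCoef h n ∧ n * bCoef h n ≤ 4 * oddInd n ∧
    0 ≤ wCoef h n ∧ (1 ≤ n → wCoef h n ≤ 4 * n) := by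
  induction n using Nat.strong_induction_on with
  | _ n ih =>
    match n with
    | 0 => simp [bCoef_zero, wCoef_zero, oddInd]
    | 1 => simp [bCoef_one, wCoef_one, oddInd]
    | n + 2 =>
      have hq := nat_mul_qCoef h (n := n + 2) (by omega)
      have hn0 : (0 : ℝ) < (n + 2 : ℕ) := by positivity
      have hq0 : 0 ≤ qCoef h (n + 2) := by
        refine div_nonneg (Finset.sum_nonneg fun k hk => ?_) hn0.le
        rw [Finset.mem_range] at hk
        rcases Nat.eq_zero_or_pos k with rfl | hk0
        · simp
        · have := (ih k hk).1
          have := (ih (n + 2 - k) (by omega)).2.2.1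
          positivity
      have hq1 : (n + 2 : ℕ) * qCoef h (n + 2) ≤ 4 * ((n + 2 : ℕ) ^ 2 - oddInd (n + 2)) := by
        rw [hq]
        have : ∀ k ∈ Finset.range (n + 2), (k : ℝ) * bCoef h k * wCoef h (n + 2 - k) ≤
            16 * (oddInd k * (((n + 2 : ℕ) : ℝ) - k)) := by
          intro k hk
          rw [Finset.mem_range] at hk
          have i1 := (ih k hk).2.1
          rcases Nat.eq_zero_or_pos k with rfl | hk0
          · simp [oddInd]
          · obtain ⟨-, -, i2, i3⟩ := ih (n + 2 - k) (by omega)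
            have i3 := i3 (by omega)
            rw [Nat.cast_sub hk.le] at i3
            have := oddInd_nonneg k
            calc _ ≤ (4 * oddInd k) * (4 * (((n + 2 : ℕ) : ℝ) - k)) := by gcongr
              _ = _ := by ring
        refine (Finset.sum_le_sum this).trans ?_
        rw [← Finset.mul_sum, sum_oddInd_sub]
        linarith
      rw [wCoef_add_two]
      rcases Nat.even_or_odd (n + 2) with hp | hp
      · rw [bCoef_even h hp, oddInd_of_even hp] at *
        refine ⟨le_rfl, by simp, by linarith, fun _ => ?_⟩
        rw [zero_add]
        nlinarith
      · rw [oddInd_of_odd hp] at *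
        have h1 := diffSymbol_one_mul_sq_le hh.le (n + 2)
        have h2 := diffSymbol_pos hh one_pos
        have h3 := diffSymbol_mul_bCoef hh hp
        rw [wCoef_add_two] at h3
        have hn2 : (4 : ℝ) ≤ (n + 2 : ℕ) ^ 2 := by
          push_cast; nlinarith [Nat.cast_nonneg (α := ℝ) n]
        generalize diffSymbol h (n + 2 : ℕ) = a at *
        generalize diffSymbol h 1 = e at *
        generalize bCoef h (n + 2) = b at *
        generalize qCoef h (n + 2) = q at *
        generalize ((n + 2 : ℕ) : ℝ) = N at *
        have hae0 : 0 < a - e := by nlinarith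
        have hb : b = e * q / (a - e) := by field_simp; linarith
        have hb0 : 0 ≤ b := by rw [hb]; positivity
        have hb1 : N * b ≤ 4 := by
          have : e * (N ^ 2 - 1) * b ≤ e * q := by nlinarith
          have : (N ^ 2 - 1) * b ≤ q := by nlinarith
          have : (N ^ 2 - 1) * (N * b) ≤ (N ^ 2 - 1) * 4 := by nlinarith
          exact le_of_mul_le_mul_left this (by linarith)
        refine ⟨hb0, by linarith, by linarith, fun _ => ?_⟩
        nlinarith

lemma bCoef_nonneg {h : ℝ} (hh : 0 < h) (n : ℕ) : 0 ≤ bCoef h n := (coef_bounds hh n).1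

lemma nat_mul_bCoef_le {h : ℝ} (hh : 0 < h) (n : ℕ) : n * bCoef h n ≤ 4 * oddInd n :=
  (coef_bounds hh n).2.1

lemma wCoef_nonneg {h : ℝ} (hh : 0 < h) (n : ℕ) : 0 ≤ wCoef h n := (coef_bounds hh n).2.2.1

lemma wCoef_le {h : ℝ} (hh : 0 < h) {n : ℕ} (hn : 1 ≤ n) : wCoef h n ≤ 4 * n :=
  (coef_bounds hh n).2.2.2 hn

lemma coef_lower {h : ℝ} (hh : 0 < h) (n : ℕ) : 4 * oddInd n * (1 - n ^ 2 * h ^ 2) ≤ n * bCoef h n ∧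
    4 * n * (1 - n ^ 2 * h ^ 2 / 2) ≤ wCoef h n := by
  induction n using Nat.strong_induction_on with
  | _ n ih =>
    match n with
    | 0 => simp [bCoef_zero, wCoef_zero, oddInd]
    | 1 => simp [bCoef_one, wCoef_one, oddInd]; constructor <;> nlinarith
    | n + 2 =>
      have hq := nat_mul_qCoef h (n := n + 2) (by omega)
      have hn0 : (0 : ℝ) < (n + 2 : ℕ) := by positivity
      have hn2 : (4 : ℝ) ≤ (n + 2 : ℕ) ^ 2 := by
        push_cast; nlinarith [Nat.cast_nonneg (α := ℝ) n]
      have hq1 : 4 * ((n + 2 : ℕ) ^ 2 - oddInd (n + 2)) - 16 * h ^ 2 *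
          ((1 - oddInd (n + 2)) * ((n + 2 : ℕ) ^ 2 * ((n + 2 : ℕ) ^ 2 + 2) / 24 +
            (n + 2 : ℕ) ^ 2 * ((n + 2 : ℕ) ^ 2 - 2) / 16) +
          oddInd (n + 2) * (((n + 2 : ℕ) ^ 2 - 1) * ((n + 2 : ℕ) ^ 2 - 3) / 24 +
            ((n + 2 : ℕ) ^ 2 - 1) ^ 2 / 16)) ≤ (n + 2 : ℕ) * qCoef h (n + 2) := by
        rw [hq, ← sum_oddInd_loss]
        have : ∀ k ∈ Finset.range (n + 2), 16 * (oddInd k * (((n + 2 : ℕ) : ℝ) - k)) - 16 * h ^ 2 *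
            (oddInd k * ((((n + 2 : ℕ) : ℝ) - k) * (k ^ 2 + (((n + 2 : ℕ) : ℝ) - k) ^ 2 / 2))) ≤
            (k : ℝ) * bCoef h k * wCoef h (n + 2 - k) := by
          intro k hk
          rw [Finset.mem_range] at hk
          have hkN : (k : ℝ) ≤ (n + 2 : ℕ) := by exact_mod_cast hk.le
          have j1 := bCoef_nonneg hh k
          have j2 := wCoef_nonneg hh (n + 2 - k)
          rcases Nat.eq_zero_or_pos k with rfl | hk0
          · simp [oddInd]
          rcases Nat.even_or_odd k with hp | hp
          · rw [oddInd_of_even hp]; simp; positivity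
          have i1 := (ih k hk).1
          have i2 := (ih (n + 2 - k) (by omega)).2
          rw [oddInd_of_odd hp] at i1 ⊢
          rw [Nat.cast_sub hk.le] at i2
          have hm : 0 ≤ ((n + 2 : ℕ) : ℝ) - k := by linarith
          generalize ((n + 2 : ℕ) : ℝ) - k = m at *
          generalize wCoef h (n + 2 - k) = w at *
          have j3 : 0 ≤ k * bCoef h k := by positivity
          generalize k * bCoef h k = b at *
          by_cases hneg : 1 - (k ^ 2 * h ^ 2 + m ^ 2 * h ^ 2 / 2) ≤ 0
          · have : 16 * m * (1 - (k ^ 2 * h ^ 2 + m ^ 2 * h ^ 2 / 2)) ≤ 0 :=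
              mul_nonpos_of_nonneg_of_nonpos (by positivity) hneg
            have : 0 ≤ b * w := by positivity
            linarith
          · push Not at hneg
            have p1 : 0 ≤ k ^ 2 * h ^ 2 := by positivity
            have p2 : 0 ≤ m ^ 2 * h ^ 2 / 2 := by positivity
            have a2 : 0 ≤ 1 - m ^ 2 * h ^ 2 / 2 := by linarith
            calc _ = 16 * m * (1 - (k ^ 2 * h ^ 2 + m ^ 2 * h ^ 2 / 2)) := by ring
              _ ≤ 16 * m * ((1 - k ^ 2 * h ^ 2) * (1 - m ^ 2 * h ^ 2 / 2)) := by gcongr; nlinarith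
              _ = (4 * 1 * (1 - k ^ 2 * h ^ 2)) * (4 * m * (1 - m ^ 2 * h ^ 2 / 2)) := by ring
              _ ≤ b * w := by gcongr
        have := Finset.sum_le_sum this
        rw [Finset.sum_sub_distrib, ← Finset.mul_sum, ← Finset.mul_sum, sum_oddInd_sub] at this
        linarith
      have hb0 := bCoef_nonneg hh (n + 2)
      have hw0 := wCoef_nonneg hh (n + 2)
      have hdl := diffSymbol_le hh.le (n + 2)
      rw [wCoef_add_two] at hw0 ⊢
      rcases Nat.even_or_odd (n + 2) with hp | hp
      · rw [bCoef_even h hp, oddInd_of_even hp] at *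
        refine ⟨by simp, ?_⟩
        generalize qCoef h (n + 2) = q at *
        generalize ((n + 2 : ℕ) : ℝ) = N at *
        have h2 : 0 ≤ h ^ 2 * N ^ 2 * (N ^ 2 - 4) := mul_nonneg (by positivity) (by linarith)
        rw [zero_add]
        have : N * (4 * N * (1 - N ^ 2 * h ^ 2 / 2)) ≤ N * q := by nlinarith
        exact le_of_mul_le_mul_left this hn0
      · have hn3 : (9 : ℝ) ≤ (n + 2 : ℕ) ^ 2 := by
          have : 1 ≤ n := by
            rcases Nat.eq_zero_or_pos n with rfl | h0
            · exact absurd hp (by decide)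
            · exact h0
          have : (1 : ℝ) ≤ n := by exact_mod_cast this
          push_cast; nlinarith
        rw [oddInd_of_odd hp] at *
        have h2 := diffSymbol_pos hh one_pos
        have h3 := diffSymbol_mul_bCoef hh hp
        rw [wCoef_add_two] at h3
        have hub := nat_mul_bCoef_le hh (n + 2)
        rw [oddInd_of_odd hp] at hub
        generalize diffSymbol h (n + 2 : ℕ) = a at *
        generalize diffSymbol h 1 = e at *
        generalize bCoef h (n + 2) = b at *
        generalize qCoef h (n + 2) = q at *
        generalize ((n + 2 : ℕ) : ℝ) = N at *
        have hx : 0 ≤ N ^ 2 * h ^ 2 := by positivity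
        have hq2 : 4 * (N ^ 2 - 1) * (1 - 5 / 12 * (N ^ 2 * h ^ 2)) ≤ N * q := by
          have : 0 ≤ (N ^ 2 - 1) * h ^ 2 := mul_nonneg (by linarith) (by positivity)
          nlinarith
        have hb1 : 4 * (1 - N ^ 2 * h ^ 2) ≤ N * b := by
          rcases lt_or_ge 1 (N * h) with hc | hc
          · have : 1 ≤ N ^ 2 * h ^ 2 := by nlinarith
            have : 0 ≤ N * b := by positivity
            linarith
          · have hd := hdl hc
            have hx1 : N ^ 2 * h ^ 2 ≤ 1 := by
              have : 0 ≤ N * h := by positivity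
              nlinarith
            have k1 : (a - e) * (N * b) = e * (N * q) := by linear_combination N * h3
            set x := N ^ 2 * h ^ 2 with hxd
            have k2 : a - e ≤ e * ((N ^ 2 - 1) * (1 + 9 / 16 * x)) := by
              have : 0 ≤ e * x * (N ^ 2 - 9) := by
                apply mul_nonneg (by positivity); linarith
              nlinarith
            have k3 : e * (4 * (N ^ 2 - 1) * (1 - 5 / 12 * x)) ≤ (a - e) * (N * b) := by
              rw [k1]; gcongr
            have k4 : (a - e) * (N * b) ≤ e * ((N ^ 2 - 1) * (1 + 9 / 16 * x)) * (N * b) := by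
              gcongr
            have k5 : (e * (N ^ 2 - 1)) * (4 * (1 - 5 / 12 * x)) ≤
                (e * (N ^ 2 - 1)) * ((1 + 9 / 16 * x) * (N * b)) := by linarith
            have k6 := le_of_mul_le_mul_left k5 (mul_pos h2 (by linarith))
            nlinarith
        refine ⟨by linarith, ?_⟩
        have : N * (4 * N * (1 - N ^ 2 * h ^ 2 / 2)) ≤ N * (b + q) := by
          have : 0 ≤ (N ^ 2 * h ^ 2) * (N ^ 2 - 7) := mul_nonneg hx (by linarith)
          nlinarith
        exact le_of_mul_le_mul_left this hn0

lemma summable_norm_mul_pow {a : ℕ → ℂ} {C : ℝ} (k : ℕ) (ha : ∀ n, ‖a n‖ ≤ C * ((n : ℝ) + 1) ^ k)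
    {z : ℂ} (hz : ‖z‖ < 1) : Summable fun n => ‖a n * z ^ n‖ := by
  have h1 : Summable fun n : ℕ => ((n : ℝ) ^ k * ‖z‖ ^ n) :=
    summable_pow_mul_geometric_of_norm_lt_one k (by simpa using hz)
  have h2 : Summable fun n : ℕ => C * (2 ^ k * ((n : ℝ) ^ k * ‖z‖ ^ n)) :=
    (h1.mul_left _).mul_left _
  refine Summable.of_norm_bounded_eventually_nat h2 ?_
  filter_upwards [eventually_ge_atTop 1] with n hn
  have hC : 0 ≤ C := by
    have := (norm_nonneg _).trans (ha 0); simpa using this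
  have hn1 : (1 : ℝ) ≤ n := by exact_mod_cast hn
  have h3 : ((n : ℝ) + 1) ^ k ≤ 2 ^ k * (n : ℝ) ^ k := by
    rw [← mul_pow]; exact pow_le_pow_left₀ (by positivity) (by linarith) k
  rw [norm_norm, norm_mul, norm_pow]
  calc ‖a n‖ * ‖z‖ ^ n ≤ C * (2 ^ k * (n : ℝ) ^ k) * ‖z‖ ^ n :=
        mul_le_mul_of_nonneg_right ((ha n).trans (mul_le_mul_of_nonneg_left h3 hC)) (by positivity)
    _ = _ := by ring

lemma hasDerivAt_tsum_mul_pow {a : ℕ → ℂ} {C : ℝ} (ha : ∀ n, ‖a n‖ ≤ C * ((n : ℝ) + 1))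
    {z : ℂ} (hz : ‖z‖ < 1) : HasDerivAt (fun z => ∑' n, a n * z ^ n)
      (∑' n : ℕ, ((n : ℂ) + 1) * a (n + 1) * z ^ n) z := by
  obtain ⟨r, hr1, hr2⟩ := exists_between hz
  have hr0 : 0 ≤ r := (norm_nonneg _).trans hr1.le
  have hC : 0 ≤ C := by
    have := (norm_nonneg _).trans (ha 0); simpa using this
  have hsum : Summable fun n : ℕ => (n : ℝ) * (C * ((n : ℝ) + 1)) * r ^ (n - 1) := by
    rw [← summable_nat_add_iff 1]
    have := summable_norm_mul_pow (a := fun n : ℕ => (((n : ℝ) + 1) * (C * ((n : ℝ) + 2)) : ℝ))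
      (C := 2 * C) (z := (r : ℂ)) 2 (by
        intro n
        rw [Complex.norm_real, Real.norm_of_nonneg (by positivity)]
        have : 0 ≤ C * (n : ℝ) := by positivity
        nlinarith [mul_nonneg this (Nat.cast_nonneg (α := ℝ) n)]) (by simpa [abs_of_nonneg hr0] using hr2)
    refine this.congr fun n => ?_
    rw [norm_mul, norm_pow, Complex.norm_real, Complex.norm_real, Real.norm_of_nonneg hr0,
      Real.norm_of_nonneg (by positivity)]
    push_cast
    ring
  have h0 : Summable fun n => a n * z ^ n :=
    (summable_norm_mul_pow 1 (by simpa using ha) hz).of_norm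
  have key := hasDerivAt_tsum_of_isPreconnected (g := fun n z => a n * z ^ n)
    (g' := fun n z => a n * ((n : ℂ) * z ^ (n - 1))) (t := Metric.ball (0 : ℂ) r) (y₀ := z) (y := z)
    hsum Metric.isOpen_ball (convex_ball _ _).isPreconnected
    (fun n y _ => (hasDerivAt_pow n y).const_mul _) (fun n y hy => ?_) (by simpa using hr1) h0
    (by simpa using hr1)
  · refine key.congr_deriv ?_
    have hs : Summable fun n : ℕ => a n * ((n : ℂ) * z ^ (n - 1)) := by
      refine Summable.of_norm_bounded hsum fun n => ?_
      rw [norm_mul, norm_mul, norm_pow, Complex.norm_natCast]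
      calc ‖a n‖ * (n * ‖z‖ ^ (n - 1)) ≤ (C * (n + 1)) * (n * r ^ (n - 1)) := by
            gcongr
            exact ha n
        _ = _ := by ring
    rw [hs.tsum_eq_zero_add]
    simp only [Nat.cast_zero, zero_mul, mul_zero, zero_add]
    refine tsum_congr fun n => ?_
    push_cast
    ring
  · rw [norm_mul, norm_mul, norm_pow, Complex.norm_natCast]
    calc ‖a n‖ * (n * ‖y‖ ^ (n - 1)) ≤ (C * (n + 1)) * (n * r ^ (n - 1)) := by
          gcongr
          · exact ha n
          · exact (mem_ball_zero_iff.mp hy).le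
      _ = _ := by ring

/-- The sum of the series `∑ bₙ zⁿ`. -/
def vFun (h : ℝ) (z : ℂ) : ℂ := ∑' n, (bCoef h n : ℂ) * z ^ n

/-- The sum of the series `∑ wₙ zⁿ`. -/
def wFun (h : ℝ) (z : ℂ) : ℂ := ∑' n, (wCoef h n : ℂ) * z ^ n

lemma bCoef_le_four {h : ℝ} (hh : 0 < h) (n : ℕ) : bCoef h n ≤ 4 := by
  rcases Nat.eq_zero_or_pos n with rfl | hn
  · simp [bCoef_zero]
  · have h1 := nat_mul_bCoef_le hh n
    have h2 : oddInd n ≤ 1 := by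
      rcases Nat.even_or_odd n with hp | hp
      · rw [oddInd_of_even hp]; norm_num
      · rw [oddInd_of_odd hp]
    have h3 : (1 : ℝ) ≤ n := by exact_mod_cast hn
    nlinarith [bCoef_nonneg hh n]

lemma norm_bCoef_le {h : ℝ} (hh : 0 < h) (n : ℕ) : ‖(bCoef h n : ℂ)‖ ≤ 4 * ((n : ℝ) + 1) := by
  rw [Complex.norm_real, Real.norm_of_nonneg (bCoef_nonneg hh n)]
  nlinarith [bCoef_le_four hh n, Nat.cast_nonneg (α := ℝ) n]

lemma norm_wCoef_le {h : ℝ} (hh : 0 < h) (n : ℕ) : ‖(wCoef h n : ℂ)‖ ≤ 4 * ((n : ℝ) + 1) := by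
  rw [Complex.norm_real, Real.norm_of_nonneg (wCoef_nonneg hh n)]
  rcases Nat.eq_zero_or_pos n with rfl | hn
  · simp [wCoef_zero]
  · linarith [wCoef_le hh hn]

lemma wFun_eq_exp {h : ℝ} (hh : 0 < h) {z : ℂ} (hz : ‖z‖ < 1) :
    wFun h z = Complex.exp (vFun h z) := by
  have hd : ∀ y ∈ Metric.ball (0 : ℂ) 1,
      HasDerivAt (fun z => wFun h z * Complex.exp (-vFun h z)) 0 y := by
    intro y hy
    have hy1 : ‖y‖ < 1 := mem_ball_zero_iff.mp hy
    have h1 := hasDerivAt_tsum_mul_pow (norm_bCoef_le hh) hy1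
    have h2 := hasDerivAt_tsum_mul_pow (norm_wCoef_le hh) hy1
    have h3 : (∑' n : ℕ, ((n : ℂ) + 1) * (wCoef h (n + 1) : ℂ) * y ^ n) =
        (∑' n : ℕ, ((n : ℂ) + 1) * (bCoef h (n + 1) : ℂ) * y ^ n) * wFun h y := by
      rw [wFun, tsum_mul_tsum_eq_tsum_sum_range_of_summable_norm]
      · refine tsum_congr fun n => ?_
        have := congrArg (fun x : ℝ => (x : ℂ)) (wCoef_convolution h n)
        push_cast at this
        rw [this, Finset.sum_mul]
        refine Finset.sum_congr rfl fun k hk => ?_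
        have hk : k ≤ n := by simpa [Nat.lt_succ_iff] using hk
        rw [← pow_mul_pow_sub y hk]
        ring
      · refine summable_norm_mul_pow (C := 8) 2 (fun n => ?_) hy1
        rw [norm_mul]
        have i1 : ‖((n : ℂ) + 1)‖ = n + 1 := by
          rw [← Nat.cast_one, ← Nat.cast_add, Complex.norm_natCast]; push_cast; rfl
        have i2 := norm_bCoef_le hh (n + 1)
        push_cast at i2
        rw [i1]
        nlinarith [Nat.cast_nonneg (α := ℝ) n]
      · exact summable_norm_mul_pow 1 (by simpa using norm_wCoef_le hh) hy1
    refine ((h2.mul h1.neg.cexp)).congr_deriv ?_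
    rw [h3]
    simp only [wFun]
    ring
  have hc : wFun h z * Complex.exp (-vFun h z) = wFun h 0 * Complex.exp (-vFun h 0) := by
    refine (convex_ball (0 : ℂ) 1).is_const_of_fderivWithin_eq_zero (𝕜 := ℂ)
      (f := fun z => wFun h z * Complex.exp (-vFun h z))
      (fun y hy => (hd y hy).differentiableAt.differentiableWithinAt) (fun y hy => ?_)
      (by simpa using hz) (by simp)
    rw [fderivWithin_of_isOpen Metric.isOpen_ball hy]
    ext; simp [(hd y hy).deriv]
  have h0 : wFun h 0 = 1 := by
    rw [wFun, tsum_eq_single 0 (by intro n hn; simp [hn])]; simp [wCoef_zero]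
  have h0' : vFun h 0 = 0 := by
    rw [vFun, tsum_eq_single 0 (by intro n hn; simp [hn])]; simp [bCoef_zero]
  rw [h0, h0', Complex.exp_neg] at hc
  field_simp at hc
  simpa using hc

lemma vFun_neg (h : ℝ) (z : ℂ) : vFun h (-z) = -vFun h z := by
  rw [vFun, vFun, ← tsum_neg]
  refine tsum_congr fun n => ?_
  rcases Nat.even_or_odd n with hp | hp
  · simp [bCoef_even h hp]
  · rw [hp.neg_pow]; ring

lemma vFun_conj (h : ℝ) (z : ℂ) : vFun h (starRingEnd ℂ z) = starRingEnd ℂ (vFun h z) := by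
  rw [vFun, vFun, Complex.conj_tsum]
  refine tsum_congr fun n => ?_
  simp

lemma diffSymbol_eq (h : ℝ) (n : ℕ) :
    (diffSymbol h n : ℂ) = Complex.exp h ^ n - 2 + Complex.exp (-h) ^ n := by
  have : diffSymbol h n = Real.exp (n * h) - 2 + Real.exp (n * -h) := by
    rw [diffSymbol, Real.sinh_eq]
    have e1 : Real.exp (n * h) = Real.exp (n * h / 2) ^ 2 := by rw [← Real.exp_nat_mul]; ring_nf
    have e2 : Real.exp (n * -h) = Real.exp (-(n * h / 2)) ^ 2 := by
      rw [← Real.exp_nat_mul]; ring_nf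
    have e3 : Real.exp (n * h / 2) * Real.exp (-(n * h / 2)) = 1 := by
      rw [← Real.exp_add]; simp
    rw [e1, e2]
    linear_combination (-2) * e3
  rw [this, ← Complex.exp_nat_mul, ← Complex.exp_nat_mul]
  push_cast
  rfl

lemma vFun_diff_aux {h : ℝ} (hh : 0 < h) {z : ℂ} (hz : ‖z‖ < Real.exp (-h)) :
    vFun h (Complex.exp h * z) - 2 * vFun h z + vFun h (Complex.exp (-h) * z) =
      (diffSymbol h 1 : ℂ) * Complex.sinh (vFun h z) := by
  have he : Real.exp (-h) < 1 := by rw [Real.exp_lt_one_iff]; linarith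
  have hz1 : ‖z‖ < 1 := hz.trans he
  have hz2 : ‖Complex.exp h * z‖ < 1 := by
    rw [norm_mul, ← Complex.ofReal_exp, Complex.norm_real, Real.norm_of_nonneg (Real.exp_pos h).le]
    calc Real.exp h * ‖z‖ < Real.exp h * Real.exp (-h) := by gcongr
      _ = 1 := by rw [← Real.exp_add]; simp
  have hz3 : ‖Complex.exp (-h) * z‖ < 1 := by
    rw [norm_mul, ← Complex.ofReal_neg, ← Complex.ofReal_exp, Complex.norm_real,
      Real.norm_of_nonneg (Real.exp_pos _).le]
    nlinarith [norm_nonneg z, Real.exp_pos (-h)]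
  have hs : ∀ {y : ℂ}, ‖y‖ < 1 → Summable fun n => (bCoef h n : ℂ) * y ^ n := fun hy =>
    (summable_norm_mul_pow 1 (by simpa using norm_bCoef_le hh) hy).of_norm
  have hw : ∀ {y : ℂ}, ‖y‖ < 1 → Summable fun n => (wCoef h n : ℂ) * y ^ n := fun hy =>
    (summable_norm_mul_pow 1 (by simpa using norm_wCoef_le hh) hy).of_norm
  have hneg : ‖-z‖ < 1 := by simpa
  rw [Complex.sinh, ← vFun_neg, ← wFun_eq_exp hh hz1, ← wFun_eq_exp hh hneg]
  have h1 := ((hs hz2).hasSum.sub ((hs hz1).hasSum.mul_left 2)).add (hs hz3).hasSum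
  have h2 := ((((hw hz1).hasSum.sub (hw hneg).hasSum)).div_const 2).mul_left (diffSymbol h 1 : ℂ)
  refine h1.unique (h2.congr_fun ?_)
  intro n
  rcases Nat.even_or_odd n with hp | hp
  · simp [bCoef_even h hp, hp.neg_pow]
  · rw [hp.neg_pow, mul_pow, mul_pow]
    have e1 := congrArg (fun x : ℝ => (x : ℂ)) (diffSymbol_mul_bCoef hh hp)
    push_cast at e1
    rw [diffSymbol_eq] at e1
    linear_combination z ^ n * e1

/-- Continuation of `vFun` by means of the difference equation. -/
def vExt (h : ℝ) : ℕ → ℂ → ℂ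
  | 0 => vFun h
  | N + 1 => fun z => 2 * vExt h N (Complex.exp (-h) * z) -
      vExt h N (Complex.exp (-h) * (Complex.exp (-h) * z)) +
      (diffSymbol h 1 : ℂ) * Complex.sinh (vExt h N (Complex.exp (-h) * z))

lemma norm_exp_neg_mul_lt {h r : ℝ} {z : ℂ} (hz : ‖z‖ < Real.exp (r + h)) :
    ‖Complex.exp (-h) * z‖ < Real.exp r := by
  rw [norm_mul, ← Complex.ofReal_neg, ← Complex.ofReal_exp, Complex.norm_real,
    Real.norm_of_nonneg (Real.exp_pos _).le]
  calc Real.exp (-h) * ‖z‖ < Real.exp (-h) * Real.exp (r + h) := by gcongr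
    _ = Real.exp r := by rw [← Real.exp_add]; ring_nf

lemma vExt_succ {h : ℝ} (hh : 0 < h) (N : ℕ) {z : ℂ} (hz : ‖z‖ < Real.exp (N * h)) :
    vExt h (N + 1) z = vExt h N z := by
  induction N generalizing z with
  | zero =>
    have e : Complex.exp h * (Complex.exp (-h) * z) = z := by
      rw [← mul_assoc, ← Complex.exp_add]; simp
    have := vFun_diff_aux hh (z := Complex.exp (-h) * z) (by
      refine norm_exp_neg_mul_lt ?_
      simpa using hz)
    rw [e] at this
    simp only [vExt]
    linear_combination -this
  | succ N ih =>
    have hz1 : ‖Complex.exp (-h) * z‖ < Real.exp (N * h) := by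
      refine norm_exp_neg_mul_lt ?_
      convert hz using 2; push_cast; ring
    have hz2 : ‖Complex.exp (-h) * (Complex.exp (-h) * z)‖ < Real.exp (N * h) := by
      refine norm_exp_neg_mul_lt (hz1.trans ?_)
      rw [Real.exp_lt_exp]; linarith
    have e1 := ih hz1
    have e2 := ih hz2
    rw [vExt]
    simp only [e1, e2]
    rfl

lemma differentiableAt_vExt {h : ℝ} (hh : 0 < h) (N : ℕ) {z : ℂ} (hz : ‖z‖ < Real.exp (N * h)) :
    DifferentiableAt ℂ (vExt h N) z := by
  induction N generalizing z with
  | zero => exact (hasDerivAt_tsum_mul_pow (norm_bCoef_le hh) (by simpa using hz)).differentiableAt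
  | succ N ih =>
    have hz1 : ‖Complex.exp (-h) * z‖ < Real.exp (N * h) := by
      refine norm_exp_neg_mul_lt ?_
      convert hz using 2; push_cast; ring
    have hz2 : ‖Complex.exp (-h) * (Complex.exp (-h) * z)‖ < Real.exp (N * h) := by
      refine norm_exp_neg_mul_lt (hz1.trans ?_)
      rw [Real.exp_lt_exp]; linarith
    have d1 : DifferentiableAt ℂ (fun z => vExt h N (Complex.exp (-h) * z)) z :=
      DifferentiableAt.comp (g := vExt h N) z (ih hz1) (by fun_prop)
    have d2 : DifferentiableAt ℂ (fun z => vExt h N (Complex.exp (-h) * (Complex.exp (-h) * z))) z :=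
      DifferentiableAt.comp (g := vExt h N) z (ih hz2) (by fun_prop)
    exact ((d1.const_mul 2).sub d2).add ((d1.csinh).const_mul _)

lemma vExt_eq {h : ℝ} (hh : 0 < h) (N : ℕ) {z : ℂ} (hz : ‖z‖ < 1) : vExt h N z = vFun h z := by
  induction N with
  | zero => rfl
  | succ N ih =>
    rw [vExt_succ hh N (hz.trans_le (Real.one_le_exp (by positivity))), ih]

lemma hasFPowerSeriesOnBall_vFun {h : ℝ} (hh : 0 < h) : HasFPowerSeriesOnBall (vFun h)
    (FormalMultilinearSeries.ofScalars ℂ fun n => (bCoef h n : ℂ)) 0 1 where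
  r_le := by
    refine FormalMultilinearSeries.le_radius_of_bound (r := 1) _ 4 fun n => ?_
    rw [FormalMultilinearSeries.ofScalars_norm, Complex.norm_real,
      Real.norm_of_nonneg (bCoef_nonneg hh n)]
    simpa using bCoef_le_four hh n
  r_pos := one_pos
  hasSum := by
    intro y hy
    have hy1 : ‖y‖ < 1 := by
      rw [Metric.mem_eball, edist_zero_right, ← ofReal_norm, ENNReal.ofReal_lt_one] at hy
      exact hy
    simp only [FormalMultilinearSeries.ofScalars_apply_eq, smul_eq_mul, zero_add]
    exact (summable_norm_mul_pow 1 (by simpa using norm_bCoef_le hh) hy1).of_norm.hasSum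

lemma hasFPowerSeriesOnBall_vExt {h : ℝ} (hh : 0 < h) (N : ℕ) {r : NNReal} (hr : 0 < r)
    (hrN : (r : ℝ) < Real.exp (N * h)) : HasFPowerSeriesOnBall (vExt h N)
    (FormalMultilinearSeries.ofScalars ℂ fun n => (bCoef h n : ℂ)) 0 r ∧
    FormalMultilinearSeries.ofScalars ℂ (fun n => (bCoef h n : ℂ)) =
      cauchyPowerSeries (vExt h N) 0 r := by
  have h1 : DifferentiableOn ℂ (vExt h N) (Metric.closedBall 0 r) := fun z hz =>
    (differentiableAt_vExt hh N
      ((mem_closedBall_zero_iff.mp hz).trans_lt hrN)).differentiableWithinAt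
  have h2 := h1.hasFPowerSeriesOnBall hr
  have h3 : HasFPowerSeriesAt (vExt h N)
      (FormalMultilinearSeries.ofScalars ℂ fun n => (bCoef h n : ℂ)) 0 := by
    refine (hasFPowerSeriesOnBall_vFun hh).hasFPowerSeriesAt.congr ?_
    filter_upwards [Metric.ball_mem_nhds (0 : ℂ) one_pos] with z hz
    exact (vExt_eq hh N (mem_ball_zero_iff.mp hz)).symm
  have h4 := h3.eq_formalMultilinearSeries h2.hasFPowerSeriesAt
  exact ⟨h4 ▸ h2, h4⟩

lemma exists_exp_gt {h : ℝ} (hh : 0 < h) (r : ℝ) : ∃ N : ℕ, r < Real.exp (N * h) := by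
  obtain ⟨N, hN⟩ := exists_nat_gt (r / h)
  refine ⟨N, ?_⟩
  rw [div_lt_iff₀ hh] at hN
  linarith [Real.add_one_le_exp (N * h)]

lemma hasSum_vFun_aux {h : ℝ} (hh : 0 < h) (N : ℕ) {z : ℂ} (hz : ‖z‖ < Real.exp (N * h)) :
    HasSum (fun n => (bCoef h n : ℂ) * z ^ n) (vExt h N z) := by
  obtain ⟨r, hr1, hr2⟩ := exists_between hz
  have hr0 : 0 < r := (norm_nonneg _).trans_lt hr1
  lift r to NNReal using hr0.le
  have := (hasFPowerSeriesOnBall_vExt hh N (by exact_mod_cast hr0) hr2).1.hasSum (y := z)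
    (by simpa [Metric.mem_eball, edist_zero_right, enorm] using hr1)
  simpa only [FormalMultilinearSeries.ofScalars_apply_eq, smul_eq_mul, zero_add] using this

lemma vFun_eq_vExt {h : ℝ} (hh : 0 < h) (N : ℕ) {z : ℂ} (hz : ‖z‖ < Real.exp (N * h)) :
    vFun h z = vExt h N z := (hasSum_vFun_aux hh N hz).tsum_eq

lemma summable_vFun {h : ℝ} (hh : 0 < h) (z : ℂ) : Summable fun n => (bCoef h n : ℂ) * z ^ n := by
  obtain ⟨N, hN⟩ := exists_exp_gt hh ‖z‖
  exact (hasSum_vFun_aux hh N hN).summable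

lemma differentiable_vFun {h : ℝ} (hh : 0 < h) : Differentiable ℂ (vFun h) := by
  intro z
  obtain ⟨N, hN⟩ := exists_exp_gt hh ‖z‖
  refine (differentiableAt_vExt hh N hN).congr_of_eventuallyEq ?_
  filter_upwards [Metric.isOpen_ball.mem_nhds (mem_ball_zero_iff.mpr hN)] with y hy
  exact vFun_eq_vExt hh N (mem_ball_zero_iff.mp hy)

lemma vFun_diff {h : ℝ} (hh : 0 < h) (z : ℂ) :
    vFun h (Complex.exp h * z) - 2 * vFun h z + vFun h (Complex.exp (-h) * z) =
      (diffSymbol h 1 : ℂ) * Complex.sinh (vFun h z) := by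
  obtain ⟨N, hN⟩ := exists_exp_gt hh ‖Complex.exp h * z‖
  have e : Complex.exp (-h) * (Complex.exp h * z) = z := by
    rw [← mul_assoc, ← Complex.exp_add]; simp
  have h1 : ‖z‖ < Real.exp (N * h) := by
    have := norm_exp_neg_mul_lt (h := h) (r := N * h) (z := Complex.exp h * z)
      (hN.trans (by rw [Real.exp_lt_exp]; linarith))
    rwa [e] at this
  have h2 := norm_exp_neg_mul_lt (h := h) (r := N * h) (z := z)
      (h1.trans (by rw [Real.exp_lt_exp]; linarith))
  have h0 := vExt_succ hh N hN
  rw [vExt] at h0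
  simp only [e] at h0
  rw [vFun_eq_vExt hh N hN, vFun_eq_vExt hh N h1, vFun_eq_vExt hh N h2]
  linear_combination -h0

lemma bCoef_eq_integral {h : ℝ} (hh : 0 < h) (n : ℕ) {r : ℝ} (hr : 0 < r) :
    (bCoef h n : ℂ) = (2 * π * Complex.I : ℂ)⁻¹ • ∮ z in C(0, r), (z⁻¹) ^ n * z⁻¹ * vFun h z := by
  obtain ⟨N, hN⟩ := exists_exp_gt hh r
  lift r to NNReal using hr.le
  have h1 := (hasFPowerSeriesOnBall_vExt hh N (by exact_mod_cast hr) hN).2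
  have h2 := congrArg (fun p => p n fun _ => (1 : ℂ)) h1
  simp only [FormalMultilinearSeries.ofScalars_apply_eq] at h2
  rw [cauchyPowerSeries_apply] at h2
  simp only [one_pow, smul_eq_mul, mul_one, sub_zero, one_div] at h2
  rw [h2, smul_eq_mul]
  congr 1
  refine circleIntegral.integral_congr hr.le fun z hz => ?_
  have hz' : ‖z‖ = r := by simpa using hz
  rw [vFun_eq_vExt hh N (hz' ▸ hN)]
  ring

/-- The separatrix `4 arctan (exp t)` of the pendulum, on the complex domain. -/
def pendulum (t : ℂ) : ℂ :=
  -2 * Complex.I * (Complex.log (1 + Complex.I * Complex.exp t) -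
    Complex.log (1 - Complex.I * Complex.exp t))

/-- A domain of analyticity of `pendulum`. -/
def pendulumDomain : Set ℂ := {t | t.re < 0 ∨ |t.im| < π / 2}

lemma mem_slitPlane_of_mem {t : ℂ} (ht : t ∈ pendulumDomain) :
    1 + Complex.I * Complex.exp t ∈ Complex.slitPlane ∧
      1 - Complex.I * Complex.exp t ∈ Complex.slitPlane := by
  rcases ht with ht | ht
  · have hn : ‖Complex.I * Complex.exp t‖ < 1 := by
      rw [norm_mul, Complex.norm_I, one_mul, Complex.norm_exp, Real.exp_lt_one_iff]; exact ht
    refine ⟨Complex.mem_slitPlane_of_norm_lt_one hn, ?_⟩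
    rw [sub_eq_add_neg]
    exact Complex.mem_slitPlane_of_norm_lt_one (by rwa [norm_neg])
  · rw [abs_lt] at ht
    have h1 : 0 < Real.exp t.re * Real.cos t.im :=
      mul_pos (Real.exp_pos _) (Real.cos_pos_of_mem_Ioo ⟨by linarith, by linarith⟩)
    constructor <;> rw [Complex.mem_slitPlane_iff] <;> right <;>
      simp [Complex.exp_re, Real.cos_pos_of_mem_Ioo ⟨by linarith [ht.1], ht.2⟩ |>.ne']

lemma one_add_mul_one_sub (t : ℂ) : (1 + Complex.I * Complex.exp t) * (1 - Complex.I * Complex.exp t) =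
    2 * Complex.exp t * Complex.cosh t := by
  rw [Complex.cosh, Complex.exp_neg]
  have := Complex.exp_ne_zero t
  field_simp
  ring_nf
  simp

lemma cosh_ne_zero_of_mem {t : ℂ} (ht : t ∈ pendulumDomain) : Complex.cosh t ≠ 0 := by
  have h := mem_slitPlane_of_mem ht
  have h1 := mul_ne_zero (Complex.slitPlane_ne_zero h.1) (Complex.slitPlane_ne_zero h.2)
  rw [one_add_mul_one_sub] at h1
  exact right_ne_zero_of_mul h1

lemma hasDerivAt_pendulum {t : ℂ} (ht : t ∈ pendulumDomain) :
    HasDerivAt pendulum (2 / Complex.cosh t) t := by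
  have h := mem_slitPlane_of_mem ht
  have h0 := cosh_ne_zero_of_mem ht
  have d0 : HasDerivAt (fun t => Complex.I * Complex.exp t) (Complex.I * Complex.exp t) t :=
    (Complex.hasDerivAt_exp t).const_mul _
  have d1 := ((d0.const_add 1).clog h.1).sub ((d0.const_sub 1).clog h.2)
  refine (d1.const_mul (-2 * Complex.I)).congr_deriv ?_
  have e := one_add_mul_one_sub t
  have n1 := Complex.slitPlane_ne_zero h.1
  have n2 := Complex.slitPlane_ne_zero h.2
  have hI := Complex.I_sq
  have : Complex.I * Complex.exp t / (1 + Complex.I * Complex.exp t) -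
      -(Complex.I * Complex.exp t) / (1 - Complex.I * Complex.exp t) =
      2 * (Complex.I * Complex.exp t) / (2 * Complex.exp t * Complex.cosh t) := by
    rw [← e]; field_simp; ring
  rw [this]
  have := Complex.exp_ne_zero t
  field_simp
  linear_combination -hI

lemma exp_I_mul_pendulum {t : ℂ} (ht : t ∈ pendulumDomain) : Complex.exp (Complex.I * pendulum t) =
    ((1 + Complex.I * Complex.exp t) / (1 - Complex.I * Complex.exp t)) ^ 2 := by
  have h := mem_slitPlane_of_mem ht
  have e : Complex.I * pendulum t = (2 : ℕ) * (Complex.log (1 + Complex.I * Complex.exp t) -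
    Complex.log (1 - Complex.I * Complex.exp t)) := by
    rw [pendulum]; push_cast; ring_nf; simp; ring
  rw [e, Complex.exp_nat_mul, Complex.exp_sub, Complex.exp_log (Complex.slitPlane_ne_zero h.1),
    Complex.exp_log (Complex.slitPlane_ne_zero h.2)]

lemma sin_cos_pendulum {t : ℂ} (ht : t ∈ pendulumDomain) :
    Complex.sin (pendulum t) = -2 * Complex.sinh t / Complex.cosh t ^ 2 ∧
    Complex.cos (pendulum t) = 1 - 2 / Complex.cosh t ^ 2 := by
  have h := mem_slitPlane_of_mem ht
  have n1 := Complex.slitPlane_ne_zero h.1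
  have n2 := Complex.slitPlane_ne_zero h.2
  have e := exp_I_mul_pendulum ht
  have e' : Complex.exp (-pendulum t * Complex.I) =
      ((1 - Complex.I * Complex.exp t) / (1 + Complex.I * Complex.exp t)) ^ 2 := by
    rw [show -pendulum t * Complex.I = -(Complex.I * pendulum t) by ring, Complex.exp_neg, e,
      ← inv_pow, inv_div]
  have e2 : Complex.exp (pendulum t * Complex.I) = _ := (by rw [mul_comm] : _ = _).trans e
  have q := one_add_mul_one_sub t
  have c1 : Complex.cosh t = (1 + Complex.I * Complex.exp t) * (1 - Complex.I * Complex.exp t) /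
      (2 * Complex.exp t) := by rw [q]; field_simp
  have s1 : Complex.sinh t = (Complex.exp t ^ 2 - 1) / (2 * Complex.exp t) := by
    rw [Complex.sinh, Complex.exp_neg]; field_simp
  rw [Complex.sin, Complex.cos, e', e2, c1, s1]
  generalize Complex.exp t = x at *
  have h4 : Complex.I ^ 4 = 1 := Complex.I_pow_four
  constructor
  · rw [← sub_eq_zero]
    field_simp
    ring_nf
    simp only [Complex.I_sq, h4]
    ring
  · rw [← sub_eq_zero]
    field_simp
    ring_nf
    simp only [Complex.I_sq]
    ring

lemma pendulum_zero : pendulum 0 = π := by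
  have m := mem_slitPlane_of_mem (t := 0) (Or.inr (by simp [Real.pi_pos]))
  simp only [Complex.exp_zero, mul_one] at m
  have e : Complex.log (1 + Complex.I) - Complex.log (1 - Complex.I) = π / 2 * Complex.I := by
    have a1 := Complex.abs_arg_lt_pi_div_two_iff.mpr (Or.inl (by simp : 0 < (1 + Complex.I).re))
    have a2 := Complex.abs_arg_lt_pi_div_two_iff.mpr (Or.inl (by simp : 0 < (1 - Complex.I).re))
    rw [abs_lt] at a1 a2
    rw [← Complex.log_I, ← Complex.log_exp (x := Complex.log (1 + Complex.I) - Complex.log (1 - Complex.I)),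
      Complex.exp_sub, Complex.exp_log (Complex.slitPlane_ne_zero m.1),
      Complex.exp_log (Complex.slitPlane_ne_zero m.2)]
    · congr 1
      rw [div_eq_iff (Complex.slitPlane_ne_zero m.2)]
      ring_nf; simp; ring
    · simp only [Complex.sub_im, Complex.log_im]; linarith
    · simp only [Complex.sub_im, Complex.log_im]; linarith
  rw [pendulum, Complex.exp_zero, mul_one, e]
  ring_nf; simp

lemma pendulum_add_neg {t : ℂ} (ht : |t.im| < π / 2) : pendulum t + pendulum (-t) = 2 * π := by
  have hconv : Convex ℝ {t : ℂ | |t.im| < π / 2} := by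
    have : {t : ℂ | |t.im| < π / 2} = Complex.imLm ⁻¹' (Metric.ball 0 (π / 2)) := by
      ext t; simp
    rw [this]
    exact (convex_ball _ _).is_linear_preimage Complex.imLm.isLinear
  have hopen : IsOpen {t : ℂ | |t.im| < π / 2} :=
    isOpen_lt (continuous_abs.comp Complex.continuous_im) continuous_const
  have hd : ∀ y ∈ {t : ℂ | |t.im| < π / 2},
      HasDerivAt (fun t => pendulum t + pendulum (-t)) 0 y := by
    intro y hy
    have hy' : |(-y).im| < π / 2 := by simpa using hy
    have h1 := hasDerivAt_pendulum (t := y) (Or.inr hy)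
    have h2 := (hasDerivAt_pendulum (t := -y) (Or.inr hy')).comp y (hasDerivAt_neg y)
    refine (h1.add h2).congr_deriv ?_
    simp
  have hc := hconv.is_const_of_fderivWithin_eq_zero (𝕜 := ℂ)
      (f := fun t => pendulum t + pendulum (-t))
      (fun y hy => (hd y hy).differentiableAt.differentiableWithinAt) (fun y hy => by
        rw [fderivWithin_of_isOpen hopen hy]
        ext; simp [(hd y hy).deriv])
      ht (show (0 : ℂ) ∈ {t : ℂ | |t.im| < π / 2} by simp [Real.pi_pos])
  simp only [neg_zero, pendulum_zero] at hc
  rw [hc]; ring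

lemma abs_re_pendulum_le {t : ℂ} (ht : t.re < 0) : |(pendulum t).re| ≤ 2 * π := by
  have hn : ‖Complex.I * Complex.exp t‖ < 1 := by
    rw [norm_mul, Complex.norm_I, one_mul, Complex.norm_exp, Real.exp_lt_one_iff]; exact ht
  have hr := (Complex.abs_re_le_norm (Complex.I * Complex.exp t)).trans_lt hn
  rw [abs_lt] at hr
  have a1 := Complex.abs_arg_lt_pi_div_two_iff.mpr
    (Or.inl (by rw [Complex.add_re, Complex.one_re]; linarith : 0 < (1 + Complex.I * Complex.exp t).re))
  have a2 := Complex.abs_arg_lt_pi_div_two_iff.mpr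
    (Or.inl (by rw [Complex.sub_re, Complex.one_re]; linarith : 0 < (1 - Complex.I * Complex.exp t).re))
  rw [abs_lt] at a1 a2
  have : (pendulum t).re = 2 * ((1 + Complex.I * Complex.exp t).arg - (1 - Complex.I * Complex.exp t).arg) := by
    rw [pendulum, ← Complex.log_im, ← Complex.log_im, ← Complex.sub_im]
    generalize (Complex.log (1 + Complex.I * Complex.exp t) -
      Complex.log (1 - Complex.I * Complex.exp t)) = w
    simp [Complex.mul_re]
  rw [this, abs_le]
  constructor <;> linarith

lemma hasSum_pendulum {t : ℂ} (ht : t.re < 0) :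
    HasSum (fun n : ℕ => -Complex.I * ((4 * oddInd n / n : ℝ) * (Complex.I * Complex.exp t) ^ n))
      (pendulum t) := by
  have hn : ‖Complex.I * Complex.exp t‖ < 1 := by
    rw [norm_mul, Complex.norm_I, one_mul, Complex.norm_exp, Real.exp_lt_one_iff]; exact ht
  have h1 := Complex.hasSum_taylorSeries_neg_log hn
  have h2 := Complex.hasSum_taylorSeries_neg_log (z := -(Complex.I * Complex.exp t)) (by rwa [norm_neg])
  rw [sub_neg_eq_add] at h2
  have h3 := (h1.sub h2).mul_left (-2 * Complex.I)
  have e : pendulum t = -2 * Complex.I * (-Complex.log (1 - Complex.I * Complex.exp t) -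
      -Complex.log (1 + Complex.I * Complex.exp t)) := by rw [pendulum]; ring
  rw [e]
  refine h3.congr_fun fun n => ?_
  rw [neg_pow, oddInd]
  push_cast
  ring

/-- The entire solution of the second order difference equation given by `vFun`. -/
def uHat (h : ℝ) (t : ℂ) : ℂ := -Complex.I * vFun h (Complex.I * Complex.exp t)

lemma differentiable_uHat {h : ℝ} (hh : 0 < h) : Differentiable ℂ (uHat h) := by
  have := differentiable_vFun hh
  unfold uHat
  fun_prop

lemma uHat_add_pi (h : ℝ) (t : ℂ) : uHat h (t + π * Complex.I) = -uHat h t := by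
  rw [uHat, uHat, Complex.exp_add, Complex.exp_pi_mul_I,
    show Complex.I * (Complex.exp t * -1) = -(Complex.I * Complex.exp t) by ring, vFun_neg]
  ring

lemma uHat_conj (h : ℝ) (t : ℂ) : uHat h (starRingEnd ℂ t) = starRingEnd ℂ (uHat h t) := by
  have : Complex.I * Complex.exp (starRingEnd ℂ t) = starRingEnd ℂ (-(Complex.I * Complex.exp t)) := by
    simp [Complex.exp_conj]
  rw [uHat, uHat, this, vFun_conj, vFun_neg]
  simp

lemma uHat_diff {h : ℝ} (hh : 0 < h) (t : ℂ) :
    uHat h (t + h) - 2 * uHat h t + uHat h (t - h) = (diffSymbol h 1 : ℂ) * Complex.sin (uHat h t) := by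
  have := vFun_diff hh (Complex.I * Complex.exp t)
  have e1 : Complex.I * Complex.exp (t + h) = Complex.exp h * (Complex.I * Complex.exp t) := by
    rw [Complex.exp_add]; ring
  have e2 : Complex.I * Complex.exp (t - h) = Complex.exp (-h) * (Complex.I * Complex.exp t) := by
    rw [sub_eq_add_neg, Complex.exp_add]; ring
  have e3 : Complex.sinh (vFun h (Complex.I * Complex.exp t)) = Complex.sin (uHat h t) * Complex.I := by
    rw [← Complex.sinh_mul_I]
    congr 1
    rw [uHat]
    ring_nf; simp
  rw [e3] at this
  have hI := Complex.I_sq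
  have e5 : uHat h (t + h) = -Complex.I * vFun h (Complex.exp h * (Complex.I * Complex.exp t)) := by
    rw [uHat, e1]
  have e6 : uHat h (t - h) = -Complex.I * vFun h (Complex.exp (-h) * (Complex.I * Complex.exp t)) := by
    rw [uHat, e2]
  rw [e5, e6]
  have e4 : uHat h t = -Complex.I * vFun h (Complex.I * Complex.exp t) := rfl
  linear_combination (-Complex.I) * this - (diffSymbol h 1 : ℂ) * Complex.sin (uHat h t) * hI -
    2 * e4

lemma norm_uHat_sub_pendulum_le {h : ℝ} (hh : 0 < h) {τ : ℝ} (hτ : 0 < τ) {t : ℂ} (ht : t.re = -τ) :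
    ‖uHat h t - pendulum t‖ ≤ 12 * h ^ 2 * Real.exp (-(2 * τ)) / τ ^ 2 := by
  have h1 := (hasSum_pendulum (t := t) (by linarith))
  have h2 := (summable_vFun hh (Complex.I * Complex.exp t)).hasSum.mul_left (-Complex.I)
  have h3 := h2.sub h1
  set x := Real.exp (-τ) with hx
  have hx0 : 0 < x := Real.exp_pos _
  have hx1 : x < 1 := by rw [hx, Real.exp_lt_one_iff]; linarith
  have hn : ‖Complex.I * Complex.exp t‖ = x := by
    rw [norm_mul, Complex.norm_I, one_mul, Complex.norm_exp, ht]
  have hg : HasSum (fun n : ℕ => (n : ℝ) * x ^ n) (x / (1 - x) ^ 2) :=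
    hasSum_coe_mul_geometric_of_norm_lt_one (by rwa [Real.norm_of_nonneg hx0.le])
  have hterm : ∀ n : ℕ, ‖-Complex.I * ((bCoef h n : ℂ) * (Complex.I * Complex.exp t) ^ n) -
      -Complex.I * ((4 * oddInd n / n : ℝ) * (Complex.I * Complex.exp t) ^ n)‖ =
      |bCoef h n - 4 * oddInd n / n| * x ^ n := by
    intro n
    rw [← mul_sub, ← sub_mul, ← Complex.ofReal_sub, norm_mul, norm_mul, norm_pow, hn,
      Complex.norm_real, norm_neg, Complex.norm_I, one_mul, Real.norm_eq_abs]
  have hbig : ∀ n : ℕ, |bCoef h (n + 2) - 4 * oddInd (n + 2) / (n + 2 : ℕ)| ≤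
      4 * h ^ 2 * (n + 2) * oddInd n := by
    intro n
    have hn0 : (0 : ℝ) < (n + 2 : ℕ) := by positivity
    have i1 := nat_mul_bCoef_le hh (n + 2)
    have i2 := (coef_lower hh (n + 2)).1
    have i3 : oddInd (n + 2) = oddInd n := by rw [oddInd, oddInd, pow_add]; norm_num
    have i4 := oddInd_nonneg n
    rw [i3] at i1 i2 ⊢
    have : bCoef h (n + 2) - 4 * oddInd n / (n + 2 : ℕ) =
        ((n + 2 : ℕ) * bCoef h (n + 2) - 4 * oddInd n) / (n + 2 : ℕ) := by field_simp
    rw [this, abs_div, abs_of_pos hn0, div_le_iff₀ hn0, abs_le]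
    push_cast at i1 i2 ⊢
    constructor
    · nlinarith
    · have : 0 ≤ 4 * h ^ 2 * (n + 2) * oddInd n * (n + 2) := by positivity
      linarith
  have htail : HasSum (fun n : ℕ => 12 * h ^ 2 * x ^ 2 * (n * x ^ n)) (12 * h ^ 2 * x ^ 2 * (x / (1 - x) ^ 2)) :=
    hg.mul_left _
  rw [← hasSum_nat_add_iff' 2] at h3
  have hz : ∑ i ∈ Finset.range 2, (-Complex.I * ((bCoef h i : ℂ) * (Complex.I * Complex.exp t) ^ i) -
      -Complex.I * ((4 * oddInd i / i : ℝ) * (Complex.I * Complex.exp t) ^ i)) = 0 := by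
    rw [Finset.sum_range_succ, Finset.sum_range_one]
    simp [bCoef_zero, bCoef_one, oddInd]
  rw [hz, sub_zero] at h3
  have key := h3.norm_le_of_bounded htail fun n => by
    rw [hterm]
    refine (mul_le_mul_of_nonneg_right (hbig n) (by positivity)).trans ?_
    have i5 : ((n : ℝ) + 2) * oddInd n ≤ 3 * n := by
      rcases Nat.even_or_odd n with hp | hp
      · rw [oddInd_of_even hp]; simp
      · rw [oddInd_of_odd hp]
        have : (1 : ℝ) ≤ n := by exact_mod_cast hp.pos
        linarith
    rw [pow_add]
    calc 4 * h ^ 2 * (n + 2) * oddInd n * (x ^ n * x ^ 2) =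
        (4 * h ^ 2 * x ^ 2 * x ^ n) * (((n : ℝ) + 2) * oddInd n) := by ring
      _ ≤ (4 * h ^ 2 * x ^ 2 * x ^ n) * (3 * n) := mul_le_mul_of_nonneg_left i5 (by positivity)
      _ = _ := by ring
  refine key.trans ?_
  have e2 : Real.exp (-(2 * τ)) = x ^ 2 := by rw [hx, ← Real.exp_nat_mul]; ring_nf
  have e3 : x / (1 - x) ^ 2 ≤ 1 / τ ^ 2 := by
    rw [div_le_div_iff₀ (by nlinarith) (by positivity)]
    have hy : Real.exp (-(τ / 2)) ^ 2 = x := by rw [hx, ← Real.exp_nat_mul]; ring_nf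
    have hs : τ / 2 ≤ Real.sinh (τ / 2) := Real.self_le_sinh_iff.mpr (by linarith)
    have hs2 : 2 * Real.sinh (τ / 2) * Real.exp (-(τ / 2)) = 1 - x := by
      rw [Real.sinh_eq, ← hy]
      have : Real.exp (τ / 2) * Real.exp (-(τ / 2)) = 1 := by rw [← Real.exp_add]; simp
      linear_combination this
    rw [← hs2, ← hy]
    have : τ ^ 2 ≤ (2 * Real.sinh (τ / 2)) ^ 2 := pow_le_pow_left₀ hτ.le (by linarith) 2
    have := mul_le_mul_of_nonneg_left this (sq_nonneg (Real.exp (-(τ / 2))))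
    linarith [mul_pow (2 * Real.sinh (τ / 2)) (Real.exp (-(τ / 2))) 2]
  rw [e2]
  calc 12 * h ^ 2 * x ^ 2 * (x / (1 - x) ^ 2) ≤ 12 * h ^ 2 * x ^ 2 * (1 / τ ^ 2) :=
        mul_le_mul_of_nonneg_left e3 (by positivity)
    _ = _ := by ring

lemma norm_le_mul_of_deriv {P P' : ℝ → ℂ} {h K : ℝ} (hP : ∀ s ∈ Icc 0 h, HasDerivAt P (P' s) s)
    (h0 : P 0 = 0) (hK : ∀ s ∈ Icc 0 h, ‖P' s‖ ≤ K) {s : ℝ} (hs : s ∈ Icc 0 h) : ‖P s‖ ≤ K * h := by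
  have hh : 0 ≤ h := hs.1.trans hs.2
  have := (convex_Icc (0 : ℝ) h).norm_image_sub_le_of_norm_hasDerivWithin_le
    (fun x hx => (hP x hx).hasDerivWithinAt) hK (left_mem_Icc.mpr hh) hs
  rw [h0, sub_zero, sub_zero] at this
  have hK0 : 0 ≤ K := (norm_nonneg _).trans (hK s hs)
  refine this.trans (mul_le_mul_of_nonneg_left ?_ hK0)
  rw [Real.norm_of_nonneg hs.1]; exact hs.2

lemma norm_second_diff_le {φ φ₁ φ₂ φ₃ φ₄ : ℝ → ℂ} {h M : ℝ} (hh : 0 ≤ h)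
    (h1 : ∀ s, |s| ≤ h → HasDerivAt φ (φ₁ s) s) (h2 : ∀ s, |s| ≤ h → HasDerivAt φ₁ (φ₂ s) s)
    (h3 : ∀ s, |s| ≤ h → HasDerivAt φ₂ (φ₃ s) s) (h4 : ∀ s, |s| ≤ h → HasDerivAt φ₃ (φ₄ s) s)
    (hM : ∀ s, |s| ≤ h → ‖φ₄ s‖ ≤ M) :
    ‖φ h - 2 * φ 0 + φ (-h) - h ^ 2 * φ₂ 0‖ ≤ 2 * M * h ^ 4 := by
  have hm : ∀ {s : ℝ}, s ∈ Icc 0 h → |s| ≤ h ∧ |-s| ≤ h := fun hs => by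
    rw [abs_neg, abs_of_nonneg hs.1]; exact ⟨hs.2, hs.2⟩
  have hneg : ∀ {ψ ψ' : ℝ → ℂ}, (∀ s, |s| ≤ h → HasDerivAt ψ (ψ' s) s) → ∀ s ∈ Icc 0 h,
      HasDerivAt (fun s => ψ (-s)) (-ψ' (-s)) s := by
    intro ψ ψ' hψ s hs
    have := (hψ (-s) (hm hs).2).scomp s (hasDerivAt_neg s)
    refine this.congr_deriv ?_
    simp
  have k3 : ∀ s ∈ Icc 0 h, ‖φ₃ s - φ₃ (-s)‖ ≤ 2 * M * h := fun s hs =>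
    norm_le_mul_of_deriv (P := fun s => φ₃ s - φ₃ (-s)) (P' := fun s => φ₄ s - -φ₄ (-s))
      (fun s hs => (h4 s (hm hs).1).sub (hneg h4 s hs)) (by simp) (fun s hs => by
        rw [sub_neg_eq_add]
        refine (norm_add_le _ _).trans ?_
        linarith [hM s (hm hs).1, hM (-s) (hm hs).2]) hs
  have k2 : ∀ s ∈ Icc 0 h, ‖φ₂ s + φ₂ (-s) - 2 * φ₂ 0‖ ≤ 2 * M * h * h := fun s hs =>
    norm_le_mul_of_deriv (P := fun s => φ₂ s + φ₂ (-s) - 2 * φ₂ 0) (P' := fun s => φ₃ s + -φ₃ (-s))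
      (fun s hs => ((h3 s (hm hs).1).add (hneg h3 s hs)).sub_const _) (by simp; ring)
      (fun s hs => by simpa [← sub_eq_add_neg] using k3 s hs) hs
  have k1 : ∀ s ∈ Icc 0 h, ‖φ₁ s - φ₁ (-s) - 2 * s * φ₂ 0‖ ≤ 2 * M * h * h * h := fun s hs =>
    norm_le_mul_of_deriv (P := fun s : ℝ => φ₁ s - φ₁ (-s) - 2 * s * φ₂ 0)
      (P' := fun s => φ₂ s - -φ₂ (-s) - 2 * φ₂ 0)
      (fun s hs => by
        refine (((h2 s (hm hs).1).sub (hneg h2 s hs)).sub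
          ((((hasDerivAt_id s).ofReal_comp).const_mul 2).mul_const (φ₂ 0))).congr_deriv ?_
        simp)
      (by simp) (fun s hs => by simpa using k2 s hs) hs
  have k0 := norm_le_mul_of_deriv (P := fun s : ℝ => φ s + φ (-s) - 2 * φ 0 - s ^ 2 * φ₂ 0)
      (P' := fun s => φ₁ s + -φ₁ (-s) - 2 * s * φ₂ 0) (h := h) (K := 2 * M * h * h * h)
      (fun s hs => by
        refine ((((h1 s (hm hs).1).add (hneg h1 s hs)).sub_const _).sub
          ((((hasDerivAt_id s).ofReal_comp).pow 2).mul_const (φ₂ 0))).congr_deriv ?_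
        simp)
      (by simp; ring) (fun s hs => by simpa [← sub_eq_add_neg] using k1 s hs) (right_mem_Icc.mpr hh)
  refine le_of_eq_of_le ?_ (k0.trans_eq (by ring))
  congr 1
  ring

lemma normSq_cosh (t : ℂ) : ‖Complex.cosh t‖ ^ 2 = Real.sinh t.re ^ 2 + Real.cos t.im ^ 2 := by
  have e : Complex.cosh t = (Real.cosh t.re * Real.cos t.im : ℝ) +
      (Real.sinh t.re * Real.sin t.im : ℝ) * Complex.I := by
    conv_lhs => rw [← Complex.re_add_im t]
    rw [Complex.cosh_add, Complex.cosh_mul_I, Complex.sinh_mul_I]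
    push_cast; ring
  rw [e, ← Complex.normSq_eq_norm_sq, Complex.normSq_add_mul_I]
  have h1 := Real.cosh_sq t.re
  have h2 := Real.sin_sq_add_cos_sq t.im
  have h3 : Real.sin t.im ^ 2 = 1 - Real.cos t.im ^ 2 := by linarith
  rw [mul_pow, mul_pow, h1, h3]; ring

lemma norm_sinh_le (t : ℂ) : ‖Complex.sinh t‖ ≤ Real.cosh t.re := by
  rw [Complex.sinh, Real.cosh_eq, norm_div, Complex.norm_ofNat]
  gcongr
  refine (norm_sub_le _ _).trans ?_
  rw [Complex.norm_exp, Complex.norm_exp, Complex.neg_re]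

lemma cosh_two_le : Real.cosh 2 ≤ 4 := by
  rw [Real.cosh_eq]
  have h1 := Real.exp_one_lt_d9
  have h2 : Real.exp 2 = Real.exp 1 ^ 2 := by rw [← Real.exp_nat_mul]; norm_num
  have h3 : Real.exp (-2) ≤ 1 / 5 := by
    rw [Real.exp_neg, h2]
    have := Real.exp_one_gt_d9
    rw [inv_eq_one_div]
    apply one_div_le_one_div_of_le (by norm_num); nlinarith
  rw [h2] at *
  nlinarith [Real.exp_one_gt_d9]

lemma le_norm_cosh {t : ℂ} {r : ℝ} (hr : 0 < r) (ht : r ≤ π / 2 - |t.im|) :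
    2 / π * r ≤ ‖Complex.cosh t‖ := by
  have h1 : 2 / π * r ≤ Real.cos t.im := by
    rw [← Real.cos_abs, ← Real.sin_pi_div_two_sub]
    refine le_trans ?_ (Real.mul_le_sin (by linarith) (by linarith [abs_nonneg t.im]))
    gcongr
  have h2 : 0 ≤ 2 / π * r := by positivity
  have h3 := normSq_cosh t
  refine abs_le_of_sq_le_sq' ?_ (norm_nonneg _) |>.2
  rw [h3]; nlinarith [sq_nonneg (Real.sinh t.re)]

lemma norm_cosh_le {t : ℂ} {r : ℝ} (h0 : |t.im| ≤ π / 2) (hr : π / 2 - |t.im| ≤ r) (ht : |t.re| ≤ r)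
    (hr2 : r ≤ 2) : ‖Complex.cosh t‖ ≤ 5 * r := by
  have hr0 : 0 ≤ r := (abs_nonneg _).trans ht
  have h1 : |Real.cos t.im| ≤ r := by
    rw [← Real.cos_abs, ← Real.sin_pi_div_two_sub]
    exact (Real.abs_sin_le_abs).trans (by rw [abs_of_nonneg (by linarith)]; exact hr)
  have h2 : |Real.sinh t.re| ≤ 4 * r := by
    rw [Real.abs_sinh]
    refine (sinh_le_mul_cosh (abs_nonneg _)).trans ?_
    have : Real.cosh |t.re| ≤ 4 := by
      refine le_trans (Real.cosh_le_cosh.mpr ?_) cosh_two_le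
      rw [abs_abs, abs_of_pos (by norm_num : (0 : ℝ) < 2)]; linarith
    nlinarith [abs_nonneg t.re]
  have h3 := normSq_cosh t
  rw [← sq_abs (Real.sinh _), ← sq_abs (Real.cos _)] at h3
  refine abs_le_of_sq_le_sq' ?_ (by positivity) |>.2
  rw [h3]; nlinarith [abs_nonneg (Real.sinh t.re), abs_nonneg (Real.cos t.im)]

lemma le_diffSymbol_one {h : ℝ} (hh : 0 ≤ h) : h ^ 2 ≤ diffSymbol h 1 := by
  have := Real.self_le_sinh_iff.mpr (show 0 ≤ 1 * h / 2 by positivity)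
  rw [diffSymbol]
  nlinarith

lemma diffSymbol_one_le {h : ℝ} (hh : 0 ≤ h) (h1 : h ≤ 1) : diffSymbol h 1 ≤ h ^ 2 + h ^ 4 := by
  have i1 := sinh_le_mul_cosh (show 0 ≤ 1 * h / 2 by positivity)
  have i2 := Real.cosh_sq (1 * h / 2)
  have i3 : 0 ≤ Real.sinh (1 * h / 2) := Real.sinh_nonneg_iff.2 (by positivity)
  have i4 : Real.sinh (1 * h / 2) ^ 2 ≤ (1 * h / 2) ^ 2 * (Real.sinh (1 * h / 2) ^ 2 + 1) := by
    rw [← i2, ← mul_pow]; exact pow_le_pow_left₀ i3 i1 2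
  rw [diffSymbol]
  generalize Real.sinh (1 * h / 2) ^ 2 = s at *
  have i5 : h ^ 2 ≤ 1 := by nlinarith
  by_contra hc
  push Not at hc
  nlinarith [sq_nonneg h, mul_nonneg (sq_nonneg h) (sub_nonneg.mpr i5)]

lemma pendulum_bounds {t : ℂ} {r : ℝ} (hr : 0 < r) (ht : r ≤ π / 2 - |t.im|) (hre : |t.re| ≤ 2) :
    ‖2 / Complex.cosh t‖ ≤ π / r ∧ ‖Complex.sin (pendulum t)‖ ≤ 20 / r ^ 2 ∧
      ‖Complex.cos (pendulum t)‖ ≤ 8 / r ^ 2 := by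
  have hm : t ∈ pendulumDomain := Or.inr (by linarith)
  have hc := le_norm_cosh hr ht
  have hpi := Real.pi_pos
  have hpi2 := Real.pi_lt_d2
  have h2 : 1 / ‖Complex.cosh t‖ ≤ π / (2 * r) := by
    rw [show π / (2 * r) = 1 / (2 / π * r) by field_simp]
    exact one_div_le_one_div_of_le (by positivity) hc
  have h3 : 1 / ‖Complex.cosh t‖ ^ 2 ≤ π ^ 2 / (4 * r ^ 2) := by
    have := pow_le_pow_left₀ (by positivity) h2 2
    rw [div_pow, div_pow, one_pow, show (2 * r) ^ 2 = 4 * r ^ 2 by ring] at this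
    exact this
  have hpisq : π ^ 2 ≤ 10 := by nlinarith
  have hrp : r ≤ π / 2 := by linarith [abs_nonneg t.im]
  obtain ⟨e1, e2⟩ := sin_cos_pendulum hm
  refine ⟨?_, ?_, ?_⟩
  · rw [norm_div, Complex.norm_ofNat, show (2 : ℝ) / ‖Complex.cosh t‖ = 2 * (1 / ‖Complex.cosh t‖) by ring,
      show π / r = 2 * (π / (2 * r)) by field_simp]
    linarith
  · have hs : ‖Complex.sinh t‖ ≤ 4 := by
      refine (norm_sinh_le t).trans (le_trans (Real.cosh_le_cosh.mpr ?_) cosh_two_le)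
      rwa [abs_of_pos (by norm_num : (0 : ℝ) < 2)]
    rw [e1, norm_div, norm_mul, norm_neg, Complex.norm_ofNat, norm_pow]
    calc 2 * ‖Complex.sinh t‖ / ‖Complex.cosh t‖ ^ 2 = 2 * ‖Complex.sinh t‖ * (1 / ‖Complex.cosh t‖ ^ 2) := by
          ring
      _ ≤ 2 * 4 * (π ^ 2 / (4 * r ^ 2)) := by gcongr
      _ = 2 * π ^ 2 / r ^ 2 := by field_simp
      _ ≤ _ := by gcongr; linarith
  · rw [e2]
    refine (norm_sub_le _ _).trans ?_
    rw [norm_one, norm_div, Complex.norm_ofNat, norm_pow]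
    have i1 : 1 ≤ (π / 2) ^ 2 / r ^ 2 := by
      rw [one_le_div (by positivity)]; exact pow_le_pow_left₀ hr.le hrp 2
    calc 1 + 2 / ‖Complex.cosh t‖ ^ 2 = 1 + 2 * (1 / ‖Complex.cosh t‖ ^ 2) := by ring
      _ ≤ (π / 2) ^ 2 / r ^ 2 + 2 * (π ^ 2 / (4 * r ^ 2)) := by gcongr
      _ = 3 / 4 * π ^ 2 / r ^ 2 := by field_simp; ring
      _ ≤ _ := by gcongr; linarith

lemma pendulum_consistency {t : ℂ} {r h : ℝ} (hh : 0 ≤ h) (hh1 : h ≤ 1) (hr : 0 < r)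
    (ht : r ≤ π / 2 - |t.im|) (hre : |t.re| + h ≤ 2) :
    ‖pendulum (t + h) - 2 * pendulum t + pendulum (t - h) -
      (diffSymbol h 1 : ℂ) * Complex.sin (pendulum t)‖ ≤ 800 * h ^ 4 / r ^ 4 := by
  have him : ∀ s : ℝ, (t + s).im = t.im := fun s => by simp
  have hmem : ∀ s : ℝ, t + s ∈ pendulumDomain := fun s => Or.inr (by rw [him]; linarith)
  have hre' : ∀ s : ℝ, |s| ≤ h → |(t + s).re| ≤ 2 := fun s hs => by
    rw [Complex.add_re, Complex.ofReal_re]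
    linarith [abs_add_le t.re s]
  have c1 : ∀ s : ℝ, HasDerivAt (fun z : ℂ => pendulum (t + z)) (2 / Complex.cosh (t + s)) s :=
    fun s => HasDerivAt.comp_const_add t (s : ℂ) (hasDerivAt_pendulum (hmem s))
  have c2 : ∀ s : ℝ, HasDerivAt (fun z : ℂ => 2 / Complex.cosh (t + z))
      (Complex.sin (pendulum (t + s))) s := fun s => by
    have hc := cosh_ne_zero_of_mem (hmem s)
    have i1 := HasDerivAt.comp_const_add t (s : ℂ) (Complex.hasDerivAt_cosh (t + s))
    refine ((hasDerivAt_const (s : ℂ) (2 : ℂ)).div i1 hc).congr_deriv ?_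
    rw [(sin_cos_pendulum (hmem s)).1]
    simp
  have d1 : ∀ s : ℝ, HasDerivAt (fun s : ℝ => pendulum (t + s)) (2 / Complex.cosh (t + s)) s :=
    fun s => (c1 s).comp_ofReal
  have d2 : ∀ s : ℝ, HasDerivAt (fun s : ℝ => 2 / Complex.cosh (t + s))
      (Complex.sin (pendulum (t + s))) s := fun s => (c2 s).comp_ofReal
  have d3 : ∀ s : ℝ, HasDerivAt (fun s : ℝ => Complex.sin (pendulum (t + s)))
      (Complex.cos (pendulum (t + s)) * (2 / Complex.cosh (t + s))) s := fun s =>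
    (c1 s).csin.comp_ofReal
  have d4 : ∀ s : ℝ, HasDerivAt (fun s : ℝ => Complex.cos (pendulum (t + s)) * (2 / Complex.cosh (t + s)))
      (-Complex.sin (pendulum (t + s)) * (2 / Complex.cosh (t + s)) * (2 / Complex.cosh (t + s)) +
        Complex.cos (pendulum (t + s)) * Complex.sin (pendulum (t + s))) s := fun s =>
    ((c1 s).ccos.mul (c2 s)).comp_ofReal
  have key := norm_second_diff_le (M := 360 / r ^ 4) hh (fun s _ => d1 s) (fun s _ => d2 s)
    (fun s _ => d3 s) (fun s _ => d4 s) (fun s hs => by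
      obtain ⟨b1, b2, b3⟩ := pendulum_bounds hr (by rw [him]; exact ht) (hre' s hs)
      refine (norm_add_le _ _).trans ?_
      rw [norm_mul, norm_mul, norm_mul, norm_neg]
      have hpi2 := Real.pi_lt_d2
      have hpi := Real.pi_pos
      calc _ ≤ 20 / r ^ 2 * (π / r) * (π / r) + 8 / r ^ 2 * (20 / r ^ 2) := by gcongr
        _ = (20 * π ^ 2 + 160) / r ^ 4 := by field_simp; ring
        _ ≤ _ := by gcongr; nlinarith)
  obtain ⟨b1, b2, b3⟩ := pendulum_bounds hr ht (by linarith)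
  simp only [Complex.ofReal_zero, add_zero, Complex.ofReal_neg, ← sub_eq_add_neg] at key
  have e : pendulum (t + h) - 2 * pendulum t + pendulum (t - h) -
      (diffSymbol h 1 : ℂ) * Complex.sin (pendulum t) =
      (pendulum (t + h) - 2 * pendulum t + pendulum (t - h) - h ^ 2 * Complex.sin (pendulum t)) -
      ((diffSymbol h 1 - h ^ 2 : ℝ) : ℂ) * Complex.sin (pendulum t) := by push_cast; ring
  rw [e]
  refine (norm_sub_le _ _).trans ((add_le_add_left key _).trans ?_)
  rw [norm_mul, Complex.norm_real, Real.norm_of_nonneg (by linarith [le_diffSymbol_one hh])]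
  have hrp : r ≤ π / 2 := by linarith [abs_nonneg t.im]
  have hr2 : r ^ 2 ≤ 4 := by nlinarith [Real.pi_lt_d2]
  have i1 : diffSymbol h 1 - h ^ 2 ≤ h ^ 4 := by linarith [diffSymbol_one_le hh hh1]
  calc 2 * (360 / r ^ 4) * h ^ 4 + (diffSymbol h 1 - h ^ 2) * ‖Complex.sin (pendulum t)‖
      ≤ 2 * (360 / r ^ 4) * h ^ 4 + h ^ 4 * (20 / r ^ 2) := by gcongr
    _ = (720 + 20 * r ^ 2) * h ^ 4 / r ^ 4 := by field_simp; ring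
    _ ≤ _ := by gcongr; linarith

lemma norm_sin_le_of_le_one {d : ℂ} (hd : ‖d‖ ≤ 1) : ‖Complex.sin d‖ ≤ 2 * ‖d‖ ∧
    ‖1 - Complex.cos d‖ ≤ ‖d‖ ^ 2 := by
  have hn : ‖d * Complex.I‖ = ‖d‖ := by simp
  have hn' : ‖-d * Complex.I‖ = ‖d‖ := by simp
  constructor
  · have e : Complex.sin d = ((Complex.exp (-d * Complex.I) - 1) - (Complex.exp (d * Complex.I) - 1)) *
        Complex.I / 2 := by rw [Complex.sin]; ring
    have i1 := Complex.norm_exp_sub_one_le (x := d * Complex.I) (by rwa [hn])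
    have i2 := Complex.norm_exp_sub_one_le (x := -d * Complex.I) (by rwa [hn'])
    rw [e, norm_div, norm_mul, Complex.norm_I, Complex.norm_ofNat, mul_one]
    have := norm_sub_le (Complex.exp (-d * Complex.I) - 1) (Complex.exp (d * Complex.I) - 1)
    rw [hn] at i1; rw [hn'] at i2
    linarith
  · have e : 1 - Complex.cos d = -((Complex.exp (d * Complex.I) - 1 - d * Complex.I) +
        (Complex.exp (-d * Complex.I) - 1 - -d * Complex.I)) / 2 := by rw [Complex.cos]; ring
    have i1 := Complex.norm_exp_sub_one_sub_id_le (x := d * Complex.I) (by rwa [hn])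
    have i2 := Complex.norm_exp_sub_one_sub_id_le (x := -d * Complex.I) (by rwa [hn'])
    rw [e, norm_div, norm_neg, Complex.norm_ofNat]
    have := norm_add_le (Complex.exp (d * Complex.I) - 1 - d * Complex.I)
      (Complex.exp (-d * Complex.I) - 1 - -d * Complex.I)
    rw [hn] at i1; rw [hn'] at i2
    linarith

lemma norm_sin_sub_sin_le {x d : ℂ} (hd : ‖d‖ ≤ 1) :
    ‖Complex.sin (x + d) - Complex.sin x‖ ≤ (‖Complex.sin x‖ + ‖Complex.cos x‖) * (2 * ‖d‖) := by
  obtain ⟨h1, h2⟩ := norm_sin_le_of_le_one hd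
  have e : Complex.sin (x + d) - Complex.sin x =
      Complex.cos x * Complex.sin d - Complex.sin x * (1 - Complex.cos d) := by
    rw [Complex.sin_add]; ring
  rw [e]
  refine (norm_sub_le _ _).trans ?_
  rw [norm_mul, norm_mul]
  have h3 : ‖1 - Complex.cos d‖ ≤ 2 * ‖d‖ := by nlinarith [norm_nonneg d]
  nlinarith [mul_le_mul_of_nonneg_left h1 (norm_nonneg (Complex.cos x)),
    mul_le_mul_of_nonneg_left h3 (norm_nonneg (Complex.sin x))]

lemma second_diff_gronwall {a b : ℕ → ℝ} {θ : ℝ} {N : ℕ} (hθ : 0 < θ) (hθ1 : θ ≤ 1)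
    (ha : ∀ k, 0 ≤ a k) (hb : ∀ k, 0 ≤ b k)
    (h1 : ∀ k, k < N → a (k + 1) ≤ a k + b k)
    (h2 : ∀ k, k < N → a (k + 1) ≤ 1 → b (k + 1) ≤ b k + 112 * θ ^ 2 * a (k + 1) + 800 * θ ^ 4)
    (ha0 : a 0 ≤ 12 * θ ^ 2) (hb0 : b 0 ≤ 192 * θ ^ 3) (hN : N * θ ≤ 3)
    (hK : Real.exp 339 * 2604 * θ ^ 2 ≤ 1) : a N ≤ Real.exp 339 * 2604 * θ ^ 2 := by
  have hbound : ∀ k ≤ N, Real.exp (113 * θ * k) * (204 * θ ^ 2 + 800 * θ ^ 3 * k) ≤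
      Real.exp 339 * 2604 * θ ^ 2 := by
    intro k hk
    have hk' : k * θ ≤ 3 := le_trans (by gcongr) hN
    rw [mul_assoc (Real.exp 339)]
    gcongr
    · linarith
    · nlinarith [mul_le_mul_of_nonneg_left hk' (sq_nonneg θ)]
  have key : ∀ k ≤ N, a k + b k / θ ≤ Real.exp (113 * θ * k) * (204 * θ ^ 2 + 800 * θ ^ 3 * k) := by
    intro k
    induction k with
    | zero =>
      intro _
      have : b 0 / θ ≤ 192 * θ ^ 2 := by rw [div_le_iff₀ hθ]; linarith
      simp; linarith
    | succ k ih =>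
      intro hk
      have hk' : k < N := hk
      have i1 := ih hk'.le
      have i2 := hbound k hk'.le
      have i3 := h1 k hk'
      have hbθ : b k ≤ b k / θ := le_div_self (hb k) hθ hθ1
      have i4 := h2 k hk' (by linarith)
      have hbθ0 : 0 ≤ b k / θ := div_nonneg (hb k) hθ.le
      have i5 : b (k + 1) / θ ≤ b k / θ + 112 * θ * (a k + b k) + 800 * θ ^ 3 := by
        rw [div_le_iff₀ hθ]
        have e : (b k / θ + 112 * θ * (a k + b k) + 800 * θ ^ 3) * θ =
            b k + 112 * θ ^ 2 * (a k + b k) + 800 * θ ^ 4 := by field_simp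
        rw [e]
        nlinarith [mul_le_mul_of_nonneg_left i3 (sq_nonneg θ)]
      have i6 : a (k + 1) + b (k + 1) / θ ≤ (1 + 113 * θ) * (a k + b k / θ) + 800 * θ ^ 3 := by
        have e : b k = θ * (b k / θ) := by field_simp
        have : θ * (θ * (b k / θ)) ≤ θ * (b k / θ) := by
          rw [← e]; nlinarith [hb k]
        nlinarith [mul_nonneg hθ.le (ha k)]
      have i7 : 1 + 113 * θ ≤ Real.exp (113 * θ) := by linarith [Real.add_one_le_exp (113 * θ)]
      have i8 : Real.exp (113 * θ * (k + 1 : ℕ)) = Real.exp (113 * θ) * Real.exp (113 * θ * k) := by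
        rw [← Real.exp_add]; push_cast; ring_nf
      have i9 : 1 ≤ Real.exp (113 * θ) * Real.exp (113 * θ * k) := by
        rw [← Real.exp_add]; exact Real.one_le_exp (by positivity)
      refine i6.trans ?_
      rw [i8]
      push_cast
      have j1 : (1 + 113 * θ) * (a k + b k / θ) ≤
          Real.exp (113 * θ) * (Real.exp (113 * θ * k) * (204 * θ ^ 2 + 800 * θ ^ 3 * k)) :=
        mul_le_mul i7 i1 (add_nonneg (ha k) hbθ0) (Real.exp_pos _).le
      nlinarith [mul_le_mul_of_nonneg_right i9 (show 0 ≤ 800 * θ ^ 3 by positivity)]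
  have := key N le_rfl
  have h3 : 0 ≤ b N / θ := div_nonneg (hb N) hθ.le
  linarith [hbound N le_rfl]

lemma norm_deriv_uHat_sub_le_left {h r : ℝ} (hh : 0 < h) (hr : 0 < r) {t : ℂ} (ht : t.re ≤ -r) :
    ∃ d : ℂ, HasDerivAt (fun t => uHat h t - pendulum t) d t ∧ ‖d‖ ≤ 192 * h ^ 2 / r ^ 3 := by
  have hdiff : ∀ z : ℂ, z.re < 0 → DifferentiableAt ℂ (fun t => uHat h t - pendulum t) z := fun z hz =>
    (differentiable_uHat hh).differentiableAt.sub (hasDerivAt_pendulum (Or.inl hz)).differentiableAt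
  have hre : ∀ z ∈ Metric.closedBall t (r / 4), z.re ≤ -(3 / 4 * r) := fun z hz => by
    have := (Complex.abs_re_le_norm (z - t)).trans (by simpa [dist_eq_norm] using hz)
    rw [Complex.sub_re] at this
    linarith [le_abs_self (z.re - t.re)]
  refine ⟨_, (hdiff t (by linarith)).hasDerivAt, ?_⟩
  have hb : ∀ z ∈ Metric.sphere t (r / 4), ‖uHat h z - pendulum z‖ ≤ 12 * h ^ 2 / (3 / 4 * r) ^ 2 :=
    fun z hz => by
    have h1 := hre z (Metric.sphere_subset_closedBall hz)
    refine (norm_uHat_sub_pendulum_le hh (τ := -z.re) (by linarith) (by ring)).trans ?_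
    have : Real.exp (-(2 * -z.re)) ≤ 1 := Real.exp_le_one_iff.mpr (by linarith)
    calc _ ≤ 12 * h ^ 2 * 1 / (-z.re) ^ 2 := by gcongr
      _ ≤ _ := by rw [mul_one]; gcongr; linarith
  have hd : DiffContOnCl ℂ (fun t => uHat h t - pendulum t) (Metric.ball t (r / 4)) := by
    apply DifferentiableOn.diffContOnCl
    intro z hz
    have hz' := Metric.closure_ball_subset_closedBall hz
    exact (hdiff z (by linarith [hre z hz'])).differentiableWithinAt
  refine (Complex.norm_deriv_le_of_forall_mem_sphere_norm_le (by positivity) hd hb).trans ?_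
  have e : 12 * h ^ 2 / (3 / 4 * r) ^ 2 / (r / 4) = (256 / 3) * (h ^ 2 / r ^ 3) := by field_simp; ring
  rw [e, mul_div_assoc]
  gcongr; norm_num

lemma uHat_pendulum_step {h r : ℝ} (hh : 0 < h) (hh1 : h ≤ 1) {t : ℂ} (hr : 0 < r)
    (ht : r ≤ π / 2 - |t.im|) (hre : |t.re| + h ≤ 2) (hd : ‖uHat h t - pendulum t‖ ≤ 1) :
    ‖(uHat h (t + h) - pendulum (t + h)) - (uHat h t - pendulum t)‖ ≤
      ‖(uHat h t - pendulum t) - (uHat h (t - h) - pendulum (t - h))‖ +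
        112 * (h / r) ^ 2 * ‖uHat h t - pendulum t‖ + 800 * (h / r) ^ 4 := by
  have c := pendulum_consistency hh.le hh1 hr ht hre
  have u := uHat_diff hh t
  obtain ⟨-, b2, b3⟩ := pendulum_bounds hr ht (by linarith)
  have s := norm_sin_sub_sin_le (x := pendulum t) hd
  rw [add_sub_cancel] at s
  have e : (uHat h (t + h) - pendulum (t + h)) - (uHat h t - pendulum t) =
      ((uHat h t - pendulum t) - (uHat h (t - h) - pendulum (t - h))) +
      (diffSymbol h 1 : ℂ) * (Complex.sin (uHat h t) - Complex.sin (pendulum t)) -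
      (pendulum (t + h) - 2 * pendulum t + pendulum (t - h) -
      (diffSymbol h 1 : ℂ) * Complex.sin (pendulum t)) := by
    linear_combination u
  rw [e]
  refine (norm_sub_le _ _).trans (add_le_add ((norm_add_le _ _).trans (add_le_add_right ?_ _)) ?_)
  · rw [norm_mul, Complex.norm_real, Real.norm_of_nonneg (diffSymbol_pos hh one_pos).le]
    have hε : diffSymbol h 1 ≤ 2 * h ^ 2 := by
      have : h ^ 4 ≤ h ^ 2 := pow_le_pow_of_le_one hh.le hh1 (by norm_num)
      linarith [diffSymbol_one_le hh.le hh1]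
    calc _ ≤ 2 * h ^ 2 * ((20 / r ^ 2 + 8 / r ^ 2) * (2 * ‖uHat h t - pendulum t‖)) := by
          refine mul_le_mul hε (s.trans ?_) (norm_nonneg _) (by positivity)
          gcongr
      _ = _ := by field_simp; ring
  · rw [div_pow, ← mul_div_assoc]; exact c

theorem norm_uHat_sub_pendulum_box : ∃ K : ℝ, 1 ≤ K ∧ ∀ h r : ℝ, ∀ t : ℂ, 0 < h → K * h ≤ r →
    r = π / 2 - |t.im| → t.re ≤ r → ‖uHat h t - pendulum t‖ ≤ K * h ^ 2 / r ^ 2 := by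
  set K : ℝ := Real.exp 339 * 2604 with hKdef
  have hK1 : 2604 ≤ K := by
    have := Real.one_le_exp (show (0 : ℝ) ≤ 339 by norm_num)
    rw [hKdef]; linarith
  clear_value K
  refine ⟨K, by linarith, fun h r t hh hKr hr htr => ?_⟩
  have hr0 : 0 < r := lt_of_lt_of_le (by positivity) hKr
  rcases le_or_gt t.re (-r) with hlt | hgt
  · refine (norm_uHat_sub_pendulum_le hh (τ := -t.re) (by linarith) (by ring)).trans ?_
    have : Real.exp (-(2 * -t.re)) ≤ 1 := Real.exp_le_one_iff.mpr (by linarith)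
    calc _ ≤ 12 * h ^ 2 * 1 / (-t.re) ^ 2 := by gcongr
      _ ≤ 12 * h ^ 2 / r ^ 2 := by rw [mul_one]; gcongr; linarith
      _ ≤ _ := by gcongr; linarith
  have hrp : r ≤ 8 / 5 := by linarith [abs_nonneg t.im, Real.pi_lt_d2]
  have hhr : h ≤ r / 2604 := by rw [le_div_iff₀ (by norm_num)]; nlinarith
  set N := ⌈(t.re + r) / h⌉₊ + 1 with hN
  have hN1 : (N - 1) * h < t.re + r + h := by
    have := Nat.ceil_lt_add_one (show 0 ≤ (t.re + r) / h from div_nonneg (by linarith) hh.le)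
    rw [hN]; push_cast
    calc _ = (⌈(t.re + r) / h⌉₊ : ℝ) * h := by ring
      _ < ((t.re + r) / h + 1) * h := by gcongr
      _ = _ := by field_simp
  have hN2 : t.re + r ≤ (N - 1) * h := by
    rw [← div_le_iff₀ hh]
    have := Nat.le_ceil ((t.re + r) / h)
    rw [hN]; push_cast; linarith
  clear_value N
  set d : ℂ → ℂ := fun t => uHat h t - pendulum t with hd
  set s : ℕ → ℂ := fun k => t - ((N - k) * h : ℝ) with hs
  have hss : ∀ k, s (k + 1) = s k + h := fun k => by simp only [hs]; push_cast; ring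
  have him : ∀ k, (s k).im = t.im := fun k => by simp [hs]
  have hre : ∀ k, (s k).re = t.re - (N - k) * h := fun k => by
    simp only [hs, Complex.sub_re, Complex.ofReal_re]
  have hre0 : (s 0).re + h ≤ -r := by rw [hre]; push_cast; linarith
  have hθ : 0 < h / r := by positivity
  have hθ1 : h / r ≤ 1 / 2604 := by rw [div_le_iff₀ hr0]; linarith
  have hθK : h / r * K ≤ 1 := by rw [div_mul_eq_mul_div, div_le_one hr0]; linarith
  have fin : ‖d (s N)‖ ≤ K * (h / r) ^ 2 := by
    rw [hKdef]
    refine second_diff_gronwall (a := fun k => ‖d (s k)‖) (b := fun k => ‖d (s (k + 1)) - d (s k)‖) hθ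
      (by linarith) (fun _ => norm_nonneg _) (fun _ => norm_nonneg _) (fun k _ => ?_) (fun k hk h1 => ?_)
      ?_ ?_ ?_ ?_
    · calc ‖d (s (k + 1))‖ = ‖d (s k) + (d (s (k + 1)) - d (s k))‖ := by ring_nf
        _ ≤ _ := norm_add_le _ _
    · have hk' : (k : ℝ) + 1 ≤ N := by exact_mod_cast hk
      have := uHat_pendulum_step (t := s (k + 1)) hh (by linarith) hr0 (by rw [him]; exact hr.le) (by
        rw [hre]
        have : |t.re - (N - (k + 1 : ℕ)) * h| ≤ r + 2 * h := by
          push_cast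
          rw [abs_le]; constructor <;> nlinarith [Nat.cast_nonneg (α := ℝ) k]
        linarith) h1
      rw [hss, add_sub_cancel_right, ← hss, ← hss] at this
      exact this
    · have i1 : (s 0).re ≤ -r := by linarith
      refine (norm_uHat_sub_pendulum_le hh (τ := -(s 0).re) (by linarith) (by ring)).trans ?_
      have : Real.exp (-(2 * -(s 0).re)) ≤ 1 := Real.exp_le_one_iff.mpr (by linarith)
      rw [div_pow, ← mul_div_assoc]
      calc _ ≤ 12 * h ^ 2 * 1 / (-(s 0).re) ^ 2 := by gcongr
        _ ≤ 12 * h ^ 2 / r ^ 2 := by rw [mul_one]; gcongr; linarith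
    · have hmem : ∀ z ∈ {z : ℂ | z.re ≤ -r}, ∃ d' : ℂ, HasDerivAt d d' z ∧ ‖d'‖ ≤ 192 * h ^ 2 / r ^ 3 :=
        fun z hz => norm_deriv_uHat_sub_le_left hh hr0 hz
      have hc : Convex ℝ {z : ℂ | z.re ≤ -r} := convex_halfSpace_re_le _
      have := hc.norm_image_sub_le_of_norm_hasDerivWithin_le (f := d) (f' := deriv d)
        (C := 192 * h ^ 2 / r ^ 3) (x := s 0) (y := s 1) (fun z hz => by
          obtain ⟨d', h1, -⟩ := hmem z hz
          exact h1.differentiableAt.hasDerivAt.hasDerivWithinAt) (fun z hz => by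
          obtain ⟨d', h1, h2⟩ := hmem z hz
          rwa [h1.deriv]) (by simp only [mem_ofPred_eq]; linarith) (by
          simp only [mem_ofPred_eq]; rw [show (1 : ℕ) = 0 + 1 from rfl, hss]; simpa using hre0)
      refine this.trans_eq ?_
      rw [show (1 : ℕ) = 0 + 1 from rfl, hss, add_sub_cancel_left, Complex.norm_real, Real.norm_of_nonneg hh.le]
      field_simp
    · have : (N : ℝ) * h ≤ 3 * r := by linarith
      rw [mul_div_assoc', div_le_iff₀ hr0]; exact this
    · rw [← hKdef]; nlinarith
  have hsN : s N = t := by simp [hs]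
  rw [hsN, div_pow, ← mul_div_assoc] at fin
  exact fin

lemma norm_deriv_uHat_sub_le {h ρ M : ℝ} (hh : 0 < h) (hρ : 0 < ρ) {t : ℂ}
    (hmem : ∀ z ∈ Metric.closedBall t ρ, z ∈ pendulumDomain)
    (hM : ∀ z ∈ Metric.closedBall t ρ, ‖uHat h z - pendulum z‖ ≤ M) :
    ‖deriv (uHat h) t - 2 / Complex.cosh t‖ ≤ M / ρ := by
  have hdiff : ∀ z ∈ Metric.closedBall t ρ, DifferentiableAt ℂ (fun t => uHat h t - pendulum t) z :=
    fun z hz => (differentiable_uHat hh).differentiableAt.sub (hasDerivAt_pendulum (hmem z hz)).differentiableAt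
  have hd : DiffContOnCl ℂ (fun t => uHat h t - pendulum t) (Metric.ball t ρ) := by
    apply DifferentiableOn.diffContOnCl
    intro z hz
    exact (hdiff z (Metric.closure_ball_subset_closedBall hz)).differentiableWithinAt
  have h1 := Complex.norm_deriv_le_of_forall_mem_sphere_norm_le hρ hd
    (fun z hz => hM z (Metric.sphere_subset_closedBall hz))
  have h2 := hasDerivAt_pendulum (hmem t (Metric.mem_closedBall_self hρ.le))
  have h3 : deriv (fun t => uHat h t - pendulum t) t = deriv (uHat h) t - 2 / Complex.cosh t :=
    ((differentiable_uHat hh).differentiableAt.hasDerivAt.sub h2).deriv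
  rwa [h3] at h1

lemma abs_re_im_sub_le {t z : ℂ} {ρ : ℝ} (hz : z ∈ Metric.closedBall t ρ) :
    |z.re - t.re| ≤ ρ ∧ |z.im - t.im| ≤ ρ := by
  have h : ‖z - t‖ ≤ ρ := by simpa [dist_eq_norm] using hz
  exact ⟨by simpa using (Complex.abs_re_le_norm (z - t)).trans h,
    by simpa using (Complex.abs_im_le_norm (z - t)).trans h⟩

theorem norm_deriv_uHat_box : ∃ K : ℝ, 1 ≤ K ∧ ∀ h r : ℝ, ∀ t : ℂ, 0 < h → K * h ≤ r →
    r = π / 2 - |t.im| → t.re ≤ r / 2 →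
    ‖uHat h t - pendulum t‖ ≤ K * h ^ 2 / r ^ 2 ∧
    ‖deriv (uHat h) t - 2 / Complex.cosh t‖ ≤ K * h ^ 2 / r ^ 3 := by
  obtain ⟨K, hK1, hK⟩ := norm_uHat_sub_pendulum_box
  refine ⟨8 * K, by linarith, fun h r t hh hKr hr htr => ?_⟩
  have hr0 : 0 < r := lt_of_lt_of_le (by positivity) hKr
  refine ⟨(hK h r t hh (by linarith) hr (by linarith)).trans (by gcongr; linarith), ?_⟩
  have him : ∀ z ∈ Metric.closedBall t (r / 4), 3 / 4 * r ≤ π / 2 - |z.im| := fun z hz => by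
    have h1 := (abs_re_im_sub_le hz).2
    have h2 := abs_sub_abs_le_abs_sub z.im t.im
    linarith
  have := norm_deriv_uHat_sub_le hh (ρ := r / 4) (M := K * h ^ 2 / (3 / 4 * r) ^ 2) (t := t) (by positivity)
    (fun z hz => Or.inr (by linarith [him z hz])) (fun z hz => by
      have h1 := him z hz
      have h2 := (abs_le.mp (abs_re_im_sub_le hz).1).2
      refine (hK h _ z hh (by linarith) rfl (by linarith)).trans ?_
      gcongr)
  refine this.trans ?_
  have e : K * h ^ 2 / (3 / 4 * r) ^ 2 / (r / 4) = (64 / 9) * K * (h ^ 2 / r ^ 3) := by field_simp; ring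
  rw [e, mul_div_assoc]
  gcongr; norm_num

theorem norm_deriv_uHat_left : ∃ K : ℝ, 1 ≤ K ∧ ∀ h t : ℝ, 0 < h → K * h ≤ 1 → t ≤ 1 / 2 →
    ‖deriv (uHat h) t - 2 / Complex.cosh t‖ ≤ K * h ^ 2 * Real.exp (2 * t) := by
  obtain ⟨K, hK1, hK⟩ := norm_deriv_uHat_box
  refine ⟨9 * K + 288, by linarith, fun h t hh hKh ht => ?_⟩
  have e1 := Real.exp_one_lt_d9
  have e2 : Real.exp 2 = Real.exp 1 ^ 2 := by rw [← Real.exp_nat_mul]; norm_num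
  have e3 : Real.exp 1 ^ 2 ≤ 9 := by nlinarith [Real.exp_pos 1]
  rcases le_or_gt t (-1) with h1 | h1
  · have := norm_deriv_uHat_sub_le hh (ρ := 1 / 2) (M := 12 * h ^ 2 * Real.exp (2 * t + 1) / (1 / 2) ^ 2) (t := t)
      (by norm_num) (fun z hz => by
        have h2 := (abs_le.mp (abs_re_im_sub_le hz).1).2
        rw [Complex.ofReal_re] at h2
        exact Or.inl (by linarith)) (fun z hz => by
        have h2 := (abs_le.mp (abs_re_im_sub_le hz).1).2
        rw [Complex.ofReal_re] at h2
        refine (norm_uHat_sub_pendulum_le hh (τ := -z.re) (by linarith) (by ring)).trans ?_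
        gcongr
        · linarith
        · linarith)
    refine this.trans ?_
    rw [Real.exp_add]
    have : 12 * h ^ 2 * (Real.exp (2 * t) * Real.exp 1) / (1 / 2) ^ 2 / (1 / 2) =
      (96 * Real.exp 1) * h ^ 2 * Real.exp (2 * t) := by ring
    rw [this]
    gcongr; linarith
  · have := (hK h (π / 2) t hh (by nlinarith [Real.pi_gt_three]) (by simp) (by
      rw [Complex.ofReal_re]; linarith [Real.pi_gt_three])).2
    refine this.trans ?_
    have h4 : 1 ≤ Real.exp 2 * Real.exp (2 * t) := by
      rw [← Real.exp_add]; exact Real.one_le_exp (by linarith)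
    have h5 : (1 : ℝ) ≤ (π / 2) ^ 3 := one_le_pow₀ (by linarith [Real.pi_gt_three])
    calc K * h ^ 2 / (π / 2) ^ 3 ≤ K * h ^ 2 / 1 := by gcongr
      _ = K * h ^ 2 * 1 := by ring
      _ ≤ K * h ^ 2 * (Real.exp 2 * Real.exp (2 * t)) := by gcongr
      _ ≤ K * h ^ 2 * (9 * Real.exp (2 * t)) := by gcongr; rw [e2]; exact e3
      _ ≤ _ := by nlinarith [mul_nonneg (sq_nonneg h) (Real.exp_pos (2 * t)).le]

lemma uHat_ofReal (h t : ℝ) : uHat h t = ((uHat h t).re : ℂ) := by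
  have := uHat_conj h t
  rw [Complex.conj_ofReal] at this
  exact (Complex.conj_eq_iff_re.mp this.symm).symm

lemma hasDerivAt_uHat_re {h : ℝ} (hh : 0 < h) (t : ℝ) :
    HasDerivAt (fun t : ℝ => (uHat h t).re) (deriv (uHat h) t).re t :=
  ((differentiable_uHat hh).differentiableAt (x := (t : ℂ))).hasDerivAt.real_of_complex

theorem deriv_uHat_re_bounds : ∃ K : ℝ, 1 ≤ K ∧ ∀ h t : ℝ, 0 < h → K * h ≤ 1 → t ≤ 1 / 2 →
    Real.exp t ≤ (deriv (uHat h) t).re ∧ (deriv (uHat h) t).re ≤ 5 * Real.exp t := by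
  obtain ⟨K, hK1, hK⟩ := norm_deriv_uHat_left
  refine ⟨40 * K, by linarith, fun h t hh hKh ht => ?_⟩
  have h1 := hK h t hh (by nlinarith) ht
  have h2 := (Complex.abs_re_le_norm _).trans h1
  have h3 : ((2 : ℂ) / Complex.cosh t).re = 2 / Real.cosh t := by
    rw [← Complex.ofReal_cosh, ← Complex.ofReal_ofNat, ← Complex.ofReal_div, Complex.ofReal_re]
  rw [Complex.sub_re, h3] at h2
  have h4 : 2 / Real.cosh t = 4 * Real.exp t / (Real.exp t ^ 2 + 1) := by
    rw [Real.cosh_eq, Real.exp_neg]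
    field_simp
    ring
  have hx := Real.exp_pos t
  have hx1 : Real.exp t ^ 2 ≤ 2.72 := by
    rw [← Real.exp_nat_mul]
    refine (Real.exp_le_exp.mpr (show ((2 : ℕ) : ℝ) * t ≤ 1 by push_cast; linarith)).trans ?_
    linarith [Real.exp_one_lt_d9]
  rw [show 2 * t = t + t by ring, Real.exp_add] at h2
  generalize Real.exp t = x at *
  have h5 : K * h ^ 2 * (x * x) ≤ x / 20 := by
    have : K * h ^ 2 ≤ 1 / 40 := by nlinarith
    nlinarith [mul_le_mul_of_nonneg_right this (mul_nonneg hx.le hx.le)]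
  have h6 : 4 * x / (x ^ 2 + 1) ≤ 4 * x := div_le_self (by linarith) (by nlinarith)
  have h7 : 1.07 * x ≤ 4 * x / (x ^ 2 + 1) := by rw [le_div_iff₀ (by positivity)]; nlinarith
  rw [h4] at h2
  have := abs_le.mp (h2.trans h5)
  constructor <;> linarith [this.1, this.2]

theorem exists_shift : ∃ K : ℝ, 1 ≤ K ∧ ∀ h : ℝ, 0 < h → K * h ≤ 1 →
    ∃ α : ℝ, |α| ≤ K * h ^ 2 ∧ uHat h α = π := by
  obtain ⟨K, hK1, hK⟩ := norm_deriv_uHat_box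
  obtain ⟨K', hK1', hK'⟩ := deriv_uHat_re_bounds
  refine ⟨4 * K + K', by linarith, fun h hh hKh => ?_⟩
  have h1 := (hK h (π / 2) 0 hh (by nlinarith [Real.pi_gt_three]) (by simp) (by
      simp; linarith [Real.pi_gt_three])).1
  rw [pendulum_zero] at h1
  set f : ℝ → ℝ := fun t => (uHat h t).re with hf
  have h2 : |f 0 - π| ≤ K * h ^ 2 := by
    have := (Complex.abs_re_le_norm _).trans h1
    rw [Complex.sub_re, Complex.ofReal_re] at this
    rw [hf]; simp only [Complex.ofReal_zero]
    refine this.trans (div_le_self (by positivity) ?_)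
    exact one_le_pow₀ (by linarith [Real.pi_gt_three])
  have hd := hasDerivAt_uHat_re hh
  set δ := 4 * K * h ^ 2 with hδ
  have hδ1 : δ ≤ 1 / 2 := by rw [hδ]; nlinarith
  have hexp : 1 / 4 ≤ Real.exp (-(1 / 2)) := by linarith [Real.add_one_le_exp (-(1 / 2) : ℝ)]
  have hmono : ∀ x y : ℝ, -(1 / 2) ≤ x → x ≤ y → y ≤ 1 / 2 → 1 / 4 * (y - x) ≤ f y - f x :=
    fun x y hx hxy hy => by
    refine (convex_Icc (-(1 / 2) : ℝ) (1 / 2)).mul_sub_le_image_sub_of_le_deriv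
      (fun x _ => (hd x).continuousAt.continuousWithinAt)
      (fun x _ => (hd x).differentiableAt.differentiableWithinAt) (fun z hz => ?_) x ⟨hx, by linarith⟩ y
      ⟨by linarith, hy⟩ hxy
    rw [interior_Icc] at hz
    rw [(hd z).deriv]
    refine (hexp.trans (Real.exp_le_exp.mpr hz.1.le)).trans (hK' h z hh (by nlinarith) hz.2.le).1
  have h2' := abs_le.mp h2
  have hc : ContinuousOn f (Icc (-δ) δ) := fun x _ => (hd x).continuousAt.continuousWithinAt
  have hlo := hmono (-δ) 0 (by linarith) (by linarith) (by norm_num)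
  have hhi := hmono 0 δ (by norm_num) (by linarith) (by linarith)
  obtain ⟨α, hα, he⟩ := intermediate_value_Icc (show -δ ≤ δ by linarith) hc
    (show π ∈ Icc (f (-δ)) (f δ) from ⟨by linarith, by linarith⟩)
  refine ⟨α, (abs_le.mpr hα).trans ?_, ?_⟩
  · rw [hδ]; nlinarith [sq_nonneg h]
  · rw [uHat_ofReal]; exact_mod_cast he

lemma norm_sin_cos_add_le {p d : ℂ} : ‖Complex.sin (p + d)‖ ≤
    (‖Complex.sin p‖ + ‖Complex.cos p‖) * Real.exp ‖d‖ := by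
  have hI : ‖d * Complex.I‖ = ‖d‖ := by simp
  have hI' : ‖-d * Complex.I‖ = ‖d‖ := by simp
  have h1 : ‖Complex.exp (d * Complex.I)‖ ≤ Real.exp ‖d‖ := hI ▸ Complex.norm_exp_le_exp_norm _
  have h2 : ‖Complex.exp (-d * Complex.I)‖ ≤ Real.exp ‖d‖ := hI' ▸ Complex.norm_exp_le_exp_norm _
  have hc : ‖Complex.cos d‖ ≤ Real.exp ‖d‖ := by
    rw [Complex.cos, norm_div, Complex.norm_ofNat]
    linarith [norm_add_le (Complex.exp (d * Complex.I)) (Complex.exp (-d * Complex.I))]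
  have hs : ‖Complex.sin d‖ ≤ Real.exp ‖d‖ := by
    rw [Complex.sin, norm_div, norm_mul, Complex.norm_I, Complex.norm_ofNat]
    linarith [norm_sub_le (Complex.exp (-d * Complex.I)) (Complex.exp (d * Complex.I))]
  rw [Complex.sin_add, add_mul]
  refine (norm_add_le _ _).trans ?_
  rw [norm_mul, norm_mul]
  gcongr

theorem abs_re_uHat_le : ∃ K : ℝ, 1 ≤ K ∧ ∀ h : ℝ, ∀ t : ℂ, 0 < h → h ≤ 1 → |t.re| ≤ h / 2 →
    |(uHat h t).re| ≤ K := by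
  refine ⟨3 * (2 * π + 48) + 82 * Real.exp 48, ?_, fun h t hh hh1 ht => ?_⟩
  · linarith [Real.pi_pos, Real.exp_pos 48]
  obtain ⟨ht1, ht2⟩ := abs_le.mp ht
  have hd : ∀ z : ℂ, z.re ≤ -(h / 2) → ‖uHat h z - pendulum z‖ ≤ 48 := fun z hz => by
    refine (norm_uHat_sub_pendulum_le hh (τ := -z.re) (by linarith) (by ring)).trans ?_
    have : Real.exp (-(2 * -z.re)) ≤ 1 := Real.exp_le_one_iff.mpr (by linarith)
    calc _ ≤ 12 * h ^ 2 * 1 / (h / 2) ^ 2 := by gcongr; linarith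
      _ = 48 := by field_simp; norm_num
  have hre : ∀ z : ℂ, z.re ≤ -(h / 2) → |(uHat h z).re| ≤ 2 * π + 48 := fun z hz => by
    have h1 := (Complex.abs_re_le_norm _).trans (hd z hz)
    have h2 := abs_re_pendulum_le (t := z) (by linarith)
    rw [Complex.sub_re] at h1
    rw [abs_le] at *
    constructor <;> linarith [h1.1, h1.2, h2.1, h2.2]
  have u := uHat_diff hh (t - h)
  rw [sub_add_cancel] at u
  have r1 : (t - h).re ≤ -(h / 2) := by simp; linarith
  have r2 : (t - h - h).re ≤ -(h / 2) := by simp; linarith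
  have hmem : t - h ∈ pendulumDomain := Or.inl (by linarith)
  have hcosh : h ^ 2 / 4 ≤ ‖Complex.cosh (t - h)‖ ^ 2 := by
    rw [normSq_cosh]
    have i1 : h / 2 ≤ Real.sinh (-(t - h).re) := by
      have := Real.self_le_sinh_iff.mpr (show 0 ≤ -(t - h).re by linarith)
      linarith
    rw [Real.sinh_neg] at i1
    nlinarith [sq_nonneg (Real.cos (t - h).im)]
  have hsinh : ‖Complex.sinh (t - h)‖ ≤ 4 := by
    refine (norm_sinh_le _).trans (le_trans (Real.cosh_le_cosh.mpr ?_) cosh_two_le)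
    rw [abs_of_pos (by norm_num : (0 : ℝ) < 2), abs_le]
    simp; constructor <;> linarith
  obtain ⟨e1, e2⟩ := sin_cos_pendulum hmem
  have hinv : 1 / ‖Complex.cosh (t - h)‖ ^ 2 ≤ 4 / h ^ 2 := by
    rw [show 4 / h ^ 2 = 1 / (h ^ 2 / 4) by field_simp]
    exact one_div_le_one_div_of_le (by positivity) hcosh
  have s1 : ‖Complex.sin (pendulum (t - h))‖ ≤ 32 / h ^ 2 := by
    rw [e1, norm_div, norm_mul, norm_neg, Complex.norm_ofNat, norm_pow]
    calc _ = 2 * ‖Complex.sinh (t - h)‖ * (1 / ‖Complex.cosh (t - h)‖ ^ 2) := by ring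
      _ ≤ 2 * 4 * (4 / h ^ 2) := by gcongr
      _ = _ := by ring
  have s2 : ‖Complex.cos (pendulum (t - h))‖ ≤ 1 + 8 / h ^ 2 := by
    rw [e2]
    refine (norm_sub_le _ _).trans ?_
    rw [norm_one, norm_div, Complex.norm_ofNat, norm_pow]
    calc _ = 1 + 2 * (1 / ‖Complex.cosh (t - h)‖ ^ 2) := by ring
      _ ≤ 1 + 2 * (4 / h ^ 2) := by gcongr
      _ = _ := by ring
  have s3 := norm_sin_cos_add_le (p := pendulum (t - h)) (d := uHat h (t - h) - pendulum (t - h))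
  rw [add_sub_cancel] at s3
  have hε : diffSymbol h 1 ≤ h ^ 2 + h ^ 4 := diffSymbol_one_le hh.le hh1
  have s4 : |((diffSymbol h 1 : ℂ) * Complex.sin (uHat h (t - h))).re| ≤ 72 * Real.exp 48 +
      10 * Real.exp 48 := by
    refine (Complex.abs_re_le_norm _).trans ?_
    rw [norm_mul, Complex.norm_real, Real.norm_of_nonneg (diffSymbol_pos hh one_pos).le]
    have h4 : h ^ 4 ≤ h ^ 2 := pow_le_pow_of_le_one hh.le hh1 (by norm_num)
    have h2 : h ^ 2 ≤ 1 := pow_le_one₀ hh.le hh1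
    calc _ ≤ (2 * h ^ 2) * ((32 / h ^ 2 + (1 + 8 / h ^ 2)) * Real.exp 48) := by
          refine mul_le_mul (by linarith) (s3.trans ?_) (norm_nonneg _) (by positivity)
          gcongr
          exact hd _ r1
      _ = (80 + 2 * h ^ 2) * Real.exp 48 := by field_simp; ring
      _ ≤ _ := by nlinarith [Real.exp_pos 48]
  have e := congrArg Complex.re u
  simp only [Complex.add_re, Complex.sub_re] at e
  rw [show (2 * uHat h (t - h)).re = 2 * (uHat h (t - h)).re by simp] at e
  have k1 := abs_le.mp (hre _ r1)
  have k2 := abs_le.mp (hre _ r2)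
  have k3 := abs_le.mp s4
  rw [abs_le]
  constructor <;> linarith [k1.1, k1.2, k2.1, k2.2, k3.1, k3.2]

/-- The separatrix parametrization shifted by `α`, so that it takes the value `π` at `0`, together
with its basic estimates. -/
structure SepData (K h α : ℝ) : Prop where
  h_pos : 0 < h
  h_small : K * h ≤ 1
  zero : uHat h α = π
  box : ∀ (t : ℂ) (r : ℝ), K * h ≤ r → r = π / 2 - |t.im| → |t.re| ≤ 3 * h →
    ‖uHat h (t + α) - pendulum t‖ ≤ K * h ^ 2 / r ^ 2
  deriv_le : ∀ (t : ℂ) (r : ℝ), K * h ≤ r → r = π / 2 - |t.im| → |t.re| ≤ 3 * h →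
    ‖deriv (uHat h) (t + α)‖ ≤ K / r
  le_deriv : ∀ (t : ℂ) (r : ℝ), K * h ≤ r → r = π / 2 - |t.im| → |t.re| ≤ 3 * h →
    1 ≤ K * r * ‖deriv (uHat h) (t + α)‖
  inner : ∀ t : ℂ, t.re = 0 → |(uHat h (t + α)).re| ≤ K
  deriv_real : ∀ t : ℝ, t ≤ 1 / 4 → Real.exp t / 2 ≤ (deriv (uHat h) ((t + α : ℝ) : ℂ)).re ∧
    (deriv (uHat h) ((t + α : ℝ) : ℂ)).re ≤ 10 * Real.exp t

lemma norm_pendulum_add_sub_le {t : ℂ} {r α : ℝ} (hr : 0 < r) (ht : r ≤ π / 2 - |t.im|) :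
    ‖pendulum (t + α) - pendulum t‖ ≤ π / r * |α| := by
  have hc : Convex ℝ ({z : ℂ | z.im ≤ t.im} ∩ {z : ℂ | t.im ≤ z.im}) :=
    (convex_halfSpace_im_le _).inter (convex_halfSpace_im_ge _)
  have him : ∀ z ∈ ({z : ℂ | z.im ≤ t.im} ∩ {z : ℂ | t.im ≤ z.im}), z.im = t.im := fun z hz =>
    le_antisymm hz.1 hz.2
  have := hc.norm_image_sub_le_of_norm_hasDerivWithin_le (f := pendulum)
    (f' := fun z => 2 / Complex.cosh z) (C := π / r) (x := t) (y := t + α) (fun z hz =>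
      (hasDerivAt_pendulum (Or.inr (by rw [him z hz]; linarith))).hasDerivWithinAt) (fun z hz => by
      have hcosh := le_norm_cosh hr (t := z) (by rw [him z hz]; exact ht)
      rw [norm_div, Complex.norm_ofNat, div_le_div_iff₀ (lt_of_lt_of_le (by positivity) hcosh) hr]
      calc 2 * r = π * (2 / π * r) := by field_simp
        _ ≤ _ := by gcongr) ⟨le_refl t.im, le_refl t.im⟩ (by constructor <;> simp)
  rwa [add_sub_cancel_left, Complex.norm_real, Real.norm_eq_abs] at this

theorem exists_sepData : ∃ K : ℝ, 1 ≤ K ∧ ∀ h : ℝ, 0 < h → K * h ≤ 1 → ∃ α : ℝ, SepData K h α := by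
  obtain ⟨K₁, hK₁, hbox⟩ := norm_deriv_uHat_box
  obtain ⟨K₂, hK₂, hreal⟩ := deriv_uHat_re_bounds
  obtain ⟨K₃, hK₃, hshift⟩ := exists_shift
  obtain ⟨K₄, hK₄, hinner⟩ := abs_re_uHat_le
  refine ⟨100 * K₁ + K₂ + 10 * K₃ + K₄, by linarith, fun h hh hKh => ?_⟩
  set K := 100 * K₁ + K₂ + 10 * K₃ + K₄ with hK
  have k2 : K₂ ≤ K := by linarith
  have k4 : K₄ ≤ K := by linarith
  have k5 : K₁ + 8 * K₃ ≤ K := by linarith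
  clear_value K
  have g2 : K₂ * h ≤ K * h := by gcongr
  have g4 : 100 * h ≤ K * h := by nlinarith
  obtain ⟨α, hα, hα0⟩ := hshift h hh (by nlinarith)
  have hαh : |α| ≤ h / 10 := hα.trans (by nlinarith)
  obtain ⟨α1, α2⟩ := abs_le.mp hαh
  have hre : ∀ (t : ℂ), |t.re| ≤ 3 * h → |(t + α).re| ≤ 4 * h := fun t ht => by
    rw [Complex.add_re, Complex.ofReal_re]
    linarith [abs_add_le t.re α]
  have him : ∀ (t : ℂ), (t + α).im = t.im := fun t => by simp
  have hb : ∀ (t : ℂ) (r : ℝ), K * h ≤ r → r = π / 2 - |t.im| → |t.re| ≤ 3 * h →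
      ‖uHat h (t + α) - pendulum (t + α)‖ ≤ K₁ * h ^ 2 / r ^ 2 ∧
      ‖deriv (uHat h) (t + α) - 2 / Complex.cosh (t + α)‖ ≤ 1 / (10 * r) := fun t r h1 h2 h3 => by
    have hr0 : 0 < r := by linarith
    obtain ⟨b1, b2⟩ := hbox h r (t + α) hh (by nlinarith) (by rw [him]; exact h2)
      (by linarith [(abs_le.mp (hre t h3)).2])
    refine ⟨b1, b2.trans ?_⟩
    rw [div_le_div_iff₀ (by positivity) (by positivity)]
    have : 100 * K₁ * h ^ 2 ≤ r ^ 2 := by nlinarith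
    nlinarith [mul_le_mul_of_nonneg_right this hr0.le]
  have hpi2 := Real.pi_lt_d2
  refine ⟨α, hh, hKh, hα0, fun t r h1 h2 h3 => ?_,
    fun t r h1 h2 h3 => ?_, fun t r h1 h2 h3 => ?_, fun t ht => ?_, fun t ht => ?_⟩
  · have hr0 : 0 < r := by linarith
    have i1 := (hb t r h1 h2 h3).1
    have i2 := norm_pendulum_add_sub_le (α := α) hr0 h2.le
    have i3 : π / r * |α| ≤ 8 * K₃ * h ^ 2 / r ^ 2 := by
      have hrp : r ≤ 2 := by linarith [abs_nonneg t.im]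
      calc π / r * |α| ≤ 4 / r * (K₃ * h ^ 2) := by gcongr; linarith
        _ = (r * 4) * K₃ * h ^ 2 / r ^ 2 := by field_simp
        _ ≤ _ := by gcongr; linarith
    calc _ = ‖(uHat h (t + α) - pendulum (t + α)) + (pendulum (t + α) - pendulum t)‖ := by ring_nf
      _ ≤ K₁ * h ^ 2 / r ^ 2 + 8 * K₃ * h ^ 2 / r ^ 2 := (norm_add_le _ _).trans (by linarith)
      _ = (K₁ + 8 * K₃) * h ^ 2 / r ^ 2 := by ring
      _ ≤ _ := by gcongr
  · have hr0 : 0 < r := by linarith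
    have i1 := (hb t r h1 h2 h3).2
    have i2 := (pendulum_bounds hr0 (t := t + α) (by rw [him, h2]) (by
      linarith [hre t h3])).1
    calc _ = ‖(deriv (uHat h) (t + α) - 2 / Complex.cosh (t + α)) + 2 / Complex.cosh (t + α)‖ := by ring_nf
      _ ≤ 1 / (10 * r) + π / r := (norm_add_le _ _).trans (by linarith)
      _ = (1 / 10 + π) / r := by field_simp
      _ ≤ _ := by gcongr; linarith
  · have hr0 : 0 < r := by linarith
    have i1 := (hb t r h1 h2 h3).2
    have hrp : r ≤ 2 := by linarith [abs_nonneg t.im]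
    have hr' : π / 2 - |t.im| ≤ r := h2.ge
    have i2 := norm_cosh_le (t := t + α) (r := r) (by rw [him]; linarith) (by rw [him]; exact hr')
      (by linarith [hre t h3]) hrp
    have hc : Complex.cosh (t + α) ≠ 0 := cosh_ne_zero_of_mem (Or.inr (by rw [him]; linarith))
    have i3 : 2 / (5 * r) ≤ ‖2 / Complex.cosh (t + α)‖ := by
      rw [norm_div, Complex.norm_ofNat]
      exact div_le_div_of_nonneg_left (by norm_num) (norm_pos_iff.mpr hc) i2
    have i4 : 3 / (10 * r) ≤ ‖deriv (uHat h) (t + α)‖ := by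
      have := norm_sub_norm_le (2 / Complex.cosh (t + α)) (2 / Complex.cosh (t + α) - deriv (uHat h) (t + α))
      rw [sub_sub_cancel, norm_sub_rev] at this
      have e : (3 : ℝ) / (10 * r) = 2 / (5 * r) - 1 / (10 * r) := by field_simp; norm_num
      linarith
    calc 1 ≤ 100 * (3 / 10) := by norm_num
      _ ≤ K * (3 / 10) := by gcongr; linarith
      _ = K * r * (3 / (10 * r)) := by field_simp
      _ ≤ _ := mul_le_mul_of_nonneg_left i4 (by nlinarith)
  · refine (hinner h _ hh (by linarith) ?_).trans k4
    rw [Complex.add_re, ht, zero_add, Complex.ofReal_re]; linarith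
  · obtain ⟨b1, b2⟩ := hreal h (t + α) hh (by linarith) (by linarith)
    have hα' : |α| ≤ 1 / 4 := by linarith
    have e1 : Real.exp t / 2 ≤ Real.exp (t + α) := by
      rw [Real.exp_add]
      nlinarith [Real.add_one_le_exp α, Real.exp_pos t, (abs_le.mp hα').1]
    have e2 : Real.exp (t + α) ≤ 2 * Real.exp t := by
      rw [Real.exp_add]
      have : Real.exp α ≤ 2 := by
        have h1 := Real.add_one_le_exp (-α)
        rw [Real.exp_neg] at h1
        have h2 : 1 / 2 ≤ (Real.exp α)⁻¹ := by linarith [(abs_le.mp hα').2]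
        rw [one_div] at h2
        exact (inv_le_inv₀ (by norm_num) (Real.exp_pos _)).mp h2
      nlinarith [Real.exp_pos t]
    constructor
    · exact e1.trans b1
    · linarith

lemma norm_sin_sub_sub_le {x d : ℂ} (hd : ‖d‖ ≤ 1) :
    ‖Complex.sin (x + d) - Complex.sin x - Complex.cos x * d‖ ≤
      (‖Complex.sin x‖ + ‖Complex.cos x‖) * ‖d‖ ^ 2 := by
  have hn : ‖d * Complex.I‖ = ‖d‖ := by simp
  have hn' : ‖-d * Complex.I‖ = ‖d‖ := by simp
  have h1 : ‖Complex.sin d - d‖ ≤ ‖d‖ ^ 2 := by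
    have e : Complex.sin d - d = ((Complex.exp (-d * Complex.I) - 1 - -d * Complex.I) -
        (Complex.exp (d * Complex.I) - 1 - d * Complex.I)) * Complex.I / 2 := by
      rw [Complex.sin]; linear_combination -d * Complex.I_sq
    have i1 := Complex.norm_exp_sub_one_sub_id_le (x := d * Complex.I) (by rwa [hn])
    have i2 := Complex.norm_exp_sub_one_sub_id_le (x := -d * Complex.I) (by rwa [hn'])
    rw [e, norm_div, norm_mul, Complex.norm_I, Complex.norm_ofNat]
    have := norm_sub_le (Complex.exp (-d * Complex.I) - 1 - -d * Complex.I)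
      (Complex.exp (d * Complex.I) - 1 - d * Complex.I)
    rw [hn] at i1; rw [hn'] at i2
    linarith
  have h2 := (norm_sin_le_of_le_one hd).2
  have e : Complex.sin (x + d) - Complex.sin x - Complex.cos x * d =
      Complex.cos x * (Complex.sin d - d) - Complex.sin x * (1 - Complex.cos d) := by
    rw [Complex.sin_add]; ring
  rw [e]
  refine (norm_sub_le _ _).trans ?_
  rw [norm_mul, norm_mul]
  nlinarith [mul_le_mul_of_nonneg_left h1 (norm_nonneg (Complex.cos x)),
    mul_le_mul_of_nonneg_left h2 (norm_nonneg (Complex.sin x))]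

/-- The defect of the time-reversal symmetry of the separatrix, in scaled time. -/
def sepD (h α : ℝ) (s : ℂ) : ℂ := 2 * π - uHat h (h * s + α) - uHat h (-(h * s) + α)

/-- A solution of the variational equation along the reversed separatrix, in scaled time. -/
def sepG (h α : ℝ) (s : ℂ) : ℂ := h * deriv (uHat h) (-(h * s) + α)

/-- The quadratic remainder in the difference equation satisfied by `sepD`. -/
def sepR (h α : ℝ) (s : ℂ) : ℂ := diffSymbol h 1 * (Complex.sin (uHat h (-(h * s) + α) + sepD h α s) -
  Complex.sin (uHat h (-(h * s) + α)) - Complex.cos (uHat h (-(h * s) + α)) * sepD h α s)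

lemma sepD_neg (h α : ℝ) (s : ℂ) : sepD h α (-s) = sepD h α s := by
  rw [sepD, sepD, mul_neg, neg_neg]; ring

lemma deriv_uHat_diff {h : ℝ} (hh : 0 < h) (t : ℂ) :
    deriv (uHat h) (t + h) - 2 * deriv (uHat h) t + deriv (uHat h) (t - h) =
      (diffSymbol h 1 : ℂ) * Complex.cos (uHat h t) * deriv (uHat h) t := by
  have hd : ∀ z, HasDerivAt (uHat h) (deriv (uHat h) z) z := fun z =>
    (differentiable_uHat hh).differentiableAt.hasDerivAt
  have h1 : HasDerivAt (fun t => uHat h (t + h) - 2 * uHat h t + uHat h (t - h))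
      (deriv (uHat h) (t + h) - 2 * deriv (uHat h) t + deriv (uHat h) (t - h)) t :=
    (((hd _).comp_add_const t (h : ℂ)).sub ((hd t).const_mul 2)).add ((hd _).comp_sub_const t (h : ℂ))
  have h2 : HasDerivAt (fun t => (diffSymbol h 1 : ℂ) * Complex.sin (uHat h t))
      ((diffSymbol h 1 : ℂ) * (Complex.cos (uHat h t) * deriv (uHat h) t)) t := ((hd t).csin).const_mul _
  rw [funext (uHat_diff hh)] at h1
  rw [h1.unique h2]; ring

lemma deriv_uHat_conj {h : ℝ} (t : ℂ) :
    deriv (uHat h) (starRingEnd ℂ t) = starRingEnd ℂ (deriv (uHat h) t) := by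
  have : (starRingEnd ℂ ∘ uHat h ∘ starRingEnd ℂ) = uHat h := by
    funext z; simp [uHat_conj]
  conv_lhs => rw [← this]
  rw [deriv_conj_conj]; simp

lemma sepD_diff {h : ℝ} (α : ℝ) (hh : 0 < h) (s : ℂ) :
    sepD h α (s + 1) - 2 * sepD h α s + sepD h α (s - 1) =
      diffSymbol h 1 * Complex.cos (uHat h (-(h * s) + α)) * sepD h α s + sepR h α s := by
  have h1 := uHat_diff hh (h * s + α)
  have h2 := uHat_diff hh (-(h * s) + α)
  have e : uHat h (h * s + α) = 2 * π - (uHat h (-(h * s) + α) + sepD h α s) := by rw [sepD]; ring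
  have e2 : Complex.sin (uHat h (h * s + α)) = -Complex.sin (uHat h (-(h * s) + α) + sepD h α s) := by
    rw [e, Complex.sin_sub, Complex.sin_two_pi, Complex.cos_two_pi]; ring
  rw [e2] at h1
  rw [sepR, sepD, sepD, sepD, show (h : ℂ) * (s + 1) + α = h * s + α + h by ring,
    show -((h : ℂ) * (s + 1)) + α = -(h * s) + α - h by ring,
    show (h : ℂ) * (s - 1) + α = h * s + α - h by ring,
    show -((h : ℂ) * (s - 1)) + α = -(h * s) + α + h by ring]
  rw [sepD] at h1
  linear_combination -h1 - h2

lemma sepG_diff {h : ℝ} (α : ℝ) (hh : 0 < h) (s : ℂ) :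
    sepG h α (s + 1) - 2 * sepG h α s + sepG h α (s - 1) =
      diffSymbol h 1 * Complex.cos (uHat h (-(h * s) + α)) * sepG h α s := by
  have h2 := deriv_uHat_diff hh (-(h * s) + α)
  rw [sepG, sepG, sepG, show -((h : ℂ) * (s + 1)) + α = -(h * s) + α - h by ring,
    show -((h : ℂ) * (s - 1)) + α = -(h * s) + α + h by ring]
  linear_combination h * h2

theorem exists_splitPair (K : ℝ) (hK : 1 ≤ K) : ∃ c : ℝ, 1 ≤ c ∧ ∀ h α C₀ : ℝ, SepData K h α → c ≤ C₀ →
    SplitPair c C₀ (π / (2 * h)) (sepD h α) (sepG h α) (sepR h α) := by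
  refine ⟨2 * K + 480, by linarith, fun h α C₀ S hC => ?_⟩
  have hh := S.h_pos
  have hhK := S.h_small
  have hu := differentiable_uHat hh
  have hreg : ∀ s : ℂ, |s.re| ≤ 3 / 2 → C₀ ≤ π / (2 * h) - |s.im| → ∀ t : ℂ, t = h * s ∨ t = -(h * s) →
      K * h ≤ h * (π / (2 * h) - |s.im|) ∧ h * (π / (2 * h) - |s.im|) = π / 2 - |t.im| ∧ |t.re| ≤ 3 * h := by
    intro s h1 h2 t ht
    have him : |t.im| = h * |s.im| := by
      rcases ht with rfl | rfl
      · simp [abs_mul, abs_of_pos hh]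
      · simp [abs_mul, abs_of_pos hh]
    have hre : |t.re| = h * |s.re| := by
      rcases ht with rfl | rfl
      · simp [abs_mul, abs_of_pos hh]
      · simp [abs_mul, abs_of_pos hh]
    refine ⟨?_, ?_, ?_⟩
    · rw [mul_comm K]; gcongr; linarith
    · rw [him]; field_simp
    · rw [hre]; nlinarith
  have hDb : ∀ s : ℂ, |s.re| ≤ 3 / 2 → C₀ ≤ π / (2 * h) - |s.im| →
      ‖sepD h α s‖ * (π / (2 * h) - |s.im|) ^ 2 ≤ 2 * K := by
    intro s h1 h2
    obtain ⟨a1, a2, a3⟩ := hreg s h1 h2 _ (Or.inl rfl)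
    obtain ⟨b1, b2, b3⟩ := hreg s h1 h2 _ (Or.inr rfl)
    have hρ : 0 < π / (2 * h) - |s.im| := by linarith
    generalize π / (2 * h) - |s.im| = ρ at *
    have i1 := S.box _ _ a1 a2 a3
    have i2 := S.box _ _ b1 b2 b3
    have i3 := pendulum_add_neg (t := h * s) (by linarith [mul_pos hh hρ])
    have e : sepD h α s = -(uHat h (h * s + α) - pendulum (h * s)) -
        (uHat h (-(h * s) + α) - pendulum (-(h * s))) := by rw [sepD]; linear_combination -i3
    have e2 : K * h ^ 2 / (h * ρ) ^ 2 = K / ρ ^ 2 := by field_simp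
    rw [e2] at i1 i2
    rw [← le_div_iff₀ (by positivity), e]
    refine (norm_sub_le _ _).trans ?_
    rw [norm_neg]
    calc _ ≤ K / ρ ^ 2 + K / ρ ^ 2 := add_le_add i1 i2
      _ = _ := by ring
  refine ⟨?_, ?_, ?_, ?_, ?_, ?_, ?_, ?_, ?_, ?_, ?_, ?_⟩
  · unfold sepD; fun_prop
  · unfold sepG; fun_prop
  · intro s
    rw [wronskian, wronskian, sub_add_cancel]
    linear_combination sepG h α s * sepD_diff α hh s - sepD h α s * sepG_diff α hh s
  · intro s h1 h2
    obtain ⟨b1, b2, b3⟩ := hreg s h1 h2 _ (Or.inr rfl)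
    have hρ : 0 < π / (2 * h) - |s.im| := by linarith
    generalize π / (2 * h) - |s.im| = ρ at *
    have := S.le_deriv _ _ b1 b2 b3
    rw [sepG, norm_mul, Complex.norm_real, Real.norm_of_nonneg hh.le]
    calc 1 ≤ K * ρ * (h * ‖deriv (uHat h) (-(h * s) + α)‖) := by linarith
      _ ≤ _ := by gcongr; linarith
  · intro s h1 h2
    obtain ⟨b1, b2, b3⟩ := hreg s h1 h2 _ (Or.inr rfl)
    have hρ : 0 < π / (2 * h) - |s.im| := by linarith
    generalize π / (2 * h) - |s.im| = ρ at *
    have := S.deriv_le _ _ b1 b2 b3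
    rw [sepG, norm_mul, Complex.norm_real, Real.norm_of_nonneg hh.le]
    rw [le_div_iff₀ (by positivity)] at this
    linarith
  · intro s h1 h2
    linarith [hDb s h1 h2]
  · intro s h1 h2
    have hD := hDb s h1 h2
    obtain ⟨b1, b2, b3⟩ := hreg s h1 h2 _ (Or.inr rfl)
    generalize π / (2 * h) - |s.im| = ρ at *
    have hρ0 : 0 < ρ := by linarith
    have hD1 : ‖sepD h α s‖ ≤ 1 := by
      by_contra hc
      push Not at hc
      nlinarith [sq_nonneg ρ]
    have i2 := S.box _ _ b1 b2 b3
    have e2 : K * h ^ 2 / (h * ρ) ^ 2 = K / ρ ^ 2 := by field_simp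
    rw [e2] at i2
    have i3 : ‖uHat h (-(h * s) + α) - pendulum (-(h * s))‖ ≤ 1 := by
      refine i2.trans ?_
      rw [div_le_one (by positivity)]; nlinarith
    have hr0 : 0 < h * ρ := by positivity
    have hrp : h * ρ ≤ π / 2 := by rw [b2]; linarith [abs_nonneg (-((h : ℂ) * s)).im]
    obtain ⟨-, p2, p3⟩ := pendulum_bounds hr0 b2.le (b3.trans (by nlinarith [Real.pi_lt_d2]))
    have hu0 : ∀ p d : ℂ, ‖Complex.sin p‖ ≤ 20 / (h * ρ) ^ 2 → ‖Complex.cos p‖ ≤ 20 / (h * ρ) ^ 2 → ‖d‖ ≤ 1 →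
        ‖Complex.sin (p + d)‖ ≤ 120 / (h * ρ) ^ 2 := fun p d hp1 hp2 hd => by
      refine norm_sin_cos_add_le.trans ?_
      have : Real.exp ‖d‖ ≤ 3 := (Real.exp_le_exp.mpr hd).trans (by linarith [Real.exp_one_lt_d9])
      calc _ ≤ (20 / (h * ρ) ^ 2 + 20 / (h * ρ) ^ 2) * 3 := by gcongr
        _ = _ := by ring
    have p3' : ‖Complex.cos (pendulum (-(h * s)))‖ ≤ 20 / (h * ρ) ^ 2 := p3.trans (by gcongr; norm_num)
    have j1 := hu0 _ _ p2 p3' i3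
    have j2 := hu0 (pendulum (-(h * s)) + π / 2) _ (by rwa [Complex.sin_add_pi_div_two])
      (by rwa [Complex.cos_add_pi_div_two, norm_neg]) i3
    rw [add_sub_cancel] at j1
    rw [add_right_comm, add_sub_cancel, Complex.sin_add_pi_div_two] at j2
    have k := norm_sin_sub_sub_le (x := uHat h (-(h * s) + α)) hD1
    have hε : diffSymbol h 1 ≤ 2 * h ^ 2 := by
      have hh1 : h ≤ 1 := by nlinarith
      have : h ^ 4 ≤ h ^ 2 := pow_le_pow_of_le_one hh.le hh1 (by norm_num)
      linarith [diffSymbol_one_le hh.le hh1]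
    rw [sepR, norm_mul, Complex.norm_real, Real.norm_of_nonneg (diffSymbol_pos hh one_pos).le]
    calc _ ≤ 2 * h ^ 2 * ((120 / (h * ρ) ^ 2 + 120 / (h * ρ) ^ 2) * ‖sepD h α s‖ ^ 2) * ρ ^ 2 := by
          gcongr
          exact k.trans (by gcongr)
      _ = 480 * ‖sepD h α s‖ ^ 2 := by field_simp; ring
      _ ≤ _ := by gcongr; linarith
  · rw [sepD]; simp [S.zero]; ring
  · have := uHat_diff hh α
    rw [S.zero, Complex.sin_pi, mul_zero] at this
    rw [sepD, mul_one, add_comm (h : ℂ), show -(h : ℂ) + α = α - h by ring]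
    linear_combination -this
  · have := uHat_diff hh α
    rw [S.zero, Complex.sin_pi, mul_zero] at this
    rw [sepD_neg, sepD, mul_one, add_comm (h : ℂ), show -(h : ℂ) + α = α - h by ring]
    linear_combination -this
  · intro s
    have : starRingEnd ℂ 2 = 2 := Complex.conj_ofNat 2
    rw [sepD, sepD, map_sub, map_sub, ← uHat_conj, ← uHat_conj]
    simp [this]
  · intro s
    rw [sepG, sepG, map_mul, ← deriv_uHat_conj]
    simp

/-- The symmetry defect along the imaginary axis, as a function of the scaled distance to `π / 2`. -/
def topD (h α ρ : ℝ) : ℝ := (sepD h α (((π / (2 * h) - ρ : ℝ) : ℂ) * Complex.I)).re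

lemma continuous_uHat {h : ℝ} (hh : 0 < h) : Continuous (uHat h) := (differentiable_uHat hh).continuous

lemma continuous_topD {h : ℝ} (hh : 0 < h) (α : ℝ) : Continuous (topD h α) := by
  have hU := continuous_uHat hh
  unfold topD sepD
  generalize uHat h = U at *
  fun_prop

lemma sepD_mul_I_re (h α y : ℝ) :
    (sepD h α (y * Complex.I)).re = 2 * π - 2 * (uHat h (h * y * Complex.I + α)).re := by
  have e : -((h : ℂ) * (y * Complex.I)) + α = starRingEnd ℂ (h * y * Complex.I + α) := by
    simp; ring
  rw [sepD, e, uHat_conj, ← mul_assoc]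
  simp
  ring

lemma sepD_mul_I_neg (h α y : ℝ) : sepD h α (((-y : ℝ) : ℂ) * Complex.I) = sepD h α (y * Complex.I) := by
  rw [← sepD_neg]; push_cast; ring_nf

lemma vFun_exp_mul_I (h α φ : ℝ) : vFun h (Complex.exp α * Complex.exp (φ * Complex.I)) =
    Complex.I * uHat h ((φ - π / 2) * Complex.I + α) := by
  have e : Complex.I * Complex.exp ((φ - π / 2) * Complex.I + α) =
      Complex.exp α * Complex.exp (φ * Complex.I) := by
    rw [show ((φ : ℂ) - π / 2) * Complex.I + α = φ * Complex.I + α + -(π / 2 * Complex.I) by ring,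
      Complex.exp_add, Complex.exp_neg, Complex.exp_pi_div_two_mul_I, Complex.inv_I, Complex.exp_add]
    linear_combination -Complex.exp α * Complex.exp (φ * Complex.I) * Complex.I_sq
  rw [uHat, e]
  linear_combination vFun h (Complex.exp α * Complex.exp (φ * Complex.I)) * Complex.I_sq

lemma circleMap_exp (α φ : ℝ) : circleMap 0 (Real.exp α) φ =
    Complex.exp α * Complex.exp (φ * Complex.I) := by
  rw [circleMap, zero_add]; push_cast; rfl

lemma bCoef_eq_integral_sin {h : ℝ} (hh : 0 < h) (α : ℝ) {n : ℕ} (hn : 1 ≤ n) :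
    π * (bCoef h n * Real.exp (n * α)) = ∫ φ in (0 : ℝ)..2 * π,
      (uHat h ((φ - π / 2) * Complex.I + α)).re * Real.sin (n * φ) := by
  have h1 := bCoef_eq_integral hh n (Real.exp_pos α)
  have h2 : (∮ z in C(0, Real.exp α), z ^ (n - 1) * vFun h z) = 0 :=
    Complex.circleIntegral_eq_zero_of_differentiable_on_off_countable (Real.exp_pos α).le
      countable_empty (((continuous_pow _).mul (differentiable_vFun hh).continuous).continuousOn)
      (fun z _ => ((differentiable_pow _).mul (differentiable_vFun hh)).differentiableAt)
  set q : ℝ → ℂ := fun φ => Complex.I * uHat h ((φ - π / 2) * Complex.I + α) with hq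
  have hqc : Continuous q := by
    have := continuous_uHat hh
    rw [hq]; fun_prop
  have h3 : (2 * π : ℂ) * (bCoef h n * Complex.exp (n * α)) =
      ∫ φ in (0 : ℝ)..2 * π, q φ * Complex.exp (-(n * φ * Complex.I)) := by
    rw [h1, circleIntegral, smul_eq_mul]
    have : ∀ φ : ℝ, deriv (circleMap 0 (Real.exp α)) φ • ((circleMap 0 (Real.exp α) φ)⁻¹ ^ n *
        (circleMap 0 (Real.exp α) φ)⁻¹ * vFun h (circleMap 0 (Real.exp α) φ)) =
        (Complex.I * Complex.exp (-(n * α))) * (q φ * Complex.exp (-(n * φ * Complex.I))) := by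
      intro φ
      have hc : circleMap 0 (Real.exp α) φ ≠ 0 := by
        rw [circleMap_exp]; exact mul_ne_zero (Complex.exp_ne_zero _) (Complex.exp_ne_zero _)
      have e1 : (circleMap 0 (Real.exp α) φ)⁻¹ ^ n = Complex.exp (-(n * α)) * Complex.exp (-(n * φ * Complex.I)) := by
        rw [circleMap_exp, inv_pow, mul_pow, ← Complex.exp_nat_mul, ← Complex.exp_nat_mul, mul_inv,
          ← Complex.exp_neg, ← Complex.exp_neg]
        ring_nf
      have e2 : vFun h (circleMap 0 (Real.exp α) φ) = q φ := by rw [circleMap_exp, vFun_exp_mul_I]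
      rw [deriv_circleMap, e1, e2, smul_eq_mul]
      generalize q φ = w
      field_simp
    rw [intervalIntegral.integral_congr (fun φ _ => this φ), intervalIntegral.integral_const_mul]
    have e2 : Complex.exp (-(n * α)) * Complex.exp (n * α) = 1 := by
      rw [← Complex.exp_add]; simp
    generalize (∫ φ in (0 : ℝ)..2 * π, q φ * Complex.exp (-(n * φ * Complex.I))) = J
    field_simp
    linear_combination J * e2
  have h4 : (∫ φ in (0 : ℝ)..2 * π, q φ * Complex.exp (n * φ * Complex.I)) = 0 := by
    rw [circleIntegral] at h2
    have : ∀ φ : ℝ, deriv (circleMap 0 (Real.exp α)) φ • ((circleMap 0 (Real.exp α) φ) ^ (n - 1) *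
        vFun h (circleMap 0 (Real.exp α) φ)) =
        (Complex.I * Complex.exp (n * α)) * (q φ * Complex.exp (n * φ * Complex.I)) := by
      intro φ
      have e1 : (circleMap 0 (Real.exp α) φ) * (circleMap 0 (Real.exp α) φ) ^ (n - 1) =
          Complex.exp (n * α) * Complex.exp (n * φ * Complex.I) := by
        rw [mul_pow_sub_one (by omega), circleMap_exp, mul_pow, ← Complex.exp_nat_mul, ← Complex.exp_nat_mul]
        ring_nf
      have e2 : vFun h (circleMap 0 (Real.exp α) φ) = q φ := by rw [circleMap_exp, vFun_exp_mul_I]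
      rw [deriv_circleMap, e2, smul_eq_mul]
      linear_combination Complex.I * q φ * e1
    rw [intervalIntegral.integral_congr (fun φ _ => this φ), intervalIntegral.integral_const_mul] at h2
    exact (mul_eq_zero.mp h2).resolve_left (mul_ne_zero Complex.I_ne_zero (Complex.exp_ne_zero _))
  have h5 : (2 * π : ℂ) * (bCoef h n * Complex.exp (n * α)) =
      ∫ φ in (0 : ℝ)..2 * π, (2 * uHat h ((φ - π / 2) * Complex.I + α)) * Complex.sin (n * φ) := by
    rw [h3, ← sub_zero (∫ φ in (0 : ℝ)..2 * π, q φ * Complex.exp (-(n * φ * Complex.I))), ← h4,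
      ← intervalIntegral.integral_sub]
    · refine intervalIntegral.integral_congr fun φ _ => ?_
      simp only [hq]
      rw [Complex.sin, neg_mul]
      ring
    · exact (by fun_prop : Continuous _).intervalIntegrable _ _
    · exact (by fun_prop : Continuous _).intervalIntegrable _ _
  have h6 := congrArg Complex.re h5
  rw [← Complex.reCLM_apply (∫ _ in _.._, _), ← ContinuousLinearMap.intervalIntegral_comp_comm] at h6
  · have e : ((2 * π : ℂ) * (bCoef h n * Complex.exp (n * α))).re = 2 * (π * (bCoef h n * Real.exp (n * α))) := by
      rw [show (2 * π : ℂ) * (bCoef h n * Complex.exp (n * α)) =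
        ((2 * (π * (bCoef h n * Real.exp (n * α))) : ℝ) : ℂ) by push_cast; ring, Complex.ofReal_re]
    rw [e] at h6
    have : (∫ φ in (0 : ℝ)..2 * π, Complex.reCLM ((2 * uHat h ((φ - π / 2) * Complex.I + α)) * Complex.sin (n * φ))) =
        2 * ∫ φ in (0 : ℝ)..2 * π, (uHat h ((φ - π / 2) * Complex.I + α)).re * Real.sin (n * φ) := by
      rw [← intervalIntegral.integral_const_mul]
      refine intervalIntegral.integral_congr fun φ _ => ?_
      have : Complex.sin (n * φ) = (Real.sin (n * φ) : ℂ) := by push_cast; rfl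
      simp only [Complex.reCLM_apply, this]
      rw [Complex.re_mul_ofReal]
      simp; ring
    rw [this] at h6
    linarith
  · have := continuous_uHat hh
    exact (by fun_prop : Continuous _).intervalIntegrable _ _

lemma uHat_re_symm (h α φ : ℝ) : (uHat h ((-φ - π / 2) * Complex.I + α)).re =
    -(uHat h ((φ - π / 2) * Complex.I + α)).re := by
  have e : (-φ - π / 2) * Complex.I + α + π * Complex.I = starRingEnd ℂ ((φ - π / 2) * Complex.I + α) := by
    have : starRingEnd ℂ 2 = 2 := Complex.conj_ofNat 2
    simp [this]; ring
  have := uHat_add_pi h ((-φ - π / 2) * Complex.I + α)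
  rw [e, uHat_conj] at this
  have := congrArg Complex.re this
  simp only [Complex.conj_re, Complex.neg_re] at this
  linarith

lemma sin_nat_mul_add_pi {n : ℕ} (hn : Odd n) (φ : ℝ) : Real.sin (n * (φ + π)) = -Real.sin (n * φ) := by
  obtain ⟨m, rfl⟩ := hn
  push_cast
  rw [show (2 * (m : ℝ) + 1) * (φ + π) = (2 * m + 1) * φ + π + m * (2 * π) by ring,
    Real.sin_add_nat_mul_two_pi, Real.sin_add_pi]

/-- The Taylor coefficients of the separatrix in terms of its symmetry defect. -/
theorem bCoef_formula {h : ℝ} (hh : 0 < h) (α : ℝ) {n : ℕ} (hn : Odd n) :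
    n * (bCoef h n * Real.exp (n * α)) = 4 - 2 * (n * h) / π *
      ∫ ρ in (0 : ℝ)..π / (2 * h), topD h α ρ * Real.sin (n * h * ρ) := by
  have hn0 : (0 : ℝ) < n := by exact_mod_cast hn.pos
  have hpi := Real.pi_pos
  have h1 := bCoef_eq_integral_sin hh α hn.pos
  set F : ℝ → ℝ := fun φ => (uHat h ((φ - π / 2) * Complex.I + α)).re * Real.sin (n * φ) with hF
  have hFc : Continuous F := by
    have hU := continuous_uHat hh
    rw [hF]
    generalize uHat h = U at *
    fun_prop
  have hinteg : ∀ a b, IntervalIntegrable F MeasureTheory.volume a b := fun a b => hFc.intervalIntegrable _ _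
  have hper : ∀ φ, F (φ + π) = F φ := fun φ => by
    simp only [hF]
    rw [sin_nat_mul_add_pi hn]
    have := uHat_add_pi h ((φ - π / 2) * Complex.I + α)
    rw [show (((φ + π : ℝ) : ℂ) - π / 2) * Complex.I + α = (φ - π / 2) * Complex.I + α + π * Complex.I by
      push_cast; ring, this, Complex.neg_re]
    ring
  have heven : ∀ φ, F (-φ) = F φ := fun φ => by
    simp only [hF]
    rw [mul_neg, Real.sin_neg, Complex.ofReal_neg, uHat_re_symm]
    ring
  have i1 : (∫ φ in (0 : ℝ)..2 * π, F φ) = 2 * ∫ φ in (0 : ℝ)..π, F φ := by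
    have : (∫ φ in π..2 * π, F φ) = ∫ φ in (0 : ℝ)..π, F φ := by
      have := intervalIntegral.integral_comp_add_right (a := 0) (b := π) F π
      simp only [hper, zero_add] at this
      rw [this, two_mul]
    rw [← intervalIntegral.integral_add_adjacent_intervals (hinteg 0 π) (hinteg π (2 * π)), this]; ring
  have i2 : (∫ φ in (0 : ℝ)..π, F φ) = 2 * ∫ φ in (0 : ℝ)..π / 2, F φ := by
    have : (∫ φ in π / 2..π, F φ) = ∫ φ in (0 : ℝ)..π / 2, F φ := by
      have := intervalIntegral.integral_comp_sub_left (a := 0) (b := π / 2) F π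
      rw [show π - π / 2 = π / 2 by ring, sub_zero] at this
      rw [← this]
      refine intervalIntegral.integral_congr fun φ _ => ?_
      rw [← heven φ, ← hper (-φ)]; ring_nf
    rw [← intervalIntegral.integral_add_adjacent_intervals (hinteg 0 (π / 2)) (hinteg (π / 2) π), this]; ring
  have i3 : (∫ φ in (0 : ℝ)..π / 2, F φ) = h * ∫ ρ in (0 : ℝ)..π / (2 * h), F (h * ρ) := by
    rw [intervalIntegral.mul_integral_comp_mul_left]
    congr 1 <;> field_simp
    simp
  have i4 : ∀ ρ, F (h * ρ) = π * Real.sin (n * h * ρ) - topD h α ρ * Real.sin (n * h * ρ) / 2 := fun ρ => by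
    simp only [hF]
    have := sepD_mul_I_re h α (-(π / (2 * h) - ρ))
    rw [sepD_mul_I_neg] at this
    rw [topD, this]
    have e : ((h * ρ : ℝ) : ℂ) - π / 2 = h * ((-(π / (2 * h) - ρ) : ℝ) : ℂ) := by
      have : (h : ℂ) ≠ 0 := by exact_mod_cast hh.ne'
      push_cast; field_simp; ring
    rw [e]; ring_nf
  have i5 : (∫ ρ in (0 : ℝ)..π / (2 * h), Real.sin (n * h * ρ)) = 1 / (n * h) := by
    rw [intervalIntegral.integral_comp_mul_left (fun x => Real.sin x) (by positivity), integral_sin]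
    have : (n : ℝ) * h * (π / (2 * h)) = n * π / 2 := by field_simp
    rw [this]
    have hc : Real.cos (n * π / 2) = 0 := by
      rw [Real.cos_eq_zero_iff]
      obtain ⟨m, rfl⟩ := hn
      exact ⟨m, by push_cast; ring⟩
    rw [hc, mul_zero, Real.cos_zero]; simp
  have i6 : (∫ ρ in (0 : ℝ)..π / (2 * h), F (h * ρ)) = π / (n * h) -
      (∫ ρ in (0 : ℝ)..π / (2 * h), topD h α ρ * Real.sin (n * h * ρ)) / 2 := by
    have hc := continuous_topD hh α
    rw [intervalIntegral.integral_congr (fun ρ _ => i4 ρ), intervalIntegral.integral_sub,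
      intervalIntegral.integral_const_mul, i5, intervalIntegral.integral_div]
    · ring
    · exact (by fun_prop : Continuous _).intervalIntegrable _ _
    · exact (by fun_prop : Continuous _).intervalIntegrable _ _
  rw [i1, i2, i3, i6] at h1
  generalize (∫ ρ in (0 : ℝ)..π / (2 * h), topD h α ρ * Real.sin (n * h * ρ)) = J at *
  have h2 : bCoef h n * Real.exp (n * α) = (2 * (2 * (h * (π / (n * h) - J / 2)))) / π := by
    rw [eq_div_iff hpi.ne', ← h1]; ring
  rw [h2]
  field_simp
  ring

namespace SplitPair

/-- The first exponentially small bound on a wider box. -/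
lemma wide_bound (c C₀ : ℝ) (hC : 1 ≤ C₀) (hcC : 6 * c ^ 3 ≤ C₀) : ∃ A : ℝ, 0 ≤ A ∧
    ∀ (L : ℝ) (D G R : ℂ → ℂ), C₀ ≤ L → SplitPair c C₀ L D G R → ∀ s : ℂ, |s.re| ≤ 5 / 4 →
      C₀ ≤ L - |s.im| → ‖D s‖ ≤ A * (L - |s.im|) ^ 2 * Real.exp (-(2 * π * (L - |s.im|))) := by
  set A₁ := |2 * (16 * c ^ 3 + 128 * c ^ 5) * Real.exp (2 * π * (C₀ + 1))| with hA₁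
  set B := |32 * c ^ 2 * Real.exp (2 * π * (C₀ + 1)) + 4 * c ^ 3 *
    (2 * (16 * c ^ 3 + 128 * c ^ 5) * Real.exp (2 * π * (C₀ + 1))) / C₀ ^ 2| with hB
  refine ⟨A₁ + |c| * B + c ^ 2 * A₁, by positivity, fun L D G R hL h => ?_⟩
  have hc := h.c_nonneg hL hC
  rw [abs_of_nonneg hc]
  obtain ⟨h1, h2⟩ := h.first_bound hL hC hcC rfl
  have h1' : ∀ s : ℂ, |s.re| ≤ 1 / 2 → C₀ ≤ L - |s.im| →
      ‖D s‖ ≤ A₁ * (L - |s.im|) ^ 2 * Real.exp (-(2 * π * (L - |s.im|))) := fun s a b =>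
    (h1 s a b).trans (by gcongr; exact le_abs_self _)
  have h2' : ∀ s : ℂ, -(5 / 4) ≤ s.re → s.re ≤ 1 / 4 → C₀ ≤ L - |s.im| →
      ‖wronskian D G s‖ ≤ B * Real.exp (-(2 * π * (L - |s.im|))) := fun s a b d =>
    (h2 s a b d).trans (by gcongr; exact le_abs_self _)
  clear_value A₁ B
  have hA0 : 0 ≤ A₁ := by rw [hA₁]; positivity
  have hB0 : 0 ≤ B := by rw [hB]; positivity
  clear h1 h2 hA₁ hB
  have key : ∀ (d g g' W : ℂ) (ρ E : ℝ), 1 ≤ ρ → 0 ≤ E → ‖d‖ ≤ A₁ * ρ ^ 2 * E → ‖g‖ ≤ c / ρ → ‖g'⁻¹‖ ≤ c * ρ →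
      ‖W‖ ≤ B * E → ‖(W + d * g) * g'⁻¹‖ ≤ (A₁ + c * B + c ^ 2 * A₁) * ρ ^ 2 * E := by
    intro d g g' W ρ E hρ hE e1 e2 e3 e4
    rw [norm_mul]
    calc _ ≤ (‖W‖ + ‖d‖ * ‖g‖) * ‖g'⁻¹‖ := by gcongr; exact (norm_add_le _ _).trans (by rw [norm_mul])
      _ ≤ (B * E + A₁ * ρ ^ 2 * E * (c / ρ)) * (c * ρ) := by gcongr
      _ = c * B * ρ * E + c ^ 2 * A₁ * ρ ^ 2 * E := by field_simp
      _ ≤ c * B * ρ ^ 2 * E + c ^ 2 * A₁ * ρ ^ 2 * E := by gcongr; nlinarith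
      _ ≤ _ := by nlinarith [show 0 ≤ A₁ * ρ ^ 2 * E by positivity]
  intro s hs hr
  have hr1 : 1 ≤ L - |s.im| := by linarith
  rcases le_total |s.re| (1 / 2) with h3 | h3
  · refine (h1' s h3 hr).trans ?_
    gcongr
    have : 0 ≤ c * B := by positivity
    have : 0 ≤ c ^ 2 * A₁ := by positivity
    linarith
  rcases le_total 0 s.re with h0 | h0
  · rw [abs_of_nonneg h0] at h3 hs
    have im1 : (s - 1).im = s.im := by simp
    have re1 : (s - 1).re = s.re - 1 := by simp
    have a1 : |(s - 1).re| ≤ 3 / 2 := by rw [re1, abs_le]; constructor <;> linarith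
    have a2 : |s.re| ≤ 3 / 2 := by rw [abs_le]; constructor <;> linarith
    have hr' : C₀ ≤ L - |(s - 1).im| := by rwa [im1]
    have n1 := h.G_ne a1 hr'
    have e : D s = (wronskian D G (s - 1) + D (s - 1) * G s) * (G (s - 1))⁻¹ := by
      rw [wronskian, sub_add_cancel]; field_simp; ring
    rw [e]
    refine key _ _ _ _ _ _ hr1 (Real.exp_pos _).le ?_ (h.norm_G_le hC a2 hr) ?_ ?_
    · simpa only [im1] using h1' (s - 1) (by rw [re1, abs_le]; constructor <;> linarith) hr'
    · simpa only [im1] using h.norm_inv_G_le a1 hr'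
    · simpa only [im1] using h2' (s - 1) (by rw [re1]; linarith) (by rw [re1]; linarith) hr'
  · rw [abs_of_nonpos h0] at h3 hs
    have im1 : (s + 1).im = s.im := by simp
    have re1 : (s + 1).re = s.re + 1 := by simp
    have a1 : |(s + 1).re| ≤ 3 / 2 := by rw [re1, abs_le]; constructor <;> linarith
    have a2 : |s.re| ≤ 3 / 2 := by rw [abs_le]; constructor <;> linarith
    have hr' : C₀ ≤ L - |(s + 1).im| := by rwa [im1]
    have n1 := h.G_ne a1 hr'
    have e : D s = (-wronskian D G s + D (s + 1) * G s) * (G (s + 1))⁻¹ := by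
      rw [wronskian]; field_simp; ring
    rw [e]
    refine key _ _ _ _ _ _ hr1 (Real.exp_pos _).le ?_ (h.norm_G_le hC a2 hr) ?_ ?_
    · simpa only [im1] using h1' (s + 1) (by rw [re1, abs_le]; constructor <;> linarith) hr'
    · simpa only [im1] using h.norm_inv_G_le a1 hr'
    · rw [norm_neg]; exact h2' s (by linarith) (by linarith) hr

lemma real_bound (c C₀ : ℝ) (hC : 1 ≤ C₀) (hcC : 6 * c ^ 3 ≤ C₀) : ∃ A : ℝ, 0 ≤ A ∧
    ∀ (L : ℝ) (D G R : ℂ → ℂ), C₀ + 1 ≤ L → SplitPair c C₀ L D G R → ∀ x : ℝ, |x| ≤ 1 →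
      ‖D x‖ ≤ A * L ^ 2 * Real.exp (-(2 * π * L)) ∧ ‖deriv D x‖ ≤ A * L ^ 2 * Real.exp (-(2 * π * L)) := by
  obtain ⟨A, hA, h⟩ := wide_bound c C₀ hC hcC
  refine ⟨4 * A * Real.exp (2 * π), by positivity, fun L D G R hL hS x hx => ?_⟩
  rw [abs_le] at hx
  have hb : ∀ s : ℂ, |s.re - x| ≤ 1 / 4 → |s.im| ≤ 1 / 4 →
      ‖D s‖ ≤ A * Real.exp (2 * π) * L ^ 2 * Real.exp (-(2 * π * L)) := fun s h1 h2 => by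
    rw [abs_le] at h1
    refine (h L D G R (by linarith) hS s (by rw [abs_le]; constructor <;> linarith) (by linarith)).trans ?_
    have := abs_nonneg s.im
    have e : Real.exp (-(2 * π * (L - |s.im|))) ≤ Real.exp (2 * π) * Real.exp (-(2 * π * L)) := by
      rw [← Real.exp_add]; exact Real.exp_le_exp.mpr (by nlinarith [Real.pi_pos])
    have hL' : 0 ≤ L - |s.im| := by linarith
    calc _ ≤ A * L ^ 2 * (Real.exp (2 * π) * Real.exp (-(2 * π * L))) := by gcongr; linarith
      _ = _ := by ring
  have hE : 0 ≤ A * Real.exp (2 * π) * L ^ 2 * Real.exp (-(2 * π * L)) := by positivity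
  constructor
  · have := hb x (by simp) (by simp)
    linarith
  · have := Complex.norm_deriv_le_of_forall_mem_sphere_norm_le (c := (x : ℂ)) (R := 1 / 4) (by norm_num)
      hS.diff_D.diffContOnCl (C := A * Real.exp (2 * π) * L ^ 2 * Real.exp (-(2 * π * L))) ?_
    · linarith
    · intro z hz
      have hz' : ‖z - x‖ = 1 / 4 := by simpa using hz
      apply hb
      · have := Complex.abs_re_le_norm (z - x)
        simpa [hz'] using this
      · have := Complex.abs_im_le_norm (z - x)
        rw [hz'] at this
        simpa using this

end SplitPair

/-- Second-order upper bound for the sine on `[0, π]`, by concavity. -/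
lemma sin_le_tangent {p w : ℝ} (hp : p ∈ Icc 0 π) (hw : w ∈ Icc 0 π) :
    Real.sin w ≤ Real.sin p + Real.cos p * (w - p) := by
  have hc := strictConcaveOn_sin_Icc.concaveOn
  rcases lt_trichotomy p w with h | h | h
  · have := hc.slope_le_of_hasDerivAt hp hw h (Real.hasDerivAt_sin p)
    rw [slope_def_field, div_le_iff₀ (by linarith)] at this
    linarith
  · simp [h]
  · have := hc.le_slope_of_hasDerivAt hw hp h (Real.hasDerivAt_sin p)
    rw [slope_def_field, le_div_iff₀ (by linarith)] at this
    linarith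

/-- Along an orbit pair of the pendulum recursion with angles in `[0, π]` the wronskian decreases. -/
lemma discrete_wronskian {p w g : ℕ → ℝ} {e β : ℝ} {N : ℕ} (he : 0 ≤ e) (hβ : 0 ≤ β)
    (hp : ∀ n, p (n + 2) - 2 * p (n + 1) + p n = e * Real.sin (p (n + 1)))
    (hw : ∀ n, w (n + 2) - 2 * w (n + 1) + w n = e * Real.sin (w (n + 1)))
    (hg : ∀ n, g (n + 2) - 2 * g (n + 1) + g n = e * Real.cos (p (n + 1)) * g (n + 1))
    (hg0 : ∀ n, 0 < g n) (hp0 : ∀ n, 0 ≤ p n) (hw0 : ∀ n ≤ N, 0 ≤ w n)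
    (hpi : ∀ n, p (n + 1) ≤ π ∧ p (n + 1) + (w 0 - p 0) / g 0 * g (n + 1) ≤ π)
    (hW : (w 1 - p 1) * g 0 - (w 0 - p 0) * g 1 ≤ -β) :
    ∀ n ≤ N, (w (n + 1) - p (n + 1)) * g n - (w n - p n) * g (n + 1) ≤ -β ∧
      (w n - p n) / g n ≤ (w 0 - p 0) / g 0 ∧
      (w (n + 1) - p (n + 1)) / g (n + 1) ≤ (w n - p n) / g n - β / (g n * g (n + 1)) := by
  have step : ∀ n, (w (n + 1) - p (n + 1)) * g n - (w n - p n) * g (n + 1) ≤ -β →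
      (w (n + 1) - p (n + 1)) / g (n + 1) ≤ (w n - p n) / g n - β / (g n * g (n + 1)) := fun n h => by
    have a := hg0 n
    have b := hg0 (n + 1)
    rw [div_sub_div _ _ a.ne' (by positivity), div_le_div_iff₀ b (by positivity)]
    have := mul_le_mul_of_nonneg_left h (show 0 ≤ g n * g (n + 1) by positivity)
    linarith
  intro n
  induction n with
  | zero => exact fun _ => ⟨hW, le_rfl, step 0 hW⟩
  | succ n ih =>
    intro hn
    obtain ⟨i1, i2, i3⟩ := ih (by omega)
    have a := hg0 n
    have b := hg0 (n + 1)
    have j2 : (w (n + 1) - p (n + 1)) / g (n + 1) ≤ (w 0 - p 0) / g 0 := by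
      have : 0 ≤ β / (g n * g (n + 1)) := by positivity
      linarith
    have hwpi : w (n + 1) ≤ π := by
      rw [div_le_iff₀ b] at j2
      linarith [(hpi n).2]
    have hs := sin_le_tangent ⟨hp0 (n + 1), (hpi n).1⟩ ⟨hw0 _ hn, hwpi⟩
    have k : (w (n + 1 + 1) - p (n + 1 + 1)) * g (n + 1) - (w (n + 1) - p (n + 1)) * g (n + 1 + 1) ≤ -β := by
      refine le_trans ?_ i1
      have e1 : (w (n + 2) - p (n + 2)) * g (n + 1) - (w (n + 1) - p (n + 1)) * g (n + 2) -
          ((w (n + 1) - p (n + 1)) * g n - (w n - p n) * g (n + 1)) =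
          e * g (n + 1) * (Real.sin (w (n + 1)) - (Real.sin (p (n + 1)) + Real.cos (p (n + 1)) * (w (n + 1) - p (n + 1)))) := by
        linear_combination g (n + 1) * hw n - g (n + 1) * hp n - (w (n + 1) - p (n + 1)) * hg n
      have := mul_nonneg (mul_nonneg he b.le) (sub_nonneg.mpr hs)
      change (w (n + 2) - p (n + 2)) * g (n + 1) - (w (n + 1) - p (n + 1)) * g (n + 2) ≤ _
      linarith
    exact ⟨k, j2, step _ k⟩

/-- A real solution of the pendulum recursion parametrizing an unstable separatrix. -/
structure RealSep (h e : ℝ) (u v : ℝ → ℝ) : Prop where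
  h_pos : 0 < h
  e_nonneg : 0 ≤ e
  diff_u : ∀ t, u (t + h) - 2 * u t + u (t - h) = e * Real.sin (u t)
  diff_v : ∀ t, v (t + h) - 2 * v t + v (t - h) = e * Real.cos (u t) * v t
  deriv_u : ∀ t, HasDerivAt u (v t) t
  bounds : ∀ t ≤ 1 / 4, Real.exp t / 2 ≤ v t ∧ v t ≤ 10 * Real.exp t
  zero : u 0 = π
  tendsto : Tendsto u atBot (𝓝 0)

namespace RealSep

variable {h e : ℝ} {u v : ℝ → ℝ}

lemma u_bounds (S : RealSep h e u v) {t : ℝ} (ht : t ≤ 1 / 4) :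
    Real.exp t / 2 ≤ u t ∧ u t ≤ 10 * Real.exp t := by
  have key : ∀ f : ℝ → ℝ, (∀ s < t, ∃ f', HasDerivAt f f' s ∧ 0 ≤ f') → Continuous f →
      Tendsto f atBot (𝓝 0) → 0 ≤ f t := fun f hf hfc hlim => by
    have hm : MonotoneOn f (Iic t) := by
      refine monotoneOn_of_deriv_nonneg (convex_Iic t) hfc.continuousOn ?_ ?_
      · rw [interior_Iic]
        exact fun s hs => (hf s hs).choose_spec.1.differentiableAt.differentiableWithinAt
      · rw [interior_Iic]
        intro s hs
        rw [(hf s hs).choose_spec.1.deriv]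
        exact (hf s hs).choose_spec.2
    refine le_of_tendsto hlim ?_
    filter_upwards [eventually_le_atBot t] with s hs
    exact hm hs self_mem_Iic hs
  have hc : Continuous u := continuous_iff_continuousAt.mpr fun t => (S.deriv_u t).continuousAt
  have hexp := Real.tendsto_exp_atBot
  constructor
  · have := key (fun s => u s - Real.exp s / 2) (fun s hs => ⟨_, (S.deriv_u s).sub
      ((Real.hasDerivAt_exp s).div_const 2), by linarith [(S.bounds s (by linarith)).1]⟩) (by fun_prop)
      (by simpa using S.tendsto.sub (hexp.div_const 2))
    linarith
  · have := key (fun s => 10 * Real.exp s - u s) (fun s hs => ⟨_, ((Real.hasDerivAt_exp s).const_mul 10).sub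
      (S.deriv_u s), by linarith [(S.bounds s (by linarith)).2]⟩) (by fun_prop)
      (by simpa using (hexp.const_mul 10).sub S.tendsto)
    linarith

lemma monotoneOn_u (S : RealSep h e u v) : MonotoneOn u (Iic (1 / 4)) := by
  have hc : Continuous u := continuous_iff_continuousAt.mpr fun t => (S.deriv_u t).continuousAt
  refine monotoneOn_of_deriv_nonneg (convex_Iic _) hc.continuousOn
    (fun s _ => (S.deriv_u s).differentiableAt.differentiableWithinAt) ?_
  rw [interior_Iic]
  intro s hs
  rw [(S.deriv_u s).deriv]
  have := (S.bounds s (le_of_lt hs)).1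
  have := Real.exp_pos s
  linarith

lemma u_neg_h_le (S : RealSep h e u v) (hh : h ≤ 1 / 4) : u (-h) ≤ π - h / 4 := by
  have h0 := S.h_pos
  obtain ⟨s, hs, hs'⟩ := exists_hasDerivAt_eq_slope u v (a := -h) (b := 0) (by linarith)
    (fun t _ => (S.deriv_u t).continuousAt.continuousWithinAt) (fun t _ => S.deriv_u t)
  have h1 := (S.bounds s (by linarith [hs.2])).1
  have h2 : 1 / 2 ≤ Real.exp s := by
    have := Real.add_one_le_exp s
    linarith [hs.1]
  rw [S.zero, sub_neg_eq_add, zero_add] at hs'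
  have : 1 / 4 ≤ (π - u (-h)) / h := by rw [← hs']; linarith
  rw [le_div_iff₀ h0] at this
  linarith

/-- If the separatrix has not crossed `2π` before time `T`, the splitting wronskian is bounded below. -/
lemma wronskian_lower (S : RealSep h e u v) (hh : h ≤ 1 / 4) {T : ℝ} (hT : 3 ≤ T) (hu : ∀ t ≤ T, u t < 2 * π)
    {t : ℝ} (h0 : 0 ≤ t) (h1 : t ≤ h) (hD : |2 * π - u t - u (-t)| ≤ h / 80) :
    -(400000 * h * Real.exp (-(2 * T))) ≤
      (2 * π - u (t + h) - u (-(t + h))) * v (-t) - (2 * π - u t - u (-t)) * v (-(t + h)) := by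
  have hpos := S.h_pos
  by_contra! hcon
  set β := -((2 * π - u (t + h) - u (-(t + h))) * v (-t) - (2 * π - u t - u (-t)) * v (-(t + h))) with hβ
  have hβ0 : 400000 * h * Real.exp (-(2 * T)) < β := by rw [hβ]; linarith
  set p : ℕ → ℝ := fun n => u (-(t + n * h)) with hp
  set w : ℕ → ℝ := fun n => 2 * π - u (t + n * h) with hw
  set g : ℕ → ℝ := fun n => v (-(t + n * h)) with hg
  have htn : ∀ n : ℕ, -(t + n * h) ≤ 1 / 4 := fun n => by
    have : 0 ≤ n * h := by positivity
    linarith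
  have hgl : ∀ n : ℕ, Real.exp (-(t + n * h)) / 2 ≤ g n := fun n => (S.bounds _ (htn n)).1
  have hgu : ∀ n : ℕ, g n ≤ 10 * Real.exp (-(t + n * h)) := fun n => (S.bounds _ (htn n)).2
  have hg0 : ∀ n, 0 < g n := fun n => lt_of_lt_of_le (by positivity) (hgl n)
  set N := ⌊(T - t) / h⌋₊ with hN
  set m := ⌊1 / h⌋₊ with hm
  have hN1 : N * h ≤ T - t := by
    have := Nat.floor_le (show 0 ≤ (T - t) / h by apply div_nonneg <;> linarith)
    rwa [le_div_iff₀ hpos] at this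
  have hN2 : T - t < (N + 1) * h := by
    have := Nat.lt_floor_add_one ((T - t) / h)
    rwa [div_lt_iff₀ hpos] at this
  have hm1 : m * h ≤ 1 := by
    have := Nat.floor_le (show 0 ≤ 1 / h by positivity)
    rwa [le_div_iff₀ hpos] at this
  have hm2 : 1 < (m + 1) * h := by
    have := Nat.lt_floor_add_one (1 / h)
    rwa [div_lt_iff₀ hpos] at this
  have hmN : m ≤ N := by
    by_contra! hlt
    have : (N + 1 : ℝ) ≤ m := by exact_mod_cast hlt
    have := mul_le_mul_of_nonneg_right this hpos.le
    linarith
  have hE0 : (w 0 - p 0) / g 0 ≤ 1 / 10 * h := by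
    have : w 0 - p 0 ≤ h / 80 := by
      simp only [hw, hp, Nat.cast_zero, zero_mul, add_zero]
      exact (le_abs_self _).trans hD
    have h2 : 1 / 8 ≤ g 0 := by
      have := hgl 0
      simp only [Nat.cast_zero, zero_mul, add_zero] at this
      have := Real.add_one_le_exp (-t)
      linarith
    rw [div_le_iff₀ (hg0 0)]
    nlinarith
  have hE0' : (w 0 - p 0) * Real.exp t ≤ h / 80 * 2 := by
    have : w 0 - p 0 ≤ h / 80 := by
      simp only [hw, hp, Nat.cast_zero, zero_mul, add_zero]
      exact (le_abs_self _).trans hD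
    have h3 : Real.exp t ≤ 2 := by
      have := Real.one_sub_le_exp_neg t
      have h4 : Real.exp (-t) * Real.exp t = 1 := by rw [← Real.exp_add]; simp
      nlinarith [Real.exp_pos t]
    calc _ ≤ h / 80 * Real.exp t := by gcongr
      _ ≤ _ := by gcongr
  have main := discrete_wronskian (p := p) (w := w) (g := g) (e := e) (β := β) (N := N) S.e_nonneg
    (le_trans (by positivity) hβ0.le) ?_ ?_ ?_ hg0 ?_ ?_ ?_ ?_
  rotate_left
  · intro n
    have := S.diff_u (-(t + (n + 1 : ℕ) * h))
    simp only [hp]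
    rw [← this]; push_cast; ring_nf
  · intro n
    have := S.diff_u (t + (n + 1 : ℕ) * h)
    have e2 : Real.sin (2 * π - u (t + (n + 1 : ℕ) * h)) = -Real.sin (u (t + (n + 1 : ℕ) * h)) :=
      Real.sin_two_pi_sub _
    simp only [hw]
    rw [e2, mul_neg, ← this]; push_cast; ring_nf
  · intro n
    have := S.diff_v (-(t + (n + 1 : ℕ) * h))
    simp only [hp, hg]
    rw [← this]; push_cast; ring_nf
  · intro n
    exact le_trans (by positivity) (S.u_bounds (htn n)).1
  · intro n hn
    have : (n : ℝ) * h ≤ N * h := by gcongr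
    have := hu (t + n * h) (by linarith)
    simp only [hw]; linarith
  · intro n
    have hle : p (n + 1) ≤ π - h / 4 := by
      refine le_trans (S.monotoneOn_u (htn (n + 1)) (show -h ≤ 1 / 4 by linarith) ?_) (S.u_neg_h_le hh)
      have : 0 ≤ n * h := by positivity
      push_cast; linarith
    refine ⟨by linarith, ?_⟩
    have hgn : g (n + 1) ≤ 2 * g 0 * 10 := by
      have h2 := hgl 0
      have h3 := hgu (n + 1)
      have h4 : Real.exp (-(t + (n + 1 : ℕ) * h)) ≤ Real.exp (-(t + (0 : ℕ) * h)) := by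
        apply Real.exp_le_exp.mpr
        have : 0 ≤ (n + 1 : ℕ) * h := by positivity
        push_cast at this ⊢; linarith
      generalize Real.exp (-(t + (n + 1 : ℕ) * h)) = E1 at *
      generalize Real.exp (-(t + (0 : ℕ) * h)) = E0 at *
      linarith [hg0 0]
    have : (w 0 - p 0) / g 0 * g (n + 1) ≤ h / 4 := by
      rcases le_total (w 0 - p 0) 0 with hn | hn
      · have : (w 0 - p 0) / g 0 ≤ 0 := div_nonpos_of_nonpos_of_nonneg hn (hg0 0).le
        nlinarith [hg0 (n + 1)]
      · have hd : w 0 - p 0 ≤ h / 80 := by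
          simp only [hw, hp, Nat.cast_zero, zero_mul, add_zero]
          exact (le_abs_self _).trans hD
        calc _ ≤ (w 0 - p 0) / g 0 * (2 * g 0 * 10) := by
              have := hg0 0
              gcongr
          _ = 20 * (w 0 - p 0) := by have := hg0 0; field_simp; ring
          _ ≤ _ := by linarith
    linarith
  · simp only [hw, hp, hg, hβ]
    push_cast
    simp only [one_mul, zero_mul, add_zero]
    linarith
  have hM := (main (N - m) (by omega)).2.1
  have hsum : ∀ j ≤ m, (w (N - m + j) - p (N - m + j)) / g (N - m + j) ≤
      1 / 10 * h - j * (β * Real.exp (2 * T - 4) / 100) := by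
    intro j
    induction j with
    | zero => intro _; simp only [add_zero, Nat.cast_zero, zero_mul, sub_zero]; linarith
    | succ j ih =>
      intro hj
      have i1 := ih (by omega)
      have i2 := (main (N - m + j) (by omega)).2.2
      have i3 : β * Real.exp (2 * T - 4) / 100 ≤ β / (g (N - m + j) * g (N - m + j + 1)) := by
        have hβp : 0 ≤ β := le_trans (by positivity) hβ0.le
        rw [mul_div_assoc, div_eq_mul_inv β]
        apply mul_le_mul_of_nonneg_left _ hβp
        rw [le_inv_comm₀ (by positivity) (mul_pos (hg0 _) (hg0 _))]
        have hgb : ∀ k : ℕ, N - m ≤ k → g k ≤ 10 * Real.exp (2 - T) := fun k hk => by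
          refine (hgu k).trans ?_
          gcongr
          have : ((N - m : ℕ) : ℝ) * h ≤ k * h := by gcongr
          rw [Nat.cast_sub hmN, sub_mul] at this
          linarith
        calc _ ≤ (10 * Real.exp (2 - T)) * (10 * Real.exp (2 - T)) :=
              mul_le_mul (hgb _ (by omega)) (hgb _ (by omega)) (hg0 _).le (by positivity)
          _ = 100 * (Real.exp (2 - T) * Real.exp (2 - T)) := by ring
          _ = _ := by rw [← Real.exp_add, inv_div, div_eq_mul_inv, ← Real.exp_neg]; ring_nf
      rw [← add_assoc]
      push_cast
      linarith
  have hfin := hsum m le_rfl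
  rw [Nat.sub_add_cancel hmN] at hfin
  have hlow : -20 ≤ (w N - p N) / g N := by
    rw [le_div_iff₀ (hg0 N)]
    have a1 : 0 ≤ w N := by
      have := hu (t + N * h) (by linarith)
      simp only [hw]; linarith
    have a2 := (S.u_bounds (htn N)).2
    have a3 := hgl N
    change p N ≤ _ at a2
    linarith
  have hmh : 1 / 2 ≤ m * h := by
    have : 1 / 2 < 1 - h := by linarith
    linarith
  have hexp4 : Real.exp (2 * T - 4) = Real.exp (2 * T) * Real.exp (-4) := by rw [← Real.exp_add]; ring_nf
  have he4 : 1 / 81 ≤ Real.exp (-4) := by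
    rw [Real.exp_neg, one_div]
    apply inv_anti₀ (Real.exp_pos _)
    have : Real.exp 4 = Real.exp 1 ^ 4 := by rw [← Real.exp_nat_mul]; norm_num
    rw [this]
    have : Real.exp 1 ≤ 3 := by linarith [Real.exp_one_lt_d9]
    calc _ ≤ (3 : ℝ) ^ 4 := by gcongr
      _ = 81 := by norm_num
  have hTT : Real.exp (2 * T) * Real.exp (-(2 * T)) = 1 := by rw [← Real.exp_add]; simp
  have hβT : 400000 * h < β * Real.exp (2 * T) := by
    have := mul_lt_mul_of_pos_right hβ0 (Real.exp_pos (2 * T))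
    calc 400000 * h = 400000 * h * (Real.exp (2 * T) * Real.exp (-(2 * T))) := by rw [hTT]; ring
      _ = 400000 * h * Real.exp (-(2 * T)) * Real.exp (2 * T) := by ring
      _ < _ := this
  have : 400000 * h * (1 / 81) ≤ β * Real.exp (2 * T - 4) := by
    rw [hexp4, ← mul_assoc]
    exact mul_le_mul hβT.le he4 (by norm_num) (by nlinarith)
  have : (m : ℝ) * (400000 * h * (1 / 81) / 100) ≤ m * (β * Real.exp (2 * T - 4) / 100) := by gcongr
  nlinarith

end RealSep

lemma deriv_uHat_ofReal (h t : ℝ) : deriv (uHat h) t = ((deriv (uHat h) t).re : ℂ) := by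
  have := deriv_uHat_conj (h := h) (t : ℂ)
  rw [Complex.conj_ofReal] at this
  exact (Complex.conj_eq_iff_re.mp this.symm).symm

/-- The separatrix on the real line, normalized to pass through `π` at time zero. -/
def sepU (h α t : ℝ) : ℝ := (uHat h ((t + α : ℝ) : ℂ)).re

/-- The derivative of the separatrix on the real line. -/
def sepV (h α t : ℝ) : ℝ := (deriv (uHat h) ((t + α : ℝ) : ℂ)).re

lemma SepData.realSep {K h α : ℝ} (S : SepData K h α) : RealSep h (diffSymbol h 1) (sepU h α) (sepV h α) where
  h_pos := S.h_pos
  e_nonneg := (diffSymbol_pos S.h_pos one_pos).le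
  diff_u t := by
    have := congrArg Complex.re (uHat_diff S.h_pos ((t + α : ℝ) : ℂ))
    rw [uHat_ofReal h (t + α), ← Complex.ofReal_sin, ← Complex.ofReal_mul, Complex.ofReal_re] at this
    simp only [sepU]
    rw [← this, show t + h + α = t + α + h by ring, show t - h + α = t + α - h by ring]
    push_cast
    simp
  diff_v t := by
    have := congrArg Complex.re (deriv_uHat_diff S.h_pos ((t + α : ℝ) : ℂ))
    rw [uHat_ofReal h (t + α), deriv_uHat_ofReal h (t + α), ← Complex.ofReal_cos, ← Complex.ofReal_mul,
      ← Complex.ofReal_mul, Complex.ofReal_re] at this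
    simp only [sepU, sepV]
    rw [← this, show t + h + α = t + α + h by ring, show t - h + α = t + α - h by ring]
    push_cast
    simp
  deriv_u t := (hasDerivAt_uHat_re S.h_pos (t + α)).comp_add_const t α
  bounds t ht := S.deriv_real t ht
  zero := by rw [sepU, zero_add, S.zero, Complex.ofReal_re]
  tendsto := by
    have h1 : Tendsto (fun t : ℝ => Complex.I * Complex.exp ((t + α : ℝ) : ℂ)) atBot (𝓝 0) := by
      have : Tendsto (fun t : ℝ => ((Real.exp (t + α) : ℝ) : ℂ)) atBot (𝓝 ((0 : ℝ) : ℂ)) :=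
        (Complex.continuous_ofReal.tendsto 0).comp
          (Real.tendsto_exp_atBot.comp (tendsto_atBot_add_const_right _ α tendsto_id))
      simpa using this.const_mul Complex.I
    have h2 := ((((differentiable_vFun S.h_pos).continuous.tendsto 0).comp h1).const_mul (-Complex.I))
    have h0 : vFun h 0 = 0 := by
      have := vFun_neg h 0
      rw [neg_zero] at this
      exact self_eq_neg.mp this
    rw [h0, mul_zero] at h2
    have h3 := (Complex.continuous_re.tendsto _).comp h2
    rw [Complex.zero_re] at h3
    exact h3.congr fun t => by simp [sepU, uHat]

lemma sepD_ofReal (h α x : ℝ) :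
    sepD h α x = ((2 * π - sepU h α (h * x) - sepU h α (-(h * x)) : ℝ) : ℂ) := by
  have e1 := uHat_ofReal h (h * x + α)
  have e2 := uHat_ofReal h (-(h * x) + α)
  push_cast at e1 e2
  rw [sepD, e1, e2]
  simp [sepU]

lemma sepG_ofReal (h α x : ℝ) : sepG h α x = ((h * sepV h α (-(h * x)) : ℝ) : ℂ) := by
  have e2 := deriv_uHat_ofReal h (-(h * x) + α)
  push_cast at e2
  rw [sepG, e2]
  simp [sepV]

lemma hasDerivAt_sepD {h : ℝ} (hh : 0 < h) (α : ℝ) (s : ℂ) :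
    HasDerivAt (sepD h α) (sepG h α s - sepG h α (-s)) s := by
  have hd : ∀ z, HasDerivAt (uHat h) (deriv (uHat h) z) z := fun z =>
    (differentiable_uHat hh).differentiableAt.hasDerivAt
  have i1 : HasDerivAt (fun s : ℂ => (h : ℂ) * s + α) h s := by
    simpa using ((hasDerivAt_id s).const_mul (h : ℂ)).add_const (α : ℂ)
  have i2 : HasDerivAt (fun s : ℂ => -((h : ℂ) * s) + α) (-h) s := by
    simpa using ((hasDerivAt_id s).const_mul (h : ℂ)).neg.add_const (α : ℂ)
  have h1 := (hd (h * s + α)).comp s i1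
  have h2 := (hd (-(h * s) + α)).comp s i2
  refine ((h1.const_sub (2 * π : ℂ)).sub h2).congr_deriv ?_
  rw [sepG, sepG, show -((h : ℂ) * -s) + α = h * s + α by ring]; ring

lemma wronskian_reverse {h : ℝ} (hh : 0 < h) (α : ℝ) (s : ℂ) :
    wronskian (sepD h α) (sepG h α) (-s - 1) = -wronskian (sepD h α) (sepG h α) s +
      (sepD h α (s + 1) * deriv (sepD h α) s - sepD h α s * deriv (sepD h α) (s + 1)) := by
  rw [(hasDerivAt_sepD hh α s).deriv, (hasDerivAt_sepD hh α (s + 1)).deriv, wronskian, wronskian,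
    sub_add_cancel, sepD_neg, show -s - 1 = -(s + 1) by ring, sepD_neg]
  ring

lemma pow_five_mul_exp_le {L : ℝ} (hL : 0 ≤ L) : L ^ 5 * Real.exp (-(2 * π * L)) ≤ 1 := by
  have h1 := Real.pow_div_factorial_le_exp (2 * π * L) (by positivity) 5
  have h2 : Real.exp (2 * π * L) * Real.exp (-(2 * π * L)) = 1 := by rw [← Real.exp_add]; simp
  have h3 : L ^ 5 ≤ (2 * π * L) ^ 5 / Nat.factorial 5 := by
    rw [mul_pow, mul_div_right_comm]
    apply le_mul_of_one_le_left (by positivity)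
    rw [le_div_iff₀ (by positivity)]
    have : (6 : ℝ) ≤ 2 * π := by linarith [Real.pi_gt_three]
    calc (1 : ℝ) * (Nat.factorial 5 : ℕ) ≤ 6 ^ 5 := by norm_num [Nat.factorial]
      _ ≤ _ := by gcongr
  calc _ ≤ Real.exp (2 * π * L) * Real.exp (-(2 * π * L)) := by gcongr; exact h3.trans h1
    _ = 1 := h2

set_option maxHeartbeats 2000000 in
/-- If the separatrix does not cross `2π` early, then the splitting is anomalously small. -/
theorem wronskian_two_sided (K : ℝ) (hK : 1 ≤ K) : ∃ A h₀ : ℝ, 0 ≤ A ∧ 0 < h₀ ∧ ∀ h α κ : ℝ, SepData K h α →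
    h < h₀ → 0 ≤ κ → (∀ t ≤ π ^ 2 / (2 * h) + Real.log h + κ, sepU h α t < 2 * π) →
    ∀ x : ℝ, -1 ≤ x → x ≤ 0 → ‖wronskian (sepD h α) (sepG h α) x‖ ≤
      A * (Real.exp (-(2 * κ)) + h) * Real.exp (-(2 * π * (π / (2 * h)))) := by
  obtain ⟨c, hc1, hSP⟩ := exists_splitPair K hK
  set C₀ := max (max 1 c) (6 * c ^ 3) with hC₀
  have hC1 : 1 ≤ C₀ := le_trans (le_max_left _ _) (le_max_left _ _)
  have hC2 : c ≤ C₀ := le_trans (le_max_right _ _) (le_max_left _ _)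
  have hC3 : 6 * c ^ 3 ≤ C₀ := le_max_right _ _
  obtain ⟨A, hA, hreal⟩ := SplitPair.real_bound c C₀ hC1 hC3
  refine ⟨400000 + (c ^ 2 + 2) * A ^ 2, min (1 / 4) (min (1 / (C₀ + 1)) (1 / (80 * (A + 1)))), by positivity,
    by positivity, fun h α κ S hh hκ hu => ?_⟩
  rw [lt_min_iff, lt_min_iff] at hh
  obtain ⟨hh1, hh2, hh3⟩ := hh
  have hpos := S.h_pos
  have hpi := Real.pi_gt_three
  have R := S.realSep
  have P := hSP h α C₀ S hC2
  set L := π / (2 * h) with hL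
  have hLh : 1 ≤ L * h := by rw [hL]; field_simp; linarith
  have hL1 : C₀ + 1 ≤ L := by
    rw [lt_div_iff₀ (by positivity)] at hh2
    by_contra! hlt
    nlinarith
  have hL0 : 1 ≤ L := by linarith
  set δ := A * L ^ 2 * Real.exp (-(2 * π * L)) with hδ
  have hb := fun x hx => hreal L _ _ _ hL1 P x hx
  have h5 := pow_five_mul_exp_le (show 0 ≤ L by linarith)
  have hδ1 : δ ≤ h / 80 := by
    rw [lt_div_iff₀ (by positivity)] at hh3
    calc δ = A * (L ^ 2 * Real.exp (-(2 * π * L))) * 1 := by rw [hδ]; ring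
      _ ≤ A * (L ^ 2 * Real.exp (-(2 * π * L))) * ((L * h) ^ 2 * (L * 1)) := by
          gcongr
          calc (1 : ℝ) = 1 ^ 2 * 1 := by norm_num
            _ ≤ _ := by gcongr; linarith
      _ = A * h ^ 2 * (L ^ 5 * Real.exp (-(2 * π * L))) := by ring
      _ ≤ A * h ^ 2 * 1 := by gcongr
      _ ≤ h / 80 := by nlinarith
  have hδ2 : δ ^ 2 ≤ A ^ 2 * h * Real.exp (-(2 * π * L)) := by
    calc δ ^ 2 = A ^ 2 * (L ^ 4 * Real.exp (-(2 * π * L))) * 1 * Real.exp (-(2 * π * L)) := by rw [hδ]; ring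
      _ ≤ A ^ 2 * (L ^ 4 * Real.exp (-(2 * π * L))) * (L * h) * Real.exp (-(2 * π * L)) := by gcongr
      _ = A ^ 2 * h * (L ^ 5 * Real.exp (-(2 * π * L))) * Real.exp (-(2 * π * L)) := by ring
      _ ≤ A ^ 2 * h * 1 * Real.exp (-(2 * π * L)) := by gcongr
      _ = _ := by ring
  set T := π ^ 2 / (2 * h) + Real.log h + κ with hT
  have hT3 : 3 ≤ T := by
    have h1 := Real.one_sub_inv_le_log_of_pos hpos
    have h2 : π ^ 2 / (2 * h) = π ^ 2 / 2 * h⁻¹ := by field_simp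
    have h3 : 4 ≤ h⁻¹ := by
      rw [le_inv_comm₀ (by norm_num) hpos]; linarith
    have h4 : 4 * h⁻¹ ≤ π ^ 2 / 2 * h⁻¹ := by gcongr; nlinarith
    rw [hT, h2]; linarith
  have hTe : h ^ 2 * Real.exp (-(2 * T)) = Real.exp (-(2 * κ)) * Real.exp (-(2 * π * L)) := by
    have : Real.exp (-(2 * T)) = Real.exp (-(2 * κ)) * Real.exp (-(2 * π * L)) * (Real.exp (Real.log h) ^ 2)⁻¹ := by
      rw [← Real.exp_nat_mul, ← Real.exp_neg, ← Real.exp_add, ← Real.exp_add, hT, hL]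
      congr 1; push_cast; field_simp; ring
    rw [this, Real.exp_log hpos]; field_simp
  have hWr : ∀ x : ℝ, wronskian (sepD h α) (sepG h α) x = ((h * ((2 * π - sepU h α (h * x + h) - sepU h α (-(h * x + h))) *
      sepV h α (-(h * x)) - (2 * π - sepU h α (h * x) - sepU h α (-(h * x))) * sepV h α (-(h * x + h))) : ℝ) : ℂ) := by
    intro x
    have : (x : ℂ) + 1 = ((x + 1 : ℝ) : ℂ) := by push_cast; rfl
    rw [wronskian, this, sepD_ofReal, sepD_ofReal, sepG_ofReal, sepG_ofReal, show h * (x + 1) = h * x + h by ring]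
    push_cast; ring
  have hWreal : ∀ x : ℝ, wronskian (sepD h α) (sepG h α) x = ((wronskian (sepD h α) (sepG h α) x).re : ℂ) := by
    intro x; rw [hWr, Complex.ofReal_re]
  have lower0 : ∀ x : ℝ, 0 ≤ x → x ≤ 1 → -(400000 * (Real.exp (-(2 * κ)) * Real.exp (-(2 * π * L)))) ≤
      (wronskian (sepD h α) (sepG h α) x).re := by
    intro x h0 h1
    have hD := (hb x (by rw [abs_le]; constructor <;> linarith)).1
    rw [sepD_ofReal, Complex.norm_real, Real.norm_eq_abs] at hD
    have := R.wronskian_lower hh1.le hT3 hu (t := h * x) (by positivity) (by nlinarith) (hD.trans hδ1)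
    rw [hWr, Complex.ofReal_re]
    have := mul_le_mul_of_nonneg_left this hpos.le
    rw [← hTe]; linarith
  have lower1 : ∀ x : ℝ, -1 ≤ x → x ≤ 0 → -(400000 * (Real.exp (-(2 * κ)) * Real.exp (-(2 * π * L)))) - c ^ 2 * δ ^ 2 ≤
      (wronskian (sepD h α) (sepG h α) x).re := by
    intro x h0 h1
    have i1 := lower0 (x + 1) (by linarith) (by linarith)
    have i2 := P.wronskian_step ((x + 1 : ℝ) : ℂ)
    have hx : |x + 1| ≤ 1 := by rw [abs_le]; constructor <;> linarith
    have i3 := P.norm_GR_le (by linarith) hC1 (s := ((x + 1 : ℝ) : ℂ)) (by rw [Complex.ofReal_re]; linarith)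
      (by rw [Complex.ofReal_im]; simp; linarith)
    have i4 := (hb (x + 1) hx).1
    have i5 : ‖sepG h α ((x + 1 : ℝ) : ℂ) * sepR h α ((x + 1 : ℝ) : ℂ)‖ ≤ c ^ 2 * δ ^ 2 := by
      refine i3.trans ?_
      rw [Complex.ofReal_im, abs_zero, sub_zero]
      gcongr
      exact div_le_self (by positivity) (one_le_pow₀ hL0)
    rw [← i2, show (((x + 1 : ℝ) : ℂ) - 1) = (x : ℂ) by push_cast; ring] at i5
    have i6 := (Complex.abs_re_le_norm _).trans i5
    rw [Complex.sub_re, abs_le] at i6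
    linarith
  intro x h0 h1
  have l1 := lower1 x h0 h1
  have l2 := lower1 (-x - 1) (by linarith) (by linarith)
  have hrev := congrArg Complex.re (wronskian_reverse hpos α x)
  rw [Complex.add_re, Complex.neg_re, show -(x : ℂ) - 1 = ((-x - 1 : ℝ) : ℂ) by push_cast; ring] at hrev
  have hx1 : |x| ≤ 1 := by rw [abs_le]; constructor <;> linarith
  have hx2 : |x + 1| ≤ 1 := by rw [abs_le]; constructor <;> linarith
  obtain ⟨a1, a2⟩ := hb x hx1
  obtain ⟨a3, a4⟩ := hb (x + 1) hx2
  have i7 : ‖sepD h α (x + 1) * deriv (sepD h α) x - sepD h α x * deriv (sepD h α) (x + 1)‖ ≤ 2 * δ ^ 2 := by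
    have e : (x : ℂ) + 1 = ((x + 1 : ℝ) : ℂ) := by push_cast; rfl
    rw [e]
    refine (norm_sub_le _ _).trans ?_
    rw [norm_mul, norm_mul]
    calc _ ≤ δ * δ + δ * δ := by gcongr
      _ = _ := by ring
  have i8 := (Complex.abs_re_le_norm _).trans i7
  rw [abs_le] at i8
  rw [hWreal, Complex.norm_real, Real.norm_eq_abs]
  have hE := Real.exp_pos (-(2 * π * L))
  have hfin : (c ^ 2 + 2) * δ ^ 2 ≤ (c ^ 2 + 2) * (A ^ 2 * h * Real.exp (-(2 * π * L))) := by gcongr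
  have hfin2 : 400000 * (Real.exp (-(2 * κ)) * Real.exp (-(2 * π * L))) +
      (c ^ 2 + 2) * (A ^ 2 * h * Real.exp (-(2 * π * L))) ≤ (400000 + (c ^ 2 + 2) * A ^ 2) *
      (Real.exp (-(2 * κ)) + h) * Real.exp (-(2 * π * L)) := by
    have q2 : 0 ≤ (c ^ 2 + 2) * A ^ 2 * Real.exp (-(2 * κ)) * Real.exp (-(2 * π * L)) := by positivity
    nlinarith
  rw [abs_le]
  constructor <;> linarith

/-- The convolution corresponding, under the Borel transform, to a product. -/
def mellinConv (f g : ℂ → ℂ) (p : ℂ) : ℂ := 1 / 2 * ∫ s in (0 : ℝ)..1, f (p * s) * g (p * (1 - s))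

lemma differentiableOn_mellinConv {R : ℝ} {f g : ℂ → ℂ} (hf : DifferentiableOn ℂ f (Metric.ball 0 R))
    (hg : DifferentiableOn ℂ g (Metric.ball 0 R)) : DifferentiableOn ℂ (mellinConv f g) (Metric.ball 0 R) := by
  intro p hp
  rw [mem_ball_zero_iff] at hp
  obtain ⟨r, hpr, hrR⟩ := exists_between hp
  have hsub : Metric.closedBall (0 : ℂ) r ⊆ Metric.ball 0 R := Metric.closedBall_subset_ball hrR
  have key : ∀ {F : ℂ → ℂ}, DifferentiableOn ℂ F (Metric.ball 0 R) → ∃ C, ∀ z ∈ Metric.closedBall (0 : ℂ) r,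
      ‖F z‖ ≤ C ∧ ‖deriv F z‖ ≤ C := by
    intro F hF
    obtain ⟨C1, h1⟩ := (isCompact_closedBall (0 : ℂ) r).exists_bound_of_continuousOn (hF.continuousOn.mono hsub)
    obtain ⟨C2, h2⟩ := (isCompact_closedBall (0 : ℂ) r).exists_bound_of_continuousOn
      ((hF.deriv Metric.isOpen_ball).continuousOn.mono hsub)
    exact ⟨max C1 C2, fun z hz => ⟨(h1 z hz).trans (le_max_left _ _), (h2 z hz).trans (le_max_right _ _)⟩⟩
  obtain ⟨Cf, hCf⟩ := key hf
  obtain ⟨Cg, hCg⟩ := key hg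
  have m1 : ∀ q ∈ Metric.ball (0 : ℂ) r, ∀ s ∈ Icc (0 : ℝ) 1, q * s ∈ Metric.closedBall (0 : ℂ) r ∧
      q * (1 - s) ∈ Metric.closedBall (0 : ℂ) r := by
    intro q hq s hs
    rw [mem_ball_zero_iff] at hq
    rw [mem_closedBall_zero_iff, mem_closedBall_zero_iff, norm_mul, norm_mul, ← Complex.ofReal_one,
      ← Complex.ofReal_sub, Complex.norm_real, Complex.norm_real, Real.norm_eq_abs, Real.norm_eq_abs,
      abs_of_nonneg hs.1, abs_of_nonneg (sub_nonneg.2 hs.2)]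
    constructor <;> nlinarith [hs.1, hs.2, norm_nonneg q]
  have cts : ∀ {F : ℂ → ℂ}, ContinuousOn F (Metric.ball 0 R) → ∀ q ∈ Metric.ball (0 : ℂ) r,
      ContinuousOn (fun s : ℝ => F (q * s)) (Icc 0 1) ∧ ContinuousOn (fun s : ℝ => F (q * (1 - s))) (Icc 0 1) :=
    fun hF q hq => ⟨hF.comp (by fun_prop) fun s hs => hsub (m1 q hq s hs).1,
      hF.comp (by fun_prop) fun s hs => hsub (m1 q hq s hs).2⟩
  have hpr' : p ∈ Metric.ball (0 : ℂ) r := mem_ball_zero_iff.2 hpr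
  have hd : ∀ {F : ℂ → ℂ}, DifferentiableOn ℂ F (Metric.ball 0 R) → ∀ z ∈ Metric.closedBall (0 : ℂ) r,
      HasDerivAt F (deriv F z) z := fun hF z hz =>
    (hF.differentiableAt (Metric.isOpen_ball.mem_nhds (hsub hz))).hasDerivAt
  have hI : Ioc (0 : ℝ) 1 ⊆ Icc 0 1 := Ioc_subset_Icc_self
  have main := intervalIntegral.hasDerivAt_integral_of_dominated_loc_of_deriv_le (μ := MeasureTheory.volume)
    (F := fun (q : ℂ) (s : ℝ) => f (q * s) * g (q * (1 - s)))
    (F' := fun (q : ℂ) (s : ℝ) => deriv f (q * s) * s * g (q * (1 - s)) + f (q * s) * (deriv g (q * (1 - s)) * (1 - s)))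
    (a := (0 : ℝ)) (b := 1) (bound := fun _ => Cf * Cg + Cf * Cg) (x₀ := p)
    (Metric.isOpen_ball.mem_nhds hpr') ?_ ?_ ?_ ?_ ?_ ?_
  · exact (main.2.differentiableAt.const_mul _).differentiableWithinAt
  · filter_upwards [Metric.isOpen_ball.mem_nhds hpr'] with q hq
    rw [uIoc_of_le zero_le_one]
    exact (((cts hf.continuousOn q hq).1.mul (cts hg.continuousOn q hq).2).mono hI).aestronglyMeasurable measurableSet_Ioc
  · refine ContinuousOn.intervalIntegrable ?_
    rw [uIcc_of_le zero_le_one]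
    exact (cts hf.continuousOn p hpr').1.mul (cts hg.continuousOn p hpr').2
  · rw [uIoc_of_le zero_le_one]
    have c1 := cts (hf.deriv Metric.isOpen_ball).continuousOn p hpr'
    have c2 := cts (hg.deriv Metric.isOpen_ball).continuousOn p hpr'
    refine ((((c1.1.mul (by fun_prop)).mul (cts hg.continuousOn p hpr').2).add
      ((cts hf.continuousOn p hpr').1.mul (c2.2.mul (by fun_prop)))).mono hI).aestronglyMeasurable measurableSet_Ioc
  · refine Eventually.of_forall fun s hs q hq => ?_
    rw [uIoc_of_le zero_le_one] at hs
    obtain ⟨b1, b2⟩ := m1 q hq s (hI hs)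
    have hs1 : ‖(s : ℂ)‖ ≤ 1 := by
      rw [Complex.norm_real, Real.norm_eq_abs, abs_le]; constructor <;> linarith [hs.1, hs.2]
    have hs2 : ‖(1 - s : ℂ)‖ ≤ 1 := by
      rw [← Complex.ofReal_one, ← Complex.ofReal_sub, Complex.norm_real, Real.norm_eq_abs, abs_le]
      constructor <;> linarith [hs.1, hs.2]
    have p1 := hCf _ b1
    have p2 := hCg _ b2
    have hCf0 : 0 ≤ Cf := (norm_nonneg _).trans p1.1
    refine (norm_add_le _ _).trans ?_
    rw [norm_mul, norm_mul, norm_mul, norm_mul]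
    gcongr
    · calc ‖deriv f (q * s)‖ * ‖(s : ℂ)‖ ≤ Cf * 1 := by gcongr; exact p1.2
        _ = Cf := mul_one _
    · exact p2.1
    · exact p1.1
    · calc ‖deriv g (q * (1 - s))‖ * ‖(1 - s : ℂ)‖ ≤ Cg * 1 := by gcongr; exacts [(norm_nonneg _).trans p2.1, p2.2]
        _ = Cg := mul_one _
  · exact intervalIntegrable_const
  · refine Eventually.of_forall fun s hs q hq => ?_
    rw [uIoc_of_le zero_le_one] at hs
    obtain ⟨b1, b2⟩ := m1 q hq s (hI hs)
    have i1 : HasDerivAt (fun q : ℂ => q * s) s q := by simpa using (hasDerivAt_id q).mul_const (s : ℂ)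
    have i2 : HasDerivAt (fun q : ℂ => q * (1 - s)) (1 - s) q := by
      simpa using (hasDerivAt_id q).mul_const (1 - s : ℂ)
    exact ((hd hf _ b1).comp q i1).mul ((hd hg _ b2).comp q i2)

/-- The real version of `mellinConv`. -/
def mellinConvReal (f g : ℝ → ℝ) (p : ℝ) : ℝ := 1 / 2 * ∫ s in (0 : ℝ)..1, f (p * s) * g (p * (1 - s))

/-- The entire function `4 sinh² (z / 2) / z`. -/
def sinhQuot : ℂ → ℂ := dslope (fun z => 4 * Complex.sinh (z / 2) ^ 2) 0

lemma differentiable_sinhQuot : Differentiable ℂ sinhQuot := by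
  have h : Differentiable ℂ (fun z : ℂ => 4 * Complex.sinh (z / 2) ^ 2) := by fun_prop
  exact differentiableOn_univ.1 ((Complex.differentiableOn_dslope univ_mem).2 h.differentiableOn)

lemma sinhQuot_zero : sinhQuot 0 = 0 := by
  have h : HasDerivAt (fun z : ℂ => 4 * Complex.sinh (z / 2) ^ 2) 0 0 := by
    have h1 : HasDerivAt (fun z : ℂ => z / 2) (1 / 2) 0 := (hasDerivAt_id _).div_const 2
    exact ((((Complex.hasDerivAt_sinh _).comp _ h1).pow 2).const_mul 4).congr_deriv (by simp)
  rw [sinhQuot, dslope_same, h.deriv]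

lemma sinhQuot_of_ne {z : ℂ} (hz : z ≠ 0) : sinhQuot z = 4 * Complex.sinh (z / 2) ^ 2 / z := by
  rw [sinhQuot, dslope_of_ne _ hz, slope_def_field]
  simp

lemma sinhQuot_ofReal (x : ℝ) : sinhQuot x = ((4 * Real.sinh (x / 2) ^ 2 / x : ℝ) : ℂ) := by
  rcases eq_or_ne x 0 with rfl | hx
  · simp [sinhQuot_zero]
  · rw [sinhQuot_of_ne (by exact_mod_cast hx)]; push_cast; rfl

lemma sinhQuot_I_mul (q : ℝ) : sinhQuot (Complex.I * q) = Complex.I * ((4 * Real.sin (q / 2) ^ 2 / q : ℝ) : ℂ) := by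
  rcases eq_or_ne q 0 with rfl | hx
  · simp [sinhQuot_zero]
  · have hq : (q : ℂ) ≠ 0 := by exact_mod_cast hx
    rw [sinhQuot_of_ne (mul_ne_zero Complex.I_ne_zero hq),
      show Complex.I * (q : ℂ) / 2 = (q / 2 : ℂ) * Complex.I by ring, Complex.sinh_mul_I]
    push_cast
    field_simp

lemma mellinConv_ofReal {f g : ℂ → ℂ} {f' g' : ℝ → ℝ} {p : ℝ} (hp : 0 ≤ p) (hf : ∀ x : ℝ, 0 ≤ x → x ≤ p → f x = f' x)
    (hg : ∀ x : ℝ, 0 ≤ x → x ≤ p → g x = g' x) : mellinConv f g p = mellinConvReal f' g' p := by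
  rw [mellinConv, mellinConvReal, Complex.ofReal_mul, ← intervalIntegral.integral_ofReal]
  push_cast
  congr 1
  refine intervalIntegral.integral_congr fun s hs => ?_
  rw [uIcc_of_le zero_le_one] at hs
  have e1 := hf (p * s) (by have := hs.1; positivity) (by nlinarith [hs.2])
  have e2 := hg (p * (1 - s)) (by have := sub_nonneg.2 hs.2; positivity) (by nlinarith [hs.1])
  push_cast at e1 e2
  rw [e1, e2]

lemma mellinConv_I_mul {f g : ℂ → ℂ} {f' g' : ℝ → ℝ} {p : ℝ} (hp : 0 ≤ p)
    (hf : ∀ x : ℝ, 0 ≤ x → x ≤ p → f (Complex.I * x) = f' x)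
    (hg : ∀ x : ℝ, 0 ≤ x → x ≤ p → g (Complex.I * x) = Complex.I * g' x) :
    mellinConv f g (Complex.I * p) = Complex.I * mellinConvReal f' g' p := by
  have := mellinConv_ofReal (f := fun z => f (Complex.I * z)) (g := fun z => -Complex.I * g (Complex.I * z)) hp hf
    (g' := g') (fun x h0 h1 => by rw [hg x h0 h1, ← mul_assoc]; simp)
  rw [← this, mellinConv, mellinConv, mul_left_comm, ← intervalIntegral.integral_const_mul Complex.I]
  congr 1
  refine intervalIntegral.integral_congr fun s _ => ?_
  rw [show Complex.I * ((p : ℂ) * s) = Complex.I * p * s by ring,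
    show Complex.I * ((p : ℂ) * (1 - s)) = Complex.I * p * (1 - s) by ring]
  linear_combination (f (Complex.I * p * s) * g (Complex.I * p * (1 - s))) * Complex.I_mul_I

lemma mellinConvReal_pos {f g : ℝ → ℝ} {p R : ℝ} (hf : ContinuousOn f (Ico 0 R)) (hg : ContinuousOn g (Ico 0 R)) (hp : 0 < p)
    (hR : p < R) (hf0 : ∀ x, 0 < x → x < p → 0 < f x) (hg0 : ∀ x, 0 < x → x < p → 0 < g x) :
    0 < mellinConvReal f g p := by
  refine mul_pos (by norm_num) (intervalIntegral.intervalIntegral_pos_of_pos_on ?_ (fun s hs => ?_) one_pos)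
  · refine ContinuousOn.intervalIntegrable ?_
    rw [uIcc_of_le zero_le_one]
    refine (hf.comp (by fun_prop) fun s hs => ?_).mul (hg.comp (by fun_prop) fun s hs => ?_)
    · exact ⟨mul_nonneg hp.le hs.1, by nlinarith [hs.2]⟩
    · exact ⟨mul_nonneg hp.le (sub_nonneg.2 hs.2), by nlinarith [hs.1]⟩
  · exact mul_pos (hf0 _ (mul_pos hp hs.1) (by nlinarith [hs.2]))
      (hg0 _ (mul_pos hp (sub_pos.2 hs.2)) (by nlinarith [hs.1]))

/-- The convolution equations on the imaginary axis force `m` to stay away from zero near the endpoint. -/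
lemma conv_system_lower {R : ℝ} (hR : 0 < R) (hR2 : R ≤ 2 * π) {n e : ℝ → ℝ} (hn : ContinuousOn n (Ico 0 R))
    (he : ContinuousOn e (Ico 0 R)) (hn0 : 0 < n 0)
    (h1 : ∀ q, 0 ≤ q → q < R → e q = mellinConvReal n (fun q => 4 * Real.sin (q / 2) ^ 2 / q * n q) q)
    (h2 : ∀ q, 0 ≤ q → q < R → 4 * Real.sin (q / 2) ^ 2 / q * n q = mellinConvReal n e q) :
    ∃ c, 0 < c ∧ ∀ q, R / 2 ≤ q → q < R → c ≤ 4 * Real.sin (q / 2) ^ 2 / q * n q := by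
  set k : ℝ → ℝ := fun q => 4 * Real.sin (q / 2) ^ 2 / q with hk
  have hkpos : ∀ q, 0 < q → q < R → 0 < k q := fun q h0 hq => by
    have := Real.sin_pos_of_pos_of_lt_pi (half_pos h0) (by linarith)
    rw [hk]; positivity
  have hm : ContinuousOn (fun q => k q * n q) (Ico 0 R) := by
    refine ContinuousOn.mul (Continuous.continuousOn ?_) hn
    have e : k = fun q : ℝ => (-Complex.I * sinhQuot (Complex.I * q)).re := by
      funext q
      rw [sinhQuot_I_mul, ← mul_assoc, neg_mul, Complex.I_mul_I, neg_neg, one_mul, Complex.ofReal_re]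
    rw [e]
    exact Complex.continuous_re.comp (continuous_const.mul (differentiable_sinhQuot.continuous.comp (by fun_prop)))
  have hpos : ∀ q, 0 ≤ q → q < R → 0 < n q := by
    by_contra! hcon
    obtain ⟨q1, h0, h1R, hq1⟩ := hcon
    have hcl : IsCompact (Icc 0 q1 ∩ n ⁻¹' Iic 0) :=
      isCompact_Icc.of_isClosed_subset ((hn.mono fun x hx => ⟨hx.1, hx.2.trans_lt h1R⟩).preimage_isClosed_of_isClosed
        isClosed_Icc isClosed_Iic) inter_subset_left
    obtain ⟨q0, hq0, hmin⟩ := hcl.exists_isLeast ⟨q1, ⟨h0, le_rfl⟩, hq1⟩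
    have hq0n : n q0 ≤ 0 := hq0.2
    have hq0R : q0 < R := hq0.1.2.trans_lt h1R
    have hq00 : 0 < q0 := by
      refine hq0.1.1.lt_of_ne fun h => ?_
      rw [← h] at hq0n; linarith
    have hbelow : ∀ q, 0 < q → q < q0 → 0 < n q := fun q ha hb => by
      by_contra! hq
      exact absurd (hmin ⟨⟨ha.le, hb.le.trans hq0.1.2⟩, hq⟩) (not_le.2 hb)
    have hepos : ∀ q, 0 < q → q < q0 → 0 < e q := fun q ha hb => by
      rw [h1 q ha.le (hb.trans hq0R)]
      exact mellinConvReal_pos hn hm ha (hb.trans hq0R) (fun x hx hxq => hbelow x hx (hxq.trans hb))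
        fun x hx hxq => mul_pos (hkpos x hx (hxq.trans (hb.trans hq0R))) (hbelow x hx (hxq.trans hb))
    have := mellinConvReal_pos hn he hq00 hq0R hbelow hepos
    rw [← h2 q0 hq00.le hq0R] at this
    nlinarith [hkpos q0 hq00 hq0R]
  have hepos : ∀ q, 0 < q → q < R → 0 < e q := fun q ha hb => by
    rw [h1 q ha.le hb]
    exact mellinConvReal_pos hn hm ha hb (fun x hx hxq => hpos x hx.le (hxq.trans hb))
      fun x hx hxq => mul_pos (hkpos x hx (hxq.trans hb)) (hpos x hx.le (hxq.trans hb))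
  have low : ∀ {f : ℝ → ℝ}, ContinuousOn f (Ico 0 R) → (∀ q, 0 < q → q < R → 0 < f q) →
      ∃ c, 0 < c ∧ ∀ q ∈ Icc (R / 8) (3 * R / 4), c ≤ f q := by
    intro f hf hf0
    obtain ⟨x, hx, hmin⟩ := (isCompact_Icc (a := R / 8) (b := 3 * R / 4)).exists_isMinOn
      (nonempty_Icc.2 (by linarith)) (hf.mono fun x hx => ⟨by linarith [hx.1], by linarith [hx.2]⟩)
    exact ⟨f x, hf0 x (by linarith [hx.1]) (by linarith [hx.2]), fun q hq => hmin hq⟩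
  obtain ⟨cn, hcn, hn'⟩ := low hn fun q ha hb => hpos q ha.le hb
  obtain ⟨ce, hce, he'⟩ := low he hepos
  refine ⟨1 / 2 * (cn * ce * (1 / 2 - 1 / 4)), by positivity, fun q hq1 hq2 => ?_⟩
  rw [h2 q (by linarith) hq2, mellinConvReal]
  refine mul_le_mul_of_nonneg_left ?_ (by norm_num)
  have hcts : ContinuousOn (fun s => n (q * s) * e (q * (1 - s))) (Icc 0 1) :=
    (hn.comp (by fun_prop) fun s hs => ⟨mul_nonneg (by linarith) hs.1, by nlinarith [hs.2]⟩).mul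
      (he.comp (by fun_prop) fun s hs => ⟨mul_nonneg (by linarith) (sub_nonneg.2 hs.2), by nlinarith [hs.1]⟩)
  calc cn * ce * (1 / 2 - 1 / 4) = ∫ _ in (1 / 4 : ℝ)..(1 / 2), cn * ce := by
        rw [intervalIntegral.integral_const, smul_eq_mul, mul_comm]
    _ ≤ ∫ s in (1 / 4 : ℝ)..(1 / 2), n (q * s) * e (q * (1 - s)) := by
        refine intervalIntegral.integral_mono_on (by norm_num) intervalIntegrable_const ?_ fun s hs => ?_
        · refine ContinuousOn.intervalIntegrable ?_
          rw [uIcc_of_le (by norm_num)]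
          exact hcts.mono fun s hs => ⟨by linarith [hs.1], by linarith [hs.2]⟩
        · exact mul_le_mul (hn' _ ⟨by nlinarith [hs.1, hs.2], by nlinarith [hs.1, hs.2]⟩)
            (he' _ ⟨by nlinarith [hs.1, hs.2], by nlinarith [hs.1, hs.2]⟩) hce.le
            (hpos _ (by nlinarith [hs.1]) (by nlinarith [hs.2])).le
    _ ≤ _ := by
        refine intervalIntegral.integral_mono_interval (by norm_num) (by norm_num) (by norm_num) ?_ ?_
        · filter_upwards [MeasureTheory.ae_restrict_mem measurableSet_Ioc,
            MeasureTheory.ae_restrict_of_ae (MeasureTheory.compl_mem_ae_iff.2 (MeasureTheory.measure_singleton (1 : ℝ)))] with s hs hs1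
          have h1 : s < 1 := hs.2.lt_of_ne hs1
          exact (mul_pos (hpos _ (by nlinarith [hs.1]) (by nlinarith))
            (hepos _ (by nlinarith) (by nlinarith [hs.1]))).le
        · refine ContinuousOn.intervalIntegrable ?_
          rwa [uIcc_of_le zero_le_one]

/-- The generating series `4 + (2/π) ∑ Mₖ y^(k+1)` of a sequence of moments. -/
def momSeries (M : ℕ → ℝ) (y : ℝ) : ℝ := 4 + 2 / π * ∑' k, M k * y ^ (k + 1)

/-- The complex version of `momSeries`. -/
def momSeriesC (M : ℕ → ℝ) (y : ℂ) : ℂ := 4 + 2 / π * ∑' k, (M k : ℂ) * y ^ (k + 1)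

lemma momSeriesC_ofReal (M : ℕ → ℝ) (y : ℝ) : momSeriesC M y = momSeries M y := by
  rw [momSeriesC, momSeries]
  push_cast
  rfl

lemma differentiableOn_momSeriesC {M : ℕ → ℝ} {A R : ℝ} (hR : 0 < R) (hM : ∀ k, |M k| ≤ A / R ^ (k + 1)) :
    DifferentiableOn ℂ (momSeriesC M) (Metric.ball 0 R) := by
  intro y hy
  rw [mem_ball_zero_iff] at hy
  obtain ⟨r, h1, h2⟩ := exists_between hy
  have hr : 0 < r := (norm_nonneg _).trans_lt h1
  have hs : Summable fun k : ℕ => A * (r / R) * (r / R) ^ k :=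
    (summable_geometric_of_lt_one (by positivity) ((div_lt_one hR).2 h2)).mul_left _
  have := Complex.differentiableOn_tsum_of_summable_norm (F := fun k y => (M k : ℂ) * y ^ (k + 1)) hs
    (fun k => by fun_prop) Metric.isOpen_ball (U := Metric.ball 0 r) (fun k w hw => by
      rw [mem_ball_zero_iff] at hw
      rw [norm_mul, norm_pow, Complex.norm_real, Real.norm_eq_abs]
      calc |M k| * ‖w‖ ^ (k + 1) ≤ A / R ^ (k + 1) * r ^ (k + 1) := by
            gcongr
            · exact (abs_nonneg _).trans (hM k)
            · exact hM k
        _ = _ := by rw [mul_assoc, ← pow_succ', div_pow]; ring)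
  exact ((this.differentiableAt (Metric.isOpen_ball.mem_nhds (mem_ball_zero_iff.2 h1))).const_mul
    (2 / π : ℂ)|>.const_add 4).differentiableWithinAt

lemma abs_momSeries_le {M : ℕ → ℝ} {A R y : ℝ} (hR : 0 < R) (hM : ∀ k, |M k| ≤ A / R ^ (k + 1)) (hy : 0 ≤ y) (hyR : y < R) :
    |momSeries M y| ≤ 4 + A / (1 - y / R) := by
  have hA : 0 ≤ A := by
    have := (abs_nonneg _).trans (hM 0)
    rwa [le_div_iff₀ (by positivity), zero_mul] at this
  have hq := (div_lt_one hR).2 hyR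
  have hs := (hasSum_geometric_of_lt_one (show 0 ≤ y / R by positivity) hq).mul_left A
  have : ‖∑' k, M k * y ^ (k + 1)‖ ≤ A * (1 - y / R)⁻¹ := by
    refine tsum_of_norm_bounded hs fun k => ?_
    rw [norm_mul, norm_pow, Real.norm_eq_abs, Real.norm_eq_abs, abs_of_nonneg hy]
    calc |M k| * y ^ (k + 1) ≤ A / R ^ (k + 1) * y ^ (k + 1) := by gcongr; exact hM k
      _ = A * (y / R) ^ k * (y / R) := by rw [mul_assoc, ← pow_succ, div_pow]; ring
      _ ≤ A * (y / R) ^ k * 1 := by gcongr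
      _ = _ := mul_one _
  rw [momSeries]
  refine (abs_add_le _ _).trans ?_
  rw [abs_mul, abs_of_pos (show (0 : ℝ) < 2 / π by positivity), abs_of_pos (by norm_num : (0 : ℝ) < 4)]
  have h2 : 2 / π ≤ 1 := by rw [div_le_one Real.pi_pos]; linarith [Real.pi_gt_three]
  have := mul_le_mul h2 this (norm_nonneg _) zero_le_one
  rw [one_mul, ← div_eq_mul_inv] at this
  rw [Real.norm_eq_abs] at this
  linarith

set_option maxHeartbeats 1000000 in
/-- The limiting convolution system has no solution with as weak a singularity as the decay of the
moments would give. -/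
theorem momSeries_ne {M : ℕ → ℝ} {A : ℝ} (hM : ∀ k, |M k| ≤ A / ((2 * π) ^ 2) ^ (k + 1)) (N m : ℝ → ℝ)
    (hN : N = fun x => momSeries M (-x ^ 2)) (hm : m = fun x => 4 * Real.sinh (x / 2) ^ 2 / x * N x)
    (H : ∀ x, 0 < x → x < 1 → m x = mellinConvReal N (mellinConvReal N m) x) : False := by
  have hpi := Real.pi_gt_three
  have hR : 0 < (2 * π) ^ 2 := by positivity
  set B := Metric.ball (0 : ℂ) (2 * π) with hB
  set ν : ℂ → ℂ := fun z => momSeriesC M (-z ^ 2) with hν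
  have dν : DifferentiableOn ℂ ν B := by
    refine (differentiableOn_momSeriesC hR hM).comp (by fun_prop) fun z hz => ?_
    rw [hB, mem_ball_zero_iff] at hz
    rw [mem_ball_zero_iff, norm_neg, norm_pow]
    gcongr
  set μ : ℂ → ℂ := fun z => sinhQuot z * ν z with hμ
  have dμ : DifferentiableOn ℂ μ B := differentiable_sinhQuot.differentiableOn.mul dν
  have dE := differentiableOn_mellinConv dν dμ
  have dG := differentiableOn_mellinConv dν dE
  have ν_real : ∀ x : ℝ, ν x = N x := fun x => by
    rw [hν, hN]
    simp only
    rw [← momSeriesC_ofReal]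
    push_cast; rfl
  have μ_real : ∀ x : ℝ, μ x = m x := fun x => by
    rw [hμ, hm]
    simp only
    rw [ν_real, sinhQuot_ofReal, Complex.ofReal_mul]
  have key : EqOn μ (mellinConv ν (mellinConv ν μ)) B := by
    refine (dμ.analyticOnNhd Metric.isOpen_ball).eqOn_of_preconnected_of_frequently_eq
      (dG.analyticOnNhd Metric.isOpen_ball) (convex_ball _ _).isPreconnected
      (Metric.mem_ball_self (by positivity)) (z₀ := 0) ?_
    have ht : Tendsto (fun n : ℕ => ((1 / ((n : ℝ) + 1 + 1) : ℝ) : ℂ)) atTop (𝓝[≠] 0) := by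
      refine tendsto_nhdsWithin_iff.2 ⟨?_, Eventually.of_forall fun n => ?_⟩
      · rw [← Complex.ofReal_zero]
        refine (Complex.continuous_ofReal.tendsto 0).comp ?_
        have := (tendsto_one_div_add_atTop_nhds_zero_nat (𝕜 := ℝ)).comp (tendsto_add_atTop_nat 1)
        simpa [Function.comp_def] using this
      · have : (1 / ((n : ℝ) + 1 + 1) : ℝ) ≠ 0 := by positivity
        exact Complex.ofReal_ne_zero.2 this
    refine ht.frequently (Frequently.of_forall fun n => ?_)
    have hx0 : 0 < 1 / ((n : ℝ) + 1 + 1) := by positivity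
    have hx1 : 1 / ((n : ℝ) + 1 + 1) < 1 := by
      rw [div_lt_one (by positivity)]
      have : (0 : ℝ) ≤ n := n.cast_nonneg
      linarith
    generalize 1 / ((n : ℝ) + 1 + 1) = x at *
    rw [μ_real, H x hx0 hx1]
    exact (mellinConv_ofReal hx0.le (fun y _ _ => ν_real y) fun y hy _ =>
      mellinConv_ofReal hy (fun y _ _ => ν_real y) fun y _ _ => μ_real y).symm
  set n : ℝ → ℝ := fun q => momSeries M (q ^ 2) with hn
  set k : ℝ → ℝ := fun q => 4 * Real.sin (q / 2) ^ 2 / q * n q with hk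
  have ν_im : ∀ q : ℝ, ν (Complex.I * q) = n q := fun q => by
    rw [hν, hn]
    simp only
    rw [← momSeriesC_ofReal, mul_pow, Complex.I_sq]
    push_cast; congr 1; ring
  have μ_im : ∀ q : ℝ, μ (Complex.I * q) = Complex.I * k q := fun q => by
    rw [hμ, hk]
    simp only
    rw [ν_im, sinhQuot_I_mul, Complex.ofReal_mul, mul_assoc]
  set e := mellinConvReal n k with he
  have E_im : ∀ q : ℝ, 0 ≤ q → mellinConv ν μ (Complex.I * q) = Complex.I * e q := fun q hq =>
    mellinConv_I_mul hq (fun y _ _ => ν_im y) fun y _ _ => μ_im y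
  have G_im : ∀ q : ℝ, 0 ≤ q → mellinConv ν (mellinConv ν μ) (Complex.I * q) = Complex.I * mellinConvReal n e q :=
    fun q hq => mellinConv_I_mul hq (fun y _ _ => ν_im y) fun y hy _ => E_im y hy
  have maps : ∀ q ∈ Ico (0 : ℝ) (2 * π), Complex.I * (q : ℂ) ∈ B := fun q hq => by
    rw [hB, mem_ball_zero_iff, norm_mul, Complex.norm_I, one_mul, Complex.norm_real, Real.norm_eq_abs,
      abs_of_nonneg hq.1]
    exact hq.2
  have cn : ContinuousOn n (Ico 0 (2 * π)) := by
    refine (Complex.continuous_re.comp_continuousOn (dν.continuousOn.comp (by fun_prop) maps)).congr fun q _ => ?_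
    simp only [Function.comp]
    rw [ν_im, Complex.ofReal_re]
  have ce : ContinuousOn e (Ico 0 (2 * π)) := by
    refine (Complex.continuous_im.comp_continuousOn (dE.continuousOn.comp (by fun_prop) maps)).congr fun q hq => ?_
    simp only [Function.comp]
    rw [E_im q hq.1]
    simp
  obtain ⟨c, hc, hlow⟩ := conv_system_lower (by positivity) le_rfl cn ce (by simp [hn, momSeries])
    (fun q _ _ => rfl) (fun q h0 h1 => by
      have := key (maps q ⟨h0, h1⟩)
      rw [μ_im, G_im q h0] at this
      exact_mod_cast mul_left_cancel₀ Complex.I_ne_zero this)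
  have hA : 0 ≤ A := by
    have := (abs_nonneg _).trans (hM 0)
    rwa [le_div_iff₀ (by positivity), zero_mul] at this
  set t := min 1 (c / (32 * (4 + A * π))) with ht
  have ht0 : 0 < t := by positivity
  have ht1 : t ≤ 1 := min_le_left _ _
  have ht2 : t * (32 * (4 + A * π)) ≤ c := by
    rw [← le_div_iff₀ (by positivity)]; exact min_le_right _ _
  have l := hlow (2 * π - 2 * t) (by linarith) (by linarith)
  have hn1 := abs_momSeries_le hR hM (sq_nonneg (2 * π - 2 * t)) (by gcongr <;> linarith)
  have hfrac : t / π ≤ 1 - (2 * π - 2 * t) ^ 2 / (2 * π) ^ 2 := by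
    rw [div_le_iff₀ Real.pi_pos]
    have : (1 - (2 * π - 2 * t) ^ 2 / (2 * π) ^ 2) * π = 2 * t - t * (t / π) := by field_simp; ring
    have h3 : t / π ≤ 1 := by rw [div_le_one Real.pi_pos]; linarith
    rw [this]; nlinarith
  have hn2 : n (2 * π - 2 * t) ≤ 4 + A * π / t := by
    refine (le_abs_self _).trans (hn1.trans ?_)
    have : A * π / t = A / (t / π) := by field_simp
    rw [this]
    gcongr
  have hsin : Real.sin ((2 * π - 2 * t) / 2) ^ 2 ≤ t ^ 2 := by
    rw [show (2 * π - 2 * t) / 2 = π - t by ring, Real.sin_pi_sub]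
    have := Real.sin_nonneg_of_nonneg_of_le_pi ht0.le (by linarith)
    gcongr
    exact Real.sin_le ht0.le
  have hfin : 4 * Real.sin ((2 * π - 2 * t) / 2) ^ 2 / (2 * π - 2 * t) * n (2 * π - 2 * t) ≤
      4 * t ^ 2 / 1 * (4 + A * π / t) := by
    refine (mul_le_mul_of_nonneg_left hn2 ?_).trans ?_
    · have : 0 ≤ 2 * π - 2 * t := by linarith
      positivity
    · gcongr
      linarith
  have : 4 * t ^ 2 / 1 * (4 + A * π / t) = t * (16 * t + 4 * (A * π)) := by field_simp; ring
  rw [this] at hfin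
  nlinarith

lemma integral_floor (F : ℕ → ℝ) (m : ℕ) (hm : 0 < m) :
    ∫ s in (0 : ℝ)..1, F ⌊(m : ℝ) * s⌋₊ = 1 / m * ∑ i ∈ Finset.range m, F i := by
  have hm' : (m : ℝ) ≠ 0 := by positivity
  rw [intervalIntegral.integral_comp_mul_left (fun x => F ⌊x⌋₊) hm', mul_zero, mul_one, smul_eq_mul, one_div]
  congr 1
  have hc : ∀ i : ℕ, EqOn (fun _ : ℝ => F i) (fun x : ℝ => F ⌊x⌋₊) (Ico (i : ℝ) (i + 1 : ℕ)) := fun i x hx => by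
    have : ⌊x⌋₊ = i := Nat.floor_eq_on_Ico i x (by exact_mod_cast hx)
    simp only [this]
  have hne : ∀ a : ℝ, ∀ᵐ x : ℝ, x ≠ a := fun a =>
    MeasureTheory.compl_mem_ae_iff.2 (MeasureTheory.measure_singleton a)
  have hae : ∀ i : ℕ, ∀ᵐ x : ℝ, x ∈ uIoc (i : ℝ) (i + 1 : ℕ) → F i = F ⌊x⌋₊ := fun i => by
    filter_upwards [hne ((i + 1 : ℕ) : ℝ)] with x hx hx'
    rw [uIoc_of_le (by exact_mod_cast Nat.le_succ i)] at hx'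
    exact hc i ⟨hx'.1.le, hx'.2.lt_of_ne hx⟩
  have hinteg : ∀ i : ℕ, IntervalIntegrable (fun x : ℝ => F ⌊x⌋₊) MeasureTheory.volume (i : ℝ) (i + 1 : ℕ) := fun i =>
    (intervalIntegrable_const (c := F i)).congr_ae ((MeasureTheory.ae_restrict_iff' measurableSet_uIoc).2 (hae i))
  have := intervalIntegral.sum_integral_adjacent_intervals (μ := MeasureTheory.volume) (a := fun i : ℕ => (i : ℝ))
    (n := m) (fun k _ => hinteg k)
  rw [Nat.cast_zero] at this
  rw [← this]
  refine Finset.sum_congr rfl fun i _ => ?_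
  rw [← intervalIntegral.integral_congr_ae (hae i), intervalIntegral.integral_const]
  simp

/-- The discrete convolution over odd indices. -/
def oddAvg (a b : ℕ → ℝ) (n : ℕ) : ℝ := 1 / n * ∑ i ∈ Finset.range (n / 2), a (2 * i + 1) * b (n - (2 * i + 1))

/-- Bounded arrays converging continuously to `f` along the lattices of mesh `h j`. -/
def ContConv (h : ℕ → ℝ) (a : ℕ → ℕ → ℝ) (f : ℝ → ℝ) : Prop :=
  (∃ C, 0 ≤ C ∧ ∀ j k : ℕ, k * h j ≤ 1 → |a j k| ≤ C) ∧
  ∀ (k : ℕ → ℕ) (x : ℝ), 0 < x → x < 1 → Tendsto (fun j => k j * h j) atTop (𝓝 x) →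
    Tendsto (fun j => a j (k j)) atTop (𝓝 (f x))

lemma ContConv.conv {h : ℕ → ℝ} {a b : ℕ → ℕ → ℝ} {f g : ℝ → ℝ} (hh : ∀ j, 0 < h j) (hlim : Tendsto h atTop (𝓝 0))
    (ha : ContConv h a f) (hb : ContConv h b g) :
    ContConv h (fun j => oddAvg (a j) (b j)) (mellinConvReal f g) := by
  obtain ⟨⟨C, hC, haC⟩, ha⟩ := ha
  obtain ⟨⟨D, hD, hbD⟩, hb⟩ := hb
  have bd : ∀ j n i : ℕ, n * h j ≤ 1 → i < n / 2 → |a j (2 * i + 1) * b j (n - (2 * i + 1))| ≤ C * D := by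
    intro j n i hn hi
    have e1 : 2 * i + 1 ≤ n := by omega
    have e2 : ∀ k ≤ n, (k : ℝ) * h j ≤ 1 := fun k hk =>
      le_trans (mul_le_mul_of_nonneg_right (by exact_mod_cast hk) (hh j).le) hn
    rw [abs_mul]
    exact mul_le_mul (haC _ _ (e2 _ e1)) (hbD _ _ (e2 _ (by omega))) (abs_nonneg _) hC
  refine ⟨⟨C * D, by positivity, fun j n hn => ?_⟩, fun n x hx0 hx1 hn => ?_⟩
  · beta_reduce
    rw [oddAvg, abs_mul, abs_of_nonneg (by positivity)]
    rcases Nat.eq_zero_or_pos n with rfl | hn0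
    · simp; positivity
    calc 1 / (n : ℝ) * |∑ i ∈ Finset.range (n / 2), a j (2 * i + 1) * b j (n - (2 * i + 1))| ≤
          1 / (n : ℝ) * ∑ i ∈ Finset.range (n / 2), C * D := by
          gcongr
          exact (Finset.abs_sum_le_sum_abs _ _).trans
            (Finset.sum_le_sum fun i hi => bd j n i hn (Finset.mem_range.1 hi))
      _ = ((n / 2 : ℕ) : ℝ) / n * (C * D) := by
          rw [Finset.sum_const, Finset.card_range, nsmul_eq_mul]; ring
      _ ≤ 1 * (C * D) := by
          gcongr
          rw [div_le_one (by positivity)]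
          exact_mod_cast Nat.div_le_self _ _
      _ = C * D := one_mul _
  · have hev1 : ∀ᶠ j in atTop, (n j : ℝ) * h j ≤ 1 := (hn.eventually_lt_const hx1).mono fun _ => le_of_lt
    have hm2 : ∀ j, 2 * ((n j / 2 : ℕ) : ℝ) ≤ n j ∧ (n j : ℝ) ≤ 2 * ((n j / 2 : ℕ) : ℝ) + 1 := fun j =>
      ⟨by exact_mod_cast Nat.mul_div_le (n j) 2, by
        have : n j ≤ 2 * (n j / 2) + 1 := by omega
        exact_mod_cast this⟩
    have hm : Tendsto (fun j => ((n j / 2 : ℕ) : ℝ) * h j) atTop (𝓝 (x / 2)) := by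
      have h1 : Tendsto (fun j => ((n j : ℝ) * h j - h j) / 2) atTop (𝓝 ((x - 0) / 2)) := (hn.sub hlim).div_const 2
      rw [sub_zero] at h1
      refine tendsto_of_tendsto_of_tendsto_of_le_of_le h1 (hn.div_const 2) (fun j => ?_) fun j => ?_
      · have := mul_le_mul_of_nonneg_right (hm2 j).2 (hh j).le
        simp only; linarith
      · have := mul_le_mul_of_nonneg_right (hm2 j).1 (hh j).le
        simp only; linarith
    have hev2 : ∀ᶠ j in atTop, 0 < n j / 2 := by
      filter_upwards [hm.eventually_const_lt (half_pos hx0)] with j hj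
      rcases Nat.eq_zero_or_pos (n j / 2) with h0 | h0
      · rw [h0] at hj; simp at hj
      · exact h0
    have hratio : Tendsto (fun j => ((n j / 2 : ℕ) : ℝ) / n j) atTop (𝓝 (1 / 2)) := by
      have := hm.div hn hx0.ne'
      rw [show x / 2 / x = 1 / 2 by field_simp] at this
      exact this.congr fun j => mul_div_mul_right _ _ (hh j).ne'
    set F : ℕ → ℝ → ℝ := fun j s => a j (2 * ⌊((n j / 2 : ℕ) : ℝ) * s⌋₊ + 1) *
      b j (n j - (2 * ⌊((n j / 2 : ℕ) : ℝ) * s⌋₊ + 1)) with hF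
    have hne : ∀ᵐ s : ℝ, s ≠ 1 := MeasureTheory.compl_mem_ae_iff.2 (MeasureTheory.measure_singleton _)
    have hfl : ∀ j, 0 < n j / 2 → ∀ s : ℝ, s < 1 → ⌊((n j / 2 : ℕ) : ℝ) * s⌋₊ < n j / 2 := fun j hj s hs => by
      rw [Nat.floor_lt' hj.ne']
      have : (0 : ℝ) < (n j / 2 : ℕ) := by exact_mod_cast hj
      nlinarith
    have main : Tendsto (fun j => ∫ s in (0 : ℝ)..1, F j s) atTop (𝓝 (∫ s in (0 : ℝ)..1, f (x * s) * g (x * (1 - s)))) := by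
      refine intervalIntegral.tendsto_integral_filter_of_dominated_convergence (fun _ => C * D) ?_ ?_
        intervalIntegrable_const ?_
      · refine Eventually.of_forall fun j => Measurable.aestronglyMeasurable ?_
        have : Measurable fun s : ℝ => ⌊((n j / 2 : ℕ) : ℝ) * s⌋₊ := Nat.measurable_floor.comp (measurable_const_mul _)
        exact (measurable_from_top (f := fun i : ℕ => a j (2 * i + 1) * b j (n j - (2 * i + 1)))).comp this
      · filter_upwards [hev1, hev2] with j hj1 hj2
        filter_upwards [hne] with s hs1 hs
        rw [uIoc_of_le zero_le_one] at hs
        exact bd j (n j) _ hj1 (hfl j hj2 s (hs.2.lt_of_ne hs1))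
      · filter_upwards [hne] with s hs1 hs
        rw [uIoc_of_le zero_le_one] at hs
        have hs2 : s < 1 := hs.2.lt_of_ne hs1
        have hk : Tendsto (fun j => ((2 * ⌊((n j / 2 : ℕ) : ℝ) * s⌋₊ + 1 : ℕ) : ℝ) * h j) atTop (𝓝 (x * s)) := by
          have h1 : Tendsto (fun j => 2 * (((n j / 2 : ℕ) : ℝ) * h j) * s - h j) atTop (𝓝 (2 * (x / 2) * s - 0)) :=
            ((hm.const_mul 2).mul_const s).sub hlim
          have h2 : Tendsto (fun j => 2 * (((n j / 2 : ℕ) : ℝ) * h j) * s + h j) atTop (𝓝 (2 * (x / 2) * s + 0)) :=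
            ((hm.const_mul 2).mul_const s).add hlim
          rw [show 2 * (x / 2) * s - 0 = x * s by ring] at h1
          rw [show 2 * (x / 2) * s + 0 = x * s by ring] at h2
          refine tendsto_of_tendsto_of_tendsto_of_le_of_le h1 h2 (fun j => ?_) fun j => ?_
          · have i1 := (Nat.lt_floor_add_one (((n j / 2 : ℕ) : ℝ) * s)).le
            have := mul_le_mul_of_nonneg_right i1 (hh j).le
            push_cast; linarith
          · have i1 := Nat.floor_le (show 0 ≤ ((n j / 2 : ℕ) : ℝ) * s from mul_nonneg (Nat.cast_nonneg _) hs.1.le)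
            have := mul_le_mul_of_nonneg_right i1 (hh j).le
            push_cast; linarith
        have hk2 : Tendsto (fun j => ((n j - (2 * ⌊((n j / 2 : ℕ) : ℝ) * s⌋₊ + 1) : ℕ) : ℝ) * h j) atTop
            (𝓝 (x * (1 - s))) := by
          have := hn.sub hk
          rw [show x - x * s = x * (1 - s) by ring] at this
          refine this.congr' ?_
          filter_upwards [hev2] with j hj
          have := hfl j hj s hs2
          rw [Nat.cast_sub (by omega)]; ring
        exact (ha _ _ (mul_pos hx0 hs.1) (by nlinarith [hs.1]) hk).mul
          (hb _ _ (mul_pos hx0 (sub_pos.2 hs2)) (by nlinarith [hs.1]) hk2)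
    refine (hratio.mul main).congr' ?_
    filter_upwards [hev2] with j hj
    rw [oddAvg, integral_floor (fun i => a j (2 * i + 1) * b j (n j - (2 * i + 1))) _ hj]
    field_simp

lemma integral_pow_mul_exp_neg_le {a L : ℝ} (ha : 0 < a) (hL : 0 ≤ L) (m : ℕ) :
    ∫ ρ in (0 : ℝ)..L, ρ ^ m * Real.exp (-(a * ρ)) ≤ m.factorial / a ^ (m + 1) := by
  have hd : ∀ ρ : ℝ, HasDerivAt (fun ρ => Real.exp (-(a * ρ))) (Real.exp (-(a * ρ)) * -(a * 1)) ρ := fun ρ =>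
    (((hasDerivAt_id ρ).const_mul a).neg).exp
  induction m with
  | zero =>
    have h1 := intervalIntegral.integral_eq_sub_of_hasDerivAt (a := 0) (b := L) (fun ρ _ => hd ρ)
      ((by fun_prop : Continuous _).intervalIntegrable _ _)
    rw [intervalIntegral.integral_mul_const] at h1
    simp only [pow_zero, one_mul, Nat.factorial_zero, Nat.cast_one, zero_add, pow_one]
    rw [le_div_iff₀ ha]
    have := Real.exp_pos (-(a * L))
    rw [mul_zero, neg_zero, Real.exp_zero] at h1
    linarith
  | succ m ih =>
    have h1 := intervalIntegral.integral_eq_sub_of_hasDerivAt (a := 0) (b := L)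
      (fun ρ _ => (hasDerivAt_pow (m + 1) ρ).mul (hd ρ)) ((by fun_prop : Continuous _).intervalIntegrable _ _)
    have e1 : ∀ ρ : ℝ, ((m + 1 : ℕ) : ℝ) * ρ ^ (m + 1 - 1) * Real.exp (-(a * ρ)) +
        ρ ^ (m + 1) * (Real.exp (-(a * ρ)) * -(a * 1)) = (m + 1) * (ρ ^ m * Real.exp (-(a * ρ))) -
        a * (ρ ^ (m + 1) * Real.exp (-(a * ρ))) := fun ρ => by
      rw [Nat.add_sub_cancel]; push_cast; ring
    simp only [e1] at h1
    rw [intervalIntegral.integral_sub ((by fun_prop : Continuous _).intervalIntegrable _ _)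
      ((by fun_prop : Continuous _).intervalIntegrable _ _), intervalIntegral.integral_const_mul,
      intervalIntegral.integral_const_mul] at h1
    simp only [Pi.mul_apply, zero_pow (Nat.succ_ne_zero m), zero_mul, sub_zero] at h1
    have h2 : 0 ≤ L ^ (m + 1) * Real.exp (-(a * L)) := by positivity
    rw [Nat.factorial_succ, pow_succ a, ← div_div, le_div_iff₀ ha, Nat.cast_mul, mul_div_assoc]
    have h3 := mul_le_mul_of_nonneg_left ih (show (0 : ℝ) ≤ (m + 1 : ℕ) by positivity)
    push_cast at h3 ⊢
    linarith

/-- The odd moments of a function on an interval. -/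
def oddMoment (d : ℝ → ℝ) (L : ℝ) (k : ℕ) : ℝ := ∫ ρ in (0 : ℝ)..L, d ρ * (ρ ^ (2 * k + 1) / (2 * k + 1).factorial)

lemma momSeries_oddMoment {d : ℝ → ℝ} (hd : Continuous d) {L : ℝ} (hL : 0 ≤ L) (x : ℝ) :
    momSeries (oddMoment d L) (-x ^ 2) = 4 - 2 * x / π * ∫ ρ in (0 : ℝ)..L, d ρ * Real.sin (x * ρ) := by
  obtain ⟨C, hC⟩ := (isCompact_Icc (a := 0) (b := L)).exists_bound_of_continuousOn hd.continuousOn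
  have hC0 : 0 ≤ C := (norm_nonneg _).trans (hC 0 ⟨le_rfl, hL⟩)
  obtain ⟨c, hc⟩ : ∃ c : ℕ → ℝ, ∀ n, c n = (2 * n + 1).factorial := ⟨_, fun _ => rfl⟩
  have hs : Summable fun n : ℕ => C * ((|x| * L) ^ (2 * n + 1) / c n) := by
    simp only [hc]
    exact ((Real.summable_pow_div_factorial (|x| * L)).comp_injective (i := fun n : ℕ => 2 * n + 1)
      fun a b h => by simpa using h).mul_left C
  have hsin : ∀ y : ℝ, HasSum (fun n : ℕ => (-1) ^ n * y ^ (2 * n + 1) / c n) (Real.sin y) := fun y => by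
    simp only [hc]
    exact Real.hasSum_sin y
  have hmom : ∀ n, oddMoment d L n = ∫ ρ in (0 : ℝ)..L, d ρ * (ρ ^ (2 * n + 1) / c n) := fun n => by
    rw [hc]; rfl
  have hcpos : ∀ n, 0 < c n := fun n => by rw [hc]; positivity
  clear hc
  have main := intervalIntegral.hasSum_integral_of_dominated_convergence (a := 0) (b := L) (μ := MeasureTheory.volume)
    (F := fun n ρ => d ρ * ((-1) ^ n * (x * ρ) ^ (2 * n + 1) / c n))
    (f := fun ρ => d ρ * Real.sin (x * ρ)) (fun n _ => C * ((|x| * L) ^ (2 * n + 1) / c n))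
    (fun n => (by fun_prop : Continuous _).aestronglyMeasurable) (fun n => Eventually.of_forall fun ρ hρ => ?_)
    (Eventually.of_forall fun ρ _ => hs) intervalIntegrable_const
    (Eventually.of_forall fun ρ _ => (hsin (x * ρ)).mul_left (d ρ))
  · have e : ∀ n, oddMoment d L n * (-x ^ 2) ^ (n + 1) = -x * ∫ ρ in (0 : ℝ)..L,
        d ρ * ((-1) ^ n * (x * ρ) ^ (2 * n + 1) / c n) := fun n => by
      rw [hmom, ← intervalIntegral.integral_mul_const, ← intervalIntegral.integral_const_mul]
      refine intervalIntegral.integral_congr fun ρ _ => ?_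
      rw [neg_pow (x ^ 2), mul_pow, ← pow_mul]; ring
    rw [momSeries]
    simp only [e]
    rw [(main.mul_left (-x)).tsum_eq]
    ring
  · rw [uIoc_of_le hL] at hρ
    have h1 : ‖ρ‖ ≤ L := by rw [Real.norm_eq_abs, abs_of_pos hρ.1]; exact hρ.2
    rw [norm_mul, norm_div, norm_mul, norm_pow, norm_neg, norm_one, one_pow, one_mul, norm_pow, norm_mul,
      Real.norm_of_nonneg (hcpos n).le, Real.norm_eq_abs x]
    have := (hcpos n).le
    gcongr
    exact hC ρ ⟨hρ.1.le, hρ.2⟩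

lemma pow_three_mul_exp_le {L : ℝ} (hL : 0 ≤ L) : L ^ 3 * Real.exp (-(2 * π * L)) ≤ Real.exp (-L) := by
  have h1 := Real.pow_div_factorial_le_exp (5 * L) (by positivity) 3
  have h2 : L ^ 3 ≤ Real.exp (5 * L) := by
    refine le_trans ?_ h1
    have : 0 ≤ L ^ 3 := by positivity
    rw [mul_pow, mul_div_right_comm]
    norm_num [Nat.factorial]
    linarith
  calc L ^ 3 * Real.exp (-(2 * π * L)) ≤ Real.exp (5 * L) * Real.exp (-(6 * L)) := by
        gcongr
        nlinarith [Real.pi_gt_three]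
    _ = _ := by rw [← Real.exp_add]; congr 1; ring

/-- A sequence of splitting profiles with anomalously fast decay. -/
structure DecaySeq (A : ℝ) (h η : ℕ → ℝ) (d : ℕ → ℝ → ℝ) : Prop where
  A_nonneg : 0 ≤ A
  h_pos : ∀ j, 0 < h j
  h_lim : Tendsto h atTop (𝓝 0)
  d_cont : ∀ j, Continuous (d j)
  η_nonneg : ∀ j, 0 ≤ η j
  η_le : ∀ j, η j ≤ 1
  η_lim : Tendsto η atTop (𝓝 0)
  bound : ∀ j ρ, 0 ≤ ρ → ρ ≤ π / (2 * h j) → |d j ρ| ≤ A * (Real.exp (-(2 * π * ρ)) * (1 + η j * ρ ^ 2) +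
    (π / (2 * h j)) ^ 3 * Real.exp (-(2 * π * (π / (2 * h j)))))

namespace DecaySeq

variable {A : ℝ} {h η : ℕ → ℝ} {d : ℕ → ℝ → ℝ}

lemma bound_exp (S : DecaySeq A h η d) {j : ℕ} {ρ : ℝ} (h0 : 0 ≤ ρ) (h1 : ρ ≤ π / (2 * h j)) :
    |d j ρ| ≤ 2 * A * Real.exp (-ρ) := by
  have := S.bound j ρ h0 h1
  have hA := S.A_nonneg
  have e1 := pow_three_mul_exp_le (h0.trans h1)
  have e2 : Real.exp (-(π / (2 * h j))) ≤ Real.exp (-ρ) := by gcongr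
  have e3 : Real.exp (-(2 * π * ρ)) * (1 + η j * ρ ^ 2) ≤ Real.exp (-ρ) := by
    have q := Real.quadratic_le_exp_of_nonneg (show 0 ≤ 2 * ρ by positivity)
    calc Real.exp (-(2 * π * ρ)) * (1 + η j * ρ ^ 2) ≤ Real.exp (-(3 * ρ)) * Real.exp (2 * ρ) := by
          have := S.η_nonneg j
          gcongr
          · nlinarith [Real.pi_gt_three]
          · nlinarith [S.η_le j, sq_nonneg ρ]
      _ = _ := by rw [← Real.exp_add]; congr 1; ring
  calc _ ≤ _ := this
    _ ≤ A * (Real.exp (-ρ) + Real.exp (-ρ)) := by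
        refine mul_le_mul_of_nonneg_left (add_le_add e3 (e1.trans e2)) hA
    _ = _ := by ring

lemma L_pos (S : DecaySeq A h η d) (j : ℕ) : 0 < π / (2 * h j) := by
  have := S.h_pos j; positivity

lemma abs_oddMoment_le (S : DecaySeq A h η d) (j k : ℕ) : |oddMoment (d j) (π / (2 * h j)) k| ≤ 2 * A := by
  have hL := (S.L_pos j).le
  have hA := S.A_nonneg
  have h1 := intervalIntegral.norm_integral_le_of_norm_le (μ := MeasureTheory.volume) hL
    (f := fun ρ => d j ρ * (ρ ^ (2 * k + 1) / (2 * k + 1).factorial))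
    (g := fun ρ => 2 * A / (2 * k + 1).factorial * (ρ ^ (2 * k + 1) * Real.exp (-(1 * ρ))))
    (Eventually.of_forall fun ρ hρ => by
      have h0 := hρ.1.le
      rw [norm_mul, Real.norm_eq_abs, Real.norm_of_nonneg (by positivity)]
      calc _ ≤ 2 * A * Real.exp (-ρ) * (ρ ^ (2 * k + 1) / (2 * k + 1).factorial) := by
            gcongr; exact S.bound_exp h0 hρ.2
        _ = _ := by rw [one_mul]; ring) ((by fun_prop : Continuous _).intervalIntegrable _ _)
  rw [intervalIntegral.integral_const_mul] at h1
  refine h1.trans ((mul_le_mul_of_nonneg_left (integral_pow_mul_exp_neg_le one_pos hL _) (by positivity)).trans ?_)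
  rw [one_pow, div_one, div_mul_cancel₀]
  positivity

lemma abs_oddMoment_le_decay (S : DecaySeq A h η d) (k : ℕ) : ∃ c, ∀ j, |oddMoment (d j) (π / (2 * h j)) k| ≤
    A / ((2 * π) ^ 2) ^ (k + 1) + c * η j + A * ((π / (2 * h j)) ^ (2 * k + 5) * Real.exp (-(2 * π * (π / (2 * h j))))) := by
  refine ⟨A / (2 * k + 1).factorial * ((2 * k + 3).factorial / (2 * π) ^ (2 * k + 3 + 1)), fun j => ?_⟩
  set L := π / (2 * h j) with hLdef
  have hL := (S.L_pos j).le
  have hA := S.A_nonneg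
  have hη := S.η_nonneg j
  rw [← hLdef] at hL
  set f : ℝ := ((2 * k + 1).factorial : ℝ) with hf
  have hf0 : 0 < f := by positivity
  have h1 := intervalIntegral.norm_integral_le_of_norm_le (μ := MeasureTheory.volume) hL
    (f := fun ρ => d j ρ * (ρ ^ (2 * k + 1) / f))
    (g := fun ρ => A / f * (ρ ^ (2 * k + 1) * Real.exp (-((2 * π) * ρ))) + A / f * η j * (ρ ^ (2 * k + 3) * Real.exp (-((2 * π) * ρ)))
      + A * (L ^ 3 * L ^ (2 * k + 1) * Real.exp (-(2 * π * L))))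
    (Eventually.of_forall fun ρ hρ => by
      have h0 := hρ.1.le
      have h2 := hρ.2
      rw [norm_mul, Real.norm_eq_abs, Real.norm_of_nonneg (by positivity)]
      have e : ρ ^ (2 * k + 1) / f ≤ L ^ (2 * k + 1) := by
        refine (div_le_self (by positivity) ?_).trans (by gcongr)
        rw [hf]; exact_mod_cast Nat.one_le_iff_ne_zero.2 (Nat.factorial_ne_zero _)
      calc _ ≤ A * (Real.exp (-(2 * π * ρ)) * (1 + η j * ρ ^ 2) + L ^ 3 * Real.exp (-(2 * π * L))) * (ρ ^ (2 * k + 1) / f) := by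
            gcongr; exact S.bound j ρ h0 h2
        _ = A / f * (ρ ^ (2 * k + 1) * Real.exp (-((2 * π) * ρ))) + A / f * η j * (ρ ^ (2 * k + 3) * Real.exp (-((2 * π) * ρ)))
            + A * (L ^ 3 * (ρ ^ (2 * k + 1) / f) * Real.exp (-(2 * π * L))) := by ring
        _ ≤ _ := by gcongr) ((by fun_prop : Continuous _).intervalIntegrable _ _)
  rw [intervalIntegral.integral_add ((by fun_prop : Continuous _).intervalIntegrable _ _)
    ((by fun_prop : Continuous _).intervalIntegrable _ _), intervalIntegral.integral_add
    ((by fun_prop : Continuous _).intervalIntegrable _ _) ((by fun_prop : Continuous _).intervalIntegrable _ _),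
    intervalIntegral.integral_const_mul, intervalIntegral.integral_const_mul, intervalIntegral.integral_const] at h1
  have hp := Real.two_pi_pos
  have i1 := mul_le_mul_of_nonneg_left (integral_pow_mul_exp_neg_le hp hL (2 * k + 1)) (show 0 ≤ A / f by positivity)
  have i2 := mul_le_mul_of_nonneg_left (integral_pow_mul_exp_neg_le hp hL (2 * k + 3)) (show 0 ≤ A / f * η j by positivity)
  have e1 : A / f * (f / (2 * π) ^ (2 * k + 1 + 1)) = A / ((2 * π) ^ 2) ^ (k + 1) := by
    rw [← pow_mul, show 2 * (k + 1) = 2 * k + 1 + 1 by ring]; field_simp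
  rw [← hf, e1] at i1
  refine h1.trans ((add_le_add_left (add_le_add i1 i2) _).trans_eq ?_)
  rw [smul_eq_mul]; ring

end DecaySeq

/-- The scaled coefficients of the separatrix, expressed through the splitting profile `d`. -/
def profileCoef (h : ℝ) (d : ℝ → ℝ) (n : ℕ) : ℝ :=
  4 - 2 * (n * h) / π * ∫ ρ in (0 : ℝ)..π / (2 * h), d ρ * Real.sin (n * h * ρ)

lemma DecaySeq.contConv_profileCoef {A : ℝ} {h η : ℕ → ℝ} {d : ℕ → ℝ → ℝ} (S : DecaySeq A h η d) {M : ℕ → ℝ}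
    (hM : ∀ k, Tendsto (fun j => oddMoment (d j) (π / (2 * h j)) k) atTop (𝓝 (M k))) :
    ContConv h (fun j => profileCoef (h j) (d j)) (fun x => momSeries M (-x ^ 2)) := by
  have hA := S.A_nonneg
  refine ⟨⟨4 + 2 * A, by positivity, fun j n hn => ?_⟩, fun n x hx0 hx1 hn => ?_⟩
  · have hL := (S.L_pos j).le
    have h1 := intervalIntegral.norm_integral_le_of_norm_le (μ := MeasureTheory.volume) hL
      (f := fun ρ => d j ρ * Real.sin (n * h j * ρ)) (g := fun ρ => 2 * A * (ρ ^ 0 * Real.exp (-(1 * ρ))))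
      (Eventually.of_forall fun ρ hρ => by
        rw [norm_mul, Real.norm_eq_abs, Real.norm_eq_abs]
        calc |d j ρ| * |Real.sin (n * h j * ρ)| ≤ |d j ρ| * 1 := by gcongr; exact Real.abs_sin_le_one _
          _ ≤ _ := by rw [mul_one, pow_zero, one_mul, one_mul]; exact S.bound_exp hρ.1.le hρ.2)
      ((by fun_prop : Continuous _).intervalIntegrable _ _)
    rw [intervalIntegral.integral_const_mul] at h1
    have h2 := h1.trans (mul_le_mul_of_nonneg_left (integral_pow_mul_exp_neg_le one_pos hL 0) (by positivity))
    norm_num at h2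
    have hn0 : 0 ≤ n * h j := mul_nonneg n.cast_nonneg (S.h_pos j).le
    have h3 : 2 * (n * h j) / π ≤ 1 := by
      rw [div_le_one Real.pi_pos]; linarith [Real.pi_gt_three]
    have h4 : 0 ≤ 2 * (n * h j) / π := by positivity
    beta_reduce
    rw [profileCoef]
    refine (abs_sub _ _).trans ?_
    rw [abs_of_pos (by norm_num : (0 : ℝ) < 4), abs_mul, abs_of_nonneg h4]
    refine add_le_add le_rfl ?_
    calc _ ≤ 1 * (2 * A) := mul_le_mul h3 h2 (abs_nonneg _) zero_le_one
      _ = _ := one_mul _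
  · have e : ∀ j, profileCoef (h j) (d j) (n j) = momSeries (oddMoment (d j) (π / (2 * h j))) (-(n j * h j) ^ 2) :=
      fun j => (momSeries_oddMoment (S.d_cont j) (S.L_pos j).le _).symm
    simp only [e, momSeries]
    refine (Tendsto.const_mul _ ?_).const_add _
    obtain ⟨r, hr1, hr2⟩ := exists_between hx1
    have hr0 : 0 < r := hx0.trans hr1
    refine tendsto_tsum_of_dominated_convergence (bound := fun k => 2 * A * r * r ^ k)
      ((summable_geometric_of_lt_one hr0.le hr2).mul_left _) (fun k => (hM k).mul ((hn.pow 2).neg.pow _)) ?_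
    filter_upwards [hn.eventually_lt_const hr1] with j hj k
    have hn0 : 0 ≤ n j * h j := mul_nonneg (n j).cast_nonneg (S.h_pos j).le
    rw [norm_mul, norm_pow, norm_neg, Real.norm_eq_abs, Real.norm_of_nonneg (sq_nonneg _)]
    calc _ ≤ 2 * A * r ^ (k + 1) := by
          gcongr
          · exact S.abs_oddMoment_le j k
          · nlinarith
      _ = _ := by ring

lemma ContConv.sinh_mul {h : ℕ → ℝ} (hh : ∀ j, 0 < h j) {a : ℕ → ℕ → ℝ} {f : ℝ → ℝ} (ha : ContConv h a f) :
    ContConv h (fun j n => 4 * Real.sinh (n * h j / 2) ^ 2 / (n * h j) * a j n)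
      (fun x => 4 * Real.sinh (x / 2) ^ 2 / x * f x) := by
  obtain ⟨⟨C, hC, haC⟩, ha⟩ := ha
  have hcont : Continuous fun x : ℝ => sinhQuot x := differentiable_sinhQuot.continuous.comp Complex.continuous_ofReal
  obtain ⟨D, hD⟩ := (isCompact_Icc (a := (0 : ℝ)) (b := 1)).exists_bound_of_continuousOn hcont.continuousOn
  have hD0 : 0 ≤ D := (norm_nonneg _).trans (hD 0 ⟨le_rfl, zero_le_one⟩)
  refine ⟨⟨D * C, by positivity, fun j n hn => ?_⟩, fun n x hx0 hx1 hn => ?_⟩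
  · have hn0 : 0 ≤ n * h j := mul_nonneg n.cast_nonneg (hh j).le
    have := hD _ ⟨hn0, hn⟩
    rw [sinhQuot_ofReal, Complex.norm_real, Real.norm_eq_abs] at this
    rw [abs_mul]
    exact mul_le_mul this (haC j n hn) (abs_nonneg _) hD0
  · refine Tendsto.mul ?_ (ha n x hx0 hx1 hn)
    exact ((((Real.continuous_sinh.tendsto _).comp (hn.div_const 2)).pow 2).const_mul 4).div hn hx0.ne'

lemma sum_range_two_mul_of_odd_zero {f : ℕ → ℝ} (hf : ∀ i, f (2 * i + 1) = 0) (m : ℕ) :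
    ∑ k ∈ Finset.range (2 * m), f k = ∑ i ∈ Finset.range m, f (2 * i) := by
  induction m with
  | zero => simp
  | succ m ih => rw [mul_add, mul_one, Finset.sum_range_succ, Finset.sum_range_succ, ih, hf, Finset.sum_range_succ, add_zero]

lemma profile_recursion {h α : ℝ} (hh : 0 < h) {a m : ℕ → ℝ}
    (ha : ∀ n : ℕ, Odd n → n * (bCoef h n * Real.exp (n * α)) = a n)
    (hm : ∀ n : ℕ, m n = 4 * Real.sinh (n * h / 2) ^ 2 / (n * h) * a n) {n : ℕ} (hn : Odd n) :
    m n = oddAvg a (oddAvg a m) n + diffSymbol h 1 / (h * n) * a n := by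
  set ε := diffSymbol h 1 with hε
  set w : ℕ → ℝ := fun n => ε * (wCoef h n * Real.exp (n * α)) with hw
  have hodd : ∀ n : ℕ, Odd n → w n = h * m n := fun n hn => by
    have h0 : (n : ℝ) ≠ 0 := by have := hn.pos; positivity
    have e1 := diffSymbol_mul_bCoef hh hn
    have e2 := ha n hn
    rw [hm, ← e2, hw]
    simp only
    rw [← mul_assoc ε, ← e1, diffSymbol]
    field_simp
  have hb0 : ∀ n : ℕ, Even n → bCoef h n = 0 := fun n hn => bCoef_even h hn
  have hrec : ∀ n : ℕ, 0 < n → n * w n = ∑ k ∈ Finset.range n,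
      ((k + 1 : ℕ) * (bCoef h (k + 1) * Real.exp ((k + 1 : ℕ) * α))) * w (n - 1 - k) := by
    intro n hn
    obtain ⟨N, rfl⟩ := Nat.exists_eq_succ_of_ne_zero hn.ne'
    have := wCoef_convolution h N
    have e : ((N + 1 : ℕ) : ℝ) * w (N + 1) = ε * Real.exp ((N + 1 : ℕ) * α) * (((N : ℝ) + 1) * wCoef h (N + 1)) := by
      rw [hw]; push_cast; ring
    rw [Nat.succ_eq_add_one, e, this, Finset.mul_sum]
    refine Finset.sum_congr rfl fun k hk => ?_
    have hk' : k ≤ N := by have := Finset.mem_range.1 hk; omega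
    have e3 : Real.exp ((N + 1 : ℕ) * α) = Real.exp ((k + 1 : ℕ) * α) * Real.exp ((N - k : ℕ) * α) := by
      rw [← Real.exp_add, Nat.cast_sub hk']; congr 1; push_cast; ring
    rw [Nat.add_sub_cancel, hw, e3]
    push_cast; ring
  have hterm : ∀ i n : ℕ, ((2 * i + 1 : ℕ) * (bCoef h (2 * i + 1) * Real.exp ((2 * i + 1 : ℕ) * α))) * w (n - 1 - 2 * i) =
      a (2 * i + 1) * w (n - (2 * i + 1)) := fun i n => by
    rw [ha _ ⟨i, rfl⟩, Nat.sub_sub, add_comm 1]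
  have hzero : ∀ n i : ℕ, (((2 * i + 1) + 1 : ℕ) * (bCoef h ((2 * i + 1) + 1) * Real.exp (((2 * i + 1) + 1 : ℕ) * α))) *
      w (n - 1 - (2 * i + 1)) = 0 := fun n i => by
    rw [hb0 _ ⟨i + 1, by ring⟩]; simp
  have heven : ∀ n : ℕ, Even n → 0 < n → w n = h * oddAvg a m n := fun n hn h0 => by
    have e := hrec n h0
    have e2 : n = 2 * (n / 2) := (Nat.mul_div_cancel' hn.two_dvd).symm
    rw [show Finset.range n = Finset.range (2 * (n / 2)) by rw [← e2], sum_range_two_mul_of_odd_zero (hzero n)] at e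
    have hn0 : (n : ℝ) ≠ 0 := by positivity
    rw [oddAvg, one_div, mul_left_comm, ← div_eq_inv_mul, eq_div_iff hn0, mul_comm (w n), e, Finset.mul_sum]
    refine Finset.sum_congr rfl fun i hi => ?_
    have hi' := Finset.mem_range.1 hi
    rw [hterm, hodd (n - (2 * i + 1)) (Nat.Even.sub_odd (by omega) hn ⟨i, rfl⟩)]
    ring
  have h0 := hn.pos
  have e := hrec n h0
  have e2 : n = 2 * (n / 2) + 1 := (Nat.two_mul_div_two_add_one_of_odd hn).symm
  rw [show Finset.range n = Finset.range (2 * (n / 2) + 1) by rw [← e2], Finset.sum_range_succ,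
    sum_range_two_mul_of_odd_zero (hzero n), hterm, ← e2, Nat.sub_self, hodd n hn] at e
  have hw0 : w 0 = ε := by rw [hw]; simp [wCoef_zero]
  have hs : ∑ i ∈ Finset.range (n / 2), ((2 * i + 1 : ℕ) * (bCoef h (2 * i + 1) * Real.exp ((2 * i + 1 : ℕ) * α))) *
      w (n - 1 - 2 * i) = h * ∑ i ∈ Finset.range (n / 2), a (2 * i + 1) * oddAvg a m (n - (2 * i + 1)) := by
    rw [Finset.mul_sum]
    refine Finset.sum_congr rfl fun i hi => ?_
    have hi' := Finset.mem_range.1 hi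
    rw [hterm, heven (n - (2 * i + 1)) (Nat.Odd.sub_odd hn ⟨i, rfl⟩) (by omega)]
    ring
  rw [hs, hw0] at e
  rw [oddAvg]
  field_simp
  linarith

lemma DecaySeq.comp {A : ℝ} {h η : ℕ → ℝ} {d : ℕ → ℝ → ℝ} (S : DecaySeq A h η d) {φ : ℕ → ℕ} (hφ : StrictMono φ) :
    DecaySeq A (fun j => h (φ j)) (fun j => η (φ j)) (fun j => d (φ j)) where
  A_nonneg := S.A_nonneg
  h_pos _ := S.h_pos _
  h_lim := S.h_lim.comp hφ.tendsto_atTop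
  d_cont _ := S.d_cont _
  η_nonneg _ := S.η_nonneg _
  η_le _ := S.η_le _
  η_lim := S.η_lim.comp hφ.tendsto_atTop
  bound _ := S.bound _

lemma DecaySeq.abs_limit_le {A : ℝ} {h η : ℕ → ℝ} {d : ℕ → ℝ → ℝ} (S : DecaySeq A h η d) {k : ℕ} {M : ℝ}
    (hM : Tendsto (fun j => oddMoment (d j) (π / (2 * h j)) k) atTop (𝓝 M)) : |M| ≤ A / ((2 * π) ^ 2) ^ (k + 1) := by
  obtain ⟨c, hc⟩ := S.abs_oddMoment_le_decay k
  have hL : Tendsto (fun j => π / (2 * h j)) atTop atTop := by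
    have h1 : Tendsto h atTop (𝓝[>] 0) :=
      tendsto_nhdsWithin_iff.2 ⟨S.h_lim, Eventually.of_forall fun j => S.h_pos j⟩
    have := (tendsto_inv_nhdsGT_zero.comp h1).const_mul_atTop (show 0 < π / 2 by positivity)
    refine this.congr fun j => ?_
    simp only [Function.comp]
    field_simp
  have h2 : Tendsto (fun x : ℝ => x ^ (2 * k + 5) * Real.exp (-(2 * π * x))) atTop (𝓝 0) := by
    have h3 := (tendsto_pow_mul_exp_neg_atTop_nhds_zero (2 * k + 5))
    refine squeeze_zero' ?_ ?_ h3
    · filter_upwards [eventually_ge_atTop 0] with x hx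
      positivity
    · filter_upwards [eventually_ge_atTop 0] with x hx
      have := Real.pi_gt_three
      gcongr
      nlinarith
  have h4 := ((S.η_lim.const_mul c).const_add (A / ((2 * π) ^ 2) ^ (k + 1))).add ((h2.comp hL).const_mul A)
  rw [mul_zero, add_zero, mul_zero, add_zero] at h4
  exact le_of_tendsto_of_tendsto' hM.abs h4 hc

lemma tendsto_odd_mul {h : ℕ → ℝ} (hh : ∀ j, 0 < h j) (hlim : Tendsto h atTop (𝓝 0)) {x : ℝ} (hx : 0 < x) :
    Tendsto (fun j => ((2 * ⌊x / (2 * h j)⌋₊ + 1 : ℕ) : ℝ) * h j) atTop (𝓝 x) := by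
  have h1 := hlim.const_sub x
  have h2 := hlim.const_add x
  rw [sub_zero] at h1
  rw [add_zero] at h2
  refine tendsto_of_tendsto_of_tendsto_of_le_of_le h1 h2 (fun j => ?_) (fun j => ?_)
  · have := Nat.lt_floor_add_one (x / (2 * h j))
    rw [div_lt_iff₀ (by linarith [hh j])] at this
    push_cast
    linarith
  · have := Nat.floor_le (show 0 ≤ x / (2 * h j) from div_nonneg hx.le (by linarith [hh j]))
    rw [le_div_iff₀ (by linarith [hh j])] at this
    push_cast
    linarith

lemma DecaySeq.false_of_tendsto {A : ℝ} {h η α : ℕ → ℝ} (S : DecaySeq A h η (fun j => topD (h j) (α j))) {M : ℕ → ℝ}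
    (hM : ∀ k, Tendsto (fun j => oddMoment (topD (h j) (α j)) (π / (2 * h j)) k) atTop (𝓝 (M k))) : False := by
  have ha := S.contConv_profileCoef hM
  have hm := ContConv.sinh_mul S.h_pos ha
  have hE := ha.conv S.h_pos S.h_lim hm
  have hEE := ha.conv S.h_pos S.h_lim hE
  refine momSeries_ne (fun k => S.abs_limit_le (hM k)) _ _ rfl rfl fun x hx0 hx1 => ?_
  have hn := tendsto_odd_mul S.h_pos S.h_lim hx0
  have l1 := hm.2 _ x hx0 hx1 hn
  have l2 := hEE.2 _ x hx0 hx1 hn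
  have l3 := ha.2 _ x hx0 hx1 hn
  have l4 : Tendsto (fun j => diffSymbol (h j) 1) atTop (𝓝 0) := by
    have : Continuous fun h : ℝ => 4 * Real.sinh (1 * h / 2) ^ 2 := by fun_prop
    simpa [diffSymbol, Function.comp_def] using (this.tendsto 0).comp S.h_lim
  have l5 := (l4.div hn hx0.ne').mul l3
  rw [zero_div, zero_mul] at l5
  have l6 := l2.add l5
  rw [add_zero] at l6
  refine tendsto_nhds_unique l1 (l6.congr fun j => ?_)
  have := profile_recursion (S.h_pos j) (α := α j) (a := profileCoef (h j) (topD (h j) (α j)))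
    (fun n hn => bCoef_formula (S.h_pos j) (α j) hn) (fun n => rfl) (n := 2 * ⌊x / (2 * h j)⌋₊ + 1) ⟨_, rfl⟩
  refine Eq.trans ?_ this.symm
  rw [mul_comm (h j)]
  rfl

theorem DecaySeq.false {A : ℝ} {h η α : ℕ → ℝ} (S : DecaySeq A h η (fun j => topD (h j) (α j))) : False := by
  obtain ⟨M, -, φ, hφ, hM⟩ := (isCompact_univ_pi fun _ : ℕ => isCompact_Icc (a := -(2 * A)) (b := 2 * A)).tendsto_subseq
    (x := fun j k => oddMoment (topD (h j) (α j)) (π / (2 * h j)) k)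
    (fun j k _ => abs_le.1 (S.abs_oddMoment_le j k))
  rw [tendsto_pi_nhds] at hM
  exact (S.comp hφ).false_of_tendsto hM

lemma SepData.abs_topD_le {K h α : ℝ} (S : SepData K h α) (ρ : ℝ) : |topD h α ρ| ≤ 2 * π + 2 * K := by
  have h1 := S.inner (h * ((π / (2 * h) - ρ : ℝ) : ℂ) * Complex.I) (by
    rw [← Complex.ofReal_mul, Complex.re_ofReal_mul, Complex.I_re, mul_zero])
  rw [topD, sepD_mul_I_re]
  have hpi := Real.pi_pos
  rw [abs_le] at h1 ⊢
  constructor <;> linarith [h1.1, h1.2]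

/-- The separatrix reaches height `2 * π` before the exponentially long time `π ^ 2 / (2 * h) + log h + κ`. -/
theorem exists_crossing : ∃ K, 1 ≤ K ∧ ∃ κ h₀ : ℝ, 0 < h₀ ∧ ∀ h, 0 < h → h < h₀ →
    ∃ α, SepData K h α ∧ ∃ t ≤ π ^ 2 / (2 * h) + Real.log h + κ, 2 * π ≤ sepU h α t := by
  obtain ⟨K, hK, hex⟩ := exists_sepData
  refine ⟨K, hK, ?_⟩
  by_contra! H
  have H' : ∀ j : ℕ, ∃ h α : ℝ, SepData K h α ∧ h < 1 / (j + 1) ∧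
      ∀ t ≤ π ^ 2 / (2 * h) + Real.log h + j, sepU h α t < 2 * π := fun j => by
    obtain ⟨h, h0, h1, h2⟩ := H j (1 / (K * (j + 1))) (by positivity)
    have h3 : K * h ≤ 1 / (j + 1) := by
      rw [lt_div_iff₀ (by positivity)] at h1
      rw [le_div_iff₀ (by positivity)]
      linarith
    obtain ⟨α, S⟩ := hex h h0 (h3.trans (by
      rw [div_le_one (by positivity)]; linarith [(Nat.cast_nonneg j : (0 : ℝ) ≤ j)]))
    refine ⟨h, α, S, h1.trans_le ?_, h2 α S⟩
    gcongr
    nlinarith [(Nat.cast_nonneg j : (0 : ℝ) ≤ j)]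
  choose h α S hj hu using H'
  have h0 : ∀ j, 0 < h j := fun j => (S j).h_pos
  have hlim : Tendsto h atTop (𝓝 0) :=
    squeeze_zero (fun j => (h0 j).le) (fun j => (hj j).le) tendsto_one_div_add_atTop_nhds_zero_nat
  obtain ⟨c, hc, hsplit⟩ := exists_splitPair K hK
  have hc2 : c ≤ 6 * c ^ 3 := by linarith [le_self_pow₀ hc three_ne_zero, pow_pos (zero_lt_one.trans_le hc) 3]
  set C₀ := 6 * c ^ 3 with hC₀
  have hC₁ : 1 ≤ C₀ := hc.trans hc2
  obtain ⟨A₂, hA₂, hbound⟩ := SplitPair.second_bound c C₀ hC₁ le_rfl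
  obtain ⟨A, h₁, hA, hh₁, hw⟩ := wronskian_two_sided K hK
  set η : ℕ → ℝ := fun j => A * (Real.exp (-(2 * j)) + h j) with hη
  have hηlim : Tendsto η atTop (𝓝 0) := by
    have e1 : Tendsto (fun j : ℕ => Real.exp (-(2 * (j : ℝ)))) atTop (𝓝 0) :=
      Real.tendsto_exp_neg_atTop_nhds_zero.comp (tendsto_natCast_atTop_atTop.const_mul_atTop two_pos)
    simpa using (e1.add hlim).const_mul A
  have hη0 : ∀ j, 0 ≤ η j := fun j => by have := (h0 j).le; positivity
  obtain ⟨J, hJ⟩ := eventually_atTop.1 ((hηlim.eventually_lt_const one_pos).and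
    ((hlim.eventually_lt_const hh₁).and (hlim.eventually_lt_const (show 0 < π / (2 * C₀) by positivity))))
  have hC₀L : ∀ j, J ≤ j → C₀ ≤ π / (2 * h j) := fun j hj => by
    have e := (hJ j hj).2.2
    rw [lt_div_iff₀ (by positivity)] at e
    rw [le_div_iff₀ (by linarith [h0 j])]
    linarith
  refine DecaySeq.false (A := A₂ + (2 * π + 2 * K) * Real.exp (2 * π * C₀)) (h := fun j => h (j + J)) (η := fun j => η (j + J))
    (α := fun j => α (j + J)) ⟨by positivity, fun _ => h0 _, hlim.comp (tendsto_add_atTop_nat J),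
      fun j => continuous_topD (h0 _) _, fun _ => hη0 _, fun j => (hJ _ (by omega)).1.le,
      hηlim.comp (tendsto_add_atTop_nat J), fun j ρ hρ0 hρ1 => ?_⟩
  generalize hi : j + J = i at *
  have hJi : J ≤ i := by omega
  have hL0 : 0 ≤ π / (2 * h i) := hρ0.trans hρ1
  set L := π / (2 * h i) with hL
  have hηi := hη0 i
  rcases le_or_gt C₀ ρ with hρ | hρ
  · have := hbound L _ _ _ (η i) (hC₀L i hJi) (hsplit (h i) (α i) C₀ (S i) hc2) hηi (hJ i hJi).1.le
      (hw _ _ i (S i) (hJ i hJi).2.1 (Nat.cast_nonneg i) (hu i)) (L - ρ) (by linarith) (by linarith)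
    rw [sub_sub_cancel] at this
    rw [topD]
    refine (Complex.abs_re_le_norm _).trans (this.trans ?_)
    gcongr
    have : 0 ≤ (2 * π + 2 * K) * Real.exp (2 * π * C₀) := by positivity
    linarith
  · calc |topD (h i) (α i) ρ| ≤ (2 * π + 2 * K) * 1 := by rw [mul_one]; exact (S i).abs_topD_le ρ
      _ ≤ (2 * π + 2 * K) * (Real.exp (2 * π * C₀) * Real.exp (-(2 * π * ρ))) := by
          gcongr
          rw [← Real.exp_add]
          refine Real.one_le_exp ?_
          nlinarith [Real.pi_pos]
      _ = (2 * π + 2 * K) * Real.exp (2 * π * C₀) * (Real.exp (-(2 * π * ρ)) * 1 + 0) := by ring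
      _ ≤ _ := by
          gcongr
          · linarith
          · have : 0 ≤ η i * ρ ^ 2 := by positivity
            linarith
          · positivity

lemma eq_of_exp_eq_one {X : Type*} [TopologicalSpace X] [PreconnectedSpace X] {g : X → ℂ} (hg : Continuous g)
    (h : ∀ x, Complex.exp (g x) = 1) (x y : X) : g x = g y :=
  Complex.isCoveringMap_exp.const_of_comp hg (fun a a' => Subtype.ext ((h a).trans (h a').symm)) x y

lemma sub_eq_sub_of_exp_eq {X : Type*} [TopologicalSpace X] [PreconnectedSpace X] {f g : X → ℂ} (hf : Continuous f)
    (hg : Continuous g) (h : ∀ x, Complex.exp (f x) = Complex.exp (g x)) (x y : X) : f x - f y = g x - g y := by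
  have := eq_of_exp_eq_one (g := fun x => f x - g x) (hf.sub hg) (fun x => by rw [Complex.exp_sub, h, div_self (Complex.exp_ne_zero _)]) x y
  linear_combination this

lemma exists_continuous_log {F : ℝ × ℝ → ℂ} (hF : Continuous F) (h0 : ∀ p, F p ≠ 0) :
    ∃ L : ℝ × ℝ → ℂ, Continuous L ∧ ∀ p, Complex.exp (L p) = F p := by
  have hU : IsSimplyConnected (univ : Set (ℝ × ℝ)) :=
    have := (convex_univ (𝕜 := ℝ) (E := ℝ × ℝ)).contractibleSpace univ_nonempty
    SimplyConnectedSpace.ofContractible _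
  obtain ⟨L, hL, hexp⟩ := Complex.exists_continuousOn_eqOn_exp_comp (X := ℝ × ℝ) (U := univ)
    hU isOpen_univ hF.continuousOn
    (by rintro ⟨p, -, hp⟩; exact h0 p hp)
  exact ⟨L, continuousOn_univ.1 hL, fun p => hexp (mem_univ p)⟩

/-- Two arcs from `0` to `I * Y`, one in the right and one in the left half plane, enclose the open segment between
their endpoints: a proper curve avoiding both arcs does not meet it. -/
theorem properCurve_ne_of_arcs {T Y : ℝ} (hT : 0 ≤ T) {b b' γ : ℝ → ℂ} (hb : Continuous b) (hb' : Continuous b')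
    (hγ : Continuous γ) (hγlim : Tendsto (fun s => ‖γ s‖) atTop atTop)
    (h0 : b 0 = 0) (h0' : b' 0 = 0) (h1 : b T = Y * Complex.I) (h1' : b' T = Y * Complex.I)
    (hr : ∀ p ∈ Icc 0 T, 0 < (b p).re ∨ b p = 0 ∨ b p = Y * Complex.I)
    (hr' : ∀ p ∈ Icc 0 T, (b' p).re < 0 ∨ b' p = 0 ∨ b' p = Y * Complex.I)
    (hne : ∀ p ∈ Icc 0 T, ∀ s, b p ≠ γ s) (hne' : ∀ p ∈ Icc 0 T, ∀ s, b' p ≠ γ s)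
    {y : ℝ} (hy : 0 < y) (hyY : y < Y) (s₀ : ℝ) : γ s₀ ≠ y * Complex.I := by
  intro hs₀
  set q : ℝ → ℝ := fun p => max 0 (min p T) with hq
  have hqc : Continuous q := by fun_prop
  have hqm : ∀ p, q p ∈ Icc 0 T := fun p => ⟨le_max_left _ _, max_le hT (min_le_right _ _)⟩
  have hq0 : q 0 = 0 := by simp [hq, hT]
  have hqT : q T = T := by simp [hq, hT]
  have hbq : Continuous fun p => b (q p) := hb.comp hqc
  have hbq' : Continuous fun p => b' (q p) := hb'.comp hqc
  have hd : ∀ p s, b' (q p) - γ s ≠ 0 := fun p s => sub_ne_zero.2 (hne' _ (hqm p) s)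
  obtain ⟨L, hL, hexp⟩ := exists_continuous_log (F := fun x => (b (q x.1) - γ x.2) / (b' (q x.1) - γ x.2))
    (((hbq.comp continuous_fst).sub (hγ.comp continuous_snd)).div ((hbq'.comp continuous_fst).sub (hγ.comp continuous_snd))
      fun x => hd _ _) (fun x => div_ne_zero (sub_ne_zero.2 (hne _ (hqm _) _)) (hd _ _))
  have hL1 : ∀ s, Continuous fun p => L (p, s) := fun s => hL.comp (by fun_prop)
  have hL2 : ∀ p, Continuous fun s => L (p, s) := fun p => hL.comp (by fun_prop)
  have hconst : ∀ s t, L (T, s) - L (0, s) = L (T, t) - L (0, t) := by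
    refine eq_of_exp_eq_one (g := fun s => L (T, s) - L (0, s)) ((hL2 T).sub (hL2 0)) fun s => ?_
    rw [Complex.exp_sub, hexp, hexp]
    simp only [hq0, hqT, h0, h0', h1, h1']
    have e1 := hd T s
    have e2 := hd 0 s
    rw [hqT, h1'] at e1
    rw [hq0, h0'] at e2
    rw [div_self e1, div_self e2, div_one]
  have hfar : ∃ s, L (T, s) - L (0, s) = 0 := by
    obtain ⟨C, hC⟩ := (isCompact_Icc (a := 0) (b := T)).exists_bound_of_continuousOn hb.continuousOn
    obtain ⟨C', hC'⟩ := (isCompact_Icc (a := 0) (b := T)).exists_bound_of_continuousOn hb'.continuousOn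
    obtain ⟨s, hs⟩ := (hγlim.eventually_gt_atTop (C + C' + C')).exists
    refine ⟨s, ?_⟩
    have hslit : ∀ p, (b (q p) - γ s) / (b' (q p) - γ s) ∈ Complex.slitPlane := fun p => by
      have e : (b (q p) - γ s) / (b' (q p) - γ s) = 1 + (b (q p) - b' (q p)) / (b' (q p) - γ s) := by
        field_simp [hd p s]; ring
      rw [e]
      refine Complex.mem_slitPlane_of_norm_lt_one ?_
      rw [norm_div, div_lt_one (norm_pos_iff.2 (hd p s))]
      have a1 := norm_sub_le (b (q p)) (b' (q p))
      have a2 := norm_sub_norm_le (γ s) (b' (q p))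
      rw [norm_sub_rev] at a2
      linarith [hC _ (hqm p), hC' _ (hqm p)]
    have := sub_eq_sub_of_exp_eq (hL1 s) (g := fun p => Complex.log ((b (q p) - γ s) / (b' (q p) - γ s)))
      (continuous_iff_continuousAt.2 fun p =>
        ((hbq.sub continuous_const).div (hbq'.sub continuous_const) fun p => hd p s).continuousAt.clog (hslit p))
      (fun p => by rw [hexp, Complex.exp_log (Complex.slitPlane_ne_zero (hslit p))]) T 0
    rw [this]
    have e1 := hd T s
    have e2 := hd 0 s
    rw [hqT, h1'] at e1
    rw [hq0, h0'] at e2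
    simp only [hq0, hqT, h0, h0', h1, h1']
    rw [div_self e1, div_self e2, sub_self]
  obtain ⟨s, hs⟩ := hfar
  have hnear := hconst s₀ s
  rw [hs] at hnear
  have hmem : ∀ p, b (q p) - γ s₀ ∈ Complex.slitPlane := fun p => by
    rw [Complex.mem_slitPlane_iff, hs₀]
    rcases hr _ (hqm p) with h | h | h
    · left; simpa using h
    · right; rw [h]; simpa using hy.ne'
    · right; rw [h]; simpa using sub_ne_zero.2 hyY.ne'
  have hmem' : ∀ p, γ s₀ - b' (q p) ∈ Complex.slitPlane := fun p => by
    rw [Complex.mem_slitPlane_iff, hs₀]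
    rcases hr' _ (hqm p) with h | h | h
    · left; simpa using h
    · right; rw [h]; simpa using hy.ne'
    · right; rw [h]; simpa using sub_ne_zero.2 hyY.ne
  have := sub_eq_sub_of_exp_eq (hL1 s₀)
    (g := fun p => Complex.log (b (q p) - γ s₀) - Complex.log (γ s₀ - b' (q p)) + π * Complex.I)
    (((continuous_iff_continuousAt.2 fun p => (hbq.sub continuous_const).continuousAt.clog (hmem p)).sub
      (continuous_iff_continuousAt.2 fun p => (continuous_const.sub hbq').continuousAt.clog (hmem' p))).add continuous_const)
    (fun p => by
      rw [hexp, Complex.exp_add, Complex.exp_sub, Complex.exp_log (Complex.slitPlane_ne_zero (hmem p)),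
        Complex.exp_log (Complex.slitPlane_ne_zero (hmem' p)), Complex.exp_pi_mul_I, ← neg_sub (b' (q p)), div_neg]
      ring) T 0
  rw [hnear] at this
  simp only [hq0, hqT, h0, h0', h1, h1', hs₀] at this
  have k1 : ∀ r : ℝ, 0 < r → (Complex.log (r * Complex.I)).im = π / 2 := fun r hr => by
    rw [Complex.log_im, Complex.arg_real_mul _ hr, Complex.arg_I]
  have k2 : ∀ r : ℝ, 0 < r → (Complex.log (-(r * Complex.I))).im = -(π / 2) := fun r hr => by
    rw [Complex.log_im, ← mul_neg, Complex.arg_real_mul _ hr, Complex.arg_neg_I]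
  have h2 := congrArg Complex.im this
  rw [← sub_mul, ← sub_mul, zero_sub, sub_zero, ← Complex.ofReal_sub, show (y : ℂ) - Y = -((Y - y : ℝ) : ℂ) by push_cast; ring,
    neg_mul] at h2
  simp only [Complex.sub_im, Complex.add_im, k1 _ hy, k2 _ hy, k1 _ (sub_pos.2 hyY), k2 _ (sub_pos.2 hyY), Complex.zero_im] at h2
  linarith [Real.pi_pos]

lemma continuous_comp_log {B : ℝ → ℂ} (hB : Continuous B) (hlim : Tendsto B atBot (𝓝 0)) :
    Continuous fun p : ℝ => if 0 < p then B (Real.log p) else 0 := by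
  refine continuous_iff_continuousAt.2 fun p => ?_
  rcases lt_trichotomy p 0 with hp | rfl | hp
  · refine (continuousAt_const (y := (0 : ℂ))).congr ?_
    filter_upwards [Iio_mem_nhds hp] with x hx
    rw [if_neg (not_lt.2 (mem_Iio.1 hx).le)]
  · rw [ContinuousAt, if_neg (lt_irrefl _), ← nhdsLE_sup_nhdsGT, tendsto_sup]
    constructor
    · refine tendsto_const_nhds.congr' ?_
      filter_upwards [self_mem_nhdsWithin] with x hx
      rw [if_neg (not_lt.2 hx)]
    · refine (hlim.comp Real.tendsto_log_nhdsGT_zero).congr' ?_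
      filter_upwards [self_mem_nhdsWithin] with x hx
      rw [if_pos (mem_Ioi.1 hx), Function.comp]
  · refine (hB.continuousAt.comp (Real.continuousAt_log hp.ne')).congr ?_
    filter_upwards [Ioi_mem_nhds hp] with x hx
    rw [if_pos (mem_Ioi.1 hx), Function.comp]

theorem properCurve_ne_of_rays {T Y : ℝ} {B B' γ : ℝ → ℂ} (hB : Continuous B) (hB' : Continuous B')
    (hγ : Continuous γ) (hγlim : Tendsto (fun s => ‖γ s‖) atTop atTop)
    (h0 : Tendsto B atBot (𝓝 0)) (h0' : Tendsto B' atBot (𝓝 0)) (h1 : B T = Y * Complex.I) (h1' : B' T = Y * Complex.I)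
    (hr : ∀ p < T, 0 < (B p).re) (hr' : ∀ p < T, (B' p).re < 0) (hγ0 : ∀ s, 0 ≠ γ s)
    (hne : ∀ p ≤ T, ∀ s, B p ≠ γ s) (hne' : ∀ p ≤ T, ∀ s, B' p ≠ γ s)
    {y : ℝ} (hy : 0 < y) (hyY : y < Y) (s : ℝ) : γ s ≠ y * Complex.I := by
  have hT := Real.exp_pos T
  have hlog : ∀ p ∈ Icc 0 (Real.exp T), 0 < p → Real.log p ≤ T := fun p hp h =>
    (Real.log_le_log h hp.2).trans_eq (Real.log_exp T)
  refine properCurve_ne_of_arcs hT.le (continuous_comp_log hB h0) (continuous_comp_log hB' h0') hγ hγlim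
    (if_neg (lt_irrefl _)) (if_neg (lt_irrefl _)) (by rw [if_pos hT, Real.log_exp, h1]) (by rw [if_pos hT, Real.log_exp, h1'])
    (fun p hp => ?_) (fun p hp => ?_) (fun p hp s => ?_) (fun p hp s => ?_) hy hyY s
  all_goals split_ifs with h
  · rcases (hlog p hp h).lt_or_eq with h2 | h2
    · exact Or.inl (hr _ h2)
    · exact Or.inr (Or.inr (by rw [h2, h1]))
  · exact Or.inr (Or.inl rfl)
  · rcases (hlog p hp h).lt_or_eq with h2 | h2
    · exact Or.inl (hr' _ h2)
    · exact Or.inr (Or.inr (by rw [h2, h1']))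
  · exact Or.inr (Or.inl rfl)
  · exact hne _ (hlog p hp h) s
  · exact hγ0 s
  · exact hne' _ (hlog p hp h) s
  · exact hγ0 s

lemma hasDerivAt_of_comp {N g : ℝ → ℝ} {s n q : ℝ} (hN : HasDerivAt N n s) (hn : n ≠ 0) (hg : ContinuousAt g s)
    (hgs : g s = s) (hq : HasDerivAt (fun t => N (g t)) q s) : HasDerivAt g (q / n) s := by
  have ht : Tendsto g (𝓝 s) (𝓝 s) := by simpa [ContinuousAt, hgs] using hg
  have h1 : (fun t => g t - s) =O[𝓝 s] fun t => t - s := by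
    have e1 : (fun t => g t - s) =O[𝓝 s] fun t => N (g t) - N s :=
      (hN.isTheta_sub hn).isBigO_symm.comp_tendsto (ht.prodMk (tendsto_pure.2 (Eventually.of_forall fun _ => rfl)))
    exact e1.trans (hq.isBigO_sub.congr_left fun t => by rw [hgs])
  rw [hasDerivAt_iff_isLittleO] at hN hq ⊢
  have h2 := (hN.comp_tendsto ht).trans_isBigO h1
  have h3 := (hq.sub h2).const_mul_left n⁻¹
  refine h3.congr_left fun t => ?_
  simp only [Function.comp, smul_eq_mul, hgs]
  field_simp
  ring

lemma exists_zero_of_hasDerivAt {k : ℝ → ℝ} {a b c : ℝ} (hab : a < b) (hk : Continuous k) (hc : c ≠ 0)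
    (ha : HasDerivAt k c a) (hb : HasDerivAt k c b) (ha0 : k a = 0) (hb0 : k b = 0) : ∃ x ∈ Ioo a b, k x = 0 := by
  wlog hc0 : 0 < c generalizing k c
  · obtain ⟨x, hx, h⟩ := this hk.neg (neg_ne_zero.2 hc) ha.neg hb.neg (neg_eq_zero.2 ha0) (neg_eq_zero.2 hb0)
      (by have := lt_of_le_of_ne (not_lt.1 hc0) hc; linarith)
    exact ⟨x, hx, neg_eq_zero.1 h⟩
  have sa := eventually_nhdsWithin_sign_eq_of_deriv_pos (ha.deriv ▸ hc0 : 0 < deriv k a) ha0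
  have sb := eventually_nhdsWithin_sign_eq_of_deriv_pos (hb.deriv ▸ hc0 : 0 < deriv k b) hb0
  obtain ⟨x, hx, hxm⟩ := ((sa.filter_mono nhdsWithin_le_nhds).and (Ioo_mem_nhdsGT hab)).exists
  obtain ⟨z, hz, hzm⟩ := ((sb.filter_mono nhdsWithin_le_nhds).and (Ioo_mem_nhdsLT hab)).exists
  rw [sign_pos (sub_pos.2 hxm.1), sign_eq_one_iff] at hx
  rw [sign_neg (sub_neg.2 hzm.2), sign_eq_neg_one_iff] at hz
  exact isPreconnected_Ioo.intermediate_value hzm hxm hk.continuousOn ⟨hz.le, hx.le⟩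

lemma stdMap_injective (ε : ℝ) : Function.Injective (stdMap ε) := by
  rintro ⟨x, y⟩ ⟨x', y'⟩ h
  simp only [stdMap, Prod.mk.injEq] at h
  obtain rfl : x = x' := by linarith
  simpa using h.2

lemma stdMap_add_two_pi (ε : ℝ) (p : ℝ × ℝ) : stdMap ε (p + (2 * π, 0)) = stdMap ε p + (2 * π, 0) := by
  ext <;> simp [stdMap]
  ring

namespace IsInvCircle

variable {ε ω : ℝ} {γ : ℝ → ℝ × ℝ}

lemma periodic (hγ : IsInvCircle ε ω γ) : Function.Periodic (fun s => γ s - (s, 0)) (2 * π) := fun s => by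
  simp only [hγ.2.2.2.1 s]
  ext
  · simp only [Prod.fst_sub, Prod.fst_add]; ring
  · simp

lemma translate (hγ : IsInvCircle ε ω γ) (k : ℤ) (s : ℝ) : γ (s + 2 * π * k) = γ s + (2 * π * k, 0) := by
  have h := hγ.periodic.int_mul k s
  rw [mul_comm (2 * π)]
  simp only [sub_eq_iff_eq_add] at h
  rw [h]
  ext
  · simp only [Prod.fst_sub, Prod.fst_add]; ring
  · simp

lemma injective (hγ : IsInvCircle ε ω γ) : Function.Injective γ := fun s t h => by
  obtain ⟨k, rfl⟩ := hγ.2.2.1 s t h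
  have e := congrArg Prod.fst (hγ.translate k s)
  rw [← h] at e
  simp only [Prod.fst_add] at e
  linarith

lemma exists_bound (hγ : IsInvCircle ε ω γ) : ∃ C, ∀ s, |(γ s).1 - s| ≤ C := by
  have hc : Continuous fun s => γ s - (s, 0) := hγ.1.continuous.sub (by fun_prop)
  obtain ⟨C, hC⟩ := (hγ.periodic.isBounded_of_continuous Real.two_pi_pos.ne' hc).exists_norm_le
  exact ⟨C, fun s => (norm_fst_le _).trans (hC _ (mem_range_self s))⟩

lemma tendsto_abs_fst (hγ : IsInvCircle ε ω γ) : Tendsto (fun s => |(γ s).1|) (cocompact ℝ) atTop := by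
  obtain ⟨C, hC⟩ := hγ.exists_bound
  refine tendsto_atTop_mono (fun s => ?_) (tendsto_atTop_add_const_right _ (-C) (tendsto_norm_cocompact_atTop (E := ℝ)))
  have := abs_sub_abs_le_abs_sub s (γ s).1
  rw [abs_sub_comm] at this
  rw [Real.norm_eq_abs]
  linarith [hC s]

lemma isClosedEmbedding (hγ : IsInvCircle ε ω γ) : Topology.IsClosedEmbedding γ := by
  refine .of_continuous_injective_isClosedMap hγ.1.continuous hγ.injective
    (isProperMap_iff_tendsto_cocompact.2 ⟨hγ.1.continuous, ?_⟩).isClosedMap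
  rw [← Metric.cobounded_eq_cocompact (α := ℝ × ℝ), ← tendsto_norm_atTop_iff_cobounded]
  exact tendsto_atTop_mono (fun s => norm_fst_le (γ s)) hγ.tendsto_abs_fst
end IsInvCircle

namespace IsInvCircle

variable {ε ω : ℝ} {γ : ℝ → ℝ × ℝ}

/-- The induced map of the parameter line of an invariant circle. -/
lemma exists_lift (hγ : IsInvCircle ε ω γ) : ∃ g : ℝ → ℝ, Continuous g ∧ (∀ s, γ (g s) = stdMap ε (γ s)) ∧
    ∀ s, g (s + 2 * π) = g s + 2 * π := by
  have h : ∀ s, ∃ t, γ t = stdMap ε (γ s) := fun s =>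
    hγ.2.2.2.2.1.subset (mem_image_of_mem _ (mem_range_self s))
  choose g hg using h
  refine ⟨g, ?_, hg, fun s => hγ.injective ?_⟩
  · rw [hγ.isClosedEmbedding.isInducing.continuous_iff]
    have : γ ∘ g = fun s => stdMap ε (γ s) := funext hg
    rw [this]
    have := hγ.1.continuous
    unfold stdMap
    fun_prop
  · rw [hg, hγ.2.2.2.1, stdMap_add_two_pi, hγ.2.2.2.1, hg]

lemma hasDerivAt_lift (hγ : IsInvCircle ε ω γ) {g : ℝ → ℝ} (hg : Continuous g) (hgγ : ∀ s, γ (g s) = stdMap ε (γ s))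
    {s : ℝ} (hs : g s = s) : ∃ μ, HasDerivAt g μ s ∧
      (deriv γ s).1 * μ = (deriv γ s).1 + (deriv γ s).2 + ε * Real.cos (γ s).1 * (deriv γ s).1 ∧
      (deriv γ s).2 * μ = (deriv γ s).2 + ε * Real.cos (γ s).1 * (deriv γ s).1 := by
  have hd : HasDerivAt γ (deriv γ s) s := (hγ.1.differentiable one_ne_zero s).hasDerivAt
  have h0 := hγ.2.1 s
  set a := (deriv γ s).1 with ha
  set b := (deriv γ s).2 with hb
  set σ := ε * Real.cos (γ s).1 with hσ
  have hx : HasDerivAt (fun t => (γ t).1) a s := (hasFDerivAt_fst (𝕜 := ℝ) (p := γ s)).comp_hasDerivAt s hd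
  have hy : HasDerivAt (fun t => (γ t).2) b s := (hasFDerivAt_snd (𝕜 := ℝ) (p := γ s)).comp_hasDerivAt s hd
  have hys : HasDerivAt (fun t => (γ t).2 + ε * Real.sin (γ t).1) (b + σ * a) s :=
    (hy.add (hx.sin.const_mul ε)).congr_deriv (by rw [hσ]; ring)
  have hxg : HasDerivAt (fun t => (γ (g t)).1) (a + b + σ * a) s :=
    ((hx.add hys).congr_deriv (by ring)).congr_of_eventuallyEq (Eventually.of_forall fun t => by
      simp only [hgγ, stdMap, Pi.add_apply]; ring)
  have hyg : HasDerivAt (fun t => (γ (g t)).2) (b + σ * a) s :=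
    hys.congr_of_eventuallyEq (Eventually.of_forall fun t => by simp only [hgγ, stdMap])
  have hn : a * a + b * b ≠ 0 := fun h => h0 (by
    ext
    · rw [← ha]; show a = 0; nlinarith [mul_self_nonneg a, mul_self_nonneg b]
    · rw [← hb]; show b = 0; nlinarith [mul_self_nonneg a, mul_self_nonneg b])
  have hμ := hasDerivAt_of_comp ((hx.const_mul a).add (hy.const_mul b)) hn hg.continuousAt hs
    ((hxg.const_mul a).add (hyg.const_mul b))
  exact ⟨_, hμ, (HasDerivAt.comp_of_eq s hx hμ hs.symm).unique hxg, (HasDerivAt.comp_of_eq s hy hμ hs.symm).unique hyg⟩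

theorem fixedPoint_notMem (hγ : IsInvCircle ε ω γ) (hε : 0 < ε) (hε4 : ε < 4) (k : ℤ) : (2 * π * k, 0) ∉ range γ := by
  rintro ⟨s, hs⟩
  obtain ⟨g, hg, hgγ, hper⟩ := hγ.exists_lift
  have hsg : g s = s := hγ.injective (by
    have : Real.sin (2 * π * k) = 0 := Real.sin_eq_zero_iff.2 ⟨2 * k, by push_cast; ring⟩
    simp [hgγ, hs, stdMap, this])
  obtain ⟨μ, hμ, e1, e2⟩ := hγ.hasDerivAt_lift hg hgγ hsg
  have hcos : Real.cos (γ s).1 = 1 := by rw [hs, mul_comm, Real.cos_int_mul_two_pi]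
  have h0 := hγ.2.1 s
  rw [hcos, mul_one] at e1 e2
  have hμ1 : μ - 1 ≠ 0 := fun h => h0 (by
    have hμ : μ = 1 := by linarith
    have ha : (deriv γ s).1 = 0 := by
      have : ε * (deriv γ s).1 = 0 := by rw [hμ] at e2; linarith
      exact (mul_eq_zero.1 this).resolve_left hε.ne'
    ext
    · exact ha
    · rw [hμ, ha] at e1; show _ = (0 : ℝ); linarith)
  have hsg' : g (s + 2 * π) = s + 2 * π := by rw [hper, hsg]
  have hμ' : HasDerivAt g μ (s + 2 * π) := by
    have h1 : HasDerivAt (fun t => g (t - 2 * π) + 2 * π) μ (s + 2 * π) :=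
      (HasDerivAt.comp_sub_const (s + 2 * π) (2 * π) (by rwa [add_sub_cancel_right])).add_const _
    exact h1.congr_of_eventuallyEq (Eventually.of_forall fun t => by
      have := hper (t - 2 * π)
      rwa [sub_add_cancel] at this)
  obtain ⟨t, ht, ht0⟩ := exists_zero_of_hasDerivAt (k := fun t => g t - t) (by linarith [Real.pi_pos] : s < s + 2 * π)
    (hg.sub continuous_id) hμ1 (hμ.sub (hasDerivAt_id s)) (hμ'.sub (hasDerivAt_id _)) (sub_eq_zero.2 hsg) (sub_eq_zero.2 hsg')
  have htg : g t = t := sub_eq_zero.1 ht0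
  have hfix := hgγ t
  rw [htg, stdMap] at hfix
  have f1 := congrArg Prod.fst hfix
  have f2 := congrArg Prod.snd hfix
  simp only at f1 f2
  have hy : (γ t).2 = 0 := by linarith
  have hsin : Real.sin (γ t).1 = 0 := by
    have : ε * Real.sin (γ t).1 = 0 := by linarith
    exact (mul_eq_zero.1 this).resolve_left hε.ne'
  obtain ⟨n, hn⟩ := Real.sin_eq_zero_iff.1 hsin
  rcases Int.even_or_odd' n with ⟨m, rfl | rfl⟩
  · have e : γ t = γ (s + 2 * π * (m - k : ℤ)) := by
      rw [hγ.translate, hs]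
      ext
      · rw [← hn]; push_cast; show _ = 2 * π * k + 2 * π * (m - k); ring
      · rw [hy]; show _ = (0 : ℝ) + 0; ring
    have e' := hγ.injective e
    have hpi := Real.pi_pos
    rw [e'] at ht
    have a1 : (0 : ℝ) < (m - k : ℤ) := by
      by_contra! h
      nlinarith [ht.1]
    have a2 : ((m - k : ℤ) : ℝ) < 1 := by
      by_contra! h
      nlinarith [ht.2]
    have a1' : 0 < m - k := by exact_mod_cast a1
    have a2' : m - k < 1 := by exact_mod_cast a2
    omega
  · obtain ⟨ν, -, e1, e2⟩ := hγ.hasDerivAt_lift hg hgγ htg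
    have hcos : Real.cos (γ t).1 = -1 := by
      rw [← hn, show ((2 * m + 1 : ℤ) : ℝ) * π = m * (2 * π) + π by push_cast; ring, Real.cos_int_mul_two_pi_add_pi]
    rw [hcos] at e1 e2
    refine hγ.2.1 t ?_
    have ha : (deriv γ t).1 = 0 := by
      have h : ((ν - (2 - ε) / 2) ^ 2 + ε * (4 - ε) / 4) * (deriv γ t).1 = 0 := by linear_combination (ν - 1) * e1 + e2
      have hpos : 0 < (ν - (2 - ε) / 2) ^ 2 + ε * (4 - ε) / 4 := by
        have : 0 < ε * (4 - ε) := mul_pos hε (by linarith)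
        positivity
      exact (mul_eq_zero.1 h).resolve_left hpos.ne'
    rw [ha] at e1
    ext
    · exact ha
    · show _ = (0 : ℝ); linarith

end IsInvCircle

lemma stdMap_secondDiff {ε h : ℝ} {φ : ℝ → ℝ} (hφ : ∀ t, φ (t + h) - 2 * φ t + φ (t - h) = ε * Real.sin (φ t)) (t : ℝ) :
    stdMap ε (φ t, φ t - φ (t - h)) = (φ (t + h), φ (t + h) - φ (t + h - h)) := by
  have := hφ t
  rw [add_sub_cancel_right]
  ext
  · show φ t + (φ t - φ (t - h)) + ε * Real.sin (φ t) = φ (t + h); linarith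
  · show φ t - φ (t - h) + ε * Real.sin (φ t) = φ (t + h) - φ t; linarith

lemma notMem_of_tendsto_fixedPoint {ε h c : ℝ} {φ : ℝ → ℝ} {Γ : Set (ℝ × ℝ)} {l : Filter ℝ} (hcl : IsClosed Γ)
    (hinv : stdMap ε '' Γ = Γ) (hc : (c, 0) ∉ Γ) (hh : 0 < h) (hl : l = atTop ∨ l = atBot)
    (hφ : ∀ t, φ (t + h) - 2 * φ t + φ (t - h) = ε * Real.sin (φ t)) (hlim : Tendsto φ l (𝓝 c)) (t : ℝ) :
    (φ t, φ t - φ (t - h)) ∉ Γ := by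
  intro ht
  set P : ℝ → ℝ × ℝ := fun t => (φ t, φ t - φ (t - h)) with hP
  have hstep : ∀ t, P (t + h) ∈ Γ ↔ P t ∈ Γ := fun t => by
    simp only [hP, ← stdMap_secondDiff hφ]
    nth_rewrite 1 [← hinv]
    exact (stdMap_injective ε).mem_set_image
  have hPlim : ∀ u : ℕ → ℝ, Tendsto u atTop l → Tendsto (fun n => u n - h) atTop l → (∀ n, P (u n) ∈ Γ) → False := by
    intro u hu hu' hmem
    refine hc (hcl.mem_of_tendsto (b := atTop) (f := fun n => P (u n)) ?_ (Eventually.of_forall hmem))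
    have h1 := hlim.comp hu
    have h2 := h1.sub (hlim.comp hu')
    rw [sub_self] at h2
    exact h1.prodMk_nhds h2
  have hn : Tendsto (fun n : ℕ => (n : ℝ) * h) atTop atTop := tendsto_natCast_atTop_atTop.atTop_mul_const hh
  rcases hl with rfl | rfl
  · refine hPlim (fun n => t + n * h) (tendsto_atTop_add_const_left _ _ hn)
      (tendsto_atTop_add_const_right _ (-h) (tendsto_atTop_add_const_left _ _ hn)) fun n => ?_
    induction n with
    | zero => simpa using ht
    | succ n ih => rw [show t + ((n + 1 : ℕ) : ℝ) * h = t + n * h + h by push_cast; ring]; exact (hstep _).2 ih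
  · have hn' := tendsto_neg_atTop_atBot.comp hn
    refine hPlim (fun n => t + -(n * h)) (tendsto_atBot_add_const_left _ _ hn')
      (tendsto_atBot_add_const_right _ (-h) (tendsto_atBot_add_const_left _ _ hn')) fun n => ?_
    induction n with
    | zero => simpa using ht
    | succ n ih =>
      rw [← hstep, show t + -(((n + 1 : ℕ) : ℝ) * h) + h = t + -(n * h) by push_cast; ring]
      exact ih

namespace RealSep

variable {h e : ℝ} {u v : ℝ → ℝ}

lemma continuous_u (H : RealSep h e u v) : Continuous u :=
  continuous_iff_continuousAt.2 fun t => (H.deriv_u t).continuousAt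

lemma u_pos (H : RealSep h e u v) {t : ℝ} (ht : t ≤ 0) : 0 < u t :=
  (by positivity : 0 < Real.exp t / 2).trans_le (H.u_bounds (by linarith)).1

lemma u_le_pi (H : RealSep h e u v) {t : ℝ} (ht : t ≤ 0) : u t ≤ π := by
  rw [← H.zero]
  exact H.monotoneOn_u (by rw [mem_Iic]; linarith) (by rw [mem_Iic]; norm_num) ht

lemma exists_first_crossing (H : RealSep h e u v) {t : ℝ} (ht : 2 * π ≤ u t) :
    ∃ t₁, 0 < t₁ ∧ t₁ ≤ t ∧ u t₁ = 2 * π ∧ ∀ s < t₁, u s < 2 * π := by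
  have hpi := Real.pi_pos
  have ht0 : 0 ≤ t := by
    by_contra! h
    linarith [H.u_le_pi h.le]
  set S : Set ℝ := Ici 0 ∩ u ⁻¹' Ici (2 * π) with hS
  have hcl : IsClosed S := isClosed_Ici.inter (isClosed_Ici.preimage H.continuous_u)
  have hbd : BddBelow S := ⟨0, fun s hs => hs.1⟩
  have hmem : sInf S ∈ S := hcl.csInf_mem ⟨t, ht0, ht⟩ hbd
  have hlt : ∀ s < sInf S, u s < 2 * π := fun s hs => by
    rcases le_total s 0 with h | h
    · linarith [H.u_le_pi h]
    · by_contra! h'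
      exact absurd (csInf_le hbd ⟨h, h'⟩) (not_le.2 hs)
  have hpos : 0 < sInf S := lt_of_le_of_ne hmem.1 fun h => by
    have := hmem.2
    rw [← h, mem_preimage, H.zero, mem_Ici] at this
    linarith
  refine ⟨sInf S, hpos, csInf_le hbd ⟨ht0, ht⟩, le_antisymm ?_ hmem.2, hlt⟩
  exact le_of_tendsto (H.continuous_u.continuousWithinAt (s := Iio (sInf S)))
    (eventually_mem_nhdsWithin.mono fun s hs => (hlt s hs).le)

lemma le_two_pi_sub (H : RealSep h (diffSymbol h 1) u v) {t₁ : ℝ} (ht₁ : 0 < t₁) (hu : u t₁ = 2 * π)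
    (hlt : ∀ s < t₁, u s < 2 * π) : 2 * π * h * Real.exp (-t₁ - h) ≤ 2 * π - u (t₁ - h) := by
  have hh := H.h_pos
  have hpi := Real.pi_pos
  have he : 0 < diffSymbol h 1 := diffSymbol_pos hh one_pos
  set y := 2 * π - u (t₁ - h) with hy
  have hy0 : 0 < y := sub_pos.2 (hlt _ (by linarith))
  have hsh : 0 < Real.sinh h := Real.sinh_pos_iff.2 hh
  set d : ℕ → ℝ := fun n => y * (Real.sinh (n * h) / Real.sinh h) - (2 * π - u (t₁ - n * h)) with hd
  have hrec : ∀ n : ℕ, (2 + diffSymbol h 1) * d (n + 1) - d n ≤ d (n + 2) := fun n => by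
    have hdiff := H.diff_u (t₁ - (n + 1) * h)
    have hz : 0 < 2 * π - u (t₁ - (n + 1) * h) := sub_pos.2 (hlt _ (by
      have : 0 < ((n : ℝ) + 1) * h := by positivity
      linarith))
    have hsin := Real.sin_le hz.le
    rw [Real.sin_two_pi_sub] at hsin
    have hw : Real.sinh ((n + 2) * h) + Real.sinh (n * h) = (2 + diffSymbol h 1) * Real.sinh ((n + 1) * h) := by
      rw [show ((n : ℝ) + 2) * h = (n + 1) * h + h by ring, show (n : ℝ) * h = (n + 1) * h - h by ring, Real.sinh_add,
        Real.sinh_sub, diffSymbol, one_mul]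
      have : Real.cosh h = 1 + 2 * Real.sinh (h / 2) ^ 2 := by
        conv_lhs => rw [show h = 2 * (h / 2) by ring, Real.cosh_two_mul, Real.cosh_sq]
        ring
      rw [this]; ring
    have hw' : y * (Real.sinh ((n + 2) * h) / Real.sinh h) =
        (2 + diffSymbol h 1) * (y * (Real.sinh ((n + 1) * h) / Real.sinh h)) - y * (Real.sinh (n * h) / Real.sinh h) := by
      linear_combination y / Real.sinh h * hw
    rw [show t₁ - (n + 1) * h + h = t₁ - n * h by ring, show t₁ - (n + 1) * h - h = t₁ - (n + 2) * h by ring] at hdiff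
    simp only [hd]
    push_cast
    rw [hw']
    nlinarith [mul_le_mul_of_nonneg_left hsin he.le]
  have hmono : ∀ n : ℕ, 0 ≤ d n ∧ d n ≤ d (n + 1) := by
    intro n
    induction n with
    | zero =>
      have h0 : d 0 = 0 := by simp [hd, hu]
      have h1 : d 1 = 0 := by simp [hd, hsh.ne', hy]
      simp [h0, h1]
    | succ n ih =>
      have := hrec n
      have h1 : 0 ≤ d (n + 1) := ih.1.trans ih.2
      exact ⟨h1, by nlinarith [mul_nonneg he.le h1]⟩
  set n := ⌈t₁ / h⌉₊ with hn
  have hn1 : t₁ ≤ n * h := (div_le_iff₀ hh).1 (Nat.le_ceil _)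
  have hn2 : n * h ≤ t₁ + h := by
    have := (Nat.ceil_lt_add_one (div_pos ht₁ hh).le).le
    calc n * h ≤ (t₁ / h + 1) * h := mul_le_mul_of_nonneg_right this hh.le
      _ = t₁ + h := by field_simp
  have hz : π ≤ y * (Real.sinh (n * h) / Real.sinh h) := by
    have h1 := (hmono n).1
    have h2 := H.u_le_pi (t := t₁ - n * h) (by linarith)
    simp only [hd] at h1
    linarith
  have hsb : Real.sinh (n * h) ≤ Real.exp (t₁ + h) / 2 := by
    rw [Real.sinh_eq]
    have := Real.exp_le_exp.2 hn2
    have := Real.exp_pos (-(n * h))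
    linarith
  have hhs : h ≤ Real.sinh h := Real.self_le_sinh_iff.2 hh.le
  have h3 : π * h ≤ y * (Real.exp (t₁ + h) / 2) := by
    rw [← mul_div_assoc, le_div_iff₀ hsh] at hz
    calc π * h ≤ π * Real.sinh h := mul_le_mul_of_nonneg_left hhs hpi.le
      _ ≤ _ := hz
      _ ≤ _ := mul_le_mul_of_nonneg_left hsb hy0.le
  calc 2 * π * h * Real.exp (-t₁ - h) = 2 * (π * h) * Real.exp (-t₁ - h) := by ring
    _ ≤ 2 * (y * (Real.exp (t₁ + h) / 2)) * Real.exp (-t₁ - h) := by gcongr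
    _ = y * (Real.exp (t₁ + h) * Real.exp (-t₁ - h)) := by ring
    _ = y := by rw [← Real.exp_add, show t₁ + h + (-t₁ - h) = 0 by ring, Real.exp_zero, mul_one]

theorem notMem_range (H : RealSep h e u v) {t₁ : ℝ} (ht₁ : 0 < t₁) (hu : u t₁ = 2 * π)
    (hlt : ∀ s < t₁, u s < 2 * π) {γ : ℝ → ℝ × ℝ} (hγ : Continuous γ) (hγlim : Tendsto (fun s => |(γ s).1|) atTop atTop)
    (hcl : IsClosed (range γ)) (hinv : stdMap e '' range γ = range γ) (hfix : ∀ k : ℤ, (2 * π * k, 0) ∉ range γ)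
    {y : ℝ} (hy : 0 < y) (hy₁ : y < 2 * π - u (t₁ - h)) : (0, y) ∉ range γ := by
  have hh := H.h_pos
  have huc := H.continuous_u
  have hdu := H.diff_u
  have hu' : Tendsto (fun t => u (-t)) atTop (𝓝 0) := H.tendsto.comp tendsto_neg_atTop_atBot
  have o₁ := notMem_of_tendsto_fixedPoint hcl hinv (by simpa using hfix 0) hh (.inr rfl) hdu H.tendsto
  have o₂ := notMem_of_tendsto_fixedPoint (φ := fun t => 2 * π - u (-t)) hcl hinv (by simpa using hfix 1) hh (.inl rfl)
    (fun t => by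
      have := hdu (-t)
      rw [Real.sin_two_pi_sub, neg_add, neg_sub', sub_neg_eq_add, ← sub_eq_add_neg]; linarith)
    (by simpa using hu'.const_sub (2 * π))
  have o₃ := notMem_of_tendsto_fixedPoint (φ := fun t => - u (-t)) hcl hinv (by simpa using hfix 0) hh (.inl rfl)
    (fun t => by
      have := hdu (-t)
      rw [Real.sin_neg, show -(t + h) = -t - h by ring, show -(t - h) = -t + h by ring]; linarith)
    (by simpa using hu'.neg)
  have o₄ := notMem_of_tendsto_fixedPoint (φ := fun t => u t - 2 * π) hcl hinv (by simpa using hfix (-1)) hh (.inr rfl)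
    (fun t => by
      have := hdu t
      rw [Real.sin_sub_two_pi]; linarith)
    (by simpa using H.tendsto.sub_const (2 * π))
  have hzero := hdu 0
  rw [H.zero, Real.sin_pi, zero_add, zero_sub] at hzero
  have htop := hdu t₁
  rw [hu, Real.sin_two_pi] at htop
  set X : ℝ → ℝ := fun p => if p ≤ 0 then u p else 2 * π - u p with hX
  set U : ℝ → ℝ := fun p => if p ≤ 0 then u p - u (p - h) else u (p + h) - u p with hU
  set V : ℝ → ℝ := fun p => if p ≤ 0 then u (p + h) - u p else u p - u (p - h) with hV
  have hXc : Continuous X := huc.if_le (continuous_const.sub huc) continuous_id continuous_const (by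
    rintro p rfl; rw [H.zero]; ring)
  have hUc : Continuous U := Continuous.if_le (by fun_prop) (by fun_prop) continuous_id continuous_const (by
    rintro p rfl; rw [H.zero, zero_add, zero_sub]; linarith)
  have hVc : Continuous V := Continuous.if_le (by fun_prop) (by fun_prop) continuous_id continuous_const (by
    rintro p rfl; rw [H.zero, zero_add, zero_sub]; linarith)
  have hXpos : ∀ p < t₁, 0 < X p := fun p hp => by
    simp only [hX]
    split_ifs with h0
    · exact H.u_pos h0
    · exact sub_pos.2 (hlt p hp)
  have hX0 : X t₁ = 0 := by simp [hX, ht₁.not_ge, hu]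
  have hU0 : U t₁ = 2 * π - u (t₁ - h) := by
    simp only [hU, ht₁.not_ge, if_false, hu]; linarith
  have hV0 : V t₁ = 2 * π - u (t₁ - h) := by
    simp only [hV, ht₁.not_ge, if_false, hu]
  have hshift : Tendsto (fun p => u (p - h)) atBot (𝓝 0) := H.tendsto.comp (tendsto_atBot_add_const_right _ (-h) tendsto_id)
  have hshift' : Tendsto (fun p => u (p + h)) atBot (𝓝 0) := H.tendsto.comp (tendsto_atBot_add_const_right _ h tendsto_id)
  have hXl : Tendsto X atBot (𝓝 0) := H.tendsto.congr' ((eventually_le_atBot 0).mono fun p hp => by simp [hX, hp])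
  have hUl : Tendsto U atBot (𝓝 0) := by
    have := H.tendsto.sub hshift
    rw [sub_zero] at this
    exact this.congr' ((eventually_le_atBot 0).mono fun p hp => by simp [hU, hp])
  have hVl : Tendsto V atBot (𝓝 0) := by
    have := hshift'.sub H.tendsto
    rw [sub_zero] at this
    exact this.congr' ((eventually_le_atBot 0).mono fun p hp => by simp [hV, hp])
  have hB : ∀ p, (X p, U p) ∉ range γ := fun p => by
    simp only [hX, hU]
    split_ifs with h0
    · exact o₁ p
    · have := o₂ (-p)
      rwa [neg_neg, neg_sub, sub_neg_eq_add, sub_sub_sub_cancel_left, add_comm h] at this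
  have hB' : ∀ p, (-X p, V p) ∉ range γ := fun p => by
    simp only [hX, hV]
    split_ifs with h0
    · have := o₃ (-p)
      rwa [neg_neg, neg_sub_neg, neg_sub, sub_neg_eq_add, add_comm h] at this
    · have := o₄ p
      rwa [sub_sub_sub_cancel_right, ← neg_sub] at this
  have key : ∀ a b s, (a, b) ∉ range γ → ((a : ℂ) + b * Complex.I) ≠ ((γ s).1 : ℂ) + (γ s).2 * Complex.I := by
    intro a b s hab heq
    refine hab ⟨s, ?_⟩
    have h1 := congrArg Complex.re heq
    have h2 := congrArg Complex.im heq
    simp at h1 h2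
    exact Prod.ext h1.symm h2.symm
  rintro ⟨s, hs⟩
  refine properCurve_ne_of_rays (T := t₁) (Y := 2 * π - u (t₁ - h)) (B := fun p => (X p : ℂ) + U p * Complex.I)
    (B' := fun p => ((-X p : ℝ) : ℂ) + V p * Complex.I) (γ := fun s => ((γ s).1 : ℂ) + (γ s).2 * Complex.I)
    (by fun_prop) (by fun_prop) (by fun_prop) ?_ ?_ ?_ ?_ ?_ ?_ ?_ ?_ (fun p _ s => key _ _ s (hB p))
    (fun p _ s => key _ _ s (hB' p)) hy hy₁ s ?_
  · refine tendsto_atTop_mono (fun s => ?_) hγlim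
    have := Complex.abs_re_le_norm (((γ s).1 : ℂ) + (γ s).2 * Complex.I)
    simpa using this
  · simpa using ((Complex.continuous_ofReal.tendsto _).comp hXl).add
      (((Complex.continuous_ofReal.tendsto _).comp hUl).mul_const Complex.I)
  · simpa using ((Complex.continuous_ofReal.tendsto _).comp hXl.neg).add
      (((Complex.continuous_ofReal.tendsto _).comp hVl).mul_const Complex.I)
  · simp only [hX0, hU0]; simp
  · simp only [hX0, hV0]; simp
  · intro p hp; simpa using hXpos p hp
  · intro p hp; simpa using hXpos p hp
  · intro s; simpa using key 0 0 s (by simpa using hfix 0)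
  · simp [hs]

end RealSep

lemma stdMap_neg (ε : ℝ) (p : ℝ × ℝ) : stdMap ε (-p) = -stdMap ε p := by
  ext <;> simp [stdMap] <;> ring

theorem IsInvCircle.two_pi_sub_le_abs {h ε ω y t₁ : ℝ} {u v : ℝ → ℝ} {γ : ℝ → ℝ × ℝ} (hγ : IsInvCircle ε ω γ) (hε : 0 < ε)
    (hε4 : ε < 4) (H : RealSep h ε u v) (ht₁ : 0 < t₁) (hu : u t₁ = 2 * π) (hlt : ∀ s < t₁, u s < 2 * π) {k : ℤ}
    (hy : (2 * π * (k : ℝ), y) ∈ range γ) : 2 * π - u (t₁ - h) ≤ |y| := by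
  obtain ⟨s, hs⟩ := hy
  have hs' : γ (s + 2 * π * (-k : ℤ)) = (0, y) := by
    rw [hγ.translate, hs]
    ext
    · push_cast; show 2 * π * (k : ℝ) + 2 * π * -k = 0; ring
    · show y + 0 = y; ring
  have hfix := hγ.fixedPoint_notMem hε hε4
  have hlim : Tendsto (fun s => |(γ s).1|) atTop atTop := hγ.tendsto_abs_fst.mono_left atTop_le_cocompact
  by_contra! hlt'
  rcases lt_trichotomy y 0 with h0 | rfl | h0
  · rw [abs_of_neg h0] at hlt'
    refine H.notMem_range ht₁ hu hlt (γ := fun s => -γ s) hγ.1.continuous.neg (by simpa using hlim) ?_ ?_ ?_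
      (neg_pos.2 h0) hlt' ⟨_, (congrArg Neg.neg hs').trans (by simp)⟩
    · have : range (fun s => -γ s) = -range γ := by rw [← image_neg_eq_neg, ← range_comp]; rfl
      rw [this]
      exact hγ.isClosedEmbedding.isClosed_range.neg
    · have : range (fun s => -γ s) = Neg.neg '' range γ := by rw [← range_comp]; rfl
      rw [this, image_image]
      simp only [stdMap_neg]
      rw [← image_image Neg.neg, hγ.2.2.2.2.1]
    · rintro k ⟨t, ht⟩
      refine hfix (-k) ⟨t, ?_⟩
      rw [← neg_neg (γ t)]
      simp only at ht
      rw [ht]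
      simp
  · exact hfix 0 ⟨_, hs'.trans (by simp)⟩
  · rw [abs_of_pos h0] at hlt'
    exact H.notMem_range ht₁ hu hlt hγ.1.continuous hlim hγ.isClosedEmbedding.isClosed_range hγ.2.2.2.2.1 hfix h0 hlt' ⟨_, hs'⟩

lemma exists_diffSymbol_eq {ε : ℝ} (hε : 0 < ε) (hε1 : ε < 1) :
    ∃ h, 0 < h ∧ diffSymbol h 1 = ε ∧ h ≤ √ε ∧ π ^ 2 / (2 * h) ≤ π ^ 2 / (2 * √ε) + π ^ 2 / 2 := by
  have hs : 0 < √ε := Real.sqrt_pos.2 hε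
  have hs1 : √ε < 1 := by rwa [Real.sqrt_lt' one_pos, one_pow]
  have hsq : √ε ^ 2 = ε := Real.sq_sqrt hε.le
  set h := 2 * Real.arsinh (√ε / 2) with hh
  have hpos : 0 < h := mul_pos two_pos (Real.arsinh_pos_iff.2 (by positivity))
  have he : diffSymbol h 1 = ε := by
    rw [diffSymbol, one_mul, hh, mul_div_cancel_left₀ _ two_ne_zero, Real.sinh_arsinh]
    linarith
  have h1 : h ≤ √ε := Real.le_sqrt_of_sq_le (he ▸ le_diffSymbol_one hpos.le)
  have h2 : √ε ≤ h + h ^ 2 := by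
    refine Real.sqrt_le_iff.2 ⟨by positivity, ?_⟩
    have := he ▸ diffSymbol_one_le hpos.le (h1.trans hs1.le)
    nlinarith [pow_pos hpos 3]
  refine ⟨h, hpos, he, h1, ?_⟩
  have h3 : 1 / h ≤ 1 / √ε + 1 := by
    rw [div_add_one hs.ne', div_le_div_iff₀ hpos hs]
    nlinarith
  calc π ^ 2 / (2 * h) = π ^ 2 / 2 * (1 / h) := by field_simp
    _ ≤ π ^ 2 / 2 * (1 / √ε + 1) := mul_le_mul_of_nonneg_left h3 (by positivity)
    _ = _ := by field_simp

/-- There exist `c > 0` and `ε₀'' > 0` such that for all `0 < ε < ε₀''` one has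
`|y⁺(ε)| ≥ c e^{−π²/(2√ε)}` and `|y⁻(ε)| ≥ c e^{−π²/(2√ε)}`. -/
theorem lower_bound_last_invariant_torus :
    ∃ c : ℝ, 0 < c ∧ ∃ ε₀'' : ℝ, 0 < ε₀'' ∧ ∀ ε : ℝ, 0 < ε → ε < ε₀'' → ∀ y : ℝ,
      (IsYIntersection ε (omegaPlus ε) y →
        c * Real.exp (-π ^ 2 / (2 * Real.sqrt ε)) ≤ |y|) ∧
      (IsYIntersection ε (omegaMinus ε) y →
        c * Real.exp (-π ^ 2 / (2 * Real.sqrt ε)) ≤ |y|) := by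
  obtain ⟨K, -, κ, h₀, hh₀, hcross⟩ := exists_crossing
  refine ⟨2 * π * Real.exp (-1 - κ - π ^ 2 / 2), by positivity, min 1 (h₀ ^ 2), by positivity, fun ε hε hε₀ y => ?_⟩
  have hε1 := hε₀.trans_le (min_le_left _ _)
  suffices ∀ ω, IsYIntersection ε ω y →
      2 * π * Real.exp (-1 - κ - π ^ 2 / 2) * Real.exp (-π ^ 2 / (2 * √ε)) ≤ |y| from ⟨this _, this _⟩
  rintro ω ⟨γ, hγ, k, hk⟩
  obtain ⟨h, hh, rfl, hle, hexp⟩ := exists_diffSymbol_eq hε hε1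
  have hs1 : √(diffSymbol h 1) < 1 := by rwa [Real.sqrt_lt' one_pos, one_pow]
  have hs₀ : √(diffSymbol h 1) < h₀ := (Real.sqrt_lt' hh₀).2 (hε₀.trans_le (min_le_right _ _))
  obtain ⟨α, S, t, ht, hu⟩ := hcross h hh (hle.trans_lt hs₀)
  have H := S.realSep
  obtain ⟨t₁, ht₁, ht₁t, hu₁, hlt⟩ := H.exists_first_crossing hu
  refine le_trans ?_ ((H.le_two_pi_sub ht₁ hu₁ hlt).trans
    (hγ.two_pi_sub_le_abs hε (by linarith) H ht₁ hu₁ hlt hk))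
  rw [mul_assoc, mul_assoc (2 * π), ← Real.exp_add]
  refine mul_le_mul_of_nonneg_left ?_ (by positivity)
  rw [show h * Real.exp (-t₁ - h) = Real.exp (Real.log h + (-t₁ - h)) by rw [Real.exp_add, Real.exp_log hh]]
  refine Real.exp_le_exp.2 ?_
  rw [neg_div]
  linarith
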